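/- For every ε > 0 there exists N₀ such that for all real N ≥ N₀ one has C(N) ≥ N / (log N)^{log 4 − 1 + ε}. -/

import Mathlib

open Real

/-- `countC N` is the number of integers `n` with `1 < n ≤ N` such that `n = a * b`
for some positive integers `a, b` with `a² + b²` prime. -/
noncomputable def countC (N : ℝ) : ℕ :=
  {n : ℕ | 1 < n ∧ (n : ℝ) ≤ N ∧
    ∃ a b : ℕ, 0 < a ∧ 0 < b ∧ n = a * b ∧ Nat.Prime (a ^ 2 + b ^ 2)}.ncard

open Finset

/-- Bonferroni inequality for `[0,1]`-valued weights: truncating the expansion of a product. -/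
theorem brun_pointwise {ι : Type*} [DecidableEq ι] (s : Finset ι) (h : ι → ℝ)
    (h0 : ∀ i ∈ s, 0 ≤ h i) (h1 : ∀ i ∈ s, h i ≤ 1) (k : ℕ) :
    |∏ i ∈ s, (1 - h i) - ∑ j ∈ range (k + 1), (-1 : ℝ) ^ j *
      ∑ E ∈ s.powersetCard j, ∏ i ∈ E, h i| ≤ ∑ E ∈ s.powersetCard (k + 1), ∏ i ∈ E, h i := by
  induction s using Finset.induction_on generalizing k with
  | empty =>
    have : ∑ j ∈ range (k + 1), (-1 : ℝ) ^ j *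
      ∑ E ∈ (∅ : Finset ι).powersetCard j, ∏ i ∈ E, h i = 1 := by
      rw [Finset.sum_range_succ']
      rw [sum_eq_zero]
      · simp
      · intro j _
        rw [Finset.powersetCard_eq_empty.2 (by simp)]; simp
    rw [this, Finset.powersetCard_eq_empty.2 (by simp)]; simp
  | insert a s ha ih =>
    have h0' : ∀ i ∈ s, 0 ≤ h i := fun i hi => h0 i (mem_insert_of_mem hi)
    have h1' : ∀ i ∈ s, h i ≤ 1 := fun i hi => h1 i (mem_insert_of_mem hi)
    have ha0 := h0 a (mem_insert_self a s)
    have key : ∀ j, ∑ E ∈ (insert a s).powersetCard (j + 1), ∏ i ∈ E, h i =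
        ∑ E ∈ s.powersetCard (j + 1), ∏ i ∈ E, h i + h a * ∑ E ∈ s.powersetCard j, ∏ i ∈ E, h i := by
      intro j
      rw [Finset.powersetCard_succ_insert ha, Finset.sum_union, Finset.sum_image, mul_sum]
      · congr 1
        refine sum_congr rfl fun E hE => ?_
        have : a ∉ E := fun h' => ha ((mem_powersetCard.1 hE).1 h')
        rw [prod_insert this]
      · intro E hE F hF hEF
        have h1 : a ∉ E := fun h' => ha ((mem_powersetCard.1 hE).1 h')
        have h2 : a ∉ F := fun h' => ha ((mem_powersetCard.1 hF).1 h')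
        rw [← Finset.erase_insert h1, hEF, Finset.erase_insert h2]
      · rw [Finset.disjoint_left]
        intro E hE hE'
        obtain ⟨F, hF, rfl⟩ := mem_image.1 hE'
        exact ha ((mem_powersetCard.1 hE).1 (mem_insert_self a F))
    have key0 : ∀ t : Finset ι, ∑ E ∈ t.powersetCard 0, ∏ i ∈ E, h i = 1 := by
      intro t; simp
    rw [prod_insert ha, key k]
    cases k with
    | zero =>
      have i0 := ih h0' h1' 0
      simp only [zero_add, Finset.range_one, Finset.sum_singleton, pow_zero, one_mul,
        Finset.powersetCard_zero, Finset.prod_empty] at i0 ⊢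
      have hp0 : 0 ≤ ∏ i ∈ s, (1 - h i) :=
        prod_nonneg fun i hi => sub_nonneg.2 (h1' i hi)
      have hp1 : ∏ i ∈ s, (1 - h i) ≤ 1 :=
        Finset.prod_le_one (fun i hi => sub_nonneg.2 (h1' i hi)) fun i hi => by linarith [h0' i hi]
      rw [abs_le] at i0 ⊢
      constructor <;> nlinarith
    | succ k =>
      have i1 := ih h0' h1' (k + 1)
      have i0 := ih h0' h1' k
      have e : ∑ j ∈ range (k + 1 + 1), (-1 : ℝ) ^ j *
          ∑ E ∈ (insert a s).powersetCard j, ∏ i ∈ E, h i =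
          (∑ j ∈ range (k + 1 + 1), (-1 : ℝ) ^ j * ∑ E ∈ s.powersetCard j, ∏ i ∈ E, h i)
          - h a * ∑ j ∈ range (k + 1), (-1 : ℝ) ^ j *
            ∑ E ∈ s.powersetCard j, ∏ i ∈ E, h i := by
        rw [Finset.sum_range_succ', Finset.sum_range_succ' _ (k + 1), key0, key0, mul_sum]
        rw [add_sub_right_comm, ← sum_sub_distrib]
        congr 1
        refine sum_congr rfl fun j _ => ?_
        rw [key j]; ring
      rw [e]
      rw [abs_le] at i0 i1 ⊢
      constructor <;> nlinarith

/-- Rankin's trick for elementary symmetric sums. -/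
theorem sum_powersetCard_prod_le {ι : Type*} (s : Finset ι) (g : ι → ℝ)
    (h0 : ∀ i ∈ s, 0 ≤ g i) (k : ℕ) {t : ℝ} (ht : 0 < t) :
    ∑ E ∈ s.powersetCard k, ∏ i ∈ E, g i ≤ exp (t * ∑ i ∈ s, g i) / t ^ k := by
  rw [le_div_iff₀ (by positivity), sum_mul]
  calc ∑ E ∈ s.powersetCard k, (∏ i ∈ E, g i) * t ^ k
      = ∑ E ∈ s.powersetCard k, ∏ i ∈ E, (t * g i) := by
        refine sum_congr rfl fun E hE => ?_
        rw [Finset.prod_mul_distrib, Finset.prod_const, (mem_powersetCard.1 hE).2, mul_comm]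
    _ ≤ ∑ E ∈ s.powerset, ∏ i ∈ E, (t * g i) := by
        refine sum_le_sum_of_subset_of_nonneg ?_ ?_
        · intro E hE
          exact mem_powerset.2 (mem_powersetCard.1 hE).1
        · intro E hE _
          exact prod_nonneg fun i hi => mul_nonneg ht.le (h0 i (mem_powerset.1 hE hi))
    _ = ∏ i ∈ s, (1 + t * g i) := (Finset.prod_one_add s).symm
    _ ≤ ∏ i ∈ s, exp (t * g i) := by
        refine Finset.prod_le_prod (fun i hi => ?_) fun i hi => ?_
        · have := mul_nonneg ht.le (h0 i hi); linarith
        · rw [add_comm]; exact add_one_le_exp _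
    _ = _ := by rw [← Real.exp_sum, mul_sum]

/-- Brun's pure sieve. -/
theorem brun_sum {ι α : Type*} [DecidableEq ι] (Z : Finset α) (w : α → ℝ) (hw : ∀ z ∈ Z, 0 ≤ w z)
    (s : Finset ι) (h : α → ι → ℝ) (h0 : ∀ z ∈ Z, ∀ i ∈ s, 0 ≤ h z i)
    (h1 : ∀ z ∈ Z, ∀ i ∈ s, h z i ≤ 1) (g : ι → ℝ) (g0 : ∀ i ∈ s, 0 ≤ g i)
    (g1 : ∀ i ∈ s, g i ≤ 1) {X : ℝ} (hX : 0 ≤ X) (k : ℕ) (err : Finset ι → ℝ)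
    (herr : ∀ E ⊆ s, E.card ≤ k + 1 →
      |∑ z ∈ Z, w z * ∏ i ∈ E, h z i - X * ∏ i ∈ E, g i| ≤ err E) :
    |∑ z ∈ Z, w z * ∏ i ∈ s, (1 - h z i) - X * ∏ i ∈ s, (1 - g i)| ≤
      ∑ j ∈ range (k + 2), ∑ E ∈ s.powersetCard j, err E
        + 2 * X * ∑ E ∈ s.powersetCard (k + 1), ∏ i ∈ E, g i := by
  have a1 : |∑ z ∈ Z, w z * ∏ i ∈ s, (1 - h z i) - ∑ z ∈ Z, w z * ∑ j ∈ range (k + 1),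
      (-1 : ℝ) ^ j * ∑ E ∈ s.powersetCard j, ∏ i ∈ E, h z i| ≤
      ∑ z ∈ Z, w z * ∑ E ∈ s.powersetCard (k + 1), ∏ i ∈ E, h z i := by
    rw [← sum_sub_distrib]
    refine (abs_sum_le_sum_abs _ _).trans (sum_le_sum fun z hz => ?_)
    rw [← mul_sub, abs_mul, abs_of_nonneg (hw z hz)]
    exact mul_le_mul_of_nonneg_left (brun_pointwise s (h z) (h0 z hz) (h1 z hz) k) (hw z hz)
  have sw : ∀ j, ∑ z ∈ Z, w z * ∑ E ∈ s.powersetCard j, ∏ i ∈ E, h z i =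
      ∑ E ∈ s.powersetCard j, ∑ z ∈ Z, w z * ∏ i ∈ E, h z i := by
    intro j
    simp_rw [mul_sum]
    exact sum_comm
  have e2 : ∑ z ∈ Z, w z * ∑ j ∈ range (k + 1),
      (-1 : ℝ) ^ j * ∑ E ∈ s.powersetCard j, ∏ i ∈ E, h z i =
      ∑ j ∈ range (k + 1), (-1 : ℝ) ^ j *
        ∑ E ∈ s.powersetCard j, ∑ z ∈ Z, w z * ∏ i ∈ E, h z i := by
    simp_rw [← sw, mul_sum (range (k + 1)), mul_sum Z]
    rw [sum_comm]
    refine sum_congr rfl fun j _ => sum_congr rfl fun z _ => by ring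
  have d : ∀ j ≤ k + 1, |∑ E ∈ s.powersetCard j, ∑ z ∈ Z, w z * ∏ i ∈ E, h z i -
      X * ∑ E ∈ s.powersetCard j, ∏ i ∈ E, g i| ≤ ∑ E ∈ s.powersetCard j, err E := by
    intro j hj
    rw [mul_sum, ← sum_sub_distrib]
    refine (abs_sum_le_sum_abs _ _).trans (sum_le_sum fun E hE => ?_)
    rw [mem_powersetCard] at hE
    exact herr E hE.1 (by omega)
  have a2 : |∑ z ∈ Z, w z * ∑ j ∈ range (k + 1),
      (-1 : ℝ) ^ j * ∑ E ∈ s.powersetCard j, ∏ i ∈ E, h z i - X * ∑ j ∈ range (k + 1),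
      (-1 : ℝ) ^ j * ∑ E ∈ s.powersetCard j, ∏ i ∈ E, g i| ≤
      ∑ j ∈ range (k + 1), ∑ E ∈ s.powersetCard j, err E := by
    rw [e2, mul_sum, ← sum_sub_distrib]
    refine (abs_sum_le_sum_abs _ _).trans (sum_le_sum fun j hj => ?_)
    rw [mul_left_comm, ← mul_sub, abs_mul, abs_pow, abs_neg, abs_one, one_pow, one_mul]
    exact d j (mem_range.1 hj).le
  have a3 : |X * ∏ i ∈ s, (1 - g i) - X * ∑ j ∈ range (k + 1),
      (-1 : ℝ) ^ j * ∑ E ∈ s.powersetCard j, ∏ i ∈ E, g i| ≤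
      X * ∑ E ∈ s.powersetCard (k + 1), ∏ i ∈ E, g i := by
    rw [← mul_sub, abs_mul, abs_of_nonneg hX]
    exact mul_le_mul_of_nonneg_left (brun_pointwise s g g0 g1 k) hX
  have a4 := d (k + 1) le_rfl
  simp_rw [sw] at a1
  rw [Finset.sum_range_succ _ (k + 1)]
  rw [abs_le] at *
  constructor <;> linarith

/-- Partial summation: from a weighted Mertens estimate to its harmonic version. -/
theorem abel_log {α C c : ℝ} (hα : 0 ≤ α) (hC : 0 ≤ C) (hc : 0 < c) :
    ∃ D : ℝ, 0 ≤ D ∧ ∀ {ι : Type} (s : Finset ι) (l a : ι → ℝ), (∀ i ∈ s, 0 ≤ a i) →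
      (∀ i ∈ s, c ≤ l i) → ∀ T : ℝ, 1 ≤ T →
      (∀ t, 1 ≤ t → t ≤ T → |∑ i ∈ s with l i ≤ t, a i * l i - α * t| ≤ C) →
      |∑ i ∈ s with l i ≤ T, a i - α * log T| ≤ D := by
  refine ⟨(α + C) / c + 10 * (α + C), by positivity, ?_⟩
  intro ι s l a ha hl T hT hM
  set M : ℝ → ℝ := fun t => ∑ i ∈ s with l i ≤ t, a i * l i with hMdef
  set A : ℝ → ℝ := fun t => ∑ i ∈ s with l i ≤ t, a i with hAdef
  have hdiff : ∀ (f : ι → ℝ) (u v : ℝ), u ≤ v → ∑ i ∈ s with l i ≤ v, f i =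
      ∑ i ∈ s with l i ≤ u, f i + ∑ i ∈ s with (u < l i ∧ l i ≤ v), f i := by
    intro f u v huv
    rw [← sum_filter_add_sum_filter_not (s.filter (l · ≤ v)) (l · ≤ u),
      filter_filter, filter_filter]
    congr 2
    · ext i; simp only [mem_filter]; constructor
      · rintro ⟨h1, h2, h3⟩; exact ⟨h1, h3⟩
      · rintro ⟨h1, h2⟩; exact ⟨h1, h2.trans huv, h2⟩
    · ext i; simp only [mem_filter, not_le]; tauto
  have hup : ∀ u v : ℝ, 0 < u → u ≤ v → A v - A u ≤ (M v - M u) / u := by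
    intro u v hu huv
    simp only [hAdef, hMdef]
    rw [hdiff a u v huv, hdiff _ u v huv, add_sub_cancel_left, add_sub_cancel_left,
      Finset.sum_div]
    refine sum_le_sum fun i hi => ?_
    simp only [mem_filter] at hi
    rw [le_div_iff₀ hu]
    exact mul_le_mul_of_nonneg_left hi.2.1.le (ha i hi.1)
  have hlo : ∀ u v : ℝ, 0 < u → u ≤ v → (M v - M u) / v ≤ A v - A u := by
    intro u v hu huv
    simp only [hAdef, hMdef]
    rw [hdiff a u v huv, hdiff _ u v huv, add_sub_cancel_left, add_sub_cancel_left,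
      Finset.sum_div]
    refine sum_le_sum fun i hi => ?_
    simp only [mem_filter] at hi
    rw [div_le_iff₀ (hu.trans_le huv)]
    exact mul_le_mul_of_nonneg_left hi.2.2 (ha i hi.1)
  have hA1 : 0 ≤ A 1 ∧ A 1 ≤ (α + C) / c := by
    constructor
    · exact sum_nonneg fun i hi => ha i (mem_filter.1 hi).1
    · rw [le_div_iff₀ hc]
      have : A 1 * c ≤ M 1 := by
        simp only [hAdef, hMdef]
        rw [sum_mul]
        refine sum_le_sum fun i hi => ?_
        have := (mem_filter.1 hi).1
        exact mul_le_mul_of_nonneg_left (hl i this) (ha i this)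
      have := abs_le.1 (hM 1 le_rfl hT)
      simp only [hMdef] at *
      linarith
  have ind : ∀ n : ℕ, 1 ≤ n → (n : ℝ) ≤ T →
      A n - α * log n - (M n - α * n) / n ≤ A 1 + C + (2 * α + 2 * C) * (2 - 1 / n) ∧
      -(C + (2 * α + 2 * C) * (2 - 1 / n)) ≤ A n - α * log n - (M n - α * n) / n := by
    intro n hn
    induction n, hn using Nat.le_induction with
    | base =>
      intro _
      have := abs_le.1 (hM 1 le_rfl hT)
      simp only [Nat.cast_one, log_one, mul_zero, sub_zero, div_one, mul_one] at *
      simp only [hMdef] at *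
      constructor <;> linarith
    | succ n hn ih =>
      intro hnT
      push_cast at hnT ⊢
      have hn' : (1 : ℝ) ≤ n := by exact_mod_cast hn
      obtain ⟨i1, i2⟩ := ih (by linarith)
      have h1 := hup n (n + 1) (by linarith) (by linarith)
      have h2 := hlo n (n + 1) (by linarith) (by linarith)
      have e1 := abs_le.1 (hM n hn' (by linarith))
      have e2 := abs_le.1 (hM (n + 1) (by linarith) hnT)
      change -C ≤ M n - α * n ∧ M n - α * n ≤ C at e1
      change -C ≤ M (n + 1) - α * (n + 1) ∧ M (n + 1) - α * (n + 1) ≤ C at e2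
      obtain ⟨e, he⟩ : ∃ e, e = M n - α * n := ⟨_, rfl⟩
      obtain ⟨e', he'⟩ : ∃ e, e = M (n + 1) - α * (n + 1) := ⟨_, rfl⟩
      rw [← he] at e1 i1 i2
      rw [← he'] at e2 ⊢
      have hMM : M (n + 1) - M n = α + e' - e := by rw [he, he']; ring
      rw [hMM] at h1 h2
      have hl1 : log ((n : ℝ) + 1) - log n ≤ 1 / n := by
        rw [← log_div (by positivity) (by positivity)]
        have := log_le_sub_one_of_pos (x := ((n : ℝ) + 1) / n) (by positivity)
        have h3 : ((n : ℝ) + 1) / n - 1 = 1 / n := by field_simp; ring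
        linarith
      have hl2 : 1 / ((n : ℝ) + 1) ≤ log ((n : ℝ) + 1) - log n := by
        rw [← log_div (by positivity) (by positivity)]
        have := one_sub_inv_le_log_of_pos (x := ((n : ℝ) + 1) / n) (by positivity)
        have h3 : 1 - (((n : ℝ) + 1) / n)⁻¹ = 1 / (n + 1) := by field_simp; ring
        linarith
      obtain ⟨r, hr⟩ : ∃ r, r = 1 / (n : ℝ) := ⟨_, rfl⟩
      obtain ⟨q, hq⟩ : ∃ q, q = 1 / ((n : ℝ) + 1) := ⟨_, rfl⟩
      have hrq : q ≤ r := by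
        rw [hr, hq]; exact one_div_le_one_div_of_le (by linarith) (by linarith)
      have hdr : ∀ x : ℝ, x / n = x * r := fun x => by rw [hr]; ring
      have hdq : ∀ x : ℝ, x / ((n : ℝ) + 1) = x * q := fun x => by rw [hq]; ring
      simp only [hdr, one_mul] at h1 i1 i2 hl1
      simp only [hdq, one_mul] at h2 hl2 ⊢
      have hd0 : 0 ≤ r - q := by linarith
      have k1 := mul_le_mul_of_nonneg_left hl1 hα
      have k2 := mul_le_mul_of_nonneg_left hl2 hα
      have j1 := mul_nonneg (sub_nonneg.2 e1.1) hd0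
      have j2 := mul_nonneg (sub_nonneg.2 e1.2) hd0
      have j4 := mul_nonneg (sub_nonneg.2 e2.2) hd0
      constructor <;> nlinarith
  obtain ⟨n, hn1, hn2⟩ : ∃ n : ℕ, (n : ℝ) ≤ T ∧ T < n + 1 :=
    ⟨⌊T⌋₊, Nat.floor_le (by linarith), Nat.lt_floor_add_one T⟩
  have hn0 : 1 ≤ n := by
    by_contra h
    have : n = 0 := by omega
    subst this; norm_num at hn2; linarith
  have hn' : (1 : ℝ) ≤ n := by exact_mod_cast hn0
  obtain ⟨i1, i2⟩ := ind n hn0 hn1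
  have h1 := hup n T (by linarith) hn1
  have h2 : A n ≤ A T := by
    simp only [hAdef]
    rw [hdiff a n T hn1]
    have : 0 ≤ ∑ i ∈ s with ((n : ℝ) < l i ∧ l i ≤ T), a i :=
      sum_nonneg fun i hi => ha i (mem_filter.1 hi).1
    linarith
  have e1 := abs_le.1 (hM n hn' hn1)
  have e2 := abs_le.1 (hM T hT le_rfl)
  change -C ≤ M n - α * n ∧ M n - α * n ≤ C at e1
  change -C ≤ M T - α * T ∧ M T - α * T ≤ C at e2
  have h3 : (M T - M n) / n ≤ α + 2 * C := by
    rw [div_le_iff₀ (by linarith)]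
    nlinarith
  have hl0 : log n ≤ log T := log_le_log (by linarith) hn1
  have hl1 : log T - log n ≤ 1 := by
    rw [← log_div (by positivity) (by positivity)]
    have := log_le_sub_one_of_pos (x := T / n) (by positivity)
    have h3 : T / n ≤ 2 := by rw [div_le_iff₀ (by linarith)]; linarith
    linarith
  have k1 := mul_le_mul_of_nonneg_left hl1 hα
  have k0 := mul_le_mul_of_nonneg_left hl0 hα
  have hr : 0 ≤ 1 / (n : ℝ) := by positivity
  have f1 : (M n - α * n) / n ≤ C := by rw [div_le_iff₀ (by linarith)]; nlinarith
  have f2 : -C ≤ (M n - α * n) / n := by rw [le_div_iff₀ (by linarith)]; nlinarith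
  have g1 : (2 * α + 2 * C) * (2 - 1 / n) ≤ (2 * α + 2 * C) * 2 :=
    mul_le_mul_of_nonneg_left (by linarith) (by positivity)
  obtain ⟨hA0, hA1⟩ := hA1
  change |A T - α * log T| ≤ _
  rw [abs_le]
  constructor <;> linarith

/-- The nontrivial character modulo four, as a real function. -/
noncomputable def chiFour (n : ℕ) : ℝ := ((ZMod.χ₄ n : ℤ) : ℝ)

theorem chiFour_mul (a b : ℕ) : chiFour (a * b) = chiFour a * chiFour b := by
  unfold chiFour; push_cast; rw [map_mul]; push_cast; rfl

theorem chiFour_eq (n : ℕ) : chiFour n = if n % 2 = 0 then 0 else if n % 4 = 1 then 1 else -1 := by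
  unfold chiFour
  rw [ZMod.χ₄_nat_eq_if_mod_four]
  split_ifs <;> simp

theorem abs_chiFour_le (n : ℕ) : |chiFour n| ≤ 1 := by
  rw [chiFour_eq]; split_ifs <;> simp

theorem sum_chiFour (n : ℕ) : ∑ k ∈ Ioc 0 n, chiFour k =
    if n % 4 = 1 ∨ n % 4 = 2 then 1 else 0 := by
  induction n with
  | zero => simp
  | succ n ih =>
    rw [sum_Ioc_succ_top (by omega), ih, chiFour_eq]
    have : n % 4 = 0 ∨ n % 4 = 1 ∨ n % 4 = 2 ∨ n % 4 = 3 := by omega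
    rcases this with h | h | h | h
    · rw [if_neg (by omega), if_neg (by omega), if_pos (by omega), if_pos (by omega)]; simp
    · rw [if_pos (by omega), if_pos (by omega), if_pos (by omega)]; simp
    · rw [if_pos (by omega), if_neg (by omega), if_neg (by omega), if_neg (by omega)]; simp
    · rw [if_neg (by omega), if_pos (by omega), if_neg (by omega)]; simp

theorem abs_sum_chiFour_mul_le (f : ℕ → ℝ) {a : ℕ} (hf0 : ∀ n, a < n → 0 ≤ f n)
    (hf : ∀ n, a < n → f (n + 1) ≤ f n) (b : ℕ) :
    |∑ k ∈ Ioc a b, chiFour k * f k| ≤ f (a + 1) := by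
  rcases le_or_gt b a with hab | hab
  · rw [Finset.Ioc_eq_empty (by omega)]; simpa using hf0 (a + 1) (by omega)
  have hS : ∀ n, a ≤ n → |∑ k ∈ Ioc a n, chiFour k| ≤ 1 := by
    intro n hn
    have := Finset.sum_Ioc_consecutive chiFour (Nat.zero_le a) hn
    rw [sum_chiFour, sum_chiFour] at this
    have h2 : ∑ k ∈ Ioc a n, chiFour k = (if n % 4 = 1 ∨ n % 4 = 2 then 1 else 0)
      - (if a % 4 = 1 ∨ a % 4 = 2 then 1 else 0) := by linarith
    rw [h2]; split_ifs <;> simp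
  have key : ∀ n, a + 1 ≤ n → |∑ k ∈ Ioc a n, chiFour k * f k -
      (∑ k ∈ Ioc a n, chiFour k) * f n| ≤ f (a + 1) - f n := by
    intro n hn
    induction n, hn using Nat.le_induction with
    | base => simp
    | succ n hn ih =>
      rw [sum_Ioc_succ_top (by omega), sum_Ioc_succ_top (by omega)]
      have h1 := hS n (by omega)
      have h2 := hf n (by omega)
      have h3 : |(∑ k ∈ Ioc a n, chiFour k) * (f n - f (n + 1))| ≤ f n - f (n + 1) := by
        rw [abs_mul, abs_of_nonneg (sub_nonneg.2 h2)]
        exact mul_le_of_le_one_left (sub_nonneg.2 h2) h1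
      rw [abs_le] at *
      constructor <;> nlinarith
  have h1 := key b hab
  have h2 := hS b hab.le
  have h3 := hf0 b hab
  have h4 : |(∑ k ∈ Ioc a b, chiFour k) * f b| ≤ f b := by
    rw [abs_mul, abs_of_nonneg h3]
    exact mul_le_of_le_one_left h3 h2
  rw [abs_le] at *
  constructor <;> linarith

theorem abs_sum_chiFour_div_sub_le (m : ℕ) :
    |∑ k ∈ Ioc 0 m, chiFour k / k - π / 4| ≤ 1 / ((m : ℝ) + 1) := by
  have h1 : ∀ j : ℕ, ∑ k ∈ Ioc 0 (2 * j), chiFour k / k =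
      ∑ i ∈ range j, (-1 : ℝ) ^ i / (2 * i + 1) := by
    intro j
    induction j with
    | zero => simp
    | succ j ih =>
      rw [show 2 * (j + 1) = 2 * j + 1 + 1 by ring, sum_Ioc_succ_top (by omega),
        sum_Ioc_succ_top (by omega), ih, Finset.sum_range_succ]
      have e1 : chiFour (2 * j + 1 + 1) = 0 := by rw [chiFour_eq, if_pos (by omega)]
      have e2 : chiFour (2 * j + 1) = (-1) ^ j := by
        rw [chiFour, ZMod.χ₄_eq_neg_one_pow (by omega)]
        rw [show (2 * j + 1) / 2 = j by omega]; simp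
      rw [e1, e2]; push_cast; ring
  have h2 := Real.tendsto_sum_pi_div_four
  simp_rw [← h1] at h2
  have h3 : Filter.Tendsto (fun j : ℕ => |∑ k ∈ Ioc 0 m, chiFour k / k -
      ∑ k ∈ Ioc 0 (2 * j), chiFour k / k|) Filter.atTop
      (nhds |∑ k ∈ Ioc 0 m, chiFour k / k - π / 4|) :=
    (tendsto_const_nhds.sub h2).abs
  refine le_of_tendsto h3 (Filter.eventually_atTop.2 ⟨m, fun j hj => ?_⟩)
  rw [← Finset.sum_Ioc_consecutive _ (Nat.zero_le m) (show m ≤ 2 * j by omega),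
    sub_add_cancel_left, abs_neg]
  have := abs_sum_chiFour_mul_le (fun n => 1 / (n : ℝ)) (a := m) (fun n _ => by positivity)
    (fun n hn => one_div_le_one_div_of_le (by norm_cast; omega) (by push_cast; linarith)) (2 * j)
  simpa [div_eq_mul_inv] using this

theorem abs_sum_chiFour_log_div_le (N : ℕ) :
    |∑ k ∈ Ioc 0 N, chiFour k / k * log k| ≤ 1 := by
  rcases le_or_gt N 2 with h | h
  · have : ∑ k ∈ Ioc 0 N, chiFour k / k * log k = 0 := by
      refine sum_eq_zero fun k hk => ?_
      rw [mem_Ioc] at hk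
      have : k = 1 ∨ k = 2 := by omega
      rcases this with rfl | rfl
      · simp
      · rw [chiFour_eq]; simp
    rw [this]; simp
  rw [← Finset.sum_Ioc_consecutive _ (show 0 ≤ 2 by omega) (show 2 ≤ N by omega)]
  have e : ∑ k ∈ Ioc 0 2, chiFour k / k * log k = 0 := by
    refine sum_eq_zero fun k hk => ?_
    rw [mem_Ioc] at hk
    have : k = 1 ∨ k = 2 := by omega
    rcases this with rfl | rfl
    · simp
    · rw [chiFour_eq]; simp
  rw [e, zero_add]
  have := abs_sum_chiFour_mul_le (fun n => log n / (n : ℝ)) (a := 2) (fun n _ => by positivity)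
    (fun n hn => by
      have hn' : (3 : ℝ) ≤ n := by exact_mod_cast hn
      have he := Real.exp_one_lt_d9
      exact log_div_self_antitoneOn (show exp 1 ≤ (n : ℝ) by linarith)
        (show exp 1 ≤ ((n + 1 : ℕ) : ℝ) by push_cast; linarith) (by push_cast; linarith)) N
  have h3 : log ((2 + 1 : ℕ) : ℝ) / ((2 + 1 : ℕ) : ℝ) ≤ 1 := by
    rw [div_le_one (by norm_num)]
    have := log_le_sub_one_of_pos (x := ((2 + 1 : ℕ) : ℝ)) (by norm_num)
    linarith
  refine le_trans (le_of_eq ?_) (this.trans h3)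
  congr 1
  exact sum_congr rfl fun k _ => by ring

open ArithmeticFunction hiding log in
theorem sum_mul_vonMangoldt_div (c : ℕ → ℝ) (hc : ∀ a b, c (a * b) = c a * c b) (N : ℕ) :
    ∑ n ∈ Ioc 0 N, c n * log n =
    ∑ d ∈ Ioc 0 N, c d * vonMangoldt d * ∑ k ∈ Ioc 0 (N / d), c k := by
  let f : ArithmeticFunction ℝ := ⟨fun n => c n * vonMangoldt n, by simp⟩
  let g : ArithmeticFunction ℝ := ⟨fun n => if n = 0 then 0 else c n, by simp⟩
  have h := sum_Ioc_mul_eq_sum_sum f g N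
  have h2 : ∀ m, ∑ k ∈ Ioc 0 m, g k = ∑ k ∈ Ioc 0 m, c k := fun m =>
    sum_congr rfl fun k hk => by
      have : k ≠ 0 := by rw [mem_Ioc] at hk; omega
      simp [g, this]
  simp_rw [h2] at h
  refine Eq.trans ?_ h
  refine sum_congr rfl fun n hn => ?_
  rw [mul_apply, ← vonMangoldt_sum, mul_sum]
  rw [Nat.sum_divisorsAntidiagonal (fun i j => f i * g j)]
  refine sum_congr rfl fun i hi => ?_
  rw [Nat.mem_divisors] at hi
  have h0 : n / i ≠ 0 := by
    rw [mem_Ioc] at hn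
    exact (Nat.div_pos (Nat.le_of_dvd (by omega) hi.1) (Nat.pos_of_dvd_of_pos hi.1 (by omega))).ne'
  simp only [f, g, coe_mk, h0, if_false]
  rw [mul_right_comm, ← hc, Nat.mul_div_cancel' hi.1]

open ArithmeticFunction hiding log in
theorem exists_sum_vonMangoldt_div_bound : ∃ C : ℝ, 0 ≤ C ∧ ∀ N : ℕ, 1 ≤ N →
    |∑ d ∈ Ioc 0 N, vonMangoldt d / d - log N| ≤ C := by
  refine ⟨log 4 + 4 + 1, by positivity, fun N hN => ?_⟩
  have hN' : (1 : ℝ) ≤ N := by exact_mod_cast hN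
  have h := sum_mul_vonMangoldt_div (fun _ => 1) (by simp) N
  simp only [one_mul, sum_const, Nat.card_Ioc, nsmul_eq_mul, mul_one, tsub_zero] at h
  have hpsi := Chebyshev.psi_le_const_mul_self (x := (N : ℝ)) (by positivity)
  rw [Chebyshev.psi, Nat.floor_natCast] at hpsi
  have hlogle : ∑ n ∈ Ioc 0 N, log n ≤ N * log N := by
    calc _ ≤ ∑ n ∈ Ioc 0 N, log N := sum_le_sum fun n hn => by
          rw [mem_Ioc] at hn
          exact log_le_log (by exact_mod_cast hn.1) (by exact_mod_cast hn.2)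
      _ = _ := by simp
  have hlogge : ∀ M : ℕ, (M : ℝ) * log M - M ≤ ∑ n ∈ Ioc 0 M, log n := by
    intro M
    induction M with
    | zero => simp
    | succ M ih =>
      rw [sum_Ioc_succ_top (by omega)]
      rcases Nat.eq_zero_or_pos M with rfl | hM
      · simp
      have : log ((M + 1 : ℕ) : ℝ) - log M ≤ 1 / M := by
        rw [← log_div (by positivity) (by positivity)]
        have := log_le_sub_one_of_pos (x := ((M + 1 : ℕ) : ℝ) / M) (by positivity)
        have h3 : ((M + 1 : ℕ) : ℝ) / M - 1 = 1 / M := by push_cast; field_simp; ring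
        linarith
      have h5 : (M : ℝ) * (log ((M + 1 : ℕ) : ℝ) - log M) ≤ 1 := by
        calc _ ≤ (M : ℝ) * (1 / M) := mul_le_mul_of_nonneg_left this (by positivity)
          _ = 1 := by field_simp
      push_cast at *
      linarith
  have hge := hlogge N
  have u1 : ∑ d ∈ Ioc 0 N, vonMangoldt d * ((N / d : ℕ) : ℝ) ≤
      N * ∑ d ∈ Ioc 0 N, vonMangoldt d / d := by
    rw [mul_sum]
    refine sum_le_sum fun d _ => ?_
    have := mul_le_mul_of_nonneg_left (Nat.cast_div_le (m := N) (n := d) (α := ℝ))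
      (vonMangoldt_nonneg (n := d))
    calc _ ≤ _ := this
      _ = _ := by ring
  have u2 : N * ∑ d ∈ Ioc 0 N, vonMangoldt d / d - ∑ d ∈ Ioc 0 N, vonMangoldt d ≤
      ∑ d ∈ Ioc 0 N, vonMangoldt d * ((N / d : ℕ) : ℝ) := by
    rw [mul_sum, ← sum_sub_distrib]
    refine sum_le_sum fun d hd => ?_
    rw [mem_Ioc] at hd
    have h1 : (N : ℝ) / d ≤ ((N / d : ℕ) : ℝ) + 1 := by
      rw [div_le_iff₀ (by exact_mod_cast hd.1)]
      have := Nat.lt_div_mul_add hd.1 (a := N)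
      have h2 : ((N : ℕ) : ℝ) ≤ ((N / d * d + d : ℕ) : ℝ) := by exact_mod_cast this.le
      push_cast at h2; linarith
    have := mul_le_mul_of_nonneg_left h1 (vonMangoldt_nonneg (n := d))
    calc _ = vonMangoldt d * ((N : ℝ) / d) - vonMangoldt d := by ring
      _ ≤ _ := by linarith
  rw [← h] at u1 u2
  set S := ∑ d ∈ Ioc 0 N, vonMangoldt d / d
  have hN0 : (0 : ℝ) < N := by linarith
  have l1 : (N : ℝ) * (log N - 1) ≤ N * S := by linarith
  have l2 : (N : ℝ) * S ≤ N * (log N + (log 4 + 4)) := by linarith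
  have l1' := le_of_mul_le_mul_left l1 hN0
  have l2' := le_of_mul_le_mul_left l2 hN0
  have : 0 ≤ log (4 : ℝ) := by positivity
  rw [abs_le]; constructor <;> linarith

open ArithmeticFunction hiding log in
theorem exists_sum_chiFour_vonMangoldt_bound : ∃ C : ℝ, 0 ≤ C ∧ ∀ N : ℕ, 1 ≤ N →
    |∑ d ∈ Ioc 0 N, chiFour d * (vonMangoldt d / d)| ≤ C := by
  refine ⟨(log 4 + 4 + 1) / (π / 4), by positivity, fun N hN => ?_⟩
  have hN' : (1 : ℝ) ≤ N := by exact_mod_cast hN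
  have h := sum_mul_vonMangoldt_div (fun n => chiFour n / n)
    (fun a b => by rw [chiFour_mul]; push_cast; rw [mul_div_mul_comm]) N
  have hpsi := Chebyshev.psi_le_const_mul_self (x := (N : ℝ)) (by positivity)
  rw [Chebyshev.psi, Nat.floor_natCast] at hpsi
  have h1 := abs_sum_chiFour_log_div_le N
  rw [h] at h1
  rw [le_div_iff₀ (by positivity)]
  set S := ∑ d ∈ Ioc 0 N, chiFour d * (vonMangoldt d / d)
  have h2 : |S * (π / 4) - ∑ d ∈ Ioc 0 N, chiFour d / d * vonMangoldt d *
      ∑ k ∈ Ioc 0 (N / d), chiFour k / k| ≤ log 4 + 4 := by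
    rw [sum_mul, ← sum_sub_distrib]
    calc _ ≤ ∑ d ∈ Ioc 0 N, vonMangoldt d / N := by
          refine (abs_sum_le_sum_abs _ _).trans (sum_le_sum fun d hd => ?_)
          rw [mem_Ioc] at hd
          have hd0 : (0 : ℝ) < d := by exact_mod_cast hd.1
          have e : chiFour d * (vonMangoldt d / d) * (π / 4) - chiFour d / d * vonMangoldt d *
            ∑ k ∈ Ioc 0 (N / d), chiFour k / k = chiFour d * (-(vonMangoldt d / d) *
            (∑ k ∈ Ioc 0 (N / d), chiFour k / k - π / 4)) := by ring
          rw [e, abs_mul, abs_mul, abs_neg, abs_of_nonneg (div_nonneg vonMangoldt_nonneg hd0.le)]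
          have a1 := abs_sum_chiFour_div_sub_le (N / d)
          have a2 : 1 / (((N / d : ℕ) : ℝ) + 1) ≤ d / N := by
            rw [div_le_div_iff₀ (by positivity) (by positivity)]
            have := Nat.lt_div_mul_add hd.1 (a := N)
            have h2 : ((N : ℕ) : ℝ) ≤ ((N / d * d + d : ℕ) : ℝ) := by exact_mod_cast this.le
            push_cast at h2; linarith
          calc _ ≤ 1 * (vonMangoldt d / d * (d / N)) := by
                refine mul_le_mul (abs_chiFour_le d) ?_ (by positivity) (by norm_num)
                exact mul_le_mul_of_nonneg_left (a1.trans a2) (div_nonneg vonMangoldt_nonneg hd0.le)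
            _ = _ := by field_simp
      _ ≤ _ := by
          rw [← Finset.sum_div, div_le_iff₀ (by linarith)]; exact hpsi
  have : |S| * (π / 4) = |S * (π / 4)| := by
    rw [abs_mul, abs_of_nonneg (show 0 ≤ π / 4 by positivity)]
  rw [this]
  rw [abs_le] at *
  constructor <;> linarith

open ArithmeticFunction hiding log in
theorem exists_sum_not_prime_vonMangoldt_div_le : ∃ C : ℝ, 0 ≤ C ∧ ∀ N : ℕ,
    ∑ n ∈ Ioc 0 N with ¬ n.Prime, vonMangoldt n / n ≤ C := by
  obtain ⟨C', hC'⟩ := Chebyshev.psi_sub_theta_le_mul_sqrt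
  set C := max C' 0
  have hC0 : 0 ≤ C := le_max_right _ _
  have hC : ∀ n : ℕ, ∑ n ∈ Ioc 0 n with ¬ n.Prime, vonMangoldt n ≤ C * √n := by
    intro n
    have := hC' n
    rw [Chebyshev.psi_sub_theta_eq_sum_not_prime, Nat.floor_natCast] at this
    exact this.trans (mul_le_mul_of_nonneg_right (le_max_left _ _) (sqrt_nonneg _))
  refine ⟨4 * C, by positivity, fun N => ?_⟩
  simp only [sum_filter] at hC ⊢
  have key : ∀ n : ℕ, 1 ≤ n → ∑ m ∈ Ioc 0 n, (if ¬ m.Prime then vonMangoldt m / m else 0) ≤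
      (∑ m ∈ Ioc 0 n, if ¬ m.Prime then vonMangoldt m else 0) / n
        + 2 * C * (1 - 1 / √n) := by
    intro n hn
    induction n, hn using Nat.le_induction with
    | base => simp
    | succ n hn ih =>
      rw [sum_Ioc_succ_top (by omega), sum_Ioc_succ_top (by omega)]
      have hB := hC n
      set B := ∑ m ∈ Ioc 0 n, if ¬ m.Prime then vonMangoldt m else 0
      have hn' : (1 : ℝ) ≤ n := by exact_mod_cast hn
      have e : (if ¬ Nat.Prime (n + 1) then vonMangoldt (n + 1) / ((n + 1 : ℕ) : ℝ) else 0) =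
        (if ¬ Nat.Prime (n + 1) then vonMangoldt (n + 1) else 0) / ((n + 1 : ℕ) : ℝ) := by
        split_ifs <;> simp
      rw [e, add_div]
      have hs : B / n - B / ((n + 1 : ℕ) : ℝ) ≤ 2 * C * (1 / √n - 1 / √((n + 1 : ℕ) : ℝ)) := by
        have a0 : 0 < √(n : ℝ) := sqrt_pos.2 (by linarith)
        have b0 : 0 < √((n + 1 : ℕ) : ℝ) := sqrt_pos.2 (by positivity)
        have a2 : √(n : ℝ) ^ 2 = n := sq_sqrt (by linarith)
        have b2 : √((n + 1 : ℕ) : ℝ) ^ 2 = ((n + 1 : ℕ) : ℝ) := sq_sqrt (by positivity)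
        have hab : √(n : ℝ) ≤ √((n + 1 : ℕ) : ℝ) := sqrt_le_sqrt (by push_cast; linarith)
        set a := √(n : ℝ)
        set b := √((n + 1 : ℕ) : ℝ)
        rw [← b2, ← a2]
        have hd : b ^ 2 - a ^ 2 = 1 := by rw [a2, b2]; push_cast; ring
        have e1 : B / a ^ 2 - B / b ^ 2 = B / (a ^ 2 * b ^ 2) := by
          field_simp; linear_combination B * hd
        have e2 : 1 / a - 1 / b = 1 / (a * b * (a + b)) := by
          field_simp; linear_combination hd
        rw [e1, e2, mul_one_div, div_le_div_iff₀ (by positivity) (by positivity)]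
        have : a + b ≤ 2 * b := by linarith
        calc B * (a * b * (a + b)) ≤ (C * a) * (a * b * (2 * b)) := by gcongr
          _ = 2 * C * (a ^ 2 * b ^ 2) := by ring
      linarith
  rcases Nat.eq_zero_or_pos N with rfl | hN
  · simp; positivity
  have h1 := key N hN
  have h2 := hC N
  have hN' : (1 : ℝ) ≤ N := by exact_mod_cast hN
  have h3 : (∑ m ∈ Ioc 0 N, if ¬ m.Prime then vonMangoldt m else 0) / N ≤ C := by
    rw [div_le_iff₀ (by linarith)]
    refine h2.trans (mul_le_mul_of_nonneg_left ?_ hC0)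
    rw [sqrt_le_left (by linarith)]; nlinarith
  have h4 : 2 * C * (1 - 1 / √N) ≤ 2 * C := by
    have : 0 ≤ 1 / √(N : ℝ) := by positivity
    nlinarith
  linarith

open ArithmeticFunction hiding log in
theorem exists_sum_prime_log_div_bound : ∃ C : ℝ, 0 ≤ C ∧ ∀ N : ℕ, 1 ≤ N →
    |∑ p ∈ Ioc 0 N with p.Prime, log p / p - log N| ≤ C := by
  obtain ⟨C1, h1, H1⟩ := exists_sum_vonMangoldt_div_bound
  obtain ⟨C2, h2, H2⟩ := exists_sum_not_prime_vonMangoldt_div_le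
  refine ⟨C1 + C2, by positivity, fun N hN => ?_⟩
  have a1 := H1 N hN
  have a2 := H2 N
  rw [← sum_filter_add_sum_filter_not _ Nat.Prime] at a1
  have e : ∑ p ∈ Ioc 0 N with p.Prime, vonMangoldt p / p =
      ∑ p ∈ Ioc 0 N with p.Prime, log p / p := sum_congr rfl fun p hp => by
    rw [vonMangoldt_apply_prime (mem_filter.1 hp).2]
  have a3 : 0 ≤ ∑ n ∈ Ioc 0 N with ¬ n.Prime, vonMangoldt n / n :=
    sum_nonneg fun n _ => div_nonneg vonMangoldt_nonneg (by positivity)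
  rw [e] at a1
  rw [abs_le] at *
  constructor <;> linarith

open ArithmeticFunction hiding log in
theorem exists_sum_prime_one_mod_four_log_div_bound : ∃ C : ℝ, 0 ≤ C ∧ ∀ N : ℕ, 1 ≤ N →
    |∑ p ∈ Ioc 0 N with (p.Prime ∧ p % 4 = 1), log p / p - 1 / 2 * log N| ≤ C := by
  obtain ⟨C1, h1, H1⟩ := exists_sum_prime_log_div_bound
  obtain ⟨C2, h2, H2⟩ := exists_sum_not_prime_vonMangoldt_div_le
  obtain ⟨C3, h3, H3⟩ := exists_sum_chiFour_vonMangoldt_bound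
  refine ⟨C1 + C2 + C3 + 1, by positivity, fun N hN => ?_⟩
  have a1 := H1 N hN
  have a2 := H2 N
  have a3 := H3 N hN
  rw [← sum_filter_add_sum_filter_not _ Nat.Prime] at a3
  have e : ∑ p ∈ Ioc 0 N with p.Prime, chiFour p * (vonMangoldt p / p) =
      ∑ p ∈ Ioc 0 N with p.Prime, chiFour p * (log p / p) :=
    sum_congr rfl fun p hp => by
      rw [vonMangoldt_apply_prime (mem_filter.1 hp).2]
  have a4 : |∑ n ∈ Ioc 0 N with ¬ n.Prime, chiFour n * (vonMangoldt n / n)| ≤ C2 := by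
    refine (abs_sum_le_sum_abs _ _).trans (le_trans (sum_le_sum fun n _ => ?_) a2)
    have : 0 ≤ vonMangoldt n / n := div_nonneg vonMangoldt_nonneg (by positivity)
    rw [abs_mul, abs_of_nonneg this]
    exact mul_le_of_le_one_left this (abs_chiFour_le n)
  rw [e] at a3
  have a5 : |2 * ∑ p ∈ Ioc 0 N with (p.Prime ∧ p % 4 = 1), log p / p -
      (∑ p ∈ Ioc 0 N with p.Prime, log p / p +
      ∑ p ∈ Ioc 0 N with p.Prime, chiFour p * (log p / p))| ≤ 1 := by
    rw [← filter_filter, sum_filter (fun p => p % 4 = 1), mul_sum,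
      ← sum_add_distrib, ← sum_sub_distrib]
    calc _ ≤ ∑ p ∈ Ioc 0 N with p.Prime, (if p = 2 then 1 else 0 : ℝ) := by
          refine (abs_sum_le_sum_abs _ _).trans (sum_le_sum fun p hp => ?_)
          have hp := (mem_filter.1 hp).2
          rcases hp.eq_two_or_odd with rfl | h
          · have : |log 2 / 2| ≤ (1 : ℝ) := by
              rw [abs_of_nonneg (by positivity)]
              linarith [Real.log_two_lt_d9]
            have h2 : chiFour 2 = 0 := by rw [chiFour_eq]; simp
            simpa [h2] using this
          · rw [if_neg (show p ≠ 2 by rintro rfl; omega), chiFour_eq, if_neg (show ¬ p % 2 = 0 by omega)]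
            split_ifs with h1 <;> ring_nf <;> simp
      _ ≤ 1 := by
          rw [Finset.sum_ite_eq']; split_ifs <;> norm_num
  rw [abs_le] at *
  constructor <;> linarith

theorem exists_mertens {q : ℕ → Prop} [DecidablePred q] {α C : ℝ} (hα : 0 ≤ α) (hC : 0 ≤ C)
    (h : ∀ N : ℕ, 1 ≤ N → |∑ p ∈ Ioc 0 N with (p.Prime ∧ q p), log p / p - α * log N| ≤ C) :
    ∃ D : ℝ, 0 ≤ D ∧ ∀ N : ℕ, 3 ≤ N →
      |∑ p ∈ Ioc 0 N with (p.Prime ∧ q p), (1 : ℝ) / p - α * log (log N)| ≤ D := by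
  obtain ⟨D, hD, H⟩ := abel_log (c := log 2) hα (show 0 ≤ C + α by positivity)
    (log_pos (by norm_num))
  refine ⟨D, hD, fun N hN => ?_⟩
  have hN' : (3 : ℝ) ≤ N := by exact_mod_cast hN
  have hN1 : 1 ≤ log N := by
    rw [le_log_iff_exp_le (by linarith)]
    linarith [Real.exp_one_lt_d9]
  have hmem : ∀ i ∈ (Ioc 0 N).filter (fun p => p.Prime ∧ q p), 2 ≤ i ∧ i ≤ N := fun i hi => by
    simp only [mem_filter, mem_Ioc] at hi
    exact ⟨hi.2.1.two_le, hi.1.2⟩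
  have := H ((Ioc 0 N).filter (fun p => p.Prime ∧ q p)) (fun p => log p)
    (fun p => (1 : ℝ) / p) (fun i _ => by positivity)
    (fun i hi => log_le_log (by norm_num) (by exact_mod_cast (hmem i hi).1)) (log N) hN1 ?_
  · convert this using 4
    ext i
    simp only [mem_filter, mem_Ioc]
    constructor
    · rintro ⟨h1, h2⟩
      exact ⟨⟨h1, h2⟩, log_le_log (by exact_mod_cast h1.1) (by exact_mod_cast h1.2)⟩
    · rintro ⟨h1, _⟩; exact h1
  · intro t ht1 ht2
    have hexp : (1 : ℝ) ≤ exp t := one_le_exp (by linarith)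
    have hfl1 := Nat.floor_le (exp_pos t).le
    have hfl2 := Nat.lt_floor_add_one (exp t)
    have h1 : 1 ≤ ⌊exp t⌋₊ := Nat.le_floor (by simpa using hexp)
    have h1' : (1 : ℝ) ≤ ⌊exp t⌋₊ := by exact_mod_cast h1
    have h2 := h ⌊exp t⌋₊ h1
    have e : ∑ i ∈ ((Ioc 0 N).filter (fun p => p.Prime ∧ q p)).filter (fun i : ℕ => log i ≤ t),
        ((1 : ℝ) / i * log i) =
        ∑ p ∈ Ioc 0 ⌊exp t⌋₊ with (p.Prime ∧ q p), log p / p := by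
      refine sum_congr ?_ fun p _ => by ring
      ext i
      simp only [mem_filter, mem_Ioc]
      constructor
      · rintro ⟨⟨⟨h1, h2⟩, h3⟩, h4⟩
        refine ⟨⟨h1, Nat.le_floor ?_⟩, h3⟩
        rwa [← log_le_iff_le_exp (by exact_mod_cast h1)]
      · rintro ⟨⟨h1, h2⟩, h3⟩
        have h4 : (i : ℝ) ≤ exp t := (Nat.cast_le.2 h2).trans hfl1
        refine ⟨⟨⟨h1, ?_⟩, h3⟩, (log_le_iff_le_exp (by exact_mod_cast h1)).2 h4⟩
        have : (i : ℝ) ≤ N := h4.trans ((le_log_iff_exp_le (by linarith)).1 ht2)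
        exact_mod_cast this
    rw [e]
    have l1 : log ⌊exp t⌋₊ ≤ t := (log_le_iff_le_exp (by linarith)).2 hfl1
    have l2 : t - 1 ≤ log ⌊exp t⌋₊ := by
      rw [le_log_iff_exp_le (by linarith), Real.exp_sub, div_le_iff₀ (exp_pos _)]
      have : (2 : ℝ) ≤ exp 1 := by linarith [Real.exp_one_gt_d9]
      nlinarith
    have m1 := mul_le_mul_of_nonneg_left l1 hα
    have m2 := mul_le_mul_of_nonneg_left l2 hα
    rw [abs_le] at *
    constructor <;> nlinarith

theorem exists_sum_prime_inv_bound : ∃ D : ℝ, 0 ≤ D ∧ ∀ N : ℕ, 3 ≤ N →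
    |∑ p ∈ Ioc 0 N with p.Prime, (1 : ℝ) / p - log (log N)| ≤ D := by
  obtain ⟨C, hC, H⟩ := exists_sum_prime_log_div_bound
  have := exists_mertens (q := fun _ => True) zero_le_one hC (by simpa using H)
  simpa using this

theorem exists_sum_prime_one_mod_four_inv_bound : ∃ D : ℝ, 0 ≤ D ∧ ∀ N : ℕ, 3 ≤ N →
    |∑ p ∈ Ioc 0 N with (p.Prime ∧ p % 4 = 1), (1 : ℝ) / p - 1 / 2 * log (log N)| ≤ D := by
  obtain ⟨C, hC, H⟩ := exists_sum_prime_one_mod_four_log_div_bound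
  exact exists_mertens (by norm_num) hC H

theorem exists_sum_primeFactors_inv_le : ∃ D : ℝ, 0 ≤ D ∧ ∀ (M : ℕ) (X : ℝ), 3 ≤ X → M ≠ 0 →
    log M ≤ X → ∑ p ∈ M.primeFactors, (1 : ℝ) / p ≤ log (log X) + D := by
  obtain ⟨D, hD, H⟩ := exists_sum_prime_inv_bound
  refine ⟨D + 1, by positivity, fun M X hX hM hMX => ?_⟩
  have hfl : 3 ≤ ⌊X⌋₊ := Nat.le_floor (by exact_mod_cast hX)
  have h3 : (3 : ℝ) ≤ ⌊X⌋₊ := by exact_mod_cast hfl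
  have hflX := Nat.floor_le (show 0 ≤ X by linarith)
  have h1 := (abs_le.1 (H ⌊X⌋₊ hfl)).2
  have hl : log (log ⌊X⌋₊) ≤ log (log X) :=
    log_le_log (log_pos (by linarith)) (log_le_log (by linarith) hflX)
  rw [← sum_filter_add_sum_filter_not M.primeFactors (fun p => p ≤ ⌊X⌋₊)]
  have a1 : ∑ p ∈ M.primeFactors with p ≤ ⌊X⌋₊, (1 : ℝ) / p ≤
      ∑ p ∈ Ioc 0 ⌊X⌋₊ with p.Prime, (1 : ℝ) / p := by
    refine sum_le_sum_of_subset_of_nonneg ?_ fun i _ _ => by positivity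
    intro p hp
    simp only [mem_filter, Nat.mem_primeFactors, mem_Ioc] at hp ⊢
    exact ⟨⟨hp.1.1.pos, hp.2⟩, hp.1.1⟩
  have a2 : ∑ p ∈ M.primeFactors with ¬ p ≤ ⌊X⌋₊, (1 : ℝ) / p ≤ 1 := by
    have hlX : 1 ≤ log X := by
      rw [le_log_iff_exp_le (by linarith)]; linarith [Real.exp_one_lt_d9]
    have b1 : ∀ p ∈ M.primeFactors.filter (fun p => ¬ p ≤ ⌊X⌋₊), (1 : ℝ) / p ≤ log p / X := by
      intro p hp
      simp only [mem_filter, Nat.mem_primeFactors, not_le] at hp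
      have hpX : X < p := (Nat.floor_lt (by linarith)).1 hp.2
      rw [div_le_div_iff₀ (by linarith) (by linarith)]
      have := log_le_log (by linarith) hpX.le
      nlinarith
    refine (sum_le_sum b1).trans ?_
    rw [← Finset.sum_div, div_le_one (by linarith)]
    refine le_trans ?_ hMX
    calc _ ≤ ∑ p ∈ M.primeFactors, log p :=
          sum_le_sum_of_subset_of_nonneg (filter_subset _ _) fun p hp _ => by
            have := (Nat.prime_of_mem_primeFactors hp).one_lt
            exact log_nonneg (by exact_mod_cast this.le)
      _ = log (∏ p ∈ M.primeFactors, p : ℕ) := by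
          push_cast
          rw [log_prod]
          intro p hp
          exact_mod_cast (Nat.prime_of_mem_primeFactors hp).ne_zero
      _ ≤ _ := by
          refine log_le_log ?_ ?_
          · exact_mod_cast Finset.prod_pos fun p hp => (Nat.prime_of_mem_primeFactors hp).pos
          · exact_mod_cast Nat.le_of_dvd (Nat.pos_of_ne_zero hM) (Nat.prod_primeFactors_dvd M)
  linarith

theorem sum_range_mul_periodic {M p : ℕ} (hM : M ≠ 0) (hp : p ≠ 0) (hc : M.Coprime p)
    {f g : ℕ → ℝ} (hf : Function.Periodic f M) (hg : Function.Periodic g p) :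
    ∑ n ∈ range (M * p), f n * g n =
      (∑ n ∈ range M, f n) * ∑ n ∈ range p, g n := by
  rw [Finset.sum_mul_sum, ← Finset.sum_product']
  refine sum_bij (fun n _ => (n % M, n % p)) ?_ ?_ ?_ ?_
  · intro n _
    simp only [mem_product, mem_range]
    exact ⟨Nat.mod_lt _ (Nat.pos_of_ne_zero hM), Nat.mod_lt _ (Nat.pos_of_ne_zero hp)⟩
  · intro a ha b hb hab
    rw [mem_range] at ha hb
    simp only [Prod.mk.injEq] at hab
    have : a ≡ b [MOD M * p] := (Nat.modEq_and_modEq_iff_modEq_mul hc).1 hab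
    exact this.eq_of_lt_of_lt ha hb
  · rintro ⟨u, v⟩ huv
    simp only [mem_product, mem_range] at huv
    refine ⟨Nat.chineseRemainder hc u v, mem_range.2
      (Nat.chineseRemainder_lt_mul hc u v hM hp), ?_⟩
    have h := (Nat.chineseRemainder hc u v).2
    simp only [Prod.mk.injEq]
    exact ⟨Eq.trans h.1 (Nat.mod_eq_of_lt huv.1), Eq.trans h.2 (Nat.mod_eq_of_lt huv.2)⟩
  · intro n _
    rw [hf.map_mod_nat, hg.map_mod_nat]

theorem abs_sum_range_periodic_sub_le {M : ℕ} (hM : M ≠ 0) {f : ℕ → ℝ} (hf : Function.Periodic f M)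
    (hf0 : ∀ n, 0 ≤ f n) (W : ℕ) :
    |∑ n ∈ range W, f n - W * ((∑ n ∈ range M, f n) / M)| ≤
      ∑ n ∈ range M, f n := by
  set S := ∑ n ∈ range M, f n
  have hS : 0 ≤ S := sum_nonneg fun n _ => hf0 n
  have hM' : (0 : ℝ) < M := by exact_mod_cast Nat.pos_of_ne_zero hM
  have full : ∀ q, ∑ n ∈ range (q * M), f n = q * S := by
    intro q
    induction q with
    | zero => simp
    | succ q ih =>
      rw [add_mul, one_mul, Finset.sum_range_add, ih]
      push_cast
      rw [add_mul, one_mul]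
      congr 1
      refine sum_congr rfl fun n _ => ?_
      rw [add_comm]
      exact hf.nat_mul q n
  have mono : ∀ a b, a ≤ b → ∑ n ∈ range a, f n ≤ ∑ n ∈ range b, f n := fun a b h =>
    sum_le_sum_of_subset_of_nonneg (Finset.range_mono h) fun n _ _ => hf0 n
  have l1 := mono (W / M * M) W (Nat.div_mul_le_self W M)
  have l2 := mono W ((W / M + 1) * M) (by
    rw [add_mul, one_mul]; exact (Nat.lt_div_mul_add (Nat.pos_of_ne_zero hM)).le)
  rw [full] at l1 l2
  have h1 : ((W / M : ℕ) : ℝ) * M ≤ W := by exact_mod_cast Nat.div_mul_le_self W M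
  have h2 : (W : ℝ) ≤ (((W / M : ℕ) : ℝ) + 1) * M := by
    have := (Nat.lt_div_mul_add (Nat.pos_of_ne_zero hM) (a := W)).le
    have : ((W : ℕ) : ℝ) ≤ ((W / M * M + M : ℕ) : ℝ) := by exact_mod_cast this
    push_cast at this; linarith
  push_cast at l2
  have e : (W : ℝ) * (S / M) = W / M * S := by ring
  have h1' : ((W / M : ℕ) : ℝ) ≤ W / M := by rwa [le_div_iff₀ hM']
  have h2' : (W : ℝ) / M ≤ ((W / M : ℕ) : ℝ) + 1 := by rwa [div_le_iff₀ hM']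
  have k1 := mul_le_mul_of_nonneg_right h1' hS
  have k2 := mul_le_mul_of_nonneg_right h2' hS
  rw [e, abs_le]
  constructor <;> linarith

theorem prod_periodic {P : Finset ℕ} (h : ℕ → ℕ → ℝ) (hP : ∀ p ∈ P, p.Prime)
    (hper : ∀ p ∈ P, Function.Periodic (h p) p) :
    Function.Periodic (fun n => ∏ p ∈ P, h p n) (∏ p ∈ P, p) ∧
    ∑ n ∈ range (∏ p ∈ P, p), ∏ p ∈ P, h p n =
      ∏ p ∈ P, ∑ n ∈ range p, h p n := by
  induction P using Finset.induction_on with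
  | empty => simp [Function.Periodic]
  | insert a P ha ih =>
    obtain ⟨i1, i2⟩ := ih (fun p hp => hP p (mem_insert_of_mem hp))
      (fun p hp => hper p (mem_insert_of_mem hp))
    have hpa := hper a (mem_insert_self a P)
    have hpr := hP a (mem_insert_self a P)
    constructor
    · intro n
      simp only [prod_insert ha]
      congr 1
      · have := hpa.nat_mul (∏ p ∈ P, p) n
        rwa [mul_comm] at this
      · exact i1.nat_mul a n
    · simp only [prod_insert ha]
      rw [sum_range_mul_periodic hpr.ne_zero (Finset.prod_ne_zero_iff.2 fun p hp =>
        (hP p (mem_insert_of_mem hp)).ne_zero) ?_ hpa i1, i2]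
      refine Nat.Coprime.prod_right fun p hp => ?_
      exact (Nat.coprime_primes hpr (hP p (mem_insert_of_mem hp))).2
        (by rintro rfl; exact ha hp)

theorem interval_sieve_aux {P : Finset ℕ} (h : ℕ → ℕ → ℝ) (hP : ∀ p ∈ P, p.Prime)
    (h5 : ∀ p ∈ P, 5 < p) (h0 : ∀ p ∈ P, ∀ n, 0 ≤ h p n) (h1 : ∀ p ∈ P, ∀ n, h p n ≤ 1)
    (hper : ∀ p ∈ P, Function.Periodic (h p) p)
    (hS : ∀ p ∈ P, ∑ n ∈ range p, h p n ≤ 5) (W k : ℕ) {Y : ℝ} (hY1 : 1 ≤ Y)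
    (hY : ∀ p ∈ P, (p : ℝ) ≤ Y) :
    ∑ n ∈ range W, ∏ p ∈ P, (1 - h p n) ≤
      W * exp (-∑ p ∈ P, (∑ n ∈ range p, h p n) / p) +
      (k + 2) * (exp 1 * (5 * Y) ^ (k + 1)) +
      2 * W * (exp (exp 1 * (5 * ∑ p ∈ P, (1 : ℝ) / p)) / exp 1 ^ (k + 1)) := by
  set S : ℕ → ℝ := fun p => ∑ n ∈ range p, h p n with hSdef
  have hS0 : ∀ p ∈ P, 0 ≤ S p := fun p hp => sum_nonneg fun n _ => h0 p hp n
  have hp0 : ∀ p ∈ P, (5 : ℝ) < p := fun p hp => by exact_mod_cast h5 p hp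
  have hg0 : ∀ p ∈ P, 0 ≤ S p / p := fun p hp => div_nonneg (hS0 p hp) (by positivity)
  have hg1 : ∀ p ∈ P, S p / p ≤ 1 := fun p hp => by
    have := hp0 p hp
    rw [div_le_one (by linarith)]; exact (hS p hp).trans this.le
  have main := brun_sum (range W) (fun _ => (1 : ℝ)) (fun _ _ => zero_le_one) P
    (fun n p => h p n) (fun n _ p hp => h0 p hp n) (fun n _ p hp => h1 p hp n) (fun p => S p / p)
    hg0 hg1 (X := (W : ℝ)) (by positivity) k (fun E => ∏ p ∈ E, S p) ?_
  · simp only [one_mul] at main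
    have m1 := (abs_le.1 main).2
    have m2 : ∏ p ∈ P, (1 - S p / p) ≤ exp (-∑ p ∈ P, S p / p) := by
      rw [← Finset.sum_neg_distrib, Real.exp_sum]
      refine Finset.prod_le_prod (fun p hp => by linarith [hg1 p hp]) fun p _ => ?_
      have := add_one_le_exp (-(S p / p)); linarith
    have m3 : ∑ j ∈ range (k + 2), ∑ E ∈ P.powersetCard j, ∏ p ∈ E, S p ≤
        (k + 2) * (exp 1 * (5 * Y) ^ (k + 1)) := by
      have : ∀ j ∈ range (k + 2), ∑ E ∈ P.powersetCard j, ∏ p ∈ E, S p ≤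
          exp 1 * (5 * Y) ^ (k + 1) := by
        intro j hj
        refine (sum_powersetCard_prod_le P S hS0 j (t := 1 / (5 * Y)) (by positivity)).trans ?_
        rw [div_eq_mul_inv, ← inv_pow, one_div, inv_inv]
        have hsum : ∑ p ∈ P, S p ≤ 5 * Y := by
          calc ∑ p ∈ P, S p ≤ ∑ p ∈ P, (5 : ℝ) := sum_le_sum hS
            _ = 5 * P.card := by simp [mul_comm]
            _ ≤ 5 * Y := by
              have : P.card ≤ ⌊Y⌋₊ := by
                calc P.card ≤ (Ioc 0 ⌊Y⌋₊).card := card_le_card fun p hp => by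
                      rw [mem_Ioc]
                      exact ⟨(hP p hp).pos, Nat.le_floor (hY p hp)⟩
                  _ = _ := by simp
              have h3 : (P.card : ℝ) ≤ ⌊Y⌋₊ := by exact_mod_cast this
              have := Nat.floor_le (show 0 ≤ Y by linarith)
              linarith
        gcongr
        · rw [inv_mul_le_iff₀ (by positivity)]; linarith
        · linarith
        · rw [mem_range] at hj; omega
      refine (sum_le_sum this).trans ?_
      simp
    have m4 : ∑ E ∈ P.powersetCard (k + 1), ∏ p ∈ E, (S p / p) ≤
        exp (exp 1 * (5 * ∑ p ∈ P, (1 : ℝ) / p)) / exp 1 ^ (k + 1) := by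
      refine (sum_powersetCard_prod_le P _ hg0 (k + 1) (exp_pos 1)).trans ?_
      gcongr
      rw [mul_sum]
      refine sum_le_sum fun p hp => ?_
      rw [mul_one_div]
      exact div_le_div_of_nonneg_right (hS p hp) (by positivity)
    have m5 := mul_le_mul_of_nonneg_left m2 (show (0 : ℝ) ≤ W by positivity)
    have m6 := mul_le_mul_of_nonneg_left m4 (show (0 : ℝ) ≤ 2 * W by positivity)
    linarith
  · intro E hE _
    obtain ⟨p1, p2⟩ := prod_periodic (P := E) h (fun p hp => hP p (hE hp))
      (fun p hp => hper p (hE hp))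
    have := abs_sum_range_periodic_sub_le (Finset.prod_ne_zero_iff.2 fun p hp =>
      (hP p (hE hp)).ne_zero) p1 (fun n => prod_nonneg fun p hp => h0 p (hE hp) n) W
    rw [p2] at this
    simp only [one_mul]
    rw [Finset.prod_div_distrib]
    push_cast at this
    exact this

theorem eventually_log_le_rpow {δ : ℝ} (hδ : 0 < δ) : ∀ᶠ x : ℝ in Filter.atTop, log x ≤ x ^ δ := by
  have := (isLittleO_log_rpow_atTop hδ).bound zero_lt_one
  filter_upwards [this, Filter.eventually_ge_atTop 1] with x hx hx1
  rw [one_mul, norm_of_nonneg (log_nonneg hx1), norm_of_nonneg (by positivity)] at hx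
  exact hx

theorem eventually_sieve_level {ε : ℝ} (hε : 0 < ε) (hε1 : ε < 1) : ∀ᶠ L : ℝ in Filter.atTop,
    (40 * log L + 1) * (2 + L ^ (1 - ε)) + 50 * log L + 3 ≤ L := by
  filter_upwards [eventually_log_le_rpow (show 0 < ε / 4 by positivity),
    Filter.eventually_ge_atTop (1 : ℝ),
    (tendsto_rpow_atTop (show 0 < ε / 2 by positivity)).eventually_ge_atTop 176] with L h1 h2 h3
  have a1 : 1 ≤ L ^ (ε / 4) := one_le_rpow h2 (by positivity)
  have a2 : 1 ≤ L ^ (1 - ε) := one_le_rpow h2 (by linarith)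
  have a3 : L ^ (ε / 4) ≤ L ^ (1 - ε / 2) := rpow_le_rpow_of_exponent_le h2 (by linarith)
  have a4 : L ^ (ε / 4) * L ^ (1 - ε) ≤ L ^ (1 - ε / 2) := by
    rw [← rpow_add (by linarith)]
    exact rpow_le_rpow_of_exponent_le h2 (by linarith)
  have a5 : L ^ (1 - ε / 2) * L ^ (ε / 2) = L := by
    rw [← rpow_add (by linarith)]; simp
  have a7 : (40 * log L + 1) * (2 + L ^ (1 - ε)) ≤ (41 * L ^ (ε / 4)) * (3 * L ^ (1 - ε)) := by
    apply mul_le_mul <;> linarith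
  nlinarith

/-- An upper-bound sieve on an interval for primes up to `exp ((log W) ^ (1 - ε))`. -/
theorem interval_sieve {ε : ℝ} (hε : 0 < ε) (hε1 : ε < 1) : ∀ᶠ W : ℕ in Filter.atTop,
    ∀ (P : Finset ℕ) (h : ℕ → ℕ → ℝ), (∀ p ∈ P, p.Prime ∧ 5 < p ∧ log p ≤ log W ^ (1 - ε)) →
    (∀ p ∈ P, ∀ n, 0 ≤ h p n ∧ h p n ≤ 1) → (∀ p ∈ P, Function.Periodic (h p) p) →
    (∀ p ∈ P, ∑ n ∈ range p, h p n ≤ 5) →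
    ∑ n ∈ range W, ∏ p ∈ P, (1 - h p n) ≤
      3 * W * (exp (-∑ p ∈ P, (∑ n ∈ range p, h p n) / p) + 1 / log W ^ 10) := by
  obtain ⟨D, hD, HD⟩ := exists_sum_prime_inv_bound
  have tl : Filter.Tendsto (fun W : ℕ => log (W : ℝ)) Filter.atTop Filter.atTop :=
    tendsto_log_atTop.comp tendsto_natCast_atTop_atTop
  filter_upwards [tl.eventually (eventually_sieve_level hε hε1),
    tl.eventually (tendsto_log_atTop.eventually_ge_atTop (14 * D + 1)),
    tl.eventually ((tendsto_rpow_atTop (show 0 < 1 - ε by linarith)).eventually_ge_atTop 2),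
    tl.eventually_ge_atTop 3, Filter.eventually_ge_atTop 1] with W e1 e2 e3 e4 hW1
  intro P h hP h01 hper hS
  set L := log (W : ℝ)
  set x := log L with hx
  have hx0 : 0 ≤ x := by linarith
  have hL0 : 0 < L := by linarith
  have hexpx : exp x = L := exp_log hL0
  have hWpos : (0 : ℝ) < W := by exact_mod_cast hW1
  have hexpL : exp L = W := exp_log hWpos
  set Y := exp (L ^ (1 - ε)) with hYdef
  have hY3 : 3 ≤ Y := by
    have := add_one_le_exp (L ^ (1 - ε)); linarith
  obtain ⟨k, hk1, hk2⟩ : ∃ k : ℕ, 40 * x ≤ (k : ℝ) + 1 ∧ (k : ℝ) ≤ 40 * x := by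
    refine ⟨⌊40 * x⌋₊, (Nat.lt_floor_add_one _).le, Nat.floor_le (by positivity)⟩
  have main := interval_sieve_aux h (fun p hp => (hP p hp).1) (fun p hp => (hP p hp).2.1)
    (fun p hp n => (h01 p hp n).1) (fun p hp n => (h01 p hp n).2) hper hS W k (Y := Y)
    (by linarith) (fun p hp => by
      have := (hP p hp).1.pos
      exact (log_le_iff_le_exp (by exact_mod_cast this)).1 (hP p hp).2.2)
  have hsum : ∑ p ∈ P, (1 : ℝ) / p ≤ x + D := by
    have hfl : 3 ≤ ⌊Y⌋₊ := Nat.le_floor (by exact_mod_cast hY3)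
    have hfl3 : (3 : ℝ) ≤ ⌊Y⌋₊ := by exact_mod_cast hfl
    have h1 := (abs_le.1 (HD ⌊Y⌋₊ hfl)).2
    have h2 : log ⌊Y⌋₊ ≤ L := by
      calc log ⌊Y⌋₊ ≤ log Y := log_le_log (by linarith) (Nat.floor_le (by linarith))
        _ = L ^ (1 - ε) := log_exp _
        _ ≤ L ^ (1 : ℝ) := rpow_le_rpow_of_exponent_le (by linarith) (by linarith)
        _ = L := rpow_one L
    have h3 : log (log ⌊Y⌋₊) ≤ x := log_le_log (log_pos (by linarith)) h2
    have h4 : ∑ p ∈ P, (1 : ℝ) / p ≤ ∑ p ∈ Ioc 0 ⌊Y⌋₊ with p.Prime, (1 : ℝ) / p := by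
      refine sum_le_sum_of_subset_of_nonneg ?_ fun i _ _ => by positivity
      intro p hp
      simp only [mem_filter, mem_Ioc]
      have := hP p hp
      refine ⟨⟨this.1.pos, Nat.le_floor ?_⟩, this.1⟩
      exact (log_le_iff_le_exp (by exact_mod_cast this.1.pos)).1 this.2.2
    linarith
  have hL10 : 1 / L ^ 10 = exp (-(10 * x)) := by
    rw [exp_neg, ← hexpx, ← exp_nat_mul]; norm_num
  have t2 : ((k : ℝ) + 2) * (exp 1 * (5 * Y) ^ (k + 1)) ≤ W * (1 / L ^ 10) := by
    rw [hL10, ← hexpL, ← exp_add]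
    have h5 : (5 : ℝ) ≤ exp 2 := by
      have := Real.exp_one_gt_d9
      rw [show (2 : ℝ) = 1 + 1 by norm_num, exp_add]; nlinarith
    calc ((k : ℝ) + 2) * (exp 1 * (5 * Y) ^ (k + 1))
        ≤ exp (k + 1) * (exp 1 * (exp 2 * Y) ^ (k + 1)) := by
          gcongr
          have := add_one_le_exp ((k : ℝ) + 1); linarith
      _ = exp (k + 2 + (k + 1) * (2 + L ^ (1 - ε))) := by
          rw [hYdef, ← exp_add, ← exp_nat_mul, ← exp_add, ← exp_add]; congr 1; push_cast; ring
      _ ≤ _ := by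
          apply exp_le_exp.2
          have h0 : 0 ≤ 2 + L ^ (1 - ε) := by linarith
          have : ((k : ℝ) + 1) * (2 + L ^ (1 - ε)) ≤ (40 * x + 1) * (2 + L ^ (1 - ε)) :=
            mul_le_mul_of_nonneg_right (by linarith) h0
          linarith
  have t3 : exp (exp 1 * (5 * ∑ p ∈ P, (1 : ℝ) / p)) / exp 1 ^ (k + 1) ≤ 1 / L ^ 10 := by
    rw [hL10, ← exp_nat_mul, ← exp_sub]
    apply exp_le_exp.2
    have he := Real.exp_one_lt_d9
    have h0 : 0 ≤ ∑ p ∈ P, (1 : ℝ) / p := sum_nonneg fun _ _ => by positivity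
    have : exp 1 * (5 * ∑ p ∈ P, (1 : ℝ) / p) ≤ 2.8 * (5 * (x + D)) := by
      apply mul_le_mul <;> linarith
    push_cast
    linarith
  have t4 := mul_le_mul_of_nonneg_left t3 (show (0 : ℝ) ≤ 2 * W by positivity)
  have t5 : (0 : ℝ) ≤ W * exp (-∑ p ∈ P, (∑ n ∈ range p, h p n) / p) := by positivity
  linarith

theorem sum_range_zmod {p : ℕ} [NeZero p] (g : ZMod p → ℝ) :
    ∑ r ∈ range p, g r = ∑ a, g a := by
  refine sum_bij (fun r _ => (r : ZMod p)) (fun _ _ => mem_univ _) ?_ ?_ ?_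
  · intro a ha b hb hab
    rw [mem_range] at ha hb
    have := (ZMod.natCast_eq_natCast_iff' a b p).1 hab
    rwa [Nat.mod_eq_of_lt ha, Nat.mod_eq_of_lt hb] at this
  · intro a _
    exact ⟨a.val, mem_range.2 (ZMod.val_lt a), ZMod.natCast_zmod_val a⟩
  · intro _ _; rfl

theorem exists_sq_eq_neg_one_zmod {p : ℕ} (hp : p.Prime) (h : p % 4 = 1) :
    ∃ i : ZMod p, i ^ 2 = -1 := by
  have := Fact.mk hp
  obtain ⟨i, hi⟩ := ZMod.exists_sq_eq_neg_one_iff.2 (show p % 4 ≠ 3 by omega)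
  exact ⟨i, by rw [sq, ← hi]⟩

/-- The primes in `(5, exp ((log W) ^ (1 - ε))]` not dividing `M`. -/
noncomputable def sievePrimes (ε W : ℝ) (M : ℕ) : Finset ℕ :=
  (Ioc 0 ⌊exp (log W ^ (1 - ε))⌋₊).filter fun p => p.Prime ∧ 5 < p ∧ ¬ p ∣ M

theorem mem_sievePrimes {ε W : ℝ} {M p : ℕ} : p ∈ sievePrimes ε W M ↔
    p.Prime ∧ 5 < p ∧ ¬ p ∣ M ∧ log p ≤ log W ^ (1 - ε) := by
  simp only [sievePrimes, mem_filter, mem_Ioc]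
  constructor
  · rintro ⟨⟨h1, h2⟩, h3, h4, h5⟩
    refine ⟨h3, h4, h5, ?_⟩
    rw [log_le_iff_le_exp (by exact_mod_cast h1)]
    exact (Nat.cast_le.2 h2).trans (Nat.floor_le (exp_pos _).le)
  · rintro ⟨h3, h4, h5, h6⟩
    refine ⟨⟨h3.pos, Nat.le_floor ?_⟩, h3, h4, h5⟩
    rwa [← log_le_iff_le_exp (by exact_mod_cast h3.pos)]

theorem sum_sievePrimes_ge_aux {q : ℕ → Prop} [DecidablePred q] {α D : ℝ} (hα : 0 ≤ α)
    (hα1 : α ≤ 1)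
    (H : ∀ N : ℕ, 3 ≤ N →
      |∑ p ∈ Ioc 0 N with (p.Prime ∧ q p), (1 : ℝ) / p - α * log (log N)| ≤ D)
    (ε W : ℝ) (M : ℕ) (hM : M ≠ 0) (hW : 3 ≤ log W)
    (hW2 : 2 ≤ log W ^ (1 - ε)) :
    α * ((1 - ε) * log (log W)) - (D + 6) - ∑ p ∈ M.primeFactors, (1 : ℝ) / p ≤
      ∑ p ∈ sievePrimes ε W M with q p, (1 : ℝ) / p := by
  set t := log W ^ (1 - ε) with ht
  have hfl : 3 ≤ ⌊exp t⌋₊ := Nat.le_floor (by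
    have := add_one_le_exp t; push_cast; linarith)
  have hfl3 : (3 : ℝ) ≤ ⌊exp t⌋₊ := by exact_mod_cast hfl
  have h1 := (abs_le.1 (H _ hfl)).1
  have h2 : t / 2 ≤ log ⌊exp t⌋₊ := by
    have : t - 1 ≤ log ⌊exp t⌋₊ := by
      rw [le_log_iff_exp_le (by linarith), Real.exp_sub, div_le_iff₀ (exp_pos _)]
      have := (Nat.lt_floor_add_one (exp t)).le
      have : (2 : ℝ) ≤ exp 1 := by linarith [Real.exp_one_gt_d9]
      nlinarith
    linarith
  have h3 : (1 - ε) * log (log W) - 1 ≤ log (log ⌊exp t⌋₊) := by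
    calc _ ≤ log t - log 2 := by
          rw [ht, log_rpow (by linarith)]
          have := Real.log_two_lt_d9
          linarith
      _ = log (t / 2) := (log_div (by linarith) (by norm_num)).symm
      _ ≤ _ := log_le_log (by linarith) h2
  have h4 : ∑ p ∈ Ioc 0 ⌊exp t⌋₊ with (p.Prime ∧ q p), (1 : ℝ) / p ≤
      ∑ p ∈ (sievePrimes ε W M).filter q ∪ (M.primeFactors ∪ Ioc 0 5), (1 : ℝ) / p := by
    refine sum_le_sum_of_subset_of_nonneg ?_ fun i _ _ => by positivity
    intro p hp
    simp only [mem_union, mem_filter, sievePrimes, Nat.mem_primeFactors,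
      mem_Ioc] at hp ⊢
    have := hp.1.1
    have h4 := hp.1.2
    rw [ht] at h4
    by_cases h5 : 5 < p
    · by_cases h6 : p ∣ M
      · exact Or.inr (Or.inl ⟨hp.2.1, h6, hM⟩)
      · exact Or.inl ⟨⟨⟨this, h4⟩, hp.2.1, h5, h6⟩, hp.2.2⟩
    · exact Or.inr (Or.inr ⟨this, by omega⟩)
  have h5 : ∀ (A B : Finset ℕ), ∑ p ∈ A ∪ B, (1 : ℝ) / p ≤ ∑ p ∈ A, (1 : ℝ) / p +
      ∑ p ∈ B, (1 : ℝ) / p := fun A B => by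
    rw [← Finset.sum_union_inter]
    have : 0 ≤ ∑ p ∈ A ∩ B, (1 : ℝ) / p := sum_nonneg fun i _ => by positivity
    linarith
  have h6 := h5 ((sievePrimes ε W M).filter q) (M.primeFactors ∪ Ioc 0 5)
  have h7 := h5 M.primeFactors (Ioc 0 5)
  have h8 : ∑ p ∈ Ioc (0 : ℕ) 5, (1 : ℝ) / p ≤ 5 := by
    calc _ ≤ ∑ p ∈ Ioc (0 : ℕ) 5, (1 : ℝ) := sum_le_sum fun p hp => by
          rw [mem_Ioc] at hp
          rw [div_le_one (by exact_mod_cast hp.1)]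
          exact_mod_cast hp.1
      _ = 5 := by simp
  have h9 := mul_le_mul_of_nonneg_left h3 hα
  linarith

theorem exists_sum_sievePrimes_ge : ∃ D : ℝ, 0 ≤ D ∧ ∀ (ε W : ℝ) (M : ℕ), M ≠ 0 → 0 ≤ ε → ε ≤ 1 →
    3 ≤ log W → 2 ≤ log W ^ (1 - ε) →
    (1 - ε) * log (log W) - D - ∑ p ∈ M.primeFactors, (1 : ℝ) / p ≤
      ∑ p ∈ sievePrimes ε W M, (1 : ℝ) / p ∧
    1 / 2 * ((1 - ε) * log (log W)) - D - ∑ p ∈ M.primeFactors, (1 : ℝ) / p ≤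
      ∑ p ∈ sievePrimes ε W M with p % 4 = 1, (1 : ℝ) / p := by
  obtain ⟨D1, h1, H1⟩ := exists_sum_prime_inv_bound
  obtain ⟨D2, h2, H2⟩ := exists_sum_prime_one_mod_four_inv_bound
  refine ⟨D1 + D2 + 6, by positivity, fun ε W M hM _ _ hW hW2 => ⟨?_, ?_⟩⟩
  · have := sum_sievePrimes_ge_aux (q := fun _ => True) zero_le_one le_rfl (by simpa using H1)
      ε W M hM hW hW2
    simp only [Finset.filter_true] at this
    linarith
  · have := sum_sievePrimes_ge_aux (by norm_num) (by norm_num) H2 ε W M hM hW hW2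
    linarith

theorem sum_mul_pow_padic_le {q : ℕ} (hq : q.Prime) {f : ℕ → ℝ} (hf : ∀ a, f (q * a) = f a)
    {κ C : ℝ} (hκ : 0 ≤ κ) (hκ1 : κ < 1) (hC0 : 0 ≤ C)
    (hC : ∀ n : ℕ, ∑ a ∈ Ioc 0 n, f a ≤ C * n) (n : ℕ) :
    ∑ a ∈ Ioc 0 n, f a * (1 + κ) ^ a.factorization q ≤
      C * (1 + κ / (q - 1 - κ)) * n := by
  have hq2 : (2 : ℝ) ≤ q := by exact_mod_cast hq.two_le
  have hq0 : (q : ℝ) - 1 - κ ≠ 0 := by linarith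
  set δ := κ / (q - 1 - κ) with hδ
  have hδq : (1 + κ) * δ + κ = δ * q := by
    rw [hδ]; field_simp; ring
  have key : ∀ (g : ℕ → ℝ) (n : ℕ), ∑ a ∈ Ioc 0 n with q ∣ a, g a =
      ∑ a ∈ Ioc 0 (n / q), g (q * a) := by
    intro g n
    symm
    refine sum_bij (fun a _ => q * a) ?_ ?_ ?_ (fun _ _ => rfl)
    · intro a ha
      rw [mem_Ioc, Nat.le_div_iff_mul_le hq.pos] at ha
      rw [mem_filter, mem_Ioc]
      exact ⟨⟨Nat.mul_pos hq.pos ha.1, by linarith [ha.2, mul_comm a q]⟩, dvd_mul_right _ _⟩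
    · intro a _ b _ h
      exact Nat.eq_of_mul_eq_mul_left hq.pos h
    · intro b hb
      rw [mem_filter, mem_Ioc] at hb
      obtain ⟨⟨h1, h2⟩, c, rfl⟩ := hb
      refine ⟨c, ?_, rfl⟩
      rw [mem_Ioc, Nat.le_div_iff_mul_le hq.pos]
      exact ⟨Nat.pos_of_mul_pos_left h1, by linarith [mul_comm c q]⟩
  have hD : ∀ n : ℕ, ∑ a ∈ Ioc 0 n, f a * ((1 + κ) ^ a.factorization q - 1) ≤
      C * δ * n := by
    intro n
    induction n using Nat.strong_induction_on with
    | _ n ih =>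
    rcases Nat.eq_zero_or_pos n with rfl | hn
    · simp
    have h1 : ∑ a ∈ Ioc 0 n, f a * ((1 + κ) ^ a.factorization q - 1) =
        ∑ a ∈ Ioc 0 n with q ∣ a, f a * ((1 + κ) ^ a.factorization q - 1) := by
      rw [sum_filter]
      refine sum_congr rfl fun a _ => ?_
      split_ifs with h
      · rfl
      · rw [Nat.factorization_eq_zero_of_not_dvd h]; simp
    have h2 : ∑ a ∈ Ioc 0 (n / q), f (q * a) * ((1 + κ) ^ (q * a).factorization q - 1) =
        (1 + κ) * (∑ a ∈ Ioc 0 (n / q), f a * ((1 + κ) ^ a.factorization q - 1)) +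
        κ * ∑ a ∈ Ioc 0 (n / q), f a := by
      rw [mul_sum, mul_sum, ← sum_add_distrib]
      refine sum_congr rfl fun a ha => ?_
      rw [mem_Ioc] at ha
      rw [hf, Nat.factorization_mul hq.ne_zero (by omega), Finsupp.add_apply,
        hq.factorization_self, pow_add]
      ring
    rw [h1, key, h2]
    have h3 := ih _ (Nat.div_lt_self hn hq.one_lt)
    have h4 := hC (n / q)
    have h5 : ((n / q : ℕ) : ℝ) ≤ n / q := Nat.cast_div_le
    calc _ ≤ (1 + κ) * (C * δ * (n / q : ℕ)) + κ * (C * (n / q : ℕ)) := by gcongr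
      _ = C * (δ * q) * (n / q : ℕ) := by rw [← hδq]; ring
      _ ≤ C * (δ * q) * (n / q) := by
        have : 0 ≤ δ := div_nonneg hκ (by linarith)
        gcongr
      _ = C * δ * n := by field_simp
  have h1 := hD n
  have h2 := hC n
  calc _ = ∑ a ∈ Ioc 0 n, f a * ((1 + κ) ^ a.factorization q - 1) +
        ∑ a ∈ Ioc 0 n, f a := by
        rw [← sum_add_distrib]
        exact sum_congr rfl fun a _ => by ring
    _ ≤ C * δ * n + C * n := add_le_add h1 h2
    _ = _ := by ring

theorem sum_prod_pow_factorization_le {κ : ℝ} (hκ : 0 ≤ κ) (hκ1 : κ < 1) (P : Finset ℕ)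
    (hP : ∀ p ∈ P, p.Prime) (n : ℕ) :
    ∑ a ∈ Ioc 0 n, ∏ p ∈ P, (1 + κ) ^ a.factorization p ≤
      (∏ p ∈ P, (1 + κ / (p - 1 - κ))) * n := by
  induction P using Finset.induction_on generalizing n with
  | empty => simp
  | insert q P hq ih =>
    have ih := ih fun p hp => hP p (mem_insert_of_mem hp)
    have hδ : ∀ p ∈ insert q P, 0 ≤ 1 + κ / ((p : ℝ) - 1 - κ) := fun p hp => by
      have : (2 : ℝ) ≤ p := by exact_mod_cast (hP p hp).two_le
      have : 0 ≤ κ / ((p : ℝ) - 1 - κ) := div_nonneg hκ (by linarith)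
      linarith
    have := sum_mul_pow_padic_le (hP q (mem_insert_self _ _))
      (f := fun a => ∏ p ∈ P, (1 + κ) ^ a.factorization p) (fun a => by
        rcases Nat.eq_zero_or_pos a with rfl | ha
        · simp
        refine Finset.prod_congr rfl fun p hp => ?_
        have hqp := (hP q (mem_insert_self _ _))
        have hne : q ≠ p := fun h => hq (h ▸ hp)
        rw [Nat.factorization_mul hqp.ne_zero ha.ne', Finsupp.add_apply,
          hqp.factorization, Finsupp.single_apply, if_neg hne, zero_add])
      hκ hκ1 (prod_nonneg fun p hp => hδ p (mem_insert_of_mem hp)) ih n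
    rw [prod_insert hq]
    simp only [prod_insert hq]
    calc _ = _ := sum_congr rfl fun a _ => mul_comm _ _
      _ ≤ _ := this
      _ = _ := by ring

open ArithmeticFunction hiding log in
theorem exists_sum_pow_cardFactors_le {κ : ℝ} (hκ : 0 ≤ κ) (hκ1 : κ ≤ 1 / 2) :
    ∃ C : ℝ, 0 ≤ C ∧ ∀ n : ℕ, 3 ≤ n →
      ∑ a ∈ Ioc 0 n, (1 + κ) ^ cardFactors a ≤ C * n * log n ^ κ := by
  obtain ⟨D, hD0, hD⟩ := exists_sum_prime_inv_bound
  have hs : Summable fun n : ℕ => 1 / (n : ℝ) ^ 2 :=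
    Real.summable_one_div_nat_pow.2 one_lt_two
  set S := ∑' n : ℕ, 1 / (n : ℝ) ^ 2
  refine ⟨exp (D + 6 * S), (exp_pos _).le, fun n hn => ?_⟩
  set P := (Ioc 0 n).filter Nat.Prime with hP
  have hPp : ∀ p ∈ P, p.Prime := fun p hp => (mem_filter.1 hp).2
  have h1 : ∑ a ∈ Ioc 0 n, (1 + κ) ^ cardFactors a =
      ∑ a ∈ Ioc 0 n, ∏ p ∈ P, (1 + κ) ^ a.factorization p := by
    refine sum_congr rfl fun a ha => ?_
    rw [mem_Ioc] at ha
    rw [Finset.prod_pow_eq_pow_sum, cardFactors_eq_sum_factorization, Finsupp.sum]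
    congr 1
    refine Finset.sum_subset ?_ ?_
    · intro p hp
      rw [Nat.support_factorization, Nat.mem_primeFactors] at hp
      rw [hP, mem_filter, mem_Ioc]
      exact ⟨⟨hp.1.pos, (Nat.le_of_dvd ha.1 hp.2.1).trans ha.2⟩, hp.1⟩
    · intro p _ h
      exact Finsupp.notMem_support_iff.1 h
  have hL : 0 < log n := log_pos (by exact_mod_cast (by omega : 1 < n))
  rw [h1]
  refine (sum_prod_pow_factorization_le hκ (by linarith) P hPp n).trans ?_
  have h2 : ∏ p ∈ P, (1 + κ / ((p : ℝ) - 1 - κ)) ≤ exp (D + 6 * S) * log n ^ κ := by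
    calc _ ≤ ∏ p ∈ P, exp (κ * (1 / p) + 6 * (1 / (p : ℝ) ^ 2)) := by
          refine Finset.prod_le_prod ?_ ?_
          · intro p hp
            have : (2 : ℝ) ≤ p := by exact_mod_cast (hPp p hp).two_le
            have : 0 ≤ κ / ((p : ℝ) - 1 - κ) := div_nonneg hκ (by linarith)
            linarith
          · intro p hp
            have h2 : (2 : ℝ) ≤ p := by exact_mod_cast (hPp p hp).two_le
            have : κ / ((p : ℝ) - 1 - κ) ≤ κ * (1 / p) + 6 * (1 / (p : ℝ) ^ 2) := by
              rw [div_le_iff₀ (by linarith)]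
              have h3 : (κ * (1 / p) + 6 * (1 / (p : ℝ) ^ 2)) * ((p : ℝ) - 1 - κ) =
                κ + ((6 - κ * (1 + κ)) * p - 6 * (1 + κ)) / p ^ 2 := by
                field_simp; ring
              rw [h3]
              have : 0 ≤ ((6 - κ * (1 + κ)) * p - 6 * (1 + κ)) / (p : ℝ) ^ 2 := by
                apply div_nonneg _ (by positivity)
                have : κ * (1 + κ) ≤ 1 / 2 * (3 / 2) := by gcongr; linarith
                nlinarith
              linarith
            have := add_one_le_exp (κ * (1 / p) + 6 * (1 / (p : ℝ) ^ 2))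
            linarith
      _ = exp (κ * ∑ p ∈ P, (1 : ℝ) / p + 6 * ∑ p ∈ P, 1 / (p : ℝ) ^ 2) := by
          rw [← exp_sum, sum_add_distrib, mul_sum, mul_sum]
      _ ≤ exp (κ * (log (log n) + D) + 6 * S) := by
          apply exp_le_exp.2
          have a1 := (abs_le.1 (hD n hn)).2
          have a2 : ∑ p ∈ P, 1 / (p : ℝ) ^ 2 ≤ S :=
            hs.sum_le_tsum _ fun _ _ => by positivity
          have a3 : ∑ p ∈ P, (1 : ℝ) / p ≤ log (log n) + D := by linarith
          have := mul_le_mul_of_nonneg_left a3 hκ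
          linarith
      _ ≤ exp ((D + 6 * S) + log (log n) * κ) := by
          apply exp_le_exp.2
          nlinarith
      _ = _ := by rw [exp_add, rpow_def_of_pos hL]
  calc _ ≤ exp (D + 6 * S) * log n ^ κ * n := by gcongr
    _ = _ := by ring

open ArithmeticFunction hiding log in
theorem exists_card_cardFactors_gt_le {ε : ℝ} (hε : 0 < ε) (hε1 : ε ≤ 1) :
    ∃ C : ℝ, 0 ≤ C ∧ ∀ n : ℕ, 3 ≤ n →
      (((Ioc 0 n).filter fun a => (1 + ε) * log (log n) < cardFactors a).card : ℝ) ≤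
        C * n * log n ^ (-(ε ^ 2 / 4)) := by
  obtain ⟨C, hC, H⟩ := exists_sum_pow_cardFactors_le (κ := ε / 2) (by linarith) (by linarith)
  refine ⟨C, hC, fun n hn => ?_⟩
  have hL : 0 < log n := log_pos (by exact_mod_cast (by omega : 1 < n))
  have hL1 : 1 ≤ log n := by
    rw [le_log_iff_exp_le (by positivity)]
    have : (3 : ℝ) ≤ n := by exact_mod_cast hn
    linarith [exp_one_lt_d9]
  have h1 : log n ^ (ε / 2 + ε ^ 2 / 4) * (((Ioc 0 n).filter fun a =>
      (1 + ε) * log (log n) < cardFactors a).card : ℝ) ≤ C * n * log n ^ (ε / 2) := by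
    refine le_trans ?_ (H n hn)
    rw [mul_comm, ← nsmul_eq_mul, ← sum_const]
    refine (sum_le_sum fun a ha => ?_).trans (sum_le_sum_of_subset_of_nonneg
      (filter_subset _ _) fun _ _ _ => by positivity)
    rw [mem_filter] at ha
    rw [← rpow_natCast (1 + ε / 2), rpow_def_of_pos hL, rpow_def_of_pos (by positivity : 0 < 1 + ε / 2)]
    apply exp_le_exp.2
    have h2 : ε / 2 - (ε / 2) ^ 2 / 2 ≤ log (1 + ε / 2) := by
      refine le_trans ?_ (le_log_one_add_of_nonneg (by positivity : 0 ≤ ε / 2))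
      rw [le_div_iff₀ (by positivity)]
      nlinarith [pow_pos hε 3]
    have h3 : 0 ≤ log (log n) := log_nonneg hL1
    have h4 : 0 ≤ log (1 + ε / 2) := log_nonneg (by linarith)
    calc _ ≤ log (log n) * ((ε / 2 - (ε / 2) ^ 2 / 2) * (1 + ε)) := by
          gcongr
          nlinarith [pow_pos hε 2, pow_pos hε 3]
      _ ≤ log (log n) * (log (1 + ε / 2) * (1 + ε)) := by gcongr
      _ = log (1 + ε / 2) * ((1 + ε) * log (log n)) := by ring
      _ ≤ _ := by gcongr; exact ha.2.le
  have h5 : 0 < log n ^ (ε / 2 + ε ^ 2 / 4) := by positivity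
  calc _ ≤ (C * n * log n ^ (ε / 2)) / log n ^ (ε / 2 + ε ^ 2 / 4) := by
        rw [le_div_iff₀ h5]; linarith
    _ = C * n * (log n ^ (ε / 2) / log n ^ (ε / 2 + ε ^ 2 / 4)) := by ring
    _ = _ := by rw [← rpow_sub hL]; ring_nf

open Filter Topology

theorem eventually_log_log_add_le {c : ℝ} (hc : 0 < c) (A D : ℝ) :
    ∀ᶠ W : ℝ in atTop, log (A + log (log W)) + D ≤ c * log (log W) := by
  have h1 : Tendsto (fun W : ℝ => log (log W)) atTop atTop :=
    tendsto_log_atTop.comp tendsto_log_atTop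
  have h2 : ∀ᶠ y : ℝ in atTop, log (A + y) + D ≤ c * y := by
    have h3 : ∀ᶠ y : ℝ in atTop, log y ≤ c / 4 * y := by
      have := (isLittleO_log_id_atTop.bound (show 0 < c / 4 by positivity))
      filter_upwards [this, eventually_ge_atTop 1] with y h h'
      rw [norm_of_nonneg (log_nonneg h'), id, norm_of_nonneg (by linarith)] at h
      exact h
    have h4 := (tendsto_atTop_add_const_left atTop A tendsto_id).eventually h3
    filter_upwards [h4, eventually_ge_atTop |A|, eventually_ge_atTop (D / (c / 2)),
      eventually_ge_atTop 0] with y h4 h5 h6 h7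
    rw [div_le_iff₀ (by positivity)] at h6
    have := le_abs_self A
    simp only [id] at h4
    nlinarith
  exact h1.eventually h2

theorem eventually_sum_sievePrimes_ge {ε : ℝ} (hε : 0 < ε) (hε1 : ε < 1) :
    ∀ᶠ W : ℝ in atTop, ∀ M : ℕ, M ≠ 0 → log M ≤ 100 * log W →
      (1 - 2 * ε) * log (log W) ≤ ∑ p ∈ sievePrimes ε W M, (1 : ℝ) / p ∧
      1 / 2 * ((1 - 2 * ε) * log (log W)) ≤
        ∑ p ∈ sievePrimes ε W M with p % 4 = 1, (1 : ℝ) / p := by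
  obtain ⟨D, hD, H⟩ := exists_sum_sievePrimes_ge
  obtain ⟨D', hD', H'⟩ := exists_sum_primeFactors_inv_le
  have h1 : Tendsto (fun W : ℝ => log W ^ (1 - ε)) atTop atTop :=
    (tendsto_rpow_atTop (by linarith)).comp tendsto_log_atTop
  filter_upwards [eventually_log_log_add_le (show 0 < ε / 2 by positivity) (log 100) (D + D'),
    h1.eventually_ge_atTop 2, tendsto_log_atTop.eventually_ge_atTop 3] with W h1 h2 h3 M hM hM2
  have a1 := H ε W M hM hε.le hε1.le h3 h2
  have a2 := H' M (100 * log W) (by linarith) hM hM2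
  rw [log_mul (by norm_num) (by linarith)] at a2
  constructor
  · have := a1.1
    nlinarith [log_nonneg (by linarith : 1 ≤ log W)]
  · have := a1.2
    nlinarith [log_nonneg (by linarith : 1 ≤ log W)]

theorem eventually_exp_log_rpow_le {ε : ℝ} (hε : 0 < ε) (hε1 : ε < 1) (K : ℝ) :
    ∀ᶠ W : ℝ in atTop, exp (log W ^ (1 - ε)) ≤ W * log W ^ (-K) := by
  have h : ∀ᶠ x : ℝ in atTop, x ^ (1 - ε) + K * log x ≤ x := by
    have h1 : ∀ᶠ x : ℝ in atTop, 2 ≤ x ^ ε :=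
      (tendsto_rpow_atTop hε).eventually_ge_atTop 2
    have h2 : ∀ᶠ x : ℝ in atTop, |K * log x| ≤ x / 2 := by
      have := (isLittleO_log_id_atTop.const_mul_left K).bound (show (0:ℝ) < 1 / 2 by norm_num)
      filter_upwards [this, eventually_ge_atTop 0] with x h h'
      rw [id, norm_of_nonneg h', norm_eq_abs] at h
      linarith
    filter_upwards [h1, h2, eventually_gt_atTop 0] with x h1 h2 h3
    have h4 : x ^ (1 - ε) * x ^ ε = x := by rw [← rpow_add h3]; simp
    have h5 : 0 < x ^ (1 - ε) := by positivity
    have := le_abs_self (K * log x)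
    nlinarith
  filter_upwards [tendsto_log_atTop.eventually h, eventually_gt_atTop 1] with W h1 h2
  have hL := log_pos h2
  rw [rpow_def_of_pos hL (-K)]
  nth_rewrite 2 [← exp_log (by linarith : 0 < W)]
  rw [← exp_add]
  apply exp_le_exp.2
  linarith

/-- Bounding a sum by the sieve, away from a negligible initial segment. -/
theorem eventually_sum_range_le_of_sieve {κ ε e : ℝ} (hκ : -(5 / 2) ≤ κ) (hε : 0 < ε)
    (he0 : 0 < e) (he1 : e < 1) : ∀ᶠ W : ℕ in atTop, ∀ (P : Finset ℕ) (g : ℕ → ℕ → ℝ) (F : ℕ → ℝ),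
      (∀ p ∈ P, p.Prime ∧ 5 < p ∧ log p ≤ log W ^ (1 - e)) → (∀ p n, 0 ≤ g p n ∧ g p n ≤ 1) →
      (∀ p ∈ P, Function.Periodic (g p) p) → (∀ p ∈ P, ∑ n ∈ range p, g p n ≤ 5) →
      -(κ + ε / 2) * log (log W) ≤ ∑ p ∈ P, (∑ n ∈ range p, g p n) / p →
      (∀ b, F b ≤ 1) → (∀ b : ℕ, exp (log W ^ (1 - e)) < b + 1 → F b ≤ ∏ p ∈ P, (1 - g p b)) →
      ∑ b ∈ range W, F b ≤ W * log W ^ (κ + ε) := by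
  have hc := tendsto_natCast_atTop_atTop (R := ℝ)
  have hlarge : ∀ᶠ W : ℝ in atTop, 4 ≤ log W ^ (ε / 2) :=
    ((tendsto_rpow_atTop (by positivity)).comp tendsto_log_atTop).eventually_ge_atTop 4
  filter_upwards [interval_sieve he0 he1,
    hc.eventually (eventually_exp_log_rpow_le he0 he1 10), hc.eventually hlarge,
    hc.eventually (tendsto_log_atTop.eventually_ge_atTop 4)]
    with W h1 h3 h4 h5 P g F hP hg01 hper hg5 hS hF1 hF
  have hL : 0 < log W := by linarith
  have s1 := h1 P g hP (fun p _ n => hg01 p n) hper hg5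
  have s4 : exp (-∑ p ∈ P, (∑ n ∈ range p, g p n) / p) ≤ log W ^ (κ + ε / 2) := by
    rw [rpow_def_of_pos hL]
    exact exp_le_exp.2 (by linarith)
  have s5 : ∑ b ∈ range W, F b ≤
      ∑ n ∈ range W, ∏ p ∈ P, (1 - g p n) + exp (log W ^ (1 - e)) := by
    have : ∀ b ∈ range W, F b ≤
        ∏ p ∈ P, (1 - g p b) + if (b : ℝ) + 1 ≤ exp (log W ^ (1 - e)) then 1 else 0 := by
      intro b _
      split_ifs with hs
      · have : 0 ≤ ∏ p ∈ P, (1 - g p b) :=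
          prod_nonneg fun p _ => by linarith [(hg01 p b).2]
        linarith [hF1 b]
      · linarith [hF b (not_le.1 hs)]
    refine (sum_le_sum this).trans ?_
    rw [sum_add_distrib]
    refine add_le_add le_rfl ?_
    rw [← sum_filter, sum_const, nsmul_eq_mul, mul_one]
    have hsub : ((range W).filter fun b : ℕ => (b : ℝ) + 1 ≤ exp (log W ^ (1 - e))) ⊆
        range ⌊exp (log W ^ (1 - e))⌋₊ := by
      intro b hb
      rw [mem_filter] at hb
      rw [mem_range]
      have : b + 1 ≤ ⌊exp (log W ^ (1 - e))⌋₊ := Nat.le_floor (by push_cast; exact hb.2)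
      omega
    calc _ ≤ ((range ⌊exp (log W ^ (1 - e))⌋₊).card : ℝ) := by
          exact_mod_cast card_le_card hsub
      _ ≤ _ := by rw [Finset.card_range]; exact Nat.floor_le (exp_pos _).le
  have s6 : 1 / log W ^ 10 ≤ log W ^ (κ + ε / 2) / 10 := by
    rw [div_le_div_iff₀ (by positivity) (by norm_num), one_mul, ← rpow_natCast, ← rpow_add hL]
    calc (10 : ℝ) ≤ 4 ^ (2 : ℝ) := by norm_num
      _ ≤ log W ^ (2 : ℝ) := by gcongr
      _ ≤ _ := rpow_le_rpow_of_exponent_le (by linarith) (by push_cast; linarith)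
  have s7 : log (W : ℝ) ^ (-10 : ℝ) = 1 / log W ^ 10 := by
    rw [rpow_neg hL.le, one_div]; norm_cast
  rw [s7] at h3
  have s8 : log (W : ℝ) ^ (κ + ε) = log W ^ (κ + ε / 2) * log W ^ (ε / 2) := by
    rw [← rpow_add hL]; ring_nf
  have hW0 : (0 : ℝ) ≤ W := by positivity
  have h0 : 0 < log (W : ℝ) ^ (κ + ε / 2) := by positivity
  calc _ ≤ 3 * W * (log W ^ (κ + ε / 2) + log W ^ (κ + ε / 2) / 10) +
        W * (log W ^ (κ + ε / 2) / 10) := by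
        refine s5.trans (add_le_add (s1.trans ?_) (h3.trans ?_))
        · gcongr
        · gcongr
    _ ≤ W * (log W ^ (κ + ε / 2) * 4) := by nlinarith [mul_nonneg hW0 h0.le]
    _ ≤ _ := by rw [s8]; gcongr

/-- Sieve bound for the number of `b < W` with `a ^ 2 + b ^ 2` prime. -/
theorem eventually_card_sq_add_sq_prime_le {ε : ℝ} (hε : 0 < ε) :
    ∀ᶠ W : ℕ in atTop, ∀ a : ℕ, 0 < a → log a ≤ 10 * log W →
      (((range W).filter fun b => (a ^ 2 + b ^ 2).Prime).card : ℝ) ≤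
        W * log W ^ (-1 + ε) := by
  classical
  set e := min (ε / 4) (1 / 2) with he
  have he0 : 0 < e := by positivity
  have he1 : e < 1 := (min_le_right _ _).trans_lt (by norm_num)
  have hee : e ≤ ε / 4 := min_le_left _ _
  choose! i hi using fun p (hp : p.Prime ∧ p % 4 = 1) => exists_sq_eq_neg_one_zmod hp.1 hp.2
  have hc := tendsto_natCast_atTop_atTop (R := ℝ)
  filter_upwards [eventually_sum_range_le_of_sieve (κ := -1) (by norm_num) hε he0 he1,
    hc.eventually (eventually_sum_sievePrimes_ge he0 he1),
    hc.eventually (tendsto_log_atTop.eventually_ge_atTop 4)] with W h1 h2 h5 a ha haW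
  set P := (sievePrimes e W a).filter fun p => p % 4 = 1 with hP
  have hPm : ∀ p ∈ P, (p.Prime ∧ p % 4 = 1) ∧ 5 < p ∧ ¬ p ∣ a ∧ log p ≤ log W ^ (1 - e) := by
    intro p hp
    rw [hP, mem_filter, mem_sievePrimes] at hp
    tauto
  set g : ∀ p : ℕ, ZMod p → ℝ := fun p x => if x ^ 2 = - (a : ZMod p) ^ 2 then 1 else 0 with hg
  have hsum : ∀ p ∈ P, ∑ n ∈ range p, g p n = 2 := by
    intro p hp
    obtain ⟨⟨hp1, hp2⟩, hp3, hp4, -⟩ := hPm p hp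
    have : Fact p.Prime := ⟨hp1⟩
    rw [sum_range_zmod, hg]
    simp only
    rw [Finset.sum_ite, Finset.sum_const_zero, add_zero, sum_const, nsmul_eq_mul, mul_one]
    have ha0 : (a : ZMod p) ≠ 0 := by rwa [Ne, ZMod.natCast_eq_zero_iff]
    have hi2 := hi p ⟨hp1, hp2⟩
    have hi0 : i p ≠ 0 := by
      intro h; rw [h] at hi2; simp at hi2
    have h2 : (2 : ZMod p) ≠ 0 := by
      intro h
      have : ((2 : ℕ) : ZMod p) = 0 := by exact_mod_cast h
      rw [ZMod.natCast_eq_zero_iff] at this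
      exact absurd (Nat.le_of_dvd (by norm_num) this) (by omega)
    have : (univ.filter fun x : ZMod p => x ^ 2 = - (a : ZMod p) ^ 2) =
        {i p * a, - (i p * a)} := by
      ext x
      simp only [mem_filter, mem_univ, true_and, Finset.mem_insert,
        mem_singleton]
      rw [← sq_eq_sq_iff_eq_or_eq_neg, mul_pow, hi2, neg_one_mul]
    rw [this, Finset.card_pair]
    · norm_num
    · intro h
      have h' : (2 : ZMod p) * (i p * a) = 0 := by linear_combination h
      exact (mul_ne_zero h2 (mul_ne_zero hi0 ha0)) h'
  have hg01 : ∀ p x, 0 ≤ g p x ∧ g p x ≤ 1 := by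
    intro p x; rw [hg]; dsimp only; split_ifs <;> norm_num
  have s3 : ∑ p ∈ P, (∑ n ∈ range p, g p n) / p = 2 * ∑ p ∈ P, (1 : ℝ) / p := by
    rw [mul_sum]
    exact sum_congr rfl fun p hp => by rw [hsum p hp]; ring
  rw [Finset.card_eq_sum_ones, sum_filter]
  push_cast
  refine h1 P (fun p n => g p n) _
    (fun p hp => ⟨(hPm p hp).1.1, (hPm p hp).2.1, (hPm p hp).2.2.2⟩) (fun p n => hg01 p n)
    (fun p _ n => by simp) (fun p hp => by rw [hsum p hp]; norm_num) ?_
    (fun b => by split_ifs <;> norm_num) fun b hs => ?_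
  · rw [s3]
    have := (h2 a ha.ne' (by linarith)).2
    have := log_nonneg (by linarith : 1 ≤ log (W : ℝ))
    nlinarith
  · split_ifs with hb
    · apply le_of_eq
      symm
      apply Finset.prod_eq_one
      intro p hp
      obtain ⟨⟨hp1, hp2⟩, hp3, hp4, hp5⟩ := hPm p hp
      rw [hg]
      dsimp only
      rw [if_neg, sub_zero]
      intro hx
      apply hs.not_ge
      have hdvd : p ∣ a ^ 2 + b ^ 2 := by
        rw [← ZMod.natCast_eq_zero_iff]
        push_cast
        rw [hx]; ring
      have hpe := (Nat.prime_dvd_prime_iff_eq hp1 hb).1 hdvd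
      rw [log_le_iff_le_exp (by exact_mod_cast hp1.pos)] at hp5
      refine le_trans ?_ hp5
      rw [hpe]
      have : b + 1 ≤ a ^ 2 + b ^ 2 := by nlinarith [Nat.one_le_pow 2 a ha, Nat.zero_le b, Nat.le_self_pow two_ne_zero b]
      exact_mod_cast this
    · exact prod_nonneg fun p _ => by linarith [(hg01 p b).2]

theorem sum_Ioc_inv_le_log {m n : ℕ} (hm : 0 < m) (h : m ≤ n) :
    ∑ k ∈ Ioc m n, (1 : ℝ) / k ≤ log n - log m := by
  induction n, h using Nat.le_induction with
  | base => simp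
  | succ n hn ih =>
    rw [sum_Ioc_succ_top (by omega)]
    have hn0 : (0 : ℝ) < n := by exact_mod_cast hm.trans_le hn
    have : (1 : ℝ) / (n + 1 : ℕ) ≤ log (n + 1 : ℕ) - log n := by
      rw [← log_div (by positivity) hn0.ne']
      have := one_sub_inv_le_log_of_pos (show 0 < ((n + 1 : ℕ) : ℝ) / n by positivity)
      refine le_trans (le_of_eq ?_) this
      push_cast
      field_simp
      ring
    linarith

theorem sum_Ioc_filter_inv_le {B : ℕ → Prop} [DecidablePred B] {m n : ℕ} (hm : 0 < m) (h : m ≤ n)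
    {δ : ℝ} (hδ : 0 ≤ δ)
    (hB : ∀ k, m ≤ k → k ≤ n → (((Ioc 0 k).filter B).card : ℝ) ≤ δ * k) :
    ∑ k ∈ Ioc m n with B k, (1 : ℝ) / k ≤ δ * (1 + (log n - log m)) := by
  have key : ∑ k ∈ Ioc m n with B k, (1 : ℝ) / k ≤
      (((Ioc 0 n).filter B).card : ℝ) / n + δ * ∑ k ∈ Ioc m n, (1 : ℝ) / k := by
    induction n, h using Nat.le_induction with
    | base => simp; positivity
    | succ n hn ih =>
      have ih := ih fun k h1 h2 => hB k h1 (by omega)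
      have hn0 : (0 : ℝ) < n := by exact_mod_cast hm.trans_le hn
      have h1 := hB n hn (by omega)
      rw [sum_filter] at ih ⊢
      rw [sum_Ioc_succ_top (by omega), sum_Ioc_succ_top (by omega)]
      have h2 : (((Ioc 0 (n + 1)).filter B).card : ℝ) =
          ((Ioc 0 n).filter B).card + if B (n + 1) then 1 else 0 := by
        rw [card_filter, card_filter, sum_Ioc_succ_top (by omega)]
        push_cast; rfl
      rw [h2]
      have h3 : (((Ioc 0 n).filter B).card : ℝ) / n ≤
          ((Ioc 0 n).filter B).card / (n + 1 : ℕ) + δ * (1 / (n + 1 : ℕ)) := by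
        have : (((Ioc 0 n).filter B).card : ℝ) / n =
          ((Ioc 0 n).filter B).card / (n + 1 : ℕ) +
            (((Ioc 0 n).filter B).card / n) * (1 / (n + 1 : ℕ)) := by
          push_cast; field_simp
        rw [this]
        gcongr
        rwa [div_le_iff₀ hn0]
      have h4 : (if B (n + 1) then (1 : ℝ) / (n + 1 : ℕ) else 0) =
        (if B (n + 1) then 1 else 0) / (n + 1 : ℕ) := by split_ifs <;> simp
      rw [h4, add_div]
      linarith
  have hn0 : (0 : ℝ) < n := by exact_mod_cast hm.trans_le h
  have h1 := hB n h le_rfl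
  have h2 := mul_le_mul_of_nonneg_left (sum_Ioc_inv_le_log hm h) hδ
  rw [← div_le_iff₀ hn0] at h1
  linarith

/-- Pairs `a < b ≤ a e^J` with `N e^{-J} ≤ a b ≤ N` and `a ^ 2 + b ^ 2` prime. -/
noncomputable def pairSet (N J : ℝ) : Finset (ℕ × ℕ) :=
  (Ioc 0 ⌊N⌋₊ ×ˢ Ioc 0 ⌊N⌋₊).filter fun z =>
    z.1 < z.2 ∧ (z.2 : ℝ) ≤ z.1 * exp J ∧ (z.1 : ℝ) * z.2 ≤ N ∧ N * exp (-J) ≤ z.1 * z.2 ∧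
      (z.1 ^ 2 + z.2 ^ 2).Prime

theorem mem_pairSet {N J : ℝ} {a b : ℕ} : (a, b) ∈ pairSet N J ↔ 0 < a ∧ a < b ∧
    (b : ℝ) ≤ a * exp J ∧ (a : ℝ) * b ≤ N ∧ N * exp (-J) ≤ a * b ∧ (a ^ 2 + b ^ 2).Prime := by
  rw [pairSet, mem_filter, mem_product, mem_Ioc, mem_Ioc]
  constructor
  · rintro ⟨⟨h1, h2⟩, h3⟩; exact ⟨h1.1, h3⟩
  · rintro ⟨h1, h2, h3, h4, h5⟩
    have h1' : (1 : ℝ) ≤ a := by exact_mod_cast h1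
    have h2' : (a : ℝ) ≤ b := by exact_mod_cast h2.le
    exact ⟨⟨⟨h1, Nat.le_floor (by nlinarith)⟩, ⟨h1.trans h2, Nat.le_floor (by nlinarith)⟩⟩,
      h2, h3, h4, h5⟩

theorem mem_pairSet_bounds {N J : ℝ} (hN : 0 < N) (hJ : 0 ≤ J) {a b : ℕ}
    (h : (a, b) ∈ pairSet N J) :
    (√N * exp (-J) ≤ a ∧ (a : ℝ) ≤ √N * exp J) ∧ (√N * exp (-J) ≤ b ∧ (b : ℝ) ≤ √N * exp J) := by
  obtain ⟨h1, h2, h3, h4, h5, -⟩ := mem_pairSet.1 h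
  have ha : (0 : ℝ) < a := by exact_mod_cast h1
  have hab : (a : ℝ) ≤ b := by exact_mod_cast h2.le
  have hs : √N * √N = N := mul_self_sqrt hN.le
  have he : exp (-J) * exp J = 1 := by rw [← exp_add]; simp
  have he1 : 1 ≤ exp J := one_le_exp hJ
  have he2 : 0 < exp (-J) := exp_pos _
  have hb : (0 : ℝ) < b := ha.trans_le hab
  have hba : b * exp (-J) ≤ a := by nlinarith
  have sq1 : (√N * exp (-J)) ^ 2 = N * exp (-J) * exp (-J) := by nlinarith
  have sq2 : (√N * exp J) ^ 2 = N * exp J * exp J := by nlinarith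
  have hNN : N ≤ N * exp J := by nlinarith
  have hNJ : N * exp J ≤ N * exp J * exp J := by
    nlinarith
  have hNJ' : N * exp (-J) * exp (-J) ≤ N * exp (-J) := by
    nlinarith
  have key : ∀ x y : ℝ, 0 ≤ x → 0 ≤ y → x ^ 2 ≤ y ^ 2 → x ≤ y := fun x y hx hy h =>
    (pow_le_pow_iff_left₀ hx hy two_ne_zero).1 h
  have haa : (a : ℝ) * b * exp (-J) ≤ a ^ 2 := by nlinarith
  have hbb : (b : ℝ) ^ 2 ≤ a * b * exp J := by nlinarith
  refine ⟨⟨key _ _ (by positivity) ha.le ?_, key _ _ ha.le (by positivity) ?_⟩,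
    ⟨key _ _ (by positivity) hb.le ?_, key _ _ hb.le (by positivity) ?_⟩⟩
  · rw [sq1]
    calc _ ≤ (a : ℝ) * b * exp (-J) := by gcongr
      _ ≤ _ := haa
  · rw [sq2]; nlinarith
  · rw [sq1]; nlinarith
  · rw [sq2]
    calc _ ≤ _ := hbb
      _ ≤ N * exp J := by gcongr
      _ ≤ _ := hNJ

/-- The window parameter `(log N) ^ (2 / 3)`. -/
noncomputable def windowLog (N : ℝ) : ℝ := log N ^ (2 / 3 : ℝ)

theorem eventually_windowLog {c : ℝ} (hc : 0 < c) :
    ∀ᶠ N : ℝ in atTop, 1 ≤ windowLog N ∧ windowLog N ≤ c * log N ∧ 100 ≤ log N ∧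
      exp 100 ≤ N := by
  have h1 : Tendsto (fun W : ℝ => log W ^ (1 / 3 : ℝ)) atTop atTop :=
    (tendsto_rpow_atTop (by norm_num)).comp tendsto_log_atTop
  filter_upwards [h1.eventually_ge_atTop (1 / c), eventually_ge_atTop (exp 100)] with N h1 h3
  have h2 : 100 ≤ log N := by rwa [le_log_iff_exp_le (by linarith [exp_pos 100])]
  refine ⟨one_le_rpow (by linarith) (by norm_num), ?_, h2, h3⟩
  have h4 : log N = windowLog N * log N ^ (1 / 3 : ℝ) := by
    rw [windowLog, ← rpow_add (by linarith)]; norm_num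
  rw [div_le_iff₀ hc] at h1
  have h5 : 0 ≤ windowLog N := by unfold windowLog; positivity
  rw [h4]; nlinarith

open ArithmeticFunction hiding log in
theorem eventually_sum_cardFactors_gt_inv_le {ε : ℝ} (hε : 0 < ε) (hε1 : ε ≤ 1) :
    ∀ᶠ N : ℝ in atTop, ∀ s : Finset ℕ,
      (∀ a ∈ s, √N * exp (-windowLog N) ≤ a ∧ (a : ℝ) ≤ √N * exp (windowLog N) ∧
        (1 + ε) * log (log N) < cardFactors a) →
      ∑ a ∈ s, (1 : ℝ) / a ≤ windowLog N * log N ^ (-(ε ^ 2 / 8)) := by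
  obtain ⟨C, hC, H⟩ := exists_card_cardFactors_gt_le hε hε1
  have h1 : Tendsto (fun W : ℝ => log W ^ (ε ^ 2 / 8 : ℝ)) atTop atTop :=
    (tendsto_rpow_atTop (by positivity)).comp tendsto_log_atTop
  filter_upwards [eventually_windowLog (show (0 : ℝ) < 1 / 8 by norm_num),
    h1.eventually_ge_atTop (16 * C)] with N ⟨hJ1, hJL, hL, hN⟩ hbig s hs
  set J := windowLog N
  have hN0 : 0 < N := (exp_pos _).trans_le hN
  have hL0 : 0 < log N := by linarith
  have hA : √N * exp (-J) = exp (log N / 2 - J) := by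
    rw [← exp_log (sqrt_pos.2 hN0), ← exp_add, log_sqrt hN0.le]; ring_nf
  have hA' : √N * exp J = exp (log N / 2 + J) := by
    rw [← exp_log (sqrt_pos.2 hN0), ← exp_add, log_sqrt hN0.le]
  rw [hA, hA'] at hs
  set m := ⌊exp (log N / 2 - J - 1)⌋₊ with hm
  set n := ⌊exp (log N / 2 + J)⌋₊ with hn
  have hm1 : exp (log N / 2 - J - 2) ≤ m := by
    have h1 := (Nat.lt_floor_add_one (exp (log N / 2 - J - 1))).le
    have h2 : exp (log N / 2 - J - 1) = exp (log N / 2 - J - 2) * exp 1 := by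
      rw [← exp_add]; ring_nf
    have h3 : (1 : ℝ) ≤ exp (log N / 2 - J - 2) := one_le_exp (by linarith)
    have := add_one_le_exp (1 : ℝ)
    rw [← hm] at h1
    nlinarith
  have hm4 : exp (log N / 4) ≤ m := (exp_le_exp.2 (by linarith)).trans hm1
  have hm3 : 3 ≤ m := by
    have : (3 : ℝ) ≤ m := by
      have := add_one_le_exp (log N / 4); linarith
    exact_mod_cast this
  have hmn : m ≤ n := Nat.floor_le_floor (exp_le_exp.2 (by linarith))
  have hn1 : (n : ℝ) ≤ exp (log N / 2 + J) := Nat.floor_le (exp_pos _).le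
  have h2 := sum_Ioc_filter_inv_le (B := fun a => (1 + ε) * log (log N) < cardFactors a)
    (δ := C * (log N / 4) ^ (-(ε ^ 2 / 4))) (by omega) hmn (by positivity) (fun k hk1 hk2 => by
      have hk0 : (0 : ℝ) < k := by exact_mod_cast (by omega : 0 < k)
      have hk3 : log N / 4 ≤ log k := by
        rw [le_log_iff_exp_le hk0]
        exact hm4.trans (by exact_mod_cast hk1)
      have hk4 : log k ≤ log N := by
        have : (k : ℝ) ≤ exp (log N / 2 + J) := le_trans (by exact_mod_cast hk2) hn1
        have := log_le_log hk0 this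
        rw [log_exp] at this
        linarith
      have hk := H k (by omega)
      calc _ ≤ (((Ioc 0 k).filter fun a =>
              (1 + ε) * log (log k) < cardFactors a).card : ℝ) := by
            gcongr
            linarith
        _ ≤ _ := hk
        _ ≤ C * k * (log N / 4) ^ (-(ε ^ 2 / 4)) := by
            refine mul_le_mul_of_nonneg_left ?_ (by positivity)
            exact rpow_le_rpow_of_nonpos (by linarith) hk3 (by nlinarith)
        _ = _ := by ring)
  have h3 : ∑ a ∈ s, (1 : ℝ) / a ≤
      ∑ k ∈ Ioc m n with (1 + ε) * log (log N) < cardFactors k, (1 : ℝ) / k := by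
    refine sum_le_sum_of_subset_of_nonneg ?_ fun _ _ _ => by positivity
    intro a ha
    obtain ⟨h1, h2, h3⟩ := hs a ha
    rw [mem_filter, mem_Ioc]
    refine ⟨⟨?_, Nat.le_floor h2⟩, h3⟩
    rw [hm, Nat.floor_lt (exp_pos _).le]
    exact (exp_lt_exp.2 (by linarith)).trans_le h1
  have h4 : log n - log m ≤ 2 * J + 2 := by
    have hn0 : (0 : ℝ) < n := by exact_mod_cast (by omega : 0 < n)
    have hm0 : (0 : ℝ) < m := by exact_mod_cast (by omega : 0 < m)
    have h1 := log_le_log hn0 hn1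
    have h2 : log N / 2 - J - 2 ≤ log m := by rwa [le_log_iff_exp_le hm0]
    rw [log_exp] at h1
    linarith
  have h5 : (log N / 4) ^ (-(ε ^ 2 / 4)) ≤ 2 * (log N ^ (-(ε ^ 2 / 8)) * log N ^ (-(ε ^ 2 / 8))) := by
    rw [← rpow_add hL0, div_rpow hL0.le (by norm_num)]
    have e1 : -(ε ^ 2 / 8) + -(ε ^ 2 / 8) = -(ε ^ 2 / 4) := by ring
    rw [e1, div_le_iff₀ (by positivity)]
    have : (1 : ℝ) ≤ 2 * 4 ^ (-(ε ^ 2 / 4)) := by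
      have h1 : (4 : ℝ) ^ (-(1 / 2) : ℝ) ≤ 4 ^ (-(ε ^ 2 / 4)) :=
        rpow_le_rpow_of_exponent_le (by norm_num) (by nlinarith)
      linarith
    have h0 : 0 < log N ^ (-(ε ^ 2 / 4)) := by positivity
    nlinarith
  set y := log N ^ (-(ε ^ 2 / 8)) with hy
  have hy0 : 0 < y := by positivity
  have hyC : 16 * C * y ≤ 1 := by
    rw [hy, rpow_neg hL0.le]
    rwa [← div_eq_mul_inv, div_le_one (by positivity)]
  calc _ ≤ _ := h3.trans h2
    _ ≤ C * (2 * (y * y)) * (1 + (2 * J + 2)) := by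
        have : 0 ≤ log n - log m := sub_nonneg.2 (log_le_log
          (by exact_mod_cast (by omega : 0 < m)) (by exact_mod_cast hmn))
        gcongr
    _ ≤ C * (2 * (y * y)) * (5 * J) := by gcongr; linarith
    _ = (10 * C * y) * (J * y) := by ring
    _ ≤ 1 * (J * y) := by gcongr; nlinarith [mul_nonneg hC hy0.le]
    _ = _ := one_mul _

theorem eventually_card_sieve_window_le {ε : ℝ} (hε : 0 < ε) (hε1 : ε ≤ 1) :
    ∀ᶠ N : ℝ in atTop, ∀ a : ℕ, √N * exp (-windowLog N) ≤ a → (a : ℝ) ≤ √N * exp (windowLog N) →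
      (((Ioc 0 ⌊N / a⌋₊).filter fun b => (a ^ 2 + b ^ 2).Prime).card : ℝ) ≤
        8 * (N * log N ^ (-1 + ε)) * (1 / a) := by
  obtain ⟨W0, hW0⟩ := eventually_atTop.1 (eventually_card_sq_add_sq_prime_le hε)
  filter_upwards [eventually_windowLog (show (0 : ℝ) < 1 / 8 by norm_num),
    tendsto_log_atTop.eventually_ge_atTop (4 * (W0 : ℝ))] with N ⟨hJ1, hJL, hL, hN⟩ hW a ha1 ha2
  set J := windowLog N
  have hN0 : 0 < N := (exp_pos _).trans_le hN
  have hL0 : 0 < log N := by linarith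
  have hA : √N * exp (-J) = exp (log N / 2 - J) := by
    rw [← exp_log (sqrt_pos.2 hN0), ← exp_add, log_sqrt hN0.le]; ring_nf
  have hA' : √N * exp J = exp (log N / 2 + J) := by
    rw [← exp_log (sqrt_pos.2 hN0), ← exp_add, log_sqrt hN0.le]
  rw [hA] at ha1
  rw [hA'] at ha2
  have ha0 : (0 : ℝ) < a := (exp_pos _).trans_le ha1
  have haN : exp (log N / 4) ≤ N / a := by
    rw [le_div_iff₀ ha0]
    calc _ ≤ exp (log N / 4) * exp (log N / 2 + J) := by gcongr
      _ ≤ exp (log N) := by rw [← exp_add]; exact exp_le_exp.2 (by linarith)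
      _ = N := exp_log hN0
  have h0 : 0 ≤ N / a := by positivity
  have h1N : 1 ≤ N / a := le_trans (one_le_exp (by linarith)) haN
  obtain ⟨W, hWd⟩ : ∃ W, W = ⌊N / a⌋₊ + 1 := ⟨_, rfl⟩
  have hWr : N / a ≤ W := by rw [hWd]; push_cast; exact (Nat.lt_floor_add_one _).le
  have hW2 : (W : ℝ) ≤ 2 * (N / a) := by
    rw [hWd]; push_cast; linarith [Nat.floor_le h0]
  have hW0' : (0 : ℝ) < W := by linarith
  have hWL : log N / 4 ≤ log W := by
    rw [le_log_iff_exp_le hW0']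
    exact haN.trans hWr
  have hWW : W0 ≤ W := by
    have : (W0 : ℝ) ≤ W := by
      have h1 := log_le_sub_one_of_pos hW0'
      linarith
    exact_mod_cast this
  have hfin : W * log W ^ (-1 + ε) ≤ 8 * (N * log N ^ (-1 + ε)) * (1 / a) := by
    calc _ ≤ 2 * (N / a) * (log N / 4) ^ (-1 + ε) :=
          mul_le_mul hW2 (rpow_le_rpow_of_nonpos (by linarith) hWL (by linarith))
            (rpow_nonneg (by linarith) _) (by positivity)
      _ ≤ 2 * (N / a) * (4 * log N ^ (-1 + ε)) := by
          gcongr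
          rw [div_rpow hL0.le (by norm_num), div_le_iff₀ (by positivity)]
          have : (1 : ℝ) ≤ 4 * 4 ^ (-1 + ε) := by
            rw [rpow_add (by norm_num), rpow_neg_one]
            have := one_le_rpow (show (1 : ℝ) ≤ 4 by norm_num) (show 0 ≤ ε by positivity)
            linarith
          have h0 : 0 < log N ^ (-1 + ε) := by positivity
          nlinarith
      _ = _ := by ring
  have hsub : (Ioc 0 ⌊N / a⌋₊).filter (fun b => (a ^ 2 + b ^ 2).Prime) ⊆
      (range W).filter fun b => (a ^ 2 + b ^ 2).Prime := by
    refine Finset.filter_subset_filter _ fun x hx => ?_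
    rw [mem_Ioc] at hx
    rw [mem_range]
    omega
  exact (Nat.cast_le.2 (card_le_card hsub)).trans
    ((hW0 W hWW a (by exact_mod_cast ha0) (by
      have := log_le_log ha0 ha2
      rw [log_exp] at this
      linarith)).trans hfin)

open ArithmeticFunction hiding log in
theorem eventually_card_bad_pairs_le {ε : ℝ} (hε : 0 < ε) (hε1 : ε ≤ 1) :
    ∀ᶠ N : ℝ in atTop, (((pairSet N (windowLog N)).filter fun z =>
      (1 + ε) * log (log N) < cardFactors z.1 ∨ (1 + ε) * log (log N) < cardFactors z.2).card : ℝ) ≤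
        N * windowLog N / log N * log N ^ (-(ε ^ 2 / 32)) := by
  classical
  have h1 : Tendsto (fun W : ℝ => log W ^ (ε ^ 2 / 32 : ℝ)) atTop atTop :=
    (tendsto_rpow_atTop (by positivity)).comp tendsto_log_atTop
  filter_upwards [eventually_windowLog (show (0 : ℝ) < 1 / 8 by norm_num),
    eventually_sum_cardFactors_gt_inv_le hε hε1, h1.eventually_ge_atTop 16,
    eventually_card_sieve_window_le (show 0 < ε ^ 2 / 16 by positivity) (by nlinarith)]
    with N ⟨hJ1, hJL, hL, hN⟩ hS hbig hsieve
  set J := windowLog N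
  have hN0 : 0 < N := (exp_pos _).trans_le hN
  have hL0 : 0 < log N := by linarith
  set B := (Ioc 0 ⌊N⌋₊).filter fun a : ℕ => √N * exp (-J) ≤ a ∧ (a : ℝ) ≤ √N * exp J ∧
    (1 + ε) * log (log N) < cardFactors a with hB
  have hBS := hS B fun a ha => (mem_filter.1 ha).2
  have hsub : (pairSet N J).filter (fun z =>
      (1 + ε) * log (log N) < cardFactors z.1 ∨ (1 + ε) * log (log N) < cardFactors z.2) ⊆
      (B.sigma fun a => (Ioc 0 ⌊N / a⌋₊).filter fun b => (a ^ 2 + b ^ 2).Prime).image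
        (fun x => (x.1, x.2)) ∪
      (B.sigma fun a => (Ioc 0 ⌊N / a⌋₊).filter fun b => (a ^ 2 + b ^ 2).Prime).image
        (fun x => (x.2, x.1)) := by
    rintro ⟨a, b⟩ h
    rw [mem_filter] at h
    obtain ⟨h, hbad⟩ := h
    obtain ⟨hba, hbb⟩ := mem_pairSet_bounds hN0 (by linarith : 0 ≤ J) h
    have hIoc := (mem_filter.1 h).1
    rw [mem_product] at hIoc
    obtain ⟨h1, h2, h3, h4, h5, h6⟩ := mem_pairSet.1 h
    have ha : (0 : ℝ) < a := by exact_mod_cast h1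
    have hb : (0 : ℝ) < b := by exact_mod_cast h1.trans h2
    rw [mem_union, mem_image, mem_image]
    rcases hbad with hbad | hbad
    · refine Or.inl ⟨⟨a, b⟩, ?_, rfl⟩
      simp only [Finset.mem_sigma, hB, mem_filter, mem_Ioc] at hIoc ⊢
      exact ⟨⟨hIoc.1, hba.1, hba.2, hbad⟩, ⟨h1.trans h2, Nat.le_floor (by
        rw [le_div_iff₀ ha]; linarith)⟩, h6⟩
    · refine Or.inr ⟨⟨b, a⟩, ?_, rfl⟩
      simp only [Finset.mem_sigma, hB, mem_filter, mem_Ioc] at hIoc ⊢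
      exact ⟨⟨hIoc.2, hbb.1, hbb.2, hbad⟩, ⟨h1, Nat.le_floor (by
        rw [le_div_iff₀ hb]; linarith)⟩, by rwa [add_comm]⟩
  have hcard := (card_le_card hsub).trans ((Finset.card_union_le _ _).trans
    (add_le_add Finset.card_image_le Finset.card_image_le))
  have hsig : ((B.sigma fun a => (Ioc 0 ⌊N / a⌋₊).filter fun b =>
      (a ^ 2 + b ^ 2).Prime).card : ℝ) ≤
      8 * (N * log N ^ (-1 + ε ^ 2 / 16)) * (J * log N ^ (-(ε ^ 2 / 8))) := by
    rw [Finset.card_sigma]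
    push_cast
    calc _ ≤ ∑ a ∈ B, 8 * (N * log N ^ (-1 + ε ^ 2 / 16)) * (1 / (a : ℝ)) :=
          sum_le_sum fun a ha =>
            hsieve a (mem_filter.1 ha).2.1 (mem_filter.1 ha).2.2.1
      _ ≤ _ := by rw [← mul_sum]; gcongr
  have e1 : log N ^ (-1 + ε ^ 2 / 16) * log N ^ (-(ε ^ 2 / 8)) * log N ^ (ε ^ 2 / 32) =
      (log N)⁻¹ * log N ^ (-(ε ^ 2 / 32)) := by
    rw [← rpow_add hL0, ← rpow_add hL0, ← rpow_neg_one, ← rpow_add hL0]; ring_nf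
  calc _ ≤ 2 * (8 * (N * log N ^ (-1 + ε ^ 2 / 16)) * (J * log N ^ (-(ε ^ 2 / 8)))) := by
        have : ((_ : ℕ) : ℝ) ≤ _ := Nat.cast_le.2 hcard
        refine this.trans ?_
        push_cast
        linarith
    _ = N * J * (log N ^ (-1 + ε ^ 2 / 16) * log N ^ (-(ε ^ 2 / 8)) * 16) := by ring
    _ ≤ N * J * (log N ^ (-1 + ε ^ 2 / 16) * log N ^ (-(ε ^ 2 / 8)) * log N ^ (ε ^ 2 / 32)) := by
        gcongr
    _ = _ := by rw [e1]; ring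

open ArithmeticFunction hiding log in
theorem card_filter_dvd_le_cardFactors {P : Finset ℕ} (hP : ∀ p ∈ P, p.Prime) {n : ℕ} (hn : n ≠ 0) :
    (P.filter (· ∣ n)).card ≤ cardFactors n := by
  calc _ ≤ n.primeFactors.card := card_le_card fun p hp => by
        rw [mem_filter] at hp
        exact Nat.mem_primeFactors.2 ⟨hP p hp.1, hp.2, hn⟩
    _ ≤ _ := by
        rw [cardFactors_apply, Nat.primeFactors]
        exact List.toFinset_card_le _

open ArithmeticFunction hiding log in
theorem half_pow_cardFactors_le_prod {P : Finset ℕ} (hP : ∀ p ∈ P, p.Prime) {n : ℕ} (hn : n ≠ 0) :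
    (1 / 2 : ℝ) ^ cardFactors n ≤ ∏ p ∈ P, if p ∣ n then (1 / 2 : ℝ) else 1 := by
  rw [Finset.prod_ite, Finset.prod_const_one, mul_one, Finset.prod_const]
  exact pow_le_pow_of_le_one (by norm_num) (by norm_num) (card_filter_dvd_le_cardFactors hP hn)

open ArithmeticFunction hiding log in
theorem eventually_sum_half_pow_cardFactors_le {ε : ℝ} (hε : 0 < ε) :
    ∀ᶠ W : ℕ in atTop, ∑ n ∈ range W with n ≠ 0, (1 / 2 : ℝ) ^ cardFactors n ≤
      W * log W ^ (-1 / 2 + ε) := by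
  set e := min (ε / 4) (1 / 2) with he
  have he0 : 0 < e := by positivity
  have he1 : e < 1 := (min_le_right _ _).trans_lt (by norm_num)
  have hee : e ≤ ε / 4 := min_le_left _ _
  have hc := tendsto_natCast_atTop_atTop (R := ℝ)
  filter_upwards [eventually_sum_range_le_of_sieve (κ := -1 / 2) (by norm_num) hε he0 he1,
    hc.eventually (eventually_sum_sievePrimes_ge he0 he1),
    hc.eventually (tendsto_log_atTop.eventually_ge_atTop 4)] with W h1 h2 h5
  set P := sievePrimes e W 1 with hP
  have hPm : ∀ p ∈ P, p.Prime ∧ 5 < p ∧ log p ≤ log W ^ (1 - e) := by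
    intro p hp
    rw [hP, mem_sievePrimes] at hp
    tauto
  have hsum : ∀ p ∈ P, ∑ n ∈ range p, (if p ∣ n then (1 / 2 : ℝ) else 0) = 1 / 2 := by
    intro p hp
    rw [Finset.sum_eq_single 0]
    · simp
    · intro n hn hn0
      rw [mem_range] at hn
      rw [if_neg fun h => absurd (Nat.le_of_dvd (Nat.pos_of_ne_zero hn0) h) (by omega)]
    · intro h
      exact absurd (mem_range.2 (hPm p hp).1.pos) h
  have s2 := (h2 1 one_ne_zero (by simp; positivity)).1
  have s3 : ∑ p ∈ P, (∑ n ∈ range p, (if p ∣ n then (1 / 2 : ℝ) else 0)) / p =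
      1 / 2 * ∑ p ∈ P, (1 : ℝ) / p := by
    rw [mul_sum]
    exact sum_congr rfl fun p hp => by rw [hsum p hp]; ring
  rw [sum_filter]
  refine h1 P (fun p n => if p ∣ n then 1 / 2 else 0) _ hPm (fun p n => by split_ifs <;> norm_num)
    (fun p _ n => by simp [Nat.dvd_add_left (dvd_refl p)])
    (fun p hp => by rw [hsum p hp]; norm_num) ?_ (fun n => ?_) fun n _ => ?_
  · rw [s3]
    have := log_nonneg (by linarith : 1 ≤ log (W : ℝ))
    nlinarith
  · split_ifs
    · exact pow_le_one₀ (by norm_num) (by norm_num)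
    · exact zero_le_one
  · have : ∏ p ∈ P, (1 - if p ∣ n then (1 / 2 : ℝ) else 0) =
        ∏ p ∈ P, if p ∣ n then (1 / 2 : ℝ) else 1 :=
      Finset.prod_congr rfl fun p _ => by split_ifs <;> norm_num
    rw [this]
    split_ifs with hn
    · exact half_pow_cardFactors_le_prod (fun p hp => (hPm p hp).1) hn
    · exact prod_nonneg fun p _ => by split_ifs <;> norm_num

open ArithmeticFunction hiding log in
theorem exists_sum_half_pow_cardFactors_div_le {ε : ℝ} (hε : 0 < ε) (hε1 : ε ≤ 1 / 4) :
    ∃ C : ℝ, 0 ≤ C ∧ ∀ (i : ℕ) (s : Finset ℕ), (∀ y ∈ s, 0 < y ∧ ⌊log y⌋₊ = i) →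
      ∑ y ∈ s, (1 / 2 : ℝ) ^ cardFactors y / y ≤ C * ((i : ℝ) + 1) ^ (-1 / 2 + ε) := by
  obtain ⟨W0, hW0⟩ := eventually_atTop.1 (eventually_sum_half_pow_cardFactors_le hε)
  have hW : ∀ (i : ℕ) (s : Finset ℕ), (∀ y ∈ s, 0 < y ∧ ⌊log y⌋₊ = i) →
      (∀ y ∈ s, exp i ≤ y ∧ (y : ℝ) < exp (i + 1)) := by
    intro i s hs y hy
    obtain ⟨h1, h2⟩ := hs y hy
    have hy0 : (0 : ℝ) < y := by exact_mod_cast h1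
    have hlog : 0 ≤ log (y : ℝ) := log_nonneg (by exact_mod_cast h1)
    rw [Nat.floor_eq_iff hlog] at h2
    exact ⟨(le_log_iff_exp_le hy0).1 h2.1, (log_lt_iff_lt_exp hy0).1 h2.2⟩
  have hexp : ∀ i : ℕ, ((⌊exp ((i : ℝ) + 1)⌋₊ + 1 : ℕ) : ℝ) ≤ 4 * exp i := by
    intro i
    push_cast
    have h1 : (⌊exp ((i : ℝ) + 1)⌋₊ : ℝ) ≤ exp (i + 1) := Nat.floor_le (exp_pos _).le
    have h2 : 1 ≤ exp (i : ℝ) := one_le_exp (by positivity)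
    have h3 : exp ((i : ℝ) + 1) = exp i * exp 1 := exp_add _ _
    have := exp_one_lt_d9
    nlinarith
  have hbd : ∀ (i : ℕ) (s : Finset ℕ), (∀ y ∈ s, 0 < y ∧ ⌊log y⌋₊ = i) →
      ∑ y ∈ s, (1 / 2 : ℝ) ^ cardFactors y / y ≤ (∑ n ∈ range (⌊exp ((i : ℝ) + 1)⌋₊ + 1)
        with n ≠ 0, (1 / 2 : ℝ) ^ cardFactors n) / exp i := by
    intro i s hs
    rw [Finset.sum_div]
    calc _ ≤ ∑ y ∈ s, (1 / 2 : ℝ) ^ cardFactors y / exp i := sum_le_sum fun y hy =>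
          div_le_div_of_nonneg_left (by positivity) (exp_pos _) (hW i s hs y hy).1
      _ ≤ _ := by
          refine sum_le_sum_of_subset_of_nonneg (fun y hy => ?_) fun _ _ _ => by positivity
          rw [mem_filter, mem_range]
          exact ⟨Nat.lt_succ_of_le (Nat.le_floor (hW i s hs y hy).2.le), (hs y hy).1.ne'⟩
  refine ⟨4 * (W0 + 1), by positivity, fun i s hs => ?_⟩
  refine (hbd i s hs).trans ?_
  rw [div_le_iff₀ (exp_pos _)]
  by_cases hi : W0 ≤ i
  · have h1 : i + 1 ≤ ⌊exp ((i : ℝ) + 1)⌋₊ := by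
      apply Nat.le_floor
      have := add_one_le_exp ((i : ℝ) + 1)
      push_cast; linarith
    refine (hW0 _ (by omega)).trans ?_
    have h2 : (i : ℝ) + 1 ≤ log ((⌊exp ((i : ℝ) + 1)⌋₊ + 1 : ℕ) : ℝ) := by
      rw [le_log_iff_exp_le (by positivity)]
      push_cast
      exact (Nat.lt_floor_add_one _).le
    calc _ ≤ 4 * exp i * ((i : ℝ) + 1) ^ (-1 / 2 + ε) :=
          mul_le_mul (hexp i) (rpow_le_rpow_of_nonpos (by positivity) h2 (by linarith))
            (rpow_nonneg (by linarith) _) (by positivity)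
      _ ≤ _ := by
          have : 0 ≤ (W0 : ℝ) := by positivity
          have h3 : 0 ≤ exp (i : ℝ) * ((i : ℝ) + 1) ^ (-1 / 2 + ε) := by positivity
          nlinarith [mul_nonneg this h3]
  · have h1 : ∑ n ∈ range (⌊exp ((i : ℝ) + 1)⌋₊ + 1) with n ≠ 0,
        (1 / 2 : ℝ) ^ cardFactors n ≤ 4 * exp i := by
      refine le_trans ?_ (hexp i)
      calc _ ≤ ∑ n ∈ range (⌊exp ((i : ℝ) + 1)⌋₊ + 1) with n ≠ 0, (1 : ℝ) :=
            sum_le_sum fun n _ => pow_le_one₀ (by norm_num) (by norm_num)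
        _ ≤ ∑ n ∈ range (⌊exp ((i : ℝ) + 1)⌋₊ + 1), (1 : ℝ) :=
            sum_le_sum_of_subset_of_nonneg (filter_subset _ _) fun _ _ _ => by simp
        _ = _ := by simp
    refine h1.trans ?_
    have h2 : 1 ≤ ((W0 : ℝ) + 1) * ((i : ℝ) + 1) ^ (-1 / 2 + ε) := by
      have h3 : (i : ℝ) + 1 ≤ W0 + 1 := by
        push Not at hi
        have : (i : ℝ) ≤ W0 := by exact_mod_cast hi.le
        linarith
      have h4 : ((i : ℝ) + 1) ^ (-1 : ℝ) ≤ ((i : ℝ) + 1) ^ (-1 / 2 + ε) :=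
        rpow_le_rpow_of_exponent_le (by linarith [show 0 ≤ (i : ℝ) by positivity]) (by linarith)
      rw [rpow_neg_one] at h4
      calc (1 : ℝ) = ((i : ℝ) + 1) * ((i : ℝ) + 1)⁻¹ := by
            rw [mul_inv_cancel₀ (by positivity)]
        _ ≤ _ := by gcongr
    have h3 : 0 < exp (i : ℝ) := exp_pos _
    nlinarith

theorem card_filter_forms_zmod {p : ℕ} [Fact p.Prime] (hp : 5 < p) {i u v z : ZMod p}
    (hi : i ^ 2 = -1) (hu : u ≠ 0) (hv : v ≠ 0) (hz : z ≠ 0) (huv : u ^ 2 ≠ v ^ 2) :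
    (univ.filter fun t : ZMod p => u ^ 2 + t ^ 2 * z ^ 2 = 0 ∨
      v ^ 2 + t ^ 2 * z ^ 2 = 0).card = 4 := by
  have h2 : (2 : ZMod p) ≠ 0 := by
    intro h
    have : ((2 : ℕ) : ZMod p) = 0 := by exact_mod_cast h
    rw [ZMod.natCast_eq_zero_iff] at this
    exact absurd (Nat.le_of_dvd (by norm_num) this) (by omega)
  have hi0 : i ≠ 0 := by
    intro h; rw [h] at hi; simp at hi
  have hne : ∀ u : ZMod p, u ≠ 0 → i * u / z ≠ - (i * u / z) := by
    intro u hu h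
    have : 2 * (i * u / z) = 0 := by linear_combination h
    exact mul_ne_zero h2 (div_ne_zero (mul_ne_zero hi0 hu) hz) this
  have hroot : ∀ u t : ZMod p, u ^ 2 + t ^ 2 * z ^ 2 = 0 ↔ t = i * u / z ∨ t = -(i * u / z) := by
    intro u t
    rw [← sq_eq_sq_iff_eq_or_eq_neg, div_pow, mul_pow, hi, eq_div_iff (pow_ne_zero 2 hz)]
    constructor <;> intro h <;> linear_combination h
  have hd : ∀ s : ZMod p, s ^ 2 = 1 → i * u / z ≠ s * (i * v / z) := by
    intro s hs h
    apply huv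
    have h3 : i * u = s * (i * v) := by
      field_simp at h
      linear_combination i * h
    have h4 : u = s * v := mul_left_cancel₀ hi0 (by linear_combination h3)
    rw [h4, mul_pow, hs, one_mul]
  have hd1 := hd 1 (by ring)
  have hd2 := hd (-1) (by ring)
  rw [one_mul] at hd1
  rw [neg_one_mul] at hd2
  have : (univ.filter fun t : ZMod p => u ^ 2 + t ^ 2 * z ^ 2 = 0 ∨
      v ^ 2 + t ^ 2 * z ^ 2 = 0) = {i * u / z, -(i * u / z), i * v / z, -(i * v / z)} := by
    ext t
    simp only [mem_filter, mem_univ, true_and, Finset.mem_insert,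
      mem_singleton, hroot, or_assoc]
  rw [this, card_insert_of_notMem, card_insert_of_notMem,
    Finset.card_pair (hne v hv)]
  · simp only [Finset.mem_insert, mem_singleton, not_or]
    refine ⟨fun h => hd2 ?_, fun h => hd1 ?_⟩
    · rw [← h, neg_neg]
    · exact neg_injective h
  · simp only [Finset.mem_insert, mem_singleton, not_or]
    exact ⟨hne u hu, hd1, hd2⟩

open ArithmeticFunction hiding log in
/-- Sieve bound for simultaneous prime values of two binary forms, weighted by `2 ^ (-Ω)`. -/
theorem eventually_sum_forms_prime_le {ε : ℝ} (hε : 0 < ε) :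
    ∀ᶠ W : ℕ in atTop, ∀ x y z : ℕ, 0 < x → 0 < y → 0 < z → y ≠ z →
      log x ≤ 5 * log W → log y ≤ 5 * log W → log z ≤ 5 * log W →
      ∑ w ∈ range W with 0 < w ∧ (x ^ 2 * y ^ 2 + w ^ 2 * z ^ 2).Prime ∧
        (x ^ 2 * z ^ 2 + y ^ 2 * w ^ 2).Prime, (1 / 2 : ℝ) ^ cardFactors w ≤
        W * log W ^ (-(5 / 2) + ε) := by
  set e := min (ε / 20) (1 / 2) with he
  have he0 : 0 < e := by positivity
  have he1 : e < 1 := (min_le_right _ _).trans_lt (by norm_num)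
  have hee : e ≤ ε / 20 := min_le_left _ _
  choose! i hi using fun p (hp : p.Prime ∧ p % 4 = 1) => exists_sq_eq_neg_one_zmod hp.1 hp.2
  have hc := tendsto_natCast_atTop_atTop (R := ℝ)
  filter_upwards [eventually_sum_range_le_of_sieve (κ := -(5 / 2)) (by norm_num) hε he0 he1,
    hc.eventually (eventually_sum_sievePrimes_ge he0 he1),
    hc.eventually (tendsto_log_atTop.eventually_ge_atTop 4)]
    with W h1 h2 h5 x y z hx hy hz hyz hxW hyW hzW
  set M := x * y * z * (Int.natAbs ((y : ℤ) ^ 4 - z ^ 4)) with hM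
  have hyz4 : (y : ℤ) ^ 4 - z ^ 4 ≠ 0 := by
    intro h
    apply hyz
    have : (y : ℤ) ^ 4 = z ^ 4 := by linarith
    have : y ^ 4 = z ^ 4 := by exact_mod_cast this
    exact Nat.pow_left_injective (by norm_num) this
  have hM0 : M ≠ 0 := by
    positivity
  have hML : log M ≤ 100 * log W := by
    have hy1 : (1 : ℝ) ≤ y := by exact_mod_cast hy
    have hz1 : (1 : ℝ) ≤ z := by exact_mod_cast hz
    have h6 : (Int.natAbs ((y : ℤ) ^ 4 - z ^ 4) : ℝ) ≤ (y * z : ℝ) ^ 4 := by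
      rw [Nat.cast_natAbs]
      push_cast
      have a1 : (y : ℝ) ^ 4 ≤ (y * z) ^ 4 := by gcongr; nlinarith
      have a2 : (z : ℝ) ^ 4 ≤ (y * z) ^ 4 := by gcongr; nlinarith
      have a3 : 0 < (y : ℝ) ^ 4 := by positivity
      have a4 : 0 < (z : ℝ) ^ 4 := by positivity
      rw [abs_le]
      constructor <;> linarith
    have h7 : (M : ℝ) ≤ x * y * z * (y * z) ^ 4 := by
      rw [hM]; push_cast at h6 ⊢; gcongr
    have h8 := log_le_log (by exact_mod_cast Nat.pos_of_ne_zero hM0) h7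
    rw [log_mul (by positivity) (by positivity), log_pow, log_mul (by positivity) (by positivity),
      log_mul (by positivity) (by positivity), log_mul (by positivity) (by positivity)] at h8
    push_cast at h8
    linarith
  set P := sievePrimes e W M with hP
  have hPm : ∀ p ∈ P, p.Prime ∧ 5 < p ∧ ¬ p ∣ M ∧ log p ≤ log W ^ (1 - e) := by
    intro p hp
    rw [hP, mem_sievePrimes] at hp
    tauto
  have hPM : ∀ p ∈ P, (x : ZMod p) ≠ 0 ∧ (y : ZMod p) ≠ 0 ∧ (z : ZMod p) ≠ 0 ∧
      (y : ZMod p) ^ 4 ≠ z ^ 4 := by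
    intro p hp
    have hpM := (hPm p hp).2.2.1
    have hpp := (hPm p hp).1
    rw [hM, hpp.dvd_mul, hpp.dvd_mul, hpp.dvd_mul, not_or, not_or, not_or] at hpM
    refine ⟨by rw [Ne, ZMod.natCast_eq_zero_iff]; exact hpM.1.1.1,
      by rw [Ne, ZMod.natCast_eq_zero_iff]; exact hpM.1.1.2,
      by rw [Ne, ZMod.natCast_eq_zero_iff]; exact hpM.1.2, fun h => hpM.2 ?_⟩
    rw [← Int.natCast_dvd, ← ZMod.intCast_zmod_eq_zero_iff_dvd]
    push_cast
    rw [h, sub_self]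
  set g : ∀ p : ℕ, ZMod p → ℝ := fun p t => if t = 0 then 1 / 2 else
    if p % 4 = 1 ∧ ((x * y : ZMod p) ^ 2 + t ^ 2 * z ^ 2 = 0 ∨
      (x * z : ZMod p) ^ 2 + t ^ 2 * y ^ 2 = 0) then 1 else 0 with hg
  have hg01 : ∀ p t, 0 ≤ g p t ∧ g p t ≤ 1 := by
    intro p t; rw [hg]; dsimp only; split_ifs <;> norm_num
  have hsum : ∀ p ∈ P, ∑ n ∈ range p, g p n = 1 / 2 + if p % 4 = 1 then 4 else 0 := by
    intro p hp
    obtain ⟨hp1, hp2, -, -⟩ := hPm p hp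
    obtain ⟨hx0, hy0, hz0, hyz0⟩ := hPM p hp
    have : Fact p.Prime := ⟨hp1⟩
    rw [sum_range_zmod]
    have hsplit : ∀ t : ZMod p, g p t = (if t = 0 then 1 / 2 else 0) +
        if p % 4 = 1 ∧ ((x * y / z : ZMod p) ^ 2 + t ^ 2 * 1 ^ 2 = 0 ∨
          (x * z / y : ZMod p) ^ 2 + t ^ 2 * 1 ^ 2 = 0) then 1 else 0 := by
      intro t
      have e1 : ((x * y / z : ZMod p) ^ 2 + t ^ 2 * 1 ^ 2 = 0) ↔
          ((x * y : ZMod p) ^ 2 + t ^ 2 * z ^ 2 = 0) := by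
        rw [show (x * y / z : ZMod p) ^ 2 + t ^ 2 * 1 ^ 2 =
          ((x * y : ZMod p) ^ 2 + t ^ 2 * z ^ 2) / z ^ 2 by field_simp]
        rw [div_eq_zero_iff]
        simp [hz0]
      have e2 : ((x * z / y : ZMod p) ^ 2 + t ^ 2 * 1 ^ 2 = 0) ↔
          ((x * z : ZMod p) ^ 2 + t ^ 2 * y ^ 2 = 0) := by
        rw [show (x * z / y : ZMod p) ^ 2 + t ^ 2 * 1 ^ 2 =
          ((x * z : ZMod p) ^ 2 + t ^ 2 * y ^ 2) / y ^ 2 by field_simp]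
        rw [div_eq_zero_iff]
        simp [hy0]
      simp only [e1, e2, hg]
      by_cases ht : t = 0
      · rw [if_pos ht, if_pos ht, if_neg, add_zero]
        rw [ht]
        simp [hx0, hy0, hz0]
      · rw [if_neg ht, if_neg ht, zero_add]
    rw [sum_congr rfl fun t _ => hsplit t, sum_add_distrib]
    congr 1
    · simp
    · split_ifs with h4
      · simp only [h4, true_and]
        rw [Finset.sum_ite, Finset.sum_const_zero, add_zero, sum_const, nsmul_eq_mul,
          mul_one, card_filter_forms_zmod hp2 (hi p ⟨hp1, h4⟩) (by positivity) (by positivity)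
            one_ne_zero]
        · norm_num
        · intro h
          apply hyz0
          field_simp at h
          linear_combination h
      · simp [h4]
  have s2 := h2 M hM0 hML
  rw [← hP] at s2
  have s3 : ∑ p ∈ P, (∑ n ∈ range p, g p n) / p =
      1 / 2 * ∑ p ∈ P, (1 : ℝ) / p + 4 * ∑ p ∈ P with p % 4 = 1, (1 : ℝ) / p := by
    rw [mul_sum, mul_sum, sum_filter, ← sum_add_distrib]
    exact sum_congr rfl fun p hp => by rw [hsum p hp]; split_ifs <;> ring
  rw [sum_filter]
  refine h1 P (fun p n => g p n) _ (fun p hp => ⟨(hPm p hp).1, (hPm p hp).2.1, (hPm p hp).2.2.2⟩)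
    (fun p n => hg01 p n) (fun p _ n => by simp)
    (fun p hp => by rw [hsum p hp]; split_ifs <;> norm_num) ?_ (fun w => ?_) fun w hs => ?_
  · rw [s3]
    have := log_nonneg (by linarith : 1 ≤ log (W : ℝ))
    nlinarith [s2.1, s2.2]
  · split_ifs
    · exact pow_le_one₀ (by norm_num) (by norm_num)
    · exact zero_le_one
  · split_ifs with hw
    · obtain ⟨hw0, hq1, hq2⟩ := hw
      refine (half_pow_cardFactors_le_prod (fun p hp => (hPm p hp).1) hw0.ne').trans ?_
      apply Finset.prod_le_prod (fun p _ => by split_ifs <;> norm_num)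
      intro p hp
      obtain ⟨hp1, hp3, hp4, hp5⟩ := hPm p hp
      rw [log_le_iff_le_exp (by exact_mod_cast hp1.pos)] at hp5
      have key : ∀ q : ℕ, q.Prime → w + 1 ≤ q → ¬ ((q : ZMod p) = 0) := by
        intro q hq hwq h
        rw [ZMod.natCast_eq_zero_iff] at h
        have hpe := (Nat.prime_dvd_prime_iff_eq hp1 hq).1 h
        apply hs.not_ge
        refine le_trans ?_ hp5
        rw [hpe]
        exact_mod_cast hwq
      have hle : ∀ a b : ℕ, 0 < a → 0 < b → w + 1 ≤ a ^ 2 * b ^ 2 + w ^ 2 := by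
        intro a b ha hb
        have : 0 < a ^ 2 * b ^ 2 := by positivity
        nlinarith [Nat.le_self_pow two_ne_zero w]
      have k1 := key _ hq1 ((hle x y hx hy).trans (by
        have : 0 < z ^ 2 := by positivity
        nlinarith [Nat.zero_le (w ^ 2)]))
      have k2 := key _ hq2 ((hle x z hx hz).trans (by
        have : 0 < y ^ 2 := by positivity
        nlinarith [Nat.zero_le (w ^ 2)]))
      push_cast at k1 k2
      rw [hg]
      dsimp only
      by_cases hwp : (w : ZMod p) = 0
      · rw [if_pos hwp, if_pos (by rwa [ZMod.natCast_eq_zero_iff] at hwp)]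
        norm_num
      · rw [if_neg hwp, if_neg (by rwa [ZMod.natCast_eq_zero_iff] at hwp), if_neg, sub_zero]
        rintro ⟨-, h | h⟩
        · exact k1 (by linear_combination h)
        · exact k2 (by linear_combination h)
    · exact prod_nonneg fun p _ => by linarith [(hg01 p w).2]

open ArithmeticFunction hiding log in
/-- The weight `2 ^ (-Ω n) / n`. -/
noncomputable def omegaWeight (n : ℕ) : ℝ := (1 / 2 : ℝ) ^ cardFactors n / n

theorem omegaWeight_nonneg (n : ℕ) : 0 ≤ omegaWeight n := by
  unfold omegaWeight; positivity

theorem sum_omegaWeight_window_le {ε C : ℝ} (hε : ε ≤ 1 / 4) (hC : 0 ≤ C)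
    (h : ∀ (i : ℕ) (s : Finset ℕ), (∀ y ∈ s, 0 < y ∧ ⌊log y⌋₊ = i) →
      ∑ y ∈ s, omegaWeight y ≤ C * ((i : ℝ) + 1) ^ (-(1 / 2) + ε))
    {A J K : ℝ} (hK : 0 < K) (hJ : 0 ≤ J) (hA : K ≤ A - J) (s : Finset ℕ)
    (hs : ∀ x ∈ s, 0 < x ∧ A - J ≤ log x ∧ log x ≤ A) :
    ∑ x ∈ s, omegaWeight x ≤ C * (J + 2) * K ^ (-(1 / 2) + ε) := by
  have hmaps : ∀ x ∈ s, ⌊log (x : ℝ)⌋₊ ∈ Icc ⌊A - J⌋₊ ⌊A⌋₊ := fun x hx => by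
    rw [mem_Icc]
    exact ⟨Nat.floor_le_floor (hs x hx).2.1, Nat.floor_le_floor (hs x hx).2.2⟩
  rw [← Finset.sum_fiberwise_of_maps_to hmaps]
  have hb : ∀ i ∈ Icc ⌊A - J⌋₊ ⌊A⌋₊, ∑ x ∈ s with ⌊log ((x : ℕ) : ℝ)⌋₊ = i, omegaWeight x ≤
      C * K ^ (-(1 / 2) + ε) := by
    intro i hi
    refine (h i _ fun y hy => ?_).trans ?_
    · rw [mem_filter] at hy
      exact ⟨(hs y hy.1).1, hy.2⟩
    · refine mul_le_mul_of_nonneg_left (rpow_le_rpow_of_nonpos hK ?_ (by linarith)) hC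
      have h1 := Nat.lt_floor_add_one (A - J)
      have h2 : (⌊A - J⌋₊ : ℝ) ≤ i := by exact_mod_cast (mem_Icc.1 hi).1
      linarith
  refine (Finset.sum_le_card_nsmul _ _ _ hb).trans ?_
  rw [nsmul_eq_mul, Nat.card_Icc]
  have hcard : ((⌊A⌋₊ + 1 - ⌊A - J⌋₊ : ℕ) : ℝ) ≤ J + 2 := by
    have h1 := Nat.lt_floor_add_one (A - J)
    have h2 := Nat.floor_le (show 0 ≤ A by linarith)
    have h3 : ⌊A - J⌋₊ ≤ ⌊A⌋₊ + 1 := (Nat.floor_le_floor (by linarith)).trans (Nat.le_succ _)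
    rw [Nat.cast_sub h3]
    push_cast
    linarith
  have : 0 ≤ C * K ^ (-(1 / 2) + ε) := by positivity
  calc _ ≤ (J + 2) * (C * K ^ (-(1 / 2) + ε)) := mul_le_mul_of_nonneg_right hcard this
    _ = _ := by ring

theorem card_filter_abs_sub_le {J : ℝ} (hJ : 0 ≤ J) (n i : ℕ) :
    (((range n).filter fun j : ℕ => |(i : ℝ) - j| ≤ J + 1).card : ℝ) ≤ 2 * J + 3 := by
  have hsub : ((range n).filter fun j : ℕ => |(i : ℝ) - j| ≤ J + 1).card ≤
      (Icc ⌈(i : ℝ) - (J + 1)⌉ ⌊(i : ℝ) + (J + 1)⌋).card := by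
    refine Finset.card_le_card_of_injOn (fun j : ℕ => (j : ℤ)) ?_ (fun a _ b _ hab =>
      Int.natCast_inj.1 hab)
    intro j hj
    simp only [Finset.coe_filter, Set.mem_ofPred_eq, abs_le] at hj
    simp only [Finset.coe_Icc, Set.mem_Icc]
    rw [Int.ceil_le, Int.le_floor]
    push_cast
    constructor <;> linarith [hj.2.1, hj.2.2]
  have h1 := Int.ceil_lt_add_one ((i : ℝ) - (J + 1))
  have h2 := Int.floor_le ((i : ℝ) + (J + 1))
  have h3 := Int.le_ceil ((i : ℝ) - (J + 1))
  have h4 := Int.lt_floor_add_one ((i : ℝ) + (J + 1))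
  rw [Int.card_Icc] at hsub
  have h5 : (0 : ℤ) ≤ ⌊(i : ℝ) + (J + 1)⌋ + 1 - ⌈(i : ℝ) - (J + 1)⌉ := by
    have : ((⌈(i : ℝ) - (J + 1)⌉ - 1 : ℤ) : ℝ) < ((⌊(i : ℝ) + (J + 1)⌋ + 1 : ℤ) : ℝ) := by
      push_cast; linarith
    have := Int.cast_lt.1 this
    linarith
  have h6 : ((⌊(i : ℝ) + (J + 1)⌋ + 1 - ⌈(i : ℝ) - (J + 1)⌉).toNat : ℝ) =
      ((⌊(i : ℝ) + (J + 1)⌋ + 1 - ⌈(i : ℝ) - (J + 1)⌉ : ℤ) : ℝ) := by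
    have := Int.toNat_of_nonneg h5
    exact_mod_cast this
  calc _ ≤ _ := Nat.cast_le.2 hsub
    _ ≤ 2 * J + 3 := by rw [h6]; push_cast; linarith

theorem sum_omegaWeight_pairs_le {ε C : ℝ} (hε0 : 0 < ε) (hε : ε ≤ 1 / 4) (hC : 0 ≤ C)
    (h : ∀ (i : ℕ) (s : Finset ℕ), (∀ y ∈ s, 0 < y ∧ ⌊log y⌋₊ = i) →
      ∑ y ∈ s, omegaWeight y ≤ C * ((i : ℝ) + 1) ^ (-(1 / 2) + ε))
    {J L : ℝ} (hJ : 0 ≤ J) (hL : 1 ≤ L) (s : Finset (ℕ × ℕ))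
    (hs : ∀ x ∈ s, 0 < x.1 ∧ 0 < x.2 ∧ log x.1 ≤ L ∧ log x.2 ≤ L ∧
      |log x.1 - log x.2| ≤ J) :
    ∑ x ∈ s, omegaWeight x.1 * omegaWeight x.2 ≤
      C ^ 2 * (2 * J + 3) * ((2 * L) ^ (2 * ε) * (1 + log (2 * L))) := by
  set n := ⌊L⌋₊ + 1 with hn
  set R := ((range n) ×ˢ (range n)).filter
    fun x : ℕ × ℕ => |(x.1 : ℝ) - x.2| ≤ J + 1 with hR
  set φ : ℕ × ℕ → ℕ × ℕ := fun x => (⌊log (x.1 : ℝ)⌋₊, ⌊log (x.2 : ℝ)⌋₊) with hφ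
  have hnn : ∀ m : ℕ, 0 < m → 0 ≤ log (m : ℝ) := fun m hm => log_nonneg (by exact_mod_cast hm)
  have hmaps : ∀ x ∈ s, φ x ∈ R := by
    intro x hx
    obtain ⟨h1, h2, h3, h4, h5⟩ := hs x hx
    rw [hR, mem_filter, mem_product, mem_range, mem_range, hφ, hn]
    refine ⟨⟨Nat.lt_succ_of_le (Nat.floor_le_floor h3),
      Nat.lt_succ_of_le (Nat.floor_le_floor h4)⟩, ?_⟩
    dsimp only
    have a1 := Nat.floor_le (hnn _ h1)
    have a2 := Nat.floor_le (hnn _ h2)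
    have a3 := Nat.lt_floor_add_one (log (x.1 : ℝ))
    have a4 := Nat.lt_floor_add_one (log (x.2 : ℝ))
    rw [abs_le] at h5 ⊢
    constructor <;> linarith [h5.1, h5.2]
  set c : ℕ → ℝ := fun i => C * ((i : ℝ) + 1) ^ (-(1 / 2) + ε) with hc
  have hc0 : ∀ i, 0 ≤ c i := fun i => by rw [hc]; positivity
  rw [← Finset.sum_fiberwise_of_maps_to hmaps]
  have hfib : ∀ r ∈ R, ∑ x ∈ s with φ x = r, omegaWeight x.1 * omegaWeight x.2 ≤
      (c r.1 ^ 2 + c r.2 ^ 2) / 2 := by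
    intro r _
    set s1 := (s.filter fun x => φ x = r).image Prod.fst
    set s2 := (s.filter fun x => φ x = r).image Prod.snd
    have hsub : (s.filter fun x => φ x = r) ⊆ s1 ×ˢ s2 := by
      intro x hx
      rw [mem_product]
      exact ⟨Finset.mem_image_of_mem _ hx, Finset.mem_image_of_mem _ hx⟩
    have b1 : ∑ y ∈ s1, omegaWeight y ≤ c r.1 := by
      refine h _ _ fun y hy => ?_
      obtain ⟨x, hx, rfl⟩ := mem_image.1 hy
      rw [mem_filter] at hx
      exact ⟨(hs x hx.1).1, by rw [← hx.2]⟩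
    have b2 : ∑ y ∈ s2, omegaWeight y ≤ c r.2 := by
      refine h _ _ fun y hy => ?_
      obtain ⟨x, hx, rfl⟩ := mem_image.1 hy
      rw [mem_filter] at hx
      exact ⟨(hs x hx.1).2.1, by rw [← hx.2]⟩
    calc _ ≤ ∑ x ∈ s1 ×ˢ s2, omegaWeight x.1 * omegaWeight x.2 :=
          sum_le_sum_of_subset_of_nonneg hsub fun _ _ _ =>
            mul_nonneg (omegaWeight_nonneg _) (omegaWeight_nonneg _)
      _ = (∑ y ∈ s1, omegaWeight y) * ∑ y ∈ s2, omegaWeight y := by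
          rw [sum_product, Finset.sum_mul_sum]
      _ ≤ c r.1 * c r.2 := mul_le_mul b1 b2
          (sum_nonneg fun _ _ => omegaWeight_nonneg _) (hc0 _)
      _ ≤ _ := by nlinarith [sq_nonneg (c r.1 - c r.2)]
  refine (sum_le_sum hfib).trans ?_
  have hcol : ∑ r ∈ R, c r.1 ^ 2 ≤ (2 * J + 3) * ∑ i ∈ range n, c i ^ 2 := by
    rw [hR, sum_filter, sum_product, mul_sum]
    refine sum_le_sum fun i _ => ?_
    dsimp only
    rw [← sum_filter, sum_const, nsmul_eq_mul]
    exact mul_le_mul_of_nonneg_right (card_filter_abs_sub_le hJ n i) (sq_nonneg _)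
  have hcol2 : ∑ r ∈ R, c r.2 ^ 2 ≤ (2 * J + 3) * ∑ i ∈ range n, c i ^ 2 := by
    rw [hR, sum_filter, Finset.sum_product_right, mul_sum]
    refine sum_le_sum fun i _ => ?_
    dsimp only
    rw [← sum_filter, sum_const, nsmul_eq_mul]
    refine mul_le_mul_of_nonneg_right ?_ (sq_nonneg _)
    refine le_trans (le_of_eq ?_) (card_filter_abs_sub_le hJ n i)
    congr 2
    ext j
    simp only [abs_sub_comm]
  have hn2 : (n : ℝ) ≤ 2 * L := by
    rw [hn]; push_cast
    have := Nat.floor_le (show 0 ≤ L by linarith)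
    linarith
  have hsq : ∑ i ∈ range n, c i ^ 2 ≤ C ^ 2 * ((2 * L) ^ (2 * ε) * (1 + log (2 * L))) := by
    have e1 : ∀ i ∈ range n, c i ^ 2 ≤ C ^ 2 * (2 * L) ^ (2 * ε) * ((i : ℝ) + 1)⁻¹ := by
      intro i hi
      have hi1 : (i : ℝ) + 1 ≤ n := by exact_mod_cast mem_range.1 hi
      have hip : (0 : ℝ) < (i : ℝ) + 1 := by positivity
      rw [hc]
      dsimp only
      rw [mul_pow, ← rpow_natCast (((i : ℝ) + 1) ^ (-(1 / 2) + ε)), ← rpow_mul hip.le, mul_assoc]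
      refine mul_le_mul_of_nonneg_left ?_ (sq_nonneg _)
      rw [show (-(1 / 2) + ε) * ((2 : ℕ) : ℝ) = 2 * ε + -1 by push_cast; ring, rpow_add hip,
        rpow_neg_one]
      refine mul_le_mul_of_nonneg_right ?_ (by positivity)
      exact rpow_le_rpow hip.le (hi1.trans hn2) (by linarith)
    refine (sum_le_sum e1).trans ?_
    rw [← mul_sum, mul_assoc]
    refine mul_le_mul_of_nonneg_left (mul_le_mul_of_nonneg_left ?_ (by positivity)) (sq_nonneg _)
    have h1 := harmonic_le_one_add_log n
    rw [harmonic] at h1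
    push_cast at h1
    refine h1.trans ?_
    have : log (n : ℝ) ≤ log (2 * L) := log_le_log (by rw [hn]; positivity) hn2
    linarith
  have hJ3 : 0 ≤ 2 * J + 3 := by linarith
  rw [← Finset.sum_div, sum_add_distrib]
  nlinarith [mul_le_mul_of_nonneg_left hsq hJ3]

/-- Quadruples `(((y, z), x), w)` parametrising the coincidences `(x y) (z w) = (x z) (y w)`. -/
noncomputable def quadSet (N J : ℝ) : Finset (((ℕ × ℕ) × ℕ) × ℕ) :=
  open Classical in
  (((Ioc 0 ⌊N⌋₊ ×ˢ Ioc 0 ⌊N⌋₊) ×ˢ Ioc 0 ⌊N⌋₊) ×ˢ Ioc 0 ⌊N⌋₊).filter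
    fun q => q.1.2 ≤ q.2 ∧ (q.2 : ℝ) ≤ q.1.2 * exp J ∧ q.1.1.1 ≠ q.1.1.2 ∧
      (q.1.1.1 : ℝ) ≤ q.1.1.2 * exp J ∧ (q.1.1.2 : ℝ) ≤ q.1.1.1 * exp J ∧
      N * exp (-J) ≤ q.1.2 * q.1.1.1 * q.1.1.2 * q.2 ∧ (q.1.2 * q.1.1.1 * q.1.1.2 * q.2 : ℝ) ≤ N ∧
      q.1.1.1 * q.1.1.2 ≤ q.1.2 * q.2 ∧
      (q.1.2 ^ 2 * q.1.1.1 ^ 2 + q.2 ^ 2 * q.1.1.2 ^ 2).Prime ∧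
      (q.1.2 ^ 2 * q.1.1.2 ^ 2 + q.1.1.1 ^ 2 * q.2 ^ 2).Prime

theorem mem_quadSet {N J : ℝ} {x y z w : ℕ} : (((y, z), x), w) ∈ quadSet N J ↔
    (0 < x ∧ 0 < y ∧ 0 < z ∧ 0 < w) ∧ x ≤ w ∧ (w : ℝ) ≤ x * exp J ∧ y ≠ z ∧
      (y : ℝ) ≤ z * exp J ∧ (z : ℝ) ≤ y * exp J ∧
      N * exp (-J) ≤ x * y * z * w ∧ (x * y * z * w : ℝ) ≤ N ∧ y * z ≤ x * w ∧
      (x ^ 2 * y ^ 2 + w ^ 2 * z ^ 2).Prime ∧ (x ^ 2 * z ^ 2 + y ^ 2 * w ^ 2).Prime := by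
  classical
  unfold quadSet
  simp only [mem_filter, mem_product, mem_Ioc]
  constructor
  · rintro ⟨⟨⟨⟨⟨h1, -⟩, h2, -⟩, h3, -⟩, h4, -⟩, h⟩
    exact ⟨⟨h3, h1, h2, h4⟩, h⟩
  · rintro ⟨⟨hx, hy, hz, hw⟩, h⟩
    refine ⟨?_, h⟩
    have hN : x * y * z * w ≤ ⌊N⌋₊ := Nat.le_floor (by push_cast; exact h.2.2.2.2.2.2.1)
    have h1 : x ≤ x * y * z * w := Nat.le_of_dvd (by positivity) ⟨y * z * w, by ring⟩
    have h2 : y ≤ x * y * z * w := Nat.le_of_dvd (by positivity) ⟨x * z * w, by ring⟩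
    have h3 : z ≤ x * y * z * w := Nat.le_of_dvd (by positivity) ⟨x * y * w, by ring⟩
    have h4 : w ≤ x * y * z * w := Nat.le_of_dvd (by positivity) ⟨x * y * z, by ring⟩
    exact ⟨⟨⟨⟨hy, h2.trans hN⟩, hz, h3.trans hN⟩, hx, h1.trans hN⟩, hw, h4.trans hN⟩

theorem log_bounds_of_mem_quadSet {N J : ℝ} {x y z w : ℕ} (hN : 0 < N)
    (h : (((y, z), x), w) ∈ quadSet N J) :
    |log (y : ℝ) - log z| ≤ J ∧ log (y : ℝ) + log z ≤ log N / 2 ∧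
      (log N - log y - log z) / 2 - J ≤ log x ∧ log (x : ℝ) ≤ (log N - log y - log z) / 2 := by
  rw [mem_quadSet] at h
  obtain ⟨⟨hx, hy, hz, hw⟩, h1, h2, -, h3, h4, h5, h6, h7, -⟩ := h
  have hx' : (0 : ℝ) < x := by exact_mod_cast hx
  have hy' : (0 : ℝ) < y := by exact_mod_cast hy
  have hz' : (0 : ℝ) < z := by exact_mod_cast hz
  have hw' : (0 : ℝ) < w := by exact_mod_cast hw
  have k1 := log_le_log hx' (show (x : ℝ) ≤ w by exact_mod_cast h1)
  have k2 := log_le_log hw' h2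
  have k3 := log_le_log hy' h3
  have k4 := log_le_log hz' h4
  have k5 := log_le_log (by positivity) h5
  have k6 := log_le_log (by positivity) h6
  have k7 := log_le_log (by positivity) (show (y * z : ℝ) ≤ x * w by exact_mod_cast h7)
  rw [log_mul (by positivity) (by positivity), log_exp] at k2 k3 k4 k5
  rw [log_mul (by positivity) (by positivity), log_mul (by positivity) (by positivity),
    log_mul (by positivity) (by positivity)] at k5 k6
  rw [log_mul (by positivity) (by positivity), log_mul (by positivity) (by positivity)] at k7
  rw [abs_le]
  refine ⟨⟨?_, ?_⟩, ?_, ?_, ?_⟩ <;> linarith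

open ArithmeticFunction hiding log in
theorem eventually_sum_quadSet_le {ε : ℝ} (hε : 0 < ε) (hε1 : ε ≤ 1) : ∀ᶠ N : ℝ in atTop,
    ∑ q ∈ quadSet N (windowLog N), (1 / 2 : ℝ) ^ (cardFactors q.1.1.1 + cardFactors q.1.1.2 +
      cardFactors q.1.2 + cardFactors q.2) ≤ N * windowLog N ^ 2 * log N ^ (-3 + ε) := by
  obtain ⟨e, he⟩ : ∃ e, e = ε / 8 := ⟨_, rfl⟩
  have he0 : 0 < e := by rw [he]; positivity
  have he1 : e ≤ 1 / 4 := by rw [he]; linarith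
  obtain ⟨C, hC, hCs⟩ := exists_sum_half_pow_cardFactors_div_le he0 he1
  obtain ⟨W₀, hW₀⟩ := eventually_atTop.1 (eventually_sum_forms_prime_le he0)
  obtain ⟨K, hK⟩ : ∃ K : ℝ, K = 30 * C ^ 3 * (1 / 4 ^ (-(5 / 2) + e)) * (1 / 8 ^ (-(1 / 2) + e)) *
    2 ^ (2 * e) := ⟨_, rfl⟩
  have hK0 : 0 ≤ K := by rw [hK]; positivity
  have hev : ∀ᶠ L : ℝ in atTop, K * (1 + log (2 * L)) ≤ L ^ e := by
    have h1 := isLittleO_log_rpow_atTop he0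
    have h2 : ∀ᶠ L : ℝ in atTop, K * (1 + log 2) ≤ L ^ e / 2 :=
      ((tendsto_rpow_atTop he0).atTop_div_const (by norm_num)).eventually_ge_atTop _
    filter_upwards [h1.bound (show (0 : ℝ) < 1 / (2 * (K + 1)) by positivity), h2,
      eventually_ge_atTop 1] with L h1 h2 h3
    have h0 : 0 < L ^ e := rpow_pos_of_pos (by linarith) _
    rw [norm_of_nonneg (log_nonneg h3), norm_of_nonneg h0.le, div_mul_eq_mul_div, one_mul,
      le_div_iff₀ (by positivity)] at h1
    rw [log_mul (by norm_num) (by linarith)]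
    nlinarith [log_nonneg h3]
  filter_upwards [eventually_windowLog (show (0 : ℝ) < 1 / 8 by norm_num),
    tendsto_log_atTop.eventually hev,
    (tendsto_rpow_atTop (show (0 : ℝ) < 1 / 4 by norm_num)).eventually_ge_atTop (W₀ : ℝ),
    eventually_gt_atTop 0] with N hJ hKL hNW hN
  obtain ⟨hJ1, hJ2, hL, -⟩ := hJ
  obtain ⟨J, hJdef⟩ : ∃ J, J = windowLog N := ⟨_, rfl⟩
  obtain ⟨L, hLdef⟩ : ∃ L, L = log N := ⟨_, rfl⟩
  rw [← hJdef] at hJ1 hJ2 ⊢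
  rw [← hLdef] at hJ2 hL hKL ⊢
  have hCs' : ∀ (i : ℕ) (s : Finset ℕ), (∀ y ∈ s, 0 < y ∧ ⌊log y⌋₊ = i) →
      ∑ y ∈ s, omegaWeight y ≤ C * ((i : ℝ) + 1) ^ (-(1 / 2) + e) := by
    intro i s h
    have := hCs i s h
    rwa [neg_div] at this
  set I := Ioc 0 ⌊N⌋₊ with hI
  obtain ⟨B, hB⟩ : ∃ B : ℝ, B = 2 * N * (L / 4) ^ (-(5 / 2) + e) := ⟨_, rfl⟩
  have hB0 : 0 ≤ B := by rw [hB]; positivity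
  set A : ℕ × ℕ → ℝ := fun r => (L - log r.1 - log r.2) / 2 with hA
  set c1 : ℕ × ℕ → Prop := fun r => |log (r.1 : ℝ) - log r.2| ≤ J ∧ log (r.1 : ℝ) + log r.2 ≤ L / 2
    with hc1
  set c2 : (ℕ × ℕ) → ℕ → Prop := fun r x => A r - J ≤ log x ∧ log (x : ℝ) ≤ A r with hc2
  classical
  -- the innermost sum
  have step1 : ∀ r ∈ I ×ˢ I, ∀ x ∈ I, (∑ w ∈ I, if ((r, x), w) ∈ quadSet N J then
      (1 / 2 : ℝ) ^ (cardFactors r.1 + cardFactors r.2 + cardFactors x + cardFactors w) else 0) ≤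
      if c1 r then (if c2 r x then B * (omegaWeight r.1 * omegaWeight r.2) * omegaWeight x else 0)
        else 0 := by
    rintro ⟨y, z⟩ hr x hx
    rw [mem_product, hI, mem_Ioc, mem_Ioc] at hr
    rw [hI, mem_Ioc] at hx
    by_cases hex : ∃ w, (((y, z), x), w) ∈ quadSet N J
    swap
    · rw [sum_eq_zero fun w _ => if_neg fun h => hex ⟨w, h⟩]
      have := omegaWeight_nonneg y
      have := omegaWeight_nonneg z
      have := omegaWeight_nonneg x
      split_ifs <;> positivity
    obtain ⟨w₀, hw₀⟩ := hex
    obtain ⟨b1, b2, b3, b4⟩ := log_bounds_of_mem_quadSet hN hw₀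
    rw [← hLdef] at b2 b3 b4
    rw [if_pos ⟨b1, b2⟩, if_pos ⟨b3, b4⟩]
    have hyz := (mem_quadSet.1 hw₀).2.2.2.1
    have hx0 : (0 : ℝ) < x := by exact_mod_cast hx.1
    have hy0 : (0 : ℝ) < y := by exact_mod_cast hr.1.1
    have hz0 : (0 : ℝ) < z := by exact_mod_cast hr.2.1
    have hly : 0 ≤ log (y : ℝ) := log_nonneg (by exact_mod_cast hr.1.1)
    have hlz : 0 ≤ log (z : ℝ) := log_nonneg (by exact_mod_cast hr.2.1)
    have hq : 0 < N / (x * y * z) := by positivity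
    have hlq : L / 4 ≤ log (N / (x * y * z)) := by
      rw [log_div hN.ne' (by positivity), log_mul (by positivity) (by positivity),
        log_mul (by positivity) (by positivity), ← hLdef]
      linarith
    have hq1 : N ^ (1 / 4 : ℝ) ≤ N / (x * y * z) := by
      rw [rpow_def_of_pos hN, ← hLdef, ← le_log_iff_exp_le hq]
      linarith
    obtain ⟨W, hW⟩ : ∃ W, W = ⌊N / (x * y * z)⌋₊ + 1 := ⟨_, rfl⟩
    have hW1 : N / (x * y * z) ≤ W := by
      rw [hW]; push_cast; exact (Nat.lt_floor_add_one _).le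
    have hW2 : (W : ℝ) ≤ 2 * (N / (x * y * z)) := by
      rw [hW]; push_cast
      have := Nat.floor_le hq.le
      have : 1 ≤ N / (x * y * z) := by
        rw [← log_nonneg_iff hq]; linarith
      linarith
    have hlW : L / 4 ≤ log W := hlq.trans (log_le_log hq hW1)
    have hmain := hW₀ W (by exact_mod_cast (hNW.trans hq1).trans hW1) x y z hx.1 hr.1.1 hr.2.1 hyz
      (by linarith) (by linarith) (by linarith)
    have hle : (∑ w ∈ I, if (((y, z), x), w) ∈ quadSet N J then
        (1 / 2 : ℝ) ^ (cardFactors y + cardFactors z + cardFactors x + cardFactors w) else 0) ≤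
        (1 / 2 : ℝ) ^ (cardFactors y + cardFactors z + cardFactors x) *
        ∑ w ∈ range W with 0 < w ∧ (x ^ 2 * y ^ 2 + w ^ 2 * z ^ 2).Prime ∧
        (x ^ 2 * z ^ 2 + y ^ 2 * w ^ 2).Prime, (1 / 2 : ℝ) ^ cardFactors w := by
      rw [← sum_filter, mul_sum]
      simp only [pow_add _ _ (cardFactors _)]
      refine sum_le_sum_of_subset_of_nonneg (fun w hw => ?_) fun _ _ _ => by positivity
      rw [mem_filter, mem_quadSet] at hw
      obtain ⟨-, ⟨-, -, -, hw0⟩, -, -, -, -, -, -, h6, -, h7, h8⟩ := hw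
      rw [mem_filter, mem_range, hW]
      refine ⟨Nat.lt_succ_of_le (Nat.le_floor ?_), hw0, h7, h8⟩
      rw [le_div_iff₀ (by positivity)]
      linarith
    refine hle.trans ((mul_le_mul_of_nonneg_left hmain (by positivity)).trans ?_)
    have hpw : log (W : ℝ) ^ (-(5 / 2) + e) ≤ (L / 4) ^ (-(5 / 2) + e) :=
      rpow_le_rpow_of_nonpos (by linarith) hlW (by linarith)
    have hWp : (W : ℝ) * log W ^ (-(5 / 2) + e) ≤ 2 * (N / (x * y * z)) * (L / 4) ^ (-(5 / 2) + e) :=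
      mul_le_mul hW2 hpw (rpow_nonneg (by linarith) _) (by positivity)
    refine (mul_le_mul_of_nonneg_left hWp (by positivity)).trans (le_of_eq ?_)
    rw [hB, omegaWeight, omegaWeight, omegaWeight, pow_add, pow_add]
    field_simp
  have step2 : ∀ r ∈ I ×ˢ I, (∑ x ∈ I, if c1 r then (if c2 r x then
      B * (omegaWeight r.1 * omegaWeight r.2) * omegaWeight x else 0) else 0) ≤
      if c1 r then B * (C * (J + 2) * (L / 8) ^ (-(1 / 2) + e)) *
        (omegaWeight r.1 * omegaWeight r.2) else 0 := by
    intro r hr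
    split_ifs with h
    swap
    · simp
    rw [← sum_filter, ← mul_sum]
    have := sum_omegaWeight_window_le (A := A r) (J := J) (K := L / 8) he1 hC hCs' (by linarith)
      (by linarith) (by rw [hA]; dsimp only; linarith [h.2]) (I.filter (c2 r)) (fun x hx => by
        rw [mem_filter, hI, mem_Ioc] at hx
        exact ⟨hx.1.1, hx.2⟩)
    have hnn : 0 ≤ B * (omegaWeight r.1 * omegaWeight r.2) :=
      mul_nonneg hB0 (mul_nonneg (omegaWeight_nonneg _) (omegaWeight_nonneg _))
    refine (mul_le_mul_of_nonneg_left this hnn).trans (le_of_eq ?_)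
    ring
  have step3 : ∑ r ∈ I ×ˢ I with c1 r, omegaWeight r.1 * omegaWeight r.2 ≤
      C ^ 2 * (2 * J + 3) * ((2 * L) ^ (2 * e) * (1 + log (2 * L))) := by
    refine sum_omegaWeight_pairs_le he0 he1 hC hCs' (by linarith) (by linarith) _ fun r hr => ?_
    rw [mem_filter, mem_product, hI, mem_Ioc, mem_Ioc] at hr
    obtain ⟨⟨h1, h2⟩, h3, h4⟩ := hr
    have hly : 0 ≤ log (r.1 : ℝ) := log_nonneg (by exact_mod_cast h1.1)
    have hlz : 0 ≤ log (r.2 : ℝ) := log_nonneg (by exact_mod_cast h2.1)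
    exact ⟨h1.1, h2.1, by linarith, by linarith, h3⟩
  have hquad : quadSet N J = (((I ×ˢ I) ×ˢ I) ×ˢ I).filter (· ∈ quadSet N J) := by
    ext q
    rw [mem_filter]
    refine ⟨fun h => ⟨?_, h⟩, fun h => h.2⟩
    unfold quadSet at h
    exact (mem_filter.1 h).1
  rw [hquad, sum_filter, sum_product, sum_product]
  refine (sum_le_sum fun r hr => (sum_le_sum fun x hx => step1 r hr x hx).trans
    (step2 r hr)).trans ?_
  rw [← sum_filter, ← mul_sum]
  have hL0 : 0 < L := by linarith
  have hnn : 0 ≤ B * (C * (J + 2) * (L / 8) ^ (-(1 / 2) + e)) := by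
    positivity
  refine (mul_le_mul_of_nonneg_left step3 hnn).trans ?_
  have hJJ : (J + 2) * (2 * J + 3) ≤ 15 * J ^ 2 := by nlinarith
  rw [hB, div_rpow hL0.le (by norm_num), div_rpow hL0.le (by norm_num),
    mul_rpow (by norm_num) hL0.le]
  have hlog : 0 ≤ 1 + log (2 * L) := by
    have := log_nonneg (show 1 ≤ 2 * L by linarith); linarith
  have hexp : L ^ (-(5 / 2) + e) * L ^ (-(1 / 2) + e) * L ^ (2 * e) = L ^ (-3 + 4 * e) := by
    rw [← rpow_add hL0, ← rpow_add hL0]; ring_nf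
  have hexp2 : L ^ (-3 + 4 * e) * L ^ e ≤ L ^ (-3 + ε) := by
    rw [← rpow_add hL0]
    exact rpow_le_rpow_of_exponent_le (by linarith) (by rw [he]; linarith)
  calc _ = N * ((J + 2) * (2 * J + 3)) * L ^ (-3 + 4 * e) * (K / 15 * (1 + log (2 * L))) := by
        rw [hK, ← hexp]; ring
    _ ≤ N * (15 * J ^ 2) * L ^ (-3 + 4 * e) * (K / 15 * (1 + log (2 * L))) := by gcongr
    _ = N * J ^ 2 * (L ^ (-3 + 4 * e) * (K * (1 + log (2 * L)))) := by ring
    _ ≤ N * J ^ 2 * (L ^ (-3 + 4 * e) * L ^ e) := by gcongr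
    _ ≤ _ := by gcongr

theorem exists_mul_factorisation {a b c d : ℕ} (ha : 0 < a) (h : a * b = c * d) :
    ∃ x y z w : ℕ, a = x * y ∧ b = z * w ∧ c = x * z ∧ d = y * w := by
  obtain ⟨x, y, ⟨z, rfl⟩, ⟨w, rfl⟩, rfl⟩ :=
    exists_dvd_and_dvd_of_dvd_mul (show a ∣ c * d from ⟨b, h.symm⟩)
  refine ⟨x, y, z, w, rfl, ?_, rfl, rfl⟩
  exact Nat.eq_of_mul_eq_mul_left ha (by rw [h]; ring)

open ArithmeticFunction hiding log in
theorem exists_quad_of_collision {N J : ℝ} {a b c d : ℕ} (h1 : (a, b) ∈ pairSet N J)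
    (h2 : (c, d) ∈ pairSet N J) (hne : (a, b) ≠ (c, d)) (h : a * b = c * d) :
    ∃ x y z w : ℕ, (((y, z), x), w) ∈ quadSet N J ∧ x * y * z * w = a * b ∧
      (((a, b), (c, d)) = ((x * y, z * w), (x * z, y * w)) ∨
       ((a, b), (c, d)) = ((x * y, z * w), (y * w, x * z)) ∨
       ((a, b), (c, d)) = ((y * w, x * z), (x * y, z * w))) := by
  rw [mem_pairSet] at h1 h2
  obtain ⟨ha, hab, hab', hN1, hN2, hp⟩ := h1
  obtain ⟨hc, hcd, hcd', -, -, hp'⟩ := h2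
  obtain ⟨x, y, z, w, rfl, rfl, rfl, rfl⟩ := exists_mul_factorisation ha h
  have hx : 0 < x := Nat.pos_of_mul_pos_right ha
  have hy : 0 < y := Nat.pos_of_mul_pos_left ha
  have hz : 0 < z := Nat.pos_of_mul_pos_left hc
  have hw : 0 < w := by
    by_contra hw
    simp [Nat.eq_zero_of_not_pos hw] at hab
  have hz' : (0 : ℝ) < z := by exact_mod_cast hz
  have hw' : (0 : ℝ) < w := by exact_mod_cast hw
  push_cast at hab' hcd' hN1 hN2
  have hxw : x < w := by
    have : (y * z) * (x * x) < (y * z) * (w * w) := by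
      calc (y * z) * (x * x) = (x * y) * (x * z) := by ring
        _ < (z * w) * (y * w) := Nat.mul_lt_mul'' hab hcd
        _ = _ := by ring
    exact Nat.mul_self_lt_mul_self_iff.1 (Nat.lt_of_mul_lt_mul_left this)
  have hxw' : (x : ℝ) < w := by exact_mod_cast hxw
  have hwx : (w : ℝ) ≤ x * exp J := by
    have : (y * z) * ((w : ℝ) * w) ≤ (y * z) * ((x * exp J) * (x * exp J)) := by
      calc (y * z) * ((w : ℝ) * w) = (z * w) * (y * w) := by ring
        _ ≤ (x * y * exp J) * (x * z * exp J) := by gcongr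
        _ = _ := by ring
    exact abs_le_of_sq_le_sq' (by nlinarith [le_of_mul_le_mul_left this (by positivity)])
      (by positivity) |>.2
  have hyz : y ≠ z := by
    rintro rfl
    exact hne (by rw [mul_comm y w])
  have hyz1 : (y : ℝ) ≤ z * exp J := by
    have : (y : ℝ) * w ≤ (z * exp J) * w := by
      calc (y : ℝ) * w ≤ x * z * exp J := hcd'
        _ ≤ w * z * exp J := by gcongr
        _ = _ := by ring
    exact le_of_mul_le_mul_right this hw'
  have hzy1 : (z : ℝ) ≤ y * exp J := by
    have : (z : ℝ) * w ≤ (y * exp J) * w := by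
      calc (z : ℝ) * w ≤ x * y * exp J := hab'
        _ ≤ w * y * exp J := by gcongr
        _ = _ := by ring
    exact le_of_mul_le_mul_right this hw'
  have hJ1 : 1 ≤ exp J := by
    by_contra hlt
    push Not at hlt
    nlinarith
  have p1 : x ^ 2 * y ^ 2 + w ^ 2 * z ^ 2 = (x * y) ^ 2 + (z * w) ^ 2 := by ring
  have p2 : x ^ 2 * z ^ 2 + y ^ 2 * w ^ 2 = (x * z) ^ 2 + (y * w) ^ 2 := by ring
  rcases le_or_gt (y * z) (x * w) with hle | hgt
  · refine ⟨x, y, z, w, mem_quadSet.2 ⟨⟨hx, hy, hz, hw⟩, hxw.le, hwx, hyz, hyz1, hzy1, ?_, ?_, hle,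
      p1 ▸ hp, p2 ▸ hp'⟩, by ring, Or.inl rfl⟩
    · linarith
    · linarith
  · have hxE : (x : ℝ) ≤ w * exp J := by nlinarith
    rcases lt_or_gt_of_ne hyz with hlt | hlt
    · refine ⟨y, x, w, z, mem_quadSet.2 ⟨⟨hy, hx, hw, hz⟩, hlt.le, hzy1, hxw.ne, hxE, hwx, ?_, ?_,
        hgt.le, ?_, ?_⟩, by ring, Or.inr (Or.inl ?_)⟩
      · linarith
      · linarith
      · convert hp using 1; ring
      · convert hp' using 1; ring
      · refine Prod.ext (Prod.ext ?_ ?_) (Prod.ext ?_ ?_) <;> dsimp only <;> ring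
    · refine ⟨z, x, w, y, mem_quadSet.2 ⟨⟨hz, hx, hw, hy⟩, hlt.le, hyz1, hxw.ne, hxE, hwx, ?_, ?_,
        ?_, ?_, ?_⟩, by ring, Or.inr (Or.inr ?_)⟩
      · linarith
      · linarith
      · rw [mul_comm z y]; exact hgt.le
      · convert hp' using 1; ring
      · convert hp using 1; ring
      · refine Prod.ext (Prod.ext ?_ ?_) (Prod.ext ?_ ?_) <;> dsimp only <;> ring

open ArithmeticFunction hiding log in
theorem card_collisions_le {N J m : ℝ} {G : Finset (ℕ × ℕ)} (hG : G ⊆ pairSet N J)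
    (hm : ∀ z ∈ G, (cardFactors z.1 : ℝ) ≤ m ∧ (cardFactors z.2 : ℝ) ≤ m) :
    (((G ×ˢ G).filter fun r => r.1 ≠ r.2 ∧ r.1.1 * r.1.2 = r.2.1 * r.2.2).card : ℝ) ≤
      3 * (2 ^ (2 * m) * ∑ q ∈ quadSet N J, (1 / 2 : ℝ) ^ (cardFactors q.1.1.1 +
        cardFactors q.1.1.2 + cardFactors q.1.2 + cardFactors q.2)) := by
  classical
  set T := (quadSet N J).filter fun q => ((cardFactors q.1.1.1 +
        cardFactors q.1.1.2 + cardFactors q.1.2 + cardFactors q.2 : ℕ) : ℝ) ≤ 2 * m with hT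
  set φ₀ : ((ℕ × ℕ) × ℕ) × ℕ → (ℕ × ℕ) × (ℕ × ℕ) := fun q =>
    ((q.1.2 * q.1.1.1, q.1.1.2 * q.2), (q.1.2 * q.1.1.2, q.1.1.1 * q.2))
  set φ₁ : ((ℕ × ℕ) × ℕ) × ℕ → (ℕ × ℕ) × (ℕ × ℕ) := fun q =>
    ((q.1.2 * q.1.1.1, q.1.1.2 * q.2), (q.1.1.1 * q.2, q.1.2 * q.1.1.2))
  set φ₂ : ((ℕ × ℕ) × ℕ) × ℕ → (ℕ × ℕ) × (ℕ × ℕ) := fun q =>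
    ((q.1.1.1 * q.2, q.1.2 * q.1.1.2), (q.1.2 * q.1.1.1, q.1.1.2 * q.2))
  have hsub : ((G ×ˢ G).filter fun r => r.1 ≠ r.2 ∧ r.1.1 * r.1.2 = r.2.1 * r.2.2) ⊆
      T.image φ₀ ∪ (T.image φ₁ ∪ T.image φ₂) := by
    rintro ⟨⟨a, b⟩, c, d⟩ hr
    rw [mem_filter, mem_product] at hr
    obtain ⟨⟨h1, h2⟩, h3, h4⟩ := hr
    obtain ⟨x, y, z, w, hq, hprod, hcase⟩ := exists_quad_of_collision (hG h1) (hG h2) h3 h4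
    obtain ⟨hx, hy, hz, hw⟩ := (mem_quadSet.1 hq).1
    have hqT : (((y, z), x), w) ∈ T := by
      rw [hT, mem_filter]
      refine ⟨hq, ?_⟩
      have ha := (mem_pairSet.1 (hG h1)).1
      have hb := ha.trans (mem_pairSet.1 (hG h1)).2.1
      have : cardFactors y + cardFactors z + cardFactors x + cardFactors w =
          cardFactors a + cardFactors b := by
        rw [← cardFactors_mul ha.ne' hb.ne', ← hprod, cardFactors_mul (by positivity) hw.ne',
          cardFactors_mul (by positivity) hz.ne', cardFactors_mul hx.ne' hy.ne']
        ring
      dsimp only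
      rw [this]
      push_cast
      linarith [(hm _ h1).1, (hm _ h1).2]
    rw [mem_union, mem_union, mem_image, mem_image, mem_image]
    rcases hcase with h | h | h
    · exact Or.inl ⟨_, hqT, h.symm⟩
    · exact Or.inr (Or.inl ⟨_, hqT, h.symm⟩)
    · exact Or.inr (Or.inr ⟨_, hqT, h.symm⟩)
  have hcard : ((G ×ˢ G).filter fun r => r.1 ≠ r.2 ∧ r.1.1 * r.1.2 = r.2.1 * r.2.2).card ≤
      3 * T.card := by
    refine (card_le_card hsub).trans ((Finset.card_union_le _ _).trans ?_)
    have h0 := Finset.card_image_le (s := T) (f := φ₀)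
    have h1 := Finset.card_image_le (s := T) (f := φ₁)
    have h2 := Finset.card_image_le (s := T) (f := φ₂)
    have h3 := Finset.card_union_le (T.image φ₁) (T.image φ₂)
    linarith
  have hTc : (T.card : ℝ) ≤ 2 ^ (2 * m) * ∑ q ∈ quadSet N J, (1 / 2 : ℝ) ^ (cardFactors q.1.1.1 +
        cardFactors q.1.1.2 + cardFactors q.1.2 + cardFactors q.2) := by
    rw [mul_sum, Finset.card_eq_sum_ones]
    push_cast
    refine le_trans (sum_le_sum fun q hq => ?_)
      (sum_le_sum_of_subset_of_nonneg (filter_subset _ _) fun _ _ _ => by positivity)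
    rw [mem_filter] at hq
    rw [one_div, inv_pow, ← div_eq_mul_inv, le_div_iff₀ (by positivity), one_mul, ← rpow_natCast]
    exact rpow_le_rpow_of_exponent_le (by norm_num) hq.2
  calc _ ≤ ((3 * T.card : ℕ) : ℝ) := Nat.cast_le.2 hcard
    _ = 3 * (T.card : ℝ) := by push_cast; ring
    _ ≤ _ := mul_le_mul_of_nonneg_left hTc (by norm_num)

open ArithmeticFunction hiding log in
theorem eventually_card_collisions_le {ε : ℝ} (hε : 0 < ε) (hε1 : ε ≤ 1) : ∀ᶠ N : ℝ in atTop,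
    ∀ G ⊆ pairSet N (windowLog N), (∀ z ∈ G, (cardFactors z.1 : ℝ) ≤ (1 + ε) * log (log N) ∧
      (cardFactors z.2 : ℝ) ≤ (1 + ε) * log (log N)) →
      (((G ×ˢ G).filter fun r => r.1 ≠ r.2 ∧ r.1.1 * r.1.2 = r.2.1 * r.2.2).card : ℝ) ≤
        3 * (N * windowLog N ^ 2 * log N ^ (log 4 * (1 + ε) - 3 + ε)) := by
  filter_upwards [eventually_sum_quadSet_le hε hε1,
    tendsto_log_atTop.eventually_gt_atTop 0] with N h1 h3 G hG hm
  refine (card_collisions_le hG hm).trans (mul_le_mul_of_nonneg_left ?_ (by norm_num))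
  have e1 : (2 : ℝ) ^ (2 * ((1 + ε) * log (log N))) = log N ^ (log 4 * (1 + ε)) := by
    rw [rpow_def_of_pos two_pos, rpow_def_of_pos h3, show (4 : ℝ) = 2 ^ 2 by norm_num, log_pow]
    congr 1
    push_cast
    ring
  rw [e1]
  refine (mul_le_mul_of_nonneg_left h1 (by positivity)).trans (le_of_eq ?_)
  rw [show log 4 * (1 + ε) - 3 + ε = log 4 * (1 + ε) + (-3 + ε) by ring,
    rpow_add h3 (log 4 * (1 + ε)) (-3 + ε)]
  ring

theorem sq_card_le_card_image_mul {α β : Type*} [DecidableEq α] [DecidableEq β] (G : Finset α)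
    (f : α → β) : (G.card : ℝ) ^ 2 ≤ (G.image f).card *
      (G.card + ((G ×ˢ G).filter fun r => r.1 ≠ r.2 ∧ f r.1 = f r.2).card) := by
  have h1 : (G.card : ℝ) = ∑ n ∈ G.image f, ((G.filter fun x => f x = n).card : ℝ) := by
    exact_mod_cast Finset.card_eq_sum_card_image f G
  have h2 : ∑ n ∈ G.image f, ((G.filter fun x => f x = n).card : ℝ) ^ 2 =
      (((G ×ˢ G).filter fun r => f r.1 = f r.2).card : ℝ) := by
    rw [Finset.card_eq_sum_card_fiberwise (f := fun r => f r.1) (t := G.image f)]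
    · push_cast
      refine sum_congr rfl fun n _ => ?_
      rw [sq, ← Nat.cast_mul, ← Finset.card_product]
      congr 2
      ext r
      simp only [mem_product, mem_filter]
      constructor
      · rintro ⟨⟨h1, h2⟩, h3, h4⟩; exact ⟨⟨⟨h1, h3⟩, h2.trans h4.symm⟩, h2⟩
      · rintro ⟨⟨⟨h1, h2⟩, h3⟩, h4⟩; exact ⟨⟨h1, h4⟩, h2, h3 ▸ h4⟩
    · intro r hr
      simp only [Finset.coe_filter, mem_product, Set.mem_ofPred_eq] at hr
      exact Finset.mem_image_of_mem _ hr.1.1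
  have h3 : ((G ×ˢ G).filter fun r => f r.1 = f r.2).card ≤
      G.card + ((G ×ˢ G).filter fun r => r.1 ≠ r.2 ∧ f r.1 = f r.2).card := by
    have : ((G ×ˢ G).filter fun r => f r.1 = f r.2) ⊆
        G.diag ∪ ((G ×ˢ G).filter fun r => r.1 ≠ r.2 ∧ f r.1 = f r.2) := by
      intro r hr
      rw [mem_filter, mem_product] at hr
      rw [mem_union, Finset.mem_diag, mem_filter, mem_product]
      by_cases h : r.1 = r.2
      · exact Or.inl ⟨hr.1.1, h⟩
      · exact Or.inr ⟨hr.1, h, hr.2⟩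
    calc _ ≤ _ := card_le_card this
      _ ≤ _ := Finset.card_union_le _ _
      _ = _ := by rw [Finset.diag_card]
  have h4 := sq_sum_le_card_mul_sum_sq (s := G.image f)
    (f := fun n => ((G.filter fun x => f x = n).card : ℝ))
  rw [h2, ← h1] at h4
  refine h4.trans (mul_le_mul_of_nonneg_left ?_ (by positivity))
  exact_mod_cast h3

theorem card_image_mul_le_countC {N J : ℝ} {G : Finset (ℕ × ℕ)} (hG : G ⊆ pairSet N J) :
    (G.image fun z => z.1 * z.2).card ≤ countC N := by
  unfold countC
  rw [← Set.ncard_coe_finset]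
  refine Set.ncard_le_ncard ?_ ?_
  · rintro n hn
    rw [Finset.mem_coe, mem_image] at hn
    obtain ⟨⟨a, b⟩, hz, rfl⟩ := hn
    obtain ⟨h1, h2, -, h3, -, h4⟩ := mem_pairSet.1 (hG hz)
    exact ⟨by nlinarith, by push_cast; exact h3, a, b, h1, h1.trans h2, rfl, h4⟩
  · refine (Set.finite_Iic ⌊N⌋₊).subset ?_
    rintro n ⟨-, hn, -⟩
    exact Nat.le_floor hn

open ArithmeticFunction hiding log in
theorem countC_lower_bound {c : ℝ} (hc : 0 < c)
    (hE : ∀ᶠ N : ℝ in atTop, c * (N * windowLog N / log N) ≤ (pairSet N (windowLog N)).card)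
    {ε : ℝ} (hε : 0 < ε) :
    ∀ᶠ N : ℝ in atTop, N / log N ^ (log 4 - 1 + ε) ≤ (countC N : ℝ) := by
  obtain ⟨e, he⟩ : ∃ e, e = min (ε / 5) 1 := ⟨_, rfl⟩
  have he0 : 0 < e := by rw [he]; positivity
  have he1 : e ≤ 1 := by rw [he]; exact min_le_right _ _
  have hee : e ≤ ε / 5 := by rw [he]; exact min_le_left _ _
  have hl4 : log 4 = 2 * log 2 := by
    rw [show (4 : ℝ) = 2 ^ 2 by norm_num, log_pow]; norm_num
  have hl2 := Real.log_two_gt_d9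
  have hl2' := Real.log_two_lt_d9
  have ht : ∀ a b : ℝ, 0 < a → ∀ᶠ N : ℝ in atTop, b ≤ log N ^ a := fun a b ha =>
    ((tendsto_rpow_atTop ha).comp tendsto_log_atTop).eventually_ge_atTop b
  filter_upwards [hE, eventually_card_bad_pairs_le he0 he1, eventually_card_collisions_le he0 he1,
    ht (e ^ 2 / 32) (2 / c) (by positivity), ht (ε / 2) (24 / c ^ 2) (by positivity),
    ht (1 / 100) (4 / c) (by norm_num),
    tendsto_log_atTop.eventually_ge_atTop 1, eventually_gt_atTop 0]
    with N h1 h2 h3 h4 h5 h6 h7 h8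
  obtain ⟨L, hL⟩ : ∃ L, L = log N := ⟨_, rfl⟩
  obtain ⟨J, hJ⟩ : ∃ J, J = windowLog N := ⟨_, rfl⟩
  have hJ' : J = L ^ (2 / 3 : ℝ) := by rw [hJ, hL, windowLog]
  rw [← hJ] at h1 h2 h3
  simp only [← hL] at h1 h2 h3 h4 h5 h6 h7 ⊢
  have hL0 : 0 < L := by linarith
  have hJ0 : 0 < J := by rw [hJ']; positivity
  obtain ⟨B, hB⟩ : ∃ B, B = (pairSet N J).filter fun z => (1 + e) * log L < cardFactors z.1 ∨
    (1 + e) * log L < cardFactors z.2 := ⟨_, rfl⟩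
  rw [← hB] at h2
  obtain ⟨G, hG⟩ : ∃ G, G = pairSet N J \ B := ⟨_, rfl⟩
  have hGs : G ⊆ pairSet N J := by rw [hG]; exact Finset.sdiff_subset
  have hGc : ((pairSet N J).card : ℝ) ≤ G.card + B.card := by
    have := Finset.card_le_card_sdiff_add_card (s := pairSet N J) (t := B)
    rw [hG]
    exact_mod_cast this
  have hGm : ∀ z ∈ G, (cardFactors z.1 : ℝ) ≤ (1 + e) * log L ∧
      (cardFactors z.2 : ℝ) ≤ (1 + e) * log L := by
    intro z hz
    rw [hG, Finset.mem_sdiff, hB, mem_filter, not_and, not_or, not_lt, not_lt] at hz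
    exact hz.2 hz.1
  have hQ := h3 G hGs hGm
  have hCS := sq_card_le_card_image_mul G fun z : ℕ × ℕ => z.1 * z.2
  have himg : (((G.image fun z : ℕ × ℕ => z.1 * z.2).card : ℕ) : ℝ) ≤ countC N := by
    exact_mod_cast card_image_mul_le_countC hGs
  have hbad : (B.card : ℝ) ≤ c / 2 * (N * J / L) := by
    refine h2.trans ?_
    have : L ^ (-(e ^ 2 / 32)) ≤ c / 2 := by
      rw [rpow_neg hL0.le, inv_le_comm₀ (by positivity) (by positivity), inv_div]
      exact h4
    rw [mul_comm (c / 2)]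
    exact mul_le_mul_of_nonneg_left this (by positivity)
  obtain ⟨g, hg⟩ : ∃ g : ℝ, g = c / 2 * (N * J / L) := ⟨_, rfl⟩
  have hg0 : 0 < g := by rw [hg]; positivity
  have hGg : g ≤ G.card := by rw [hg]; linarith
  obtain ⟨X, hX⟩ : ∃ X, X = N / L ^ (log 4 - 1 + ε) := ⟨_, rfl⟩
  rw [← hX]
  have hX0 : 0 < X := by rw [hX]; positivity
  have hXg : X ≤ g / 2 := by
    have e1 : g / 2 = c / 4 * (N * L ^ (-(1 / 3) : ℝ)) := by
      rw [hg, hJ', show (-(1 / 3) : ℝ) = 2 / 3 - 1 by norm_num, rpow_sub_one hL0.ne']; ring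
    have e2 : X = N * (L ^ (-(1 / 3) : ℝ) * L ^ (-(log 4 - 4 / 3 + ε))) := by
      rw [hX, ← rpow_add hL0, div_eq_mul_inv, ← rpow_neg hL0.le]; ring_nf
    have e3 : L ^ (-(log 4 - 4 / 3 + ε)) ≤ c / 4 := by
      rw [rpow_neg hL0.le, inv_le_comm₀ (by positivity) (by positivity), inv_div]
      exact h6.trans (rpow_le_rpow_of_exponent_le h7 (by linarith))
    rw [e1, e2]
    calc _ ≤ N * (L ^ (-(1 / 3) : ℝ) * (c / 4)) := by gcongr
      _ = _ := by ring
  have hXQ : X * (3 * (N * J ^ 2 * L ^ (log 4 * (1 + e) - 3 + e))) ≤ g ^ 2 / 2 := by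
    have e1 : L ^ (log 4 * (1 + e) - 3 + e) / L ^ (log 4 - 1 + ε) * L ^ (2 : ℝ) ≤ c ^ 2 / 24 := by
      rw [← rpow_sub hL0, ← rpow_add hL0]
      calc _ ≤ L ^ (-(ε / 2)) := rpow_le_rpow_of_exponent_le h7 (by nlinarith)
        _ ≤ _ := by
          rw [rpow_neg hL0.le, inv_le_comm₀ (by positivity) (by positivity), inv_div]
          exact h5
    rw [rpow_two] at e1
    have e2 : g ^ 2 / 2 = 3 * N ^ 2 * J ^ 2 / L ^ 2 * (c ^ 2 / 24) := by
      rw [hg]; ring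
    rw [e2, hX]
    refine le_trans (le_of_eq ?_) (mul_le_mul_of_nonneg_left e1 (by positivity))
    field_simp
  by_contra hlt
  push Not at hlt
  have hlt' := himg.trans_lt hlt
  obtain ⟨Q, hQd⟩ : ∃ Q : ℝ, Q = (((G ×ˢ G).filter fun r => r.1 ≠ r.2 ∧
    r.1.1 * r.1.2 = r.2.1 * r.2.2).card : ℝ) := ⟨_, rfl⟩
  rw [← hQd] at hQ hCS
  have a1 : (G.card : ℝ) ^ 2 < X * (G.card + Q) := hCS.trans_lt
    (mul_lt_mul_of_pos_right hlt' (by linarith))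
  have a2 : X * G.card ≤ (G.card : ℝ) ^ 2 / 2 := by nlinarith
  have a3 : X * Q ≤ (G.card : ℝ) ^ 2 / 2 := by
    refine (mul_le_mul_of_nonneg_left hQ hX0.le).trans (hXQ.trans ?_)
    gcongr
  linarith

section

open MeasureTheory InnerProductGeometry

/-- The scale invariant measure `dA / |ζ|²`. -/
noncomputable def logArea : Measure ℂ :=
  volume.withDensity fun ζ => ENNReal.ofReal (1 / ‖ζ‖ ^ 2)

/-- The closed truncated sector of half-angle `α` around the direction `ω`. -/
def sectorSet (ω : ℂ) (α r₀ r₁ : ℝ) : Set ℂ :=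
  {ζ | r₀ ≤ ‖ζ‖ ∧ ‖ζ‖ ≤ r₁ ∧ angle ζ ω ≤ α}

theorem measurable_angle_left (ω : ℂ) : Measurable fun ζ : ℂ => angle ζ ω := by
  unfold InnerProductGeometry.angle
  fun_prop

theorem measurableSet_sectorSet (ω : ℂ) (α r₀ r₁ : ℝ) : MeasurableSet (sectorSet ω α r₀ r₁) := by
  have h : sectorSet ω α r₀ r₁ = {ζ | r₀ ≤ ‖ζ‖} ∩ ({ζ | ‖ζ‖ ≤ r₁} ∩ {ζ | angle ζ ω ≤ α}) := by
    ext; rfl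
  rw [h]
  exact (measurableSet_le measurable_const measurable_norm).inter
    ((measurableSet_le measurable_norm measurable_const).inter
      (measurableSet_le (measurable_angle_left ω) measurable_const))

theorem logArea_sectorSet_one {r₀ r₁ α : ℝ} (h0 : 0 < r₀) (h1 : r₀ ≤ r₁)
    (hα' : α ≤ π) :
    logArea (sectorSet 1 α r₀ r₁) = ENNReal.ofReal (2 * α * log (r₁ / r₀)) := by
  unfold logArea
  rw [withDensity_apply _ (measurableSet_sectorSet _ _ _ _),
    ← lintegral_indicator (measurableSet_sectorSet _ _ _ _),
    ← Complex.lintegral_comp_polarCoord_symm]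
  have hpolar : ∫⁻ p in polarCoord.target, ENNReal.ofReal p.1 •
      (sectorSet 1 α r₀ r₁).indicator (fun ζ => ENNReal.ofReal (1 / ‖ζ‖ ^ 2))
        (Complex.polarCoord.symm p) =
      ∫⁻ p in polarCoord.target, (Set.Icc r₀ r₁ ×ˢ Set.Icc (-α) α).indicator
        (fun p : ℝ × ℝ => ENNReal.ofReal (1 / p.1)) p := by
    refine setLIntegral_congr_fun polarCoord.open_target.measurableSet fun p hp => ?_
    obtain ⟨r, θ⟩ := p
    simp only [polarCoord_target, Set.mem_prod, Set.mem_Ioi, Set.mem_Ioo] at hp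
    have hr := hp.1
    have harg : Complex.arg (Complex.polarCoord.symm (r, θ)) = θ := by
      rw [Complex.polarCoord_symm_apply]
      have := Complex.arg_mul_cos_add_sin_mul_I hr ⟨hp.2.1, hp.2.2.le⟩
      push_cast
      exact this
    have hnorm : ‖Complex.polarCoord.symm (r, θ)‖ = r := by
      rw [Complex.norm_polarCoord_symm, abs_of_pos hr]
    have hne : Complex.polarCoord.symm (r, θ) ≠ 0 := by
      rw [← norm_ne_zero_iff, hnorm]; exact hr.ne'
    have hiff : Complex.polarCoord.symm (r, θ) ∈ sectorSet 1 α r₀ r₁ ↔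
        (r, θ) ∈ Set.Icc r₀ r₁ ×ˢ Set.Icc (-α) α := by
      simp only [sectorSet, Set.mem_ofPred_eq, hnorm, Complex.angle_one_right hne, harg,
        Set.mem_prod, Set.mem_Icc, abs_le, and_assoc]
    by_cases h : (r, θ) ∈ Set.Icc r₀ r₁ ×ˢ Set.Icc (-α) α
    · simp only [Set.indicator_of_mem (hiff.2 h), Set.indicator_of_mem h, hnorm, smul_eq_mul]
      rw [← ENNReal.ofReal_mul hr.le]
      congr 1
      field_simp
    · simp only [Set.indicator_of_notMem (fun h' => h (hiff.1 h')), Set.indicator_of_notMem h,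
        smul_zero]
  have hS : MeasurableSet (Set.Icc r₀ r₁ ×ˢ Set.Icc (-α) α) :=
    measurableSet_Icc.prod measurableSet_Icc
  rw [hpolar, lintegral_indicator hS, Measure.restrict_restrict hS, polarCoord_target,
    Set.prod_inter_prod]
  have e1 : Set.Icc r₀ r₁ ∩ Set.Ioi (0 : ℝ) = Set.Icc r₀ r₁ :=
    Set.inter_eq_left.2 fun x hx => h0.trans_le hx.1
  rw [e1, Measure.volume_eq_prod, ← Measure.prod_restrict, lintegral_prod _ (by fun_prop)]
  simp only [lintegral_const, Measure.restrict_apply_univ]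
  have e2 : volume (Set.Icc (-α) α ∩ Set.Ioo (-π) π) = ENNReal.ofReal (2 * α) := by
    apply le_antisymm
    · refine (measure_mono Set.inter_subset_left).trans ?_
      rw [Real.volume_Icc]; gcongr; linarith
    · have : Set.Ioo (-α) α ⊆ Set.Icc (-α) α ∩ Set.Ioo (-π) π :=
        fun x hx => ⟨⟨hx.1.le, hx.2.le⟩, by linarith [hx.1], by linarith [hx.2]⟩
      refine le_trans ?_ (measure_mono this)
      rw [Real.volume_Ioo]; gcongr; linarith
  rw [e2, lintegral_mul_const _ (by fun_prop), mul_comm (2 * α), ENNReal.ofReal_mul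
    (log_nonneg ((one_le_div h0).2 h1))]
  congr 1
  have hii : IntegrableOn (fun x : ℝ => 1 / x) (Set.Icc r₀ r₁) := by
    refine ContinuousOn.integrableOn_compact isCompact_Icc ?_
    exact continuousOn_const.div continuousOn_id fun x hx => (h0.trans_le hx.1).ne'
  rw [← ofReal_integral_eq_lintegral_ofReal hii]
  · rw [integral_Icc_eq_integral_Ioc, ← intervalIntegral.integral_of_le h1,
      integral_one_div_of_pos h0 (h0.trans_le h1)]
  · exact (ae_restrict_iff' measurableSet_Icc).2 (.of_forall fun x hx =>
      one_div_nonneg.2 (h0.le.trans hx.1))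

theorem logArea_sectorSet {ω : ℂ} (hω : ω ≠ 0) {r₀ r₁ α : ℝ} (h0 : 0 < r₀) (h1 : r₀ ≤ r₁)
    (hα' : α ≤ π) :
    logArea (sectorSet ω α r₀ r₁) = ENNReal.ofReal (2 * α * log (r₁ / r₀)) := by
  rw [← logArea_sectorSet_one h0 h1 hα']
  have hn : 0 < ‖ω‖ := norm_pos_iff.2 hω
  obtain ⟨u, hu⟩ : ∃ u : Circle, (u : ℂ) * ‖ω‖ = ω := by
    refine ⟨⟨ω / ‖ω‖, ?_⟩, ?_⟩
    · rw [Submonoid.unitSphere, ← SetLike.mem_coe]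
      simp only [Submonoid.coe_set_mk, Subsemigroup.coe_set_mk, mem_sphere_zero_iff_norm]
      rw [norm_div, Complex.norm_real, norm_norm, div_self hn.ne']
    · change ω / ‖ω‖ * ‖ω‖ = ω
      rw [div_mul_cancel₀]
      exact_mod_cast hn.ne'
  have hmp := (rotation u).measurePreserving
  have hpre : (rotation u) ⁻¹' sectorSet ω α r₀ r₁ = sectorSet 1 α r₀ r₁ := by
    ext ζ
    have : angle ((u : ℂ) * ζ) ω = angle ζ 1 := by
      conv_lhs => rw [← hu]
      rw [Complex.angle_mul_left (Circle.coe_ne_zero u)]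
      have := angle_smul_right_of_pos ζ (1 : ℂ) hn
      simpa using this
    simp only [sectorSet, Set.mem_preimage, Set.mem_ofPred_eq, LinearIsometryEquiv.norm_map]
    simp only [rotation_apply, this]
  unfold logArea
  rw [withDensity_apply _ (measurableSet_sectorSet _ _ _ _),
    withDensity_apply _ (measurableSet_sectorSet _ _ _ _), ← hpre,
    ← hmp.setLIntegral_comp_preimage (measurableSet_sectorSet _ _ _ _) (by fun_prop)]
  simp only [LinearIsometryEquiv.norm_map]

/-- The half-open unit square centred at a Gaussian integer. -/
def gtile (z : GaussianInt) : Set ℂ :=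
  {ζ | round ζ.re = z.re ∧ round ζ.im = z.im}

theorem measurableSet_gtile (z : GaussianInt) : MeasurableSet (gtile z) := by
  have h : gtile z = (fun ζ : ℂ => ⌊ζ.re + 1 / 2⌋) ⁻¹' {z.re} ∩
      (fun ζ : ℂ => ⌊ζ.im + 1 / 2⌋) ⁻¹' {z.im} := by
    ext ζ; simp [gtile, round_eq]
  rw [h]
  have h1 : Measurable fun ζ : ℂ => ⌊ζ.re + 1 / 2⌋ :=
    Int.measurable_floor.comp (Complex.measurable_re.add_const _)
  have h2 : Measurable fun ζ : ℂ => ⌊ζ.im + 1 / 2⌋ :=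
    Int.measurable_floor.comp (Complex.measurable_im.add_const _)
  exact (h1 (measurableSet_singleton _)).inter (h2 (measurableSet_singleton _))

theorem volume_gtile (z : GaussianInt) : volume (gtile z) = 1 := by
  have h : gtile z = Complex.measurableEquivRealProd ⁻¹'
      (Set.Ico (z.re - 1 / 2 : ℝ) (z.re + 1 / 2) ×ˢ Set.Ico (z.im - 1 / 2 : ℝ) (z.im + 1 / 2)) := by
    ext ζ
    simp only [gtile, round_eq, Set.mem_ofPred_eq, Set.mem_preimage,
      Complex.measurableEquivRealProd_apply, Set.mem_prod, Set.mem_Ico, Int.floor_eq_iff]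
    constructor <;> rintro ⟨⟨_, _⟩, _, _⟩ <;> refine ⟨⟨?_, ?_⟩, ?_, ?_⟩ <;> linarith
  rw [h, Complex.volume_preserving_equiv_real_prod.measure_preimage
    (measurableSet_Ico.prod measurableSet_Ico).nullMeasurableSet, Measure.volume_eq_prod,
    Measure.prod_prod, Real.volume_Ico, Real.volume_Ico]
  norm_num

theorem gtile_disjoint {z w : GaussianInt} (h : z ≠ w) : Disjoint (gtile z) (gtile w) := by
  rw [Set.disjoint_left]
  rintro ζ ⟨h1, h2⟩ ⟨h3, h4⟩
  exact h (Zsqrtd.ext (h1.symm.trans h3) (h2.symm.trans h4))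

theorem norm_sub_le_one_of_mem_gtile {z : GaussianInt} {ζ : ℂ} (h : ζ ∈ gtile z) :
    ‖ζ - z‖ ≤ 1 := by
  have h1 := abs_sub_round ζ.re
  have h2 := abs_sub_round ζ.im
  rw [h.1] at h1
  rw [h.2] at h2
  refine (Complex.norm_le_abs_re_add_abs_im _).trans ?_
  simp only [Complex.sub_re, Complex.sub_im, ← GaussianInt.intCast_re,
    ← GaussianInt.intCast_im]
  linarith

theorem exists_mem_gtile (ζ : ℂ) : ∃ z : GaussianInt, ζ ∈ gtile z :=
  ⟨⟨round ζ.re, round ζ.im⟩, rfl, rfl⟩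

theorem tile_upper (Z : Finset GaussianInt) (A : Set ℂ)
    (hA : ∀ z ∈ Z, ∀ ζ : ℂ, ‖ζ - z‖ ≤ 1 → ζ ∈ A) (hZ : ∀ z ∈ Z, 1 < ‖(z : ℂ)‖) :
    ENNReal.ofReal (∑ z ∈ Z, 1 / (‖(z : ℂ)‖ + 1) ^ 2) ≤ logArea A := by
  rw [ENNReal.ofReal_sum_of_nonneg fun z _ => by positivity]
  calc _ ≤ ∑ z ∈ Z, logArea (gtile z) := by
        refine sum_le_sum fun z hz => ?_
        unfold logArea
        rw [withDensity_apply _ (measurableSet_gtile z)]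
        have : ENNReal.ofReal (1 / (‖(z : ℂ)‖ + 1) ^ 2) =
            ∫⁻ _ in gtile z, ENNReal.ofReal (1 / (‖(z : ℂ)‖ + 1) ^ 2) := by
          rw [setLIntegral_const, volume_gtile, mul_one]
        rw [this]
        refine setLIntegral_mono (by fun_prop) fun ζ hζ => ENNReal.ofReal_le_ofReal ?_
        have h1 := norm_sub_le_one_of_mem_gtile hζ
        have h2 := norm_sub_norm_le ζ (z : ℂ)
        have h3 := norm_sub_norm_le (z : ℂ) ζ
        rw [norm_sub_rev] at h3
        have h4 := hZ z hz
        have h5 : 0 < ‖ζ‖ := by linarith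
        gcongr
        linarith
    _ = logArea (⋃ z ∈ Z, gtile z) :=
        (measure_biUnion_finset (fun z _ w _ h => gtile_disjoint h)
          fun z _ => measurableSet_gtile z).symm
    _ ≤ _ := measure_mono (Set.iUnion₂_subset fun z hz ζ hζ =>
        hA z hz ζ (norm_sub_le_one_of_mem_gtile hζ))

theorem tile_lower (Z : Finset GaussianInt) (A : Set ℂ)
    (hA : ∀ ζ ∈ A, ∀ z : GaussianInt, ‖ζ - z‖ ≤ 1 → z ∈ Z) (hZ : ∀ z ∈ Z, 1 < ‖(z : ℂ)‖) :
    logArea A ≤ ENNReal.ofReal (∑ z ∈ Z, 1 / (‖(z : ℂ)‖ - 1) ^ 2) := by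
  rw [ENNReal.ofReal_sum_of_nonneg fun z _ => by positivity]
  calc logArea A ≤ logArea (⋃ z ∈ Z, gtile z) := by
        refine measure_mono fun ζ hζ => ?_
        obtain ⟨z, hz⟩ := exists_mem_gtile ζ
        exact Set.mem_iUnion₂.2 ⟨z, hA ζ hζ z (norm_sub_le_one_of_mem_gtile hz), hz⟩
    _ ≤ ∑ z ∈ Z, logArea (gtile z) := measure_biUnion_finset_le _ _
    _ ≤ _ := by
        refine sum_le_sum fun z hz => ?_
        unfold logArea
        rw [withDensity_apply _ (measurableSet_gtile z)]
        have : ENNReal.ofReal (1 / (‖(z : ℂ)‖ - 1) ^ 2) =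
            ∫⁻ _ in gtile z, ENNReal.ofReal (1 / (‖(z : ℂ)‖ - 1) ^ 2) := by
          rw [setLIntegral_const, volume_gtile, mul_one]
        rw [this]
        refine setLIntegral_mono (by fun_prop) fun ζ hζ => ENNReal.ofReal_le_ofReal ?_
        have h1 := norm_sub_le_one_of_mem_gtile hζ
        have h3 := norm_sub_norm_le (z : ℂ) ζ
        rw [norm_sub_rev] at h3
        have h4 := hZ z hz
        gcongr
        linarith

theorem angle_le_of_norm_sub_le {ζ z : ℂ} {r : ℝ} (hr : 2 ≤ r) (hz : r ≤ ‖z‖)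
    (h : ‖ζ - z‖ ≤ 1) : angle ζ z ≤ 2 / r := by
  have hz0 : 0 < ‖z‖ := by linarith
  have hz' : z ≠ 0 := norm_pos_iff.1 hz0
  have hζ' : ζ ≠ 0 := by
    rintro rfl
    rw [zero_sub, norm_neg] at h
    linarith
  obtain ⟨w, hw⟩ : ∃ w, w = (ζ - z) / z := ⟨_, rfl⟩
  have e : ζ / z = 1 + w := by rw [hw]; field_simp; ring
  have hwn : ‖w‖ ≤ 1 / r := by rw [hw, norm_div]; gcongr
  have hw2 : ‖w‖ ≤ 1 / 2 := hwn.trans (by gcongr)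
  rw [Complex.angle_eq_abs_arg hζ' hz', e, ← Complex.log_im]
  refine (Complex.abs_im_le_norm _).trans
    ((Complex.norm_log_one_add_half_le_self hw2).trans ?_)
  calc 3 / 2 * ‖w‖ ≤ 2 * (1 / r) := by gcongr; norm_num
    _ = 2 / r := by ring

/-- The norm of a Gaussian integer, as a real number. -/
noncomputable def nrm (z : GaussianInt) : ℝ := (z.norm : ℝ)

/-- The logarithm of the norm of a Gaussian integer. -/
noncomputable def ell (z : GaussianInt) : ℝ := log (nrm z)

theorem nrm_eq_norm_sq (z : GaussianInt) : nrm z = ‖(z : ℂ)‖ ^ 2 := by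
  rw [nrm, GaussianInt.intCast_real_norm, Complex.normSq_eq_norm_sq]

theorem nrm_mul (z w : GaussianInt) : nrm (z * w) = nrm z * nrm w := by
  simp [nrm, Zsqrtd.norm_mul]

theorem one_le_nrm {z : GaussianInt} (h : z ≠ 0) : 1 ≤ nrm z := by
  have := GaussianInt.norm_pos.2 h
  unfold nrm
  exact_mod_cast this

theorem nrm_pos {z : GaussianInt} (h : z ≠ 0) : 0 < nrm z := one_pos.trans_le (one_le_nrm h)

theorem nrm_nonneg (z : GaussianInt) : 0 ≤ nrm z := by
  rw [nrm_eq_norm_sq]; positivity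

theorem ell_nonneg (z : GaussianInt) : 0 ≤ ell z := by
  by_cases h : z = 0
  · simp [h, ell, nrm]
  · exact log_nonneg (one_le_nrm h)

theorem ell_mul {z w : GaussianInt} (hz : z ≠ 0) (hw : w ≠ 0) : ell (z * w) = ell z + ell w := by
  rw [ell, nrm_mul, log_mul (nrm_pos hz).ne' (nrm_pos hw).ne', ell, ell]

theorem exp_ell {z : GaussianInt} (hz : z ≠ 0) : exp (ell z) = nrm z := exp_log (nrm_pos hz)

theorem norm_eq_exp_ell {z : GaussianInt} (hz : z ≠ 0) : ‖(z : ℂ)‖ = exp (ell z / 2) := by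
  have h : (exp (ell z / 2)) ^ 2 = ‖(z : ℂ)‖ ^ 2 := by
    rw [← nrm_eq_norm_sq, ← exp_ell hz, ← exp_nat_mul]; congr 1; push_cast; ring
  exact ((sq_eq_sq₀ (exp_pos _).le (norm_nonneg _)).1 h).symm

theorem finite_ell_le (X : ℝ) : {z : GaussianInt | z ≠ 0 ∧ ell z ≤ X}.Finite := by
  obtain ⟨M, hM⟩ := exists_nat_ge (exp X)
  have hf : (Set.Icc (-(M : ℤ)) M ×ˢ Set.Icc (-(M : ℤ)) M).Finite :=
    (Set.finite_Icc _ _).prod (Set.finite_Icc _ _)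
  refine Set.Finite.subset (hf.image fun p : ℤ × ℤ => (⟨p.1, p.2⟩ : GaussianInt)) ?_
  rintro z ⟨h0, hz⟩
  have h1 : z.norm ≤ M := by
    have : nrm z ≤ M := by rw [← exp_ell h0]; exact (exp_le_exp.2 hz).trans hM
    unfold nrm at this
    exact_mod_cast this
  have h2 : z.norm = z.re * z.re + z.im * z.im := by rw [Zsqrtd.norm]; ring
  refine ⟨(z.re, z.im), ⟨⟨?_, ?_⟩, ?_, ?_⟩, rfl⟩ <;> nlinarith [Int.le_self_sq z.re, Int.le_self_sq z.im,
    Int.le_self_sq (-z.re), Int.le_self_sq (-z.im)]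

/-- The nonzero Gaussian integers of log-norm at most `X`. -/
noncomputable def gball (X : ℝ) : Finset GaussianInt := (finite_ell_le X).toFinset

theorem mem_gball {X : ℝ} {z : GaussianInt} : z ∈ gball X ↔ z ≠ 0 ∧ ell z ≤ X := by
  simp [gball]

open Classical in
/-- The Gaussian integers in a closed truncated sector. -/
noncomputable def gsector (ω : ℂ) (α u₀ u₁ : ℝ) : Finset GaussianInt :=
  {z ∈ gball u₁ | u₀ ≤ ell z ∧ angle (z : ℂ) ω ≤ α}

theorem mem_gsector {ω : ℂ} {α u₀ u₁ : ℝ} {z : GaussianInt} : z ∈ gsector ω α u₀ u₁ ↔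
    z ≠ 0 ∧ u₀ ≤ ell z ∧ ell z ≤ u₁ ∧ angle (z : ℂ) ω ≤ α := by
  simp only [gsector, mem_filter, mem_gball]; tauto

theorem sum_gsector_le {ω : ℂ} (hω : ω ≠ 0) {α u₀ u₁ : ℝ} (hα : 0 ≤ α) (hα' : α ≤ π)
    (hu : u₀ ≤ u₁) (h20 : 20 ≤ exp (u₀ / 2)) :
    ∑ z ∈ gsector ω α u₀ u₁, 1 / nrm z ≤
      α * (u₁ - u₀) + 100 * (exp (-u₀ / 2) * (1 + (u₁ - u₀))) := by
  obtain ⟨r₀, hr₀⟩ : ∃ r, r = exp (u₀ / 2) := ⟨_, rfl⟩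
  obtain ⟨r₁, hr₁⟩ : ∃ r, r = exp (u₁ / 2) := ⟨_, rfl⟩
  obtain ⟨ρ, hρ⟩ : ∃ r, r = exp (-u₀ / 2) := ⟨_, rfl⟩
  obtain ⟨Δ, hΔ⟩ : ∃ r, r = u₁ - u₀ := ⟨_, rfl⟩
  have hρr : ρ * r₀ = 1 := by rw [hρ, hr₀, ← exp_add]; simp; ring
  rw [← hr₀] at h20
  have hρe : ρ = 1 / r₀ := by field_simp; exact hρr
  have hρ0 : 0 < ρ := hρ ▸ exp_pos _
  have hρ1 : ρ ≤ 1 / 20 := by rw [hρe]; gcongr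
  have hr01 : r₀ ≤ r₁ := by rw [hr₀, hr₁]; gcongr
  have hΔ0 : 0 ≤ Δ := by rw [hΔ]; linarith
  rw [← hΔ, ← hρ]
  have hmem : ∀ z ∈ gsector ω α u₀ u₁, r₀ ≤ ‖(z : ℂ)‖ ∧ ‖(z : ℂ)‖ ≤ r₁ := by
    intro z hz
    rw [mem_gsector] at hz
    rw [norm_eq_exp_ell hz.1, hr₀, hr₁]
    exact ⟨exp_le_exp.2 (by linarith [hz.2.1]), exp_le_exp.2 (by linarith [hz.2.2.1])⟩
  have key := tile_upper (gsector ω α u₀ u₁) (sectorSet ω (min (α + 2 * ρ) π) (r₀ - 1) (r₁ + 1))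
    (fun z hz ζ hζ => by
      obtain ⟨h1, h2⟩ := hmem z hz
      have h3 := norm_sub_norm_le ζ (z : ℂ)
      have h4 := norm_sub_norm_le (z : ℂ) ζ
      rw [norm_sub_rev] at h4
      refine ⟨by linarith, by linarith, le_min ?_ (angle_le_pi _ _)⟩
      have h5 := angle_le_of_norm_sub_le (by linarith : 2 ≤ r₀) h1 hζ
      have h6 := angle_le_angle_add_angle ζ (z : ℂ) ω
      have h7 := (mem_gsector.1 hz).2.2.2
      have : 2 / r₀ = 2 * ρ := by rw [hρe]; ring
      linarith)
    (fun z hz => by linarith [(hmem z hz).1])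
  rw [logArea_sectorSet hω (by linarith) (by linarith) (min_le_right _ _)] at key
  have hlog : log ((r₁ + 1) / (r₀ - 1)) ≤ Δ / 2 + 3 * ρ := by
    have e : (r₁ + 1) / (r₀ - 1) ≤ exp (Δ / 2) * (1 + ρ) / (1 - ρ) := by
      have e1 : exp (Δ / 2) * r₀ = r₁ := by rw [hr₀, hr₁, hΔ, ← exp_add]; ring_nf
      have e2 : r₁ + 1 ≤ exp (Δ / 2) * (1 + ρ) * r₀ := by
        nlinarith
      rw [div_le_div_iff₀ (by linarith) (by linarith)]
      have : (1 - ρ) * r₀ = r₀ - 1 := by linarith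
      rw [← this]
      nlinarith
    refine (log_le_log (div_pos (by linarith) (by linarith)) e).trans ?_
    have hpos : 0 < exp (Δ / 2) * (1 + ρ) / (1 - ρ) :=
      div_pos (by positivity) (by linarith)
    rw [log_le_iff_le_exp hpos]
    rw [div_le_iff₀ (by linarith), exp_add, mul_assoc]
    gcongr
    have := add_one_le_exp (3 * ρ)
    nlinarith
  have hnn : 0 ≤ 2 * min (α + 2 * ρ) π * log ((r₁ + 1) / (r₀ - 1)) :=
    mul_nonneg (mul_nonneg (by norm_num) (le_min (by linarith) pi_pos.le))
      (log_nonneg (by rw [one_le_div (by linarith)]; linarith))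
  rw [ENNReal.ofReal_le_ofReal_iff hnn] at key
  have h3 : 2 * min (α + 2 * ρ) π * log ((r₁ + 1) / (r₀ - 1)) ≤ (α + 2 * ρ) * (Δ + 6 * ρ) := by
    calc _ ≤ 2 * (α + 2 * ρ) * (Δ / 2 + 3 * ρ) := by
          gcongr
          · exact log_nonneg (by rw [one_le_div (by linarith)]; linarith)
          · exact min_le_left _ _
      _ = _ := by ring
  have h4 : ∑ z ∈ gsector ω α u₀ u₁, 1 / nrm z ≤
      (1 + ρ) ^ 2 * ∑ z ∈ gsector ω α u₀ u₁, 1 / (‖(z : ℂ)‖ + 1) ^ 2 := by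
    rw [mul_sum]
    refine sum_le_sum fun z hz => ?_
    have h5 := (hmem z hz).1
    rw [nrm_eq_norm_sq, mul_one_div, div_le_div_iff₀ (pow_pos (by linarith) 2) (by positivity),
      one_mul, ← mul_pow]
    gcongr
    nlinarith
  have hπ := pi_lt_four
  calc _ ≤ (1 + ρ) ^ 2 * ((α + 2 * ρ) * (Δ + 6 * ρ)) := h4.trans (by gcongr; exact key.trans h3)
    _ ≤ (1 + 3 * ρ) * ((α + 2 * ρ) * (Δ + 6 * ρ)) := by gcongr; nlinarith
    _ ≤ _ := by
      have a1 : (α + 2 * ρ) * (Δ + 6 * ρ) ≤ α * Δ + ρ * (2 * Δ + 30) := by nlinarith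
      have a2 : (α + 2 * ρ) * (Δ + 6 * ρ) ≤ 5 * (Δ + 1) := by
        apply mul_le_mul <;> nlinarith
      nlinarith

theorem le_sum_gsector {ω : ℂ} (hω : ω ≠ 0) {α u₀ u₁ : ℝ} (hα' : α ≤ π)
    (hu : u₀ ≤ u₁) (h20 : 20 ≤ exp (u₀ / 2)) :
    α * (u₁ - u₀) - 100 * (exp (-u₀ / 2) * (1 + (u₁ - u₀))) ≤
      ∑ z ∈ gsector ω α u₀ u₁, 1 / nrm z := by
  obtain ⟨r₀, hr₀⟩ : ∃ r, r = exp (u₀ / 2) := ⟨_, rfl⟩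
  obtain ⟨r₁, hr₁⟩ : ∃ r, r = exp (u₁ / 2) := ⟨_, rfl⟩
  obtain ⟨ρ, hρ⟩ : ∃ r, r = exp (-u₀ / 2) := ⟨_, rfl⟩
  obtain ⟨Δ, hΔ⟩ : ∃ r, r = u₁ - u₀ := ⟨_, rfl⟩
  have hρr : ρ * r₀ = 1 := by rw [hρ, hr₀, ← exp_add]; simp; ring
  rw [← hr₀] at h20
  have hρe : ρ = 1 / r₀ := by field_simp; exact hρr
  have hρ0 : 0 < ρ := hρ ▸ exp_pos _
  have hρ1 : ρ ≤ 1 / 20 := by rw [hρe]; gcongr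
  rw [← hΔ, ← hρ]
  have hsum0 : 0 ≤ ∑ z ∈ gsector ω α u₀ u₁, 1 / nrm z :=
    sum_nonneg fun z _ => one_div_nonneg.2 (nrm_nonneg z)
  have hπ := pi_lt_four
  by_cases hαρ : α < 2 * ρ
  · nlinarith
  by_cases hΔρ : Δ < 6 * ρ
  · nlinarith
  push Not at hαρ hΔρ
  have e1 : exp (Δ / 2) * r₀ = r₁ := by rw [hr₀, hr₁, hΔ, ← exp_add]; ring_nf
  have hr13 : r₀ + 3 ≤ r₁ := by
    have := add_one_le_exp (Δ / 2)
    rw [← e1]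
    nlinarith
  have hmem : ∀ z ∈ gsector ω α u₀ u₁, r₀ ≤ ‖(z : ℂ)‖ := by
    intro z hz
    rw [mem_gsector] at hz
    rw [norm_eq_exp_ell hz.1, hr₀]
    exact exp_le_exp.2 (by linarith [hz.2.1])
  have key := tile_lower (gsector ω α u₀ u₁) (sectorSet ω (α - 2 * ρ) (r₀ + 1) (r₁ - 1))
    (fun ζ hζ z hz => by
      obtain ⟨h1, h2, h3⟩ := hζ
      have h4 := norm_sub_norm_le ζ (z : ℂ)
      have h5 := norm_sub_norm_le (z : ℂ) ζ
      rw [norm_sub_rev] at h5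
      have hz0 : z ≠ 0 := by
        rintro rfl
        simp only [GaussianInt.toComplex_zero, norm_zero, sub_zero] at h4 hz
        linarith
      have h8 := norm_eq_exp_ell hz0
      rw [mem_gsector]
      refine ⟨hz0, ?_, ?_, ?_⟩
      · have : exp (u₀ / 2) ≤ exp (ell z / 2) := by rw [← h8, ← hr₀]; linarith
        linarith [exp_le_exp.1 this]
      · have : exp (ell z / 2) ≤ exp (u₁ / 2) := by rw [← h8, ← hr₁]; linarith
        linarith [exp_le_exp.1 this]
      · have h5 := angle_le_of_norm_sub_le (by linarith : 2 ≤ r₀) (by linarith) hz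
        have h6 := angle_le_angle_add_angle (z : ℂ) ζ ω
        rw [angle_comm (z : ℂ) ζ] at h6
        have : 2 / r₀ = 2 * ρ := by rw [hρe]; ring
        linarith)
    (fun z hz => by linarith [hmem z hz])
  rw [logArea_sectorSet hω (by linarith) (by linarith) (by linarith)] at key
  have hlog : Δ / 2 - 3 * ρ ≤ log ((r₁ - 1) / (r₀ + 1)) := by
    rw [le_log_iff_exp_le (div_pos (by linarith) (by linarith)), le_div_iff₀ (by linarith)]
    have h1 : exp (Δ / 2 - 3 * ρ) * (1 + 3 * ρ) ≤ exp (Δ / 2) := by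
      have := add_one_le_exp (3 * ρ)
      calc _ ≤ exp (Δ / 2 - 3 * ρ) * exp (3 * ρ) := by gcongr; linarith
        _ = _ := by rw [← exp_add]; ring_nf
    have h2 : 1 ≤ exp (Δ / 2 - 3 * ρ) := one_le_exp (by linarith)
    nlinarith
  have hnn : 0 ≤ ∑ z ∈ gsector ω α u₀ u₁, 1 / (‖(z : ℂ)‖ - 1) ^ 2 :=
    sum_nonneg fun z _ => by positivity
  rw [ENNReal.ofReal_le_ofReal_iff hnn] at key
  have h3 : (α - 2 * ρ) * (Δ - 6 * ρ) ≤ 2 * (α - 2 * ρ) * log ((r₁ - 1) / (r₀ + 1)) := by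
    calc (α - 2 * ρ) * (Δ - 6 * ρ) = 2 * (α - 2 * ρ) * (Δ / 2 - 3 * ρ) := by ring
      _ ≤ _ := by
          apply mul_le_mul_of_nonneg_left hlog; linarith
  have h4 : (1 - ρ) ^ 2 * ∑ z ∈ gsector ω α u₀ u₁, 1 / (‖(z : ℂ)‖ - 1) ^ 2 ≤
      ∑ z ∈ gsector ω α u₀ u₁, 1 / nrm z := by
    rw [mul_sum]
    refine sum_le_sum fun z hz => ?_
    have h5 := hmem z hz
    rw [nrm_eq_norm_sq, mul_one_div, div_le_div_iff₀ (pow_pos (by linarith) 2) (pow_pos (by linarith) 2),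
      one_mul, ← mul_pow]
    refine pow_le_pow_left₀ (mul_nonneg (by linarith) (norm_nonneg _)) ?_ 2
    nlinarith
  have h5 : (1 - 2 * ρ) * ((α - 2 * ρ) * (Δ - 6 * ρ)) ≤ ∑ z ∈ gsector ω α u₀ u₁, 1 / nrm z := by
    refine le_trans ?_ h4
    apply mul_le_mul (by nlinarith) (h3.trans key) (mul_nonneg (by linarith) (by linarith))
      (by positivity)
  refine le_trans ?_ h5
  have a1 : α * Δ - ρ * (2 * Δ + 24) ≤ (α - 2 * ρ) * (Δ - 6 * ρ) := by nlinarith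
  have a2 : (α - 2 * ρ) * (Δ - 6 * ρ) ≤ 4 * Δ := by
    apply mul_le_mul <;> linarith
  nlinarith

theorem abs_sum_gsector_sub_le {ω : ℂ} (hω : ω ≠ 0) {α u₀ u₁ : ℝ} (hα : 0 ≤ α) (hα' : α ≤ π)
    (hu : u₀ ≤ u₁) (h20 : 20 ≤ exp (u₀ / 2)) :
    |∑ z ∈ gsector ω α u₀ u₁, 1 / nrm z - α * (u₁ - u₀)| ≤
      100 * (exp (-u₀ / 2) * (1 + (u₁ - u₀))) := by
  rw [abs_le]
  constructor
  · linarith [le_sum_gsector hω hα' hu h20]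
  · linarith [sum_gsector_le hω hα hα' hu h20]

open Classical in
theorem abs_sum_gsector_dvd_sub_le {ω : ℂ} (hω : ω ≠ 0) {α u₀ u₁ : ℝ} (hα : 0 ≤ α)
    (hα' : α ≤ π) (hu : u₀ ≤ u₁) {d : GaussianInt} (hd : d ≠ 0) (hdu : ell d + 6 ≤ u₀) :
    |∑ z ∈ gsector ω α u₀ u₁ with d ∣ z, 1 / nrm z - α * (u₁ - u₀) / nrm d| ≤
      100 * (exp ((ell d - u₀) / 2) * (1 + (u₁ - u₀))) / nrm d := by
  have hdc : (d : ℂ) ≠ 0 := by rwa [Ne, GaussianInt.toComplex_eq_zero]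
  have hang : ∀ w : GaussianInt, angle ((d * w : GaussianInt) : ℂ) ω = angle (w : ℂ) (ω / d) := by
    intro w
    rw [GaussianInt.toComplex_mul]
    conv_lhs => rw [← mul_div_cancel₀ ω hdc]
    rw [Complex.angle_mul_left hdc]
  have hsum : ∑ z ∈ gsector ω α u₀ u₁ with d ∣ z, 1 / nrm z =
      (∑ w ∈ gsector (ω / d) α (u₀ - ell d) (u₁ - ell d), 1 / nrm w) / nrm d := by
    rw [Finset.sum_div]
    symm
    refine sum_bij (fun w _ => d * w) ?_ ?_ ?_ ?_
    · intro w hw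
      rw [mem_gsector] at hw
      rw [mem_filter, mem_gsector, hang, ell_mul hd hw.1]
      exact ⟨⟨mul_ne_zero hd hw.1, by linarith, by linarith, hw.2.2.2⟩, dvd_mul_right _ _⟩
    · intro w _ w' _ h
      exact mul_left_cancel₀ hd h
    · intro z hz
      rw [mem_filter] at hz
      obtain ⟨w, rfl⟩ := hz.2
      have h1 := mem_gsector.1 hz.1
      have hw : w ≠ 0 := right_ne_zero_of_mul h1.1
      rw [hang, ell_mul hd hw] at h1
      exact ⟨w, mem_gsector.2 ⟨hw, by linarith, by linarith, h1.2.2.2⟩, rfl⟩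
    · intro w _
      rw [nrm_mul, div_div, mul_comm (nrm w)]
  have h20 : 20 ≤ exp ((u₀ - ell d) / 2) := by
    have h3 : exp 3 ≤ exp ((u₀ - ell d) / 2) := exp_le_exp.2 (by linarith)
    refine le_trans ?_ h3
    have : exp 3 = exp 1 ^ 3 := by rw [← exp_nat_mul]; norm_num
    rw [this]
    have h1 := exp_one_gt_d9
    have h2 : (2.718 : ℝ) ^ 3 ≤ exp 1 ^ 3 := by gcongr; linarith
    norm_num at h2 ⊢
    linarith
  have key := abs_sum_gsector_sub_le (div_ne_zero hω hdc) hα hα'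
    (by linarith : u₀ - ell d ≤ u₁ - ell d) h20
  rw [hsum, ← sub_div, abs_div, abs_of_pos (nrm_pos hd)]
  apply div_le_div_of_nonneg_right _ (nrm_pos hd).le
  have e1 : u₁ - ell d - (u₀ - ell d) = u₁ - u₀ := by ring
  have e2 : -(u₀ - ell d) / 2 = (ell d - u₀) / 2 := by ring
  rwa [e1, e2] at key

end

theorem gaussianInt_isUnit_cases {u : GaussianInt} (h : IsUnit u) :
    u = ⟨1, 0⟩ ∨ u = ⟨-1, 0⟩ ∨ u = ⟨0, 1⟩ ∨ u = ⟨0, -1⟩ := by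
  have h1 : u.norm = 1 := (Zsqrtd.norm_eq_one_iff' (by norm_num) u).2 h
  obtain ⟨a, b⟩ := u
  have h2 : a * a + b * b = 1 := by
    simp only [Zsqrtd.norm] at h1; linarith
  have ha : -1 ≤ a ∧ a ≤ 1 := by constructor <;> nlinarith
  have hb : -1 ≤ b ∧ b ≤ 1 := by constructor <;> nlinarith
  obtain ⟨ha1, ha2⟩ := ha
  obtain ⟨hb1, hb2⟩ := hb
  interval_cases a <;> interval_cases b <;> simp_all

/-- The Gaussian primes in the first quadrant: one for each class of associates. -/
def GCan (p : GaussianInt) : Prop := Prime p ∧ 0 < p.re ∧ 0 ≤ p.im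

theorem exists_quadrant {z : GaussianInt} (hz : z ≠ 0) :
    ∃ w, Associated z w ∧ 0 < w.re ∧ 0 ≤ w.im := by
  have hi : IsUnit (⟨0, 1⟩ : GaussianInt) :=
    (Zsqrtd.norm_eq_one_iff' (by norm_num) _).1 (by simp [Zsqrtd.norm])
  have hi' : IsUnit (⟨0, -1⟩ : GaussianInt) :=
    (Zsqrtd.norm_eq_one_iff' (by norm_num) _).1 (by simp [Zsqrtd.norm])
  have hi2 : IsUnit (⟨-1, 0⟩ : GaussianInt) :=
    (Zsqrtd.norm_eq_one_iff' (by norm_num) _).1 (by simp [Zsqrtd.norm])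
  have hass : ∀ u : GaussianInt, IsUnit u → Associated z (z * u) := fun u hu =>
    (associated_mul_unit_left z u hu).symm
  have hne : z.re ≠ 0 ∨ z.im ≠ 0 := by
    by_contra! h
    exact hz (Zsqrtd.ext h.1 h.2)
  rcases lt_trichotomy z.re 0 with h | h | h
  · rcases le_or_gt z.im 0 with h' | h'
    · exact ⟨_, hass _ hi2, by simp [Zsqrtd.re_mul]; omega, by simp [Zsqrtd.im_mul]; omega⟩
    · exact ⟨_, hass _ hi', by simp [Zsqrtd.re_mul]; omega, by simp [Zsqrtd.im_mul]; omega⟩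
  · rcases lt_or_gt_of_ne (hne.resolve_left (by simpa using h)) with h' | h'
    · exact ⟨_, hass _ hi, by simp [Zsqrtd.re_mul]; omega, by simp [Zsqrtd.im_mul]; omega⟩
    · exact ⟨_, hass _ hi', by simp [Zsqrtd.re_mul]; omega, by simp [Zsqrtd.im_mul]; omega⟩
  · rcases lt_or_ge z.im 0 with h' | h'
    · exact ⟨_, hass _ hi, by simp [Zsqrtd.re_mul]; omega, by simp [Zsqrtd.im_mul]; omega⟩
    · exact ⟨_, Associated.refl z, h, h'⟩

theorem exists_gcan {z : GaussianInt} (hz : Prime z) : ∃ p, GCan p ∧ Associated z p := by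
  obtain ⟨w, h1, h2, h3⟩ := exists_quadrant hz.ne_zero
  exact ⟨w, ⟨h1.prime hz, h2, h3⟩, h1⟩

theorem eq_of_associated_quadrant {p q : GaussianInt} (hp : 0 < p.re) (hp' : 0 ≤ p.im)
    (hq : 0 < q.re) (hq' : 0 ≤ q.im) (h : Associated p q) : p = q := by
  obtain ⟨u, hu⟩ := h
  rcases gaussianInt_isUnit_cases u.isUnit with h | h | h | h <;> rw [h] at hu <;>
    rw [← hu] at hq hq' ⊢ <;> simp [Zsqrtd.re_mul, Zsqrtd.im_mul] at hq hq' <;>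
    first
    | omega
    | (ext <;> simp)

theorem GCan.eq_of_associated {p q : GaussianInt} (hp : GCan p) (hq : GCan q)
    (h : Associated p q) : p = q :=
  eq_of_associated_quadrant hp.2.1 hp.2.2 hq.2.1 hq.2.2 h

theorem GCan.eq_of_dvd {p q : GaussianInt} (hp : GCan p) (hq : GCan q) (h : p ∣ q) : p = q :=
  hp.eq_of_associated hq ((hp.1.dvd_prime_iff_associated hq.1).1 h)

theorem norm_eq_of_associated {z w : GaussianInt} (h : Associated z w) : z.norm = w.norm := by
  obtain ⟨u, rfl⟩ := h
  have := (Zsqrtd.norm_eq_one_iff' (by norm_num) (u : GaussianInt)).2 u.isUnit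
  rw [Zsqrtd.norm_mul, this, mul_one]

theorem nrm_eq_of_associated {z w : GaussianInt} (h : Associated z w) : nrm z = nrm w := by
  rw [nrm, nrm, norm_eq_of_associated h]

theorem ell_eq_of_associated {z w : GaussianInt} (h : Associated z w) : ell z = ell w := by
  rw [ell, ell, nrm_eq_of_associated h]

theorem two_le_nrm {z : GaussianInt} (h0 : z ≠ 0) (hz : ¬ IsUnit z) : 2 ≤ nrm z := by
  have h1 := GaussianInt.norm_pos.2 h0
  have h2 : z.norm ≠ 1 := fun h => hz ((Zsqrtd.norm_eq_one_iff' (by norm_num) z).1 h)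
  have h3 : 2 ≤ z.norm := by omega
  unfold nrm
  exact_mod_cast h3

theorem Prime.two_le_nrm {p : GaussianInt} (h : Prime p) : 2 ≤ nrm p :=
  _root_.two_le_nrm h.ne_zero h.not_isUnit

theorem Prime.log_two_le_ell {p : GaussianInt} (h : Prime p) : log 2 ≤ ell p :=
  log_le_log (by norm_num) h.two_le_nrm

/-- A Gaussian prime in the first quadrant lies over a split prime, or it is `1 + i`, or inert. -/
theorem GCan.cases {p : GaussianInt} (h : GCan p) :
    (p.norm.natAbs.Prime ∧ p.norm.natAbs % 4 = 1) ∨ p = ⟨1, 1⟩ ∨ ∃ q : ℕ, 0 < q ∧ p = ⟨q, 0⟩ := by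
  obtain ⟨hp, hre, him⟩ := h
  have hn : p ∣ ((p.norm.natAbs : ℕ) : GaussianInt) := by
    have h1 : ((p.norm.natAbs : ℕ) : GaussianInt) = ((p.norm : ℤ) : GaussianInt) := by
      rw [← GaussianInt.abs_natCast_norm p]; simp
    rw [h1, Zsqrtd.norm_eq_mul_conj]
    exact dvd_mul_right _ _
  have hn1 : p.norm.natAbs ≠ 1 := fun h => hp.not_isUnit (Zsqrtd.norm_eq_one_iff.1 h)
  obtain ⟨q, hq, hpq⟩ : ∃ q : ℕ, q.Prime ∧ p ∣ (q : GaussianInt) := by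
    have hn0 : p.norm.natAbs ≠ 0 := by
      simpa [GaussianInt.norm_eq_zero] using hp.ne_zero
    rw [← Nat.prod_primeFactorsList hn0] at hn
    rw [Nat.cast_list_prod] at hn
    obtain ⟨a, ha, hpa⟩ := (Prime.dvd_prod_iff hp).1 hn
    obtain ⟨q, hq, rfl⟩ := List.mem_map.1 ha
    exact ⟨q, Nat.prime_of_mem_primeFactorsList hq, hpa⟩
  obtain ⟨r, hr⟩ := hpq
  have hqq : q * q = p.norm.natAbs * r.norm.natAbs := by
    have := congrArg Zsqrtd.norm hr
    rw [Zsqrtd.norm_mul, Zsqrtd.norm_natCast] at this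
    rw [← Int.natAbs_mul, ← this, ← Nat.cast_mul, Int.natAbs_natCast]
  have hdvd : p.norm.natAbs ∣ q ^ 2 := ⟨_, by rw [sq, hqq]⟩
  obtain ⟨k, hk, hpk⟩ := (Nat.dvd_prime_pow hq).1 hdvd
  have hnorm : p.norm = p.re * p.re + p.im * p.im := by rw [Zsqrtd.norm]; ring
  interval_cases k
  · simp [hn1] at hpk
  · rw [pow_one] at hpk
    have hmod : p.norm.natAbs % 4 ≠ 3 := by
      intro h3
      have h4 : p.norm % 4 = 3 := by
        have := GaussianInt.abs_natCast_norm p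
        omega
      rw [hnorm, Int.add_emod, Int.mul_emod, Int.mul_emod p.im] at h4
      have a1 := Int.emod_nonneg p.re (by norm_num : (4 : ℤ) ≠ 0)
      have a2 := Int.emod_lt_of_pos p.re (by norm_num : (0 : ℤ) < 4)
      have b1 := Int.emod_nonneg p.im (by norm_num : (4 : ℤ) ≠ 0)
      have b2 := Int.emod_lt_of_pos p.im (by norm_num : (0 : ℤ) < 4)
      generalize p.re % 4 = a at *
      generalize p.im % 4 = b at *
      interval_cases a <;> interval_cases b <;> omega
    rcases hq.eq_two_or_odd with h2 | hodd
    · right; left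
      have h4 : p.re * p.re + p.im * p.im = 2 := by
        have := GaussianInt.abs_natCast_norm p
        omega
      have : p.re ≤ 1 := by nlinarith
      have : p.im ≤ 1 := by nlinarith
      have h5 : p.re = 1 := by omega
      have h6 : p.im = 1 := by
        rw [h5] at h4; nlinarith
      exact Zsqrtd.ext h5 h6
    · left
      rw [hpk] at hmod ⊢
      exact ⟨hq, by omega⟩
  · right; right
    have hr1 : r.norm.natAbs = 1 := by
      have : 0 < q ^ 2 := pow_pos hq.pos 2
      rw [hpk, ← sq] at hqq
      exact Nat.eq_of_mul_eq_mul_left this (by omega)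
    have hru : IsUnit r := Zsqrtd.norm_eq_one_iff.1 hr1
    refine ⟨q, hq.pos, ?_⟩
    have hass : Associated p (q : GaussianInt) := by
      rw [hr]; exact (associated_mul_unit_left p r hru).symm
    have e : (q : GaussianInt) = ⟨q, 0⟩ := by ext <;> simp
    rw [← e]
    refine eq_of_associated_quadrant hre him ?_ ?_ hass
    · simpa using hq.pos
    · simp

theorem gaussianInt_prime_of_norm {z : GaussianInt} (h : z.norm.natAbs.Prime) : Prime z := by
  rw [← irreducible_iff_prime]
  constructor
  · intro hu
    rw [← Zsqrtd.norm_eq_one_iff] at hu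
    rw [hu] at h
    exact Nat.not_prime_one h
  · intro a b hab
    rw [hab, Zsqrtd.norm_mul, Int.natAbs_mul] at h
    rcases Nat.prime_mul_iff.1 h with h | h
    · exact Or.inr (Zsqrtd.norm_eq_one_iff.1 h.2)
    · exact Or.inl (Zsqrtd.norm_eq_one_iff.1 h.2)

open Classical in
/-- The first-quadrant Gaussian primes of log-norm at most `X`. -/
noncomputable def gprimes (X : ℝ) : Finset GaussianInt := {p ∈ gball X | GCan p}

theorem mem_gprimes {X : ℝ} {p : GaussianInt} : p ∈ gprimes X ↔ GCan p ∧ ell p ≤ X := by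
  simp only [gprimes, mem_filter, mem_gball]
  exact ⟨fun h => ⟨h.2, h.1.2⟩, fun h => ⟨⟨h.1.1.ne_zero, h.2⟩, h.1⟩⟩

open Classical in
theorem card_gprimes_norm_eq {X : ℝ} {q : ℕ} (hq : q.Prime) (hq1 : q % 4 = 1) (hX : log q ≤ X) :
    ((gprimes X).filter fun p => p.norm.natAbs = q).card = 2 := by
  have : Fact q.Prime := ⟨hq⟩
  obtain ⟨a, b, hab⟩ := Nat.Prime.sq_add_sq (p := q) (by omega)
  have ha0 : a ≠ 0 := by
    rintro rfl
    rw [zero_pow two_ne_zero, zero_add] at hab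
    exact (Nat.Prime.not_prime_pow le_rfl) (hab ▸ hq)
  have hb0 : b ≠ 0 := by
    rintro rfl
    rw [zero_pow two_ne_zero, add_zero] at hab
    exact (Nat.Prime.not_prime_pow le_rfl) (hab ▸ hq)
  have hne : a ≠ b := by
    rintro rfl
    rw [← hab] at hq1
    omega
  have hnormab : ∀ a b : ℕ, (⟨a, b⟩ : GaussianInt).norm.natAbs = a ^ 2 + b ^ 2 := by
    intro a b
    have : (⟨a, b⟩ : GaussianInt).norm = ((a ^ 2 + b ^ 2 : ℕ) : ℤ) := by
      simp only [Zsqrtd.norm]; push_cast; ring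
    rw [this, Int.natAbs_natCast]
  have hset : ((gprimes X).filter fun p => p.norm.natAbs = q) =
      {(⟨a, b⟩ : GaussianInt), ⟨b, a⟩} := by
    have hcan : ∀ a b : ℕ, a ≠ 0 → a ^ 2 + b ^ 2 = q → GCan ⟨a, b⟩ := fun a b ha h =>
      ⟨gaussianInt_prime_of_norm (by rw [hnormab, h]; exact hq), by
        simpa using Nat.pos_of_ne_zero ha, by simp⟩
    have hell : ∀ p : GaussianInt, p.norm.natAbs = q → ell p ≤ X := by
      intro p hp
      have : nrm p = q := by rw [nrm, ← GaussianInt.abs_natCast_norm, hp]; simp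
      rwa [ell, this]
    have hba : b ^ 2 + a ^ 2 = q := by rw [add_comm, hab]
    ext p
    simp only [mem_filter, mem_gprimes, Finset.mem_insert, mem_singleton]
    constructor
    · rintro ⟨⟨hp, _⟩, hpq⟩
      have h1 : p ∣ (⟨a, b⟩ : GaussianInt) * ⟨a, -b⟩ := by
        have e : (⟨a, b⟩ : GaussianInt) * ⟨a, -b⟩ = p * star p := by
          rw [← Zsqrtd.norm_eq_mul_conj, ← GaussianInt.abs_natCast_norm, hpq, ← hab]
          rw [Int.cast_natCast, Zsqrtd.ext_iff, Zsqrtd.re_natCast, Zsqrtd.im_natCast]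
          constructor
          · simp [Zsqrtd.re_mul, sq]
          · simp [Zsqrtd.im_mul]; ring
        rw [e]
        exact dvd_mul_right _ _
      rcases hp.1.dvd_or_dvd h1 with h | h
      · exact Or.inl (hp.eq_of_dvd (hcan a b ha0 hab) h)
      · right
        refine hp.eq_of_dvd (hcan b a hb0 hba) (h.trans ⟨⟨0, 1⟩, ?_⟩)
        ext <;> simp [Zsqrtd.re_mul, Zsqrtd.im_mul]
    · rintro (rfl | rfl)
      · exact ⟨⟨hcan a b ha0 hab, hell _ (by rw [hnormab, hab])⟩, by rw [hnormab, hab]⟩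
      · exact ⟨⟨hcan b a hb0 hba, hell _ (by rw [hnormab, hba])⟩, by rw [hnormab, hba]⟩
  rw [hset, Finset.card_pair]
  intro h
  have := congrArg Zsqrtd.re h
  simp at this
  exact hne this

theorem exists_sum_gprimes_log_bound :
    ∃ C, 0 ≤ C ∧ ∀ t : ℝ, 0 ≤ t → |∑ p ∈ gprimes t, 1 / nrm p * ell p - t| ≤ C := by
  classical
  obtain ⟨D, hD0, hD⟩ := exists_sum_prime_one_mod_four_log_div_bound
  have hsum : Summable fun q : ℕ => log ((q : ℝ) ^ 2) / (q : ℝ) ^ 2 := by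
    refine Summable.of_nonneg_of_le (fun q => ?_) (fun q => ?_)
      ((Real.summable_nat_rpow.2 (by norm_num : (-3 / 2 : ℝ) < -1)).mul_left 4)
    · rcases Nat.eq_zero_or_pos q with rfl | h
      · simp
      · have : (1 : ℝ) ≤ q := by exact_mod_cast h
        exact div_nonneg (log_nonneg (one_le_pow₀ this)) (by positivity)
    · rcases Nat.eq_zero_or_pos q with rfl | h
      · simp
      · have hq : (0 : ℝ) < q := by exact_mod_cast h
        have h1 := Real.log_le_rpow_div hq.le (by norm_num : (0 : ℝ) < 1 / 2)
        rw [log_pow, div_le_iff₀ (by positivity)]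
        have h2 : (q : ℝ) ^ (-3 / 2 : ℝ) * (q : ℝ) ^ 2 = (q : ℝ) ^ (1 / 2 : ℝ) := by
          rw [← rpow_natCast, ← rpow_add hq]; norm_num
        push_cast
        rw [mul_assoc, h2]
        linarith
  obtain ⟨B, hB⟩ : ∃ B, B = ∑' q : ℕ, log ((q : ℝ) ^ 2) / (q : ℝ) ^ 2 := ⟨_, rfl⟩
  have hB0 : 0 ≤ B := hB ▸ tsum_nonneg fun q => by
    rcases Nat.eq_zero_or_pos q with rfl | h
    · simp
    · have : (1 : ℝ) ≤ q := by exact_mod_cast h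
      exact div_nonneg (log_nonneg (one_le_pow₀ this)) (by positivity)
  refine ⟨2 * D + B + 2, by positivity, fun t ht => ?_⟩
  obtain ⟨N, hN⟩ : ∃ N, N = ⌊exp t⌋₊ := ⟨_, rfl⟩
  have hexp : 1 ≤ exp t := one_le_exp ht
  have hN1 : 1 ≤ N := by rw [hN]; exact Nat.le_floor (by simpa using hexp)
  have hNle : (N : ℝ) ≤ exp t := hN ▸ Nat.floor_le (exp_pos t).le
  have hNlog : |log N - t| ≤ log 2 := by
    have hNpos : (0 : ℝ) < N := by exact_mod_cast hN1
    have h1 : log N ≤ t := by rw [log_le_iff_le_exp hNpos]; exact hNle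
    have h2 : exp t ≤ 2 * N := by
      have := Nat.lt_floor_add_one (exp t)
      rw [← hN] at this
      have : (1 : ℝ) ≤ N := by exact_mod_cast hN1
      linarith
    have h3 := log_le_log (exp_pos t) h2
    rw [log_exp, log_mul (by norm_num) hNpos.ne'] at h3
    rw [abs_le]; constructor <;> linarith [log_nonneg (by norm_num : (1 : ℝ) ≤ 2)]
  have hsplit := sum_filter_add_sum_filter_not (gprimes t)
    (fun p => p.norm.natAbs.Prime ∧ p.norm.natAbs % 4 = 1) (fun p => 1 / nrm p * ell p)
  have hcast : ∀ p : GaussianInt, nrm p = (p.norm.natAbs : ℝ) := fun p => by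
    conv_lhs => rw [nrm, ← GaussianInt.abs_natCast_norm]
    simp
  have hmain : ∑ p ∈ gprimes t with p.norm.natAbs.Prime ∧ p.norm.natAbs % 4 = 1,
      1 / nrm p * ell p = 2 * ∑ q ∈ Ioc 0 N with q.Prime ∧ q % 4 = 1, log q / q := by
    rw [← Finset.sum_fiberwise_of_maps_to (t := (Ioc 0 N).filter
      fun q => q.Prime ∧ q % 4 = 1) (g := fun p : GaussianInt => p.norm.natAbs), mul_sum]
    · refine sum_congr rfl fun q hq => ?_
      rw [mem_filter, mem_Ioc] at hq
      have hq0 : (0 : ℝ) < q := by exact_mod_cast hq.1.1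
      have hqt : log q ≤ t := by
        rw [log_le_iff_le_exp hq0]
        exact le_trans (by exact_mod_cast hq.1.2) hNle
      rw [sum_congr (g := fun _ => log q / q) (s₂ := (gprimes t).filter
        fun p => p.norm.natAbs = q)]
      · rw [sum_const, nsmul_eq_mul, card_gprimes_norm_eq hq.2.1 hq.2.2 hqt]
        norm_num
      · rw [filter_filter]
        refine Finset.filter_congr fun p _ => ⟨fun h => h.2, fun h => ⟨?_, h⟩⟩
        rw [h]; exact hq.2
      · intro p hp
        rw [ell, hcast, (mem_filter.1 hp).2]; ring
    · intro p hp
      rw [mem_filter, mem_gprimes] at hp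
      rw [mem_filter, mem_Ioc]
      refine ⟨⟨hp.2.1.pos, ?_⟩, hp.2⟩
      rw [hN]
      refine Nat.le_floor ?_
      rw [← hcast, ← exp_ell hp.1.1.1.ne_zero]
      exact exp_le_exp.2 hp.1.2
  have hrest0 : 0 ≤ ∑ p ∈ gprimes t with ¬(p.norm.natAbs.Prime ∧ p.norm.natAbs % 4 = 1),
      1 / nrm p * ell p :=
    sum_nonneg fun p _ => mul_nonneg (one_div_nonneg.2 (nrm_nonneg p)) (ell_nonneg p)
  have hrest : ∑ p ∈ gprimes t with ¬(p.norm.natAbs.Prime ∧ p.norm.natAbs % 4 = 1),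
      1 / nrm p * ell p ≤ log 2 / 2 + B := by
    have hsub : (gprimes t).filter (fun p => ¬(p.norm.natAbs.Prime ∧ p.norm.natAbs % 4 = 1)) ⊆
        {(⟨1, 1⟩ : GaussianInt)} ∪
          (range (N + 1)).image (fun q : ℕ => (⟨q, 0⟩ : GaussianInt)) := by
      intro p hp
      rw [mem_filter, mem_gprimes] at hp
      rw [mem_union, mem_singleton, mem_image]
      rcases hp.1.1.cases with h | h | ⟨q, hq, h⟩
      · exact absurd h hp.2
      · exact Or.inl h
      · refine Or.inr ⟨q, ?_, h.symm⟩
        rw [mem_range, Nat.lt_succ_iff, hN]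
        refine Nat.le_floor ?_
        have h1 : nrm p = (q : ℝ) ^ 2 := by
          rw [h, nrm]; simp [Zsqrtd.norm, sq]
        have h2 : nrm p ≤ exp t := by
          rw [← exp_ell hp.1.1.1.ne_zero]; exact exp_le_exp.2 hp.1.2
        have h3 : (1 : ℝ) ≤ q := by exact_mod_cast hq
        nlinarith
    refine (sum_le_sum_of_subset_of_nonneg hsub fun p _ _ =>
      mul_nonneg (one_div_nonneg.2 (nrm_nonneg p)) (ell_nonneg p)).trans ?_
    have hun := Finset.sum_union_inter (s₁ := {(⟨1, 1⟩ : GaussianInt)})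
      (s₂ := (range (N + 1)).image (fun q : ℕ => (⟨q, 0⟩ : GaussianInt)))
      (f := fun p => 1 / nrm p * ell p)
    have hin : 0 ≤ ∑ p ∈ {(⟨1, 1⟩ : GaussianInt)} ∩
        (range (N + 1)).image (fun q : ℕ => (⟨q, 0⟩ : GaussianInt)), 1 / nrm p * ell p :=
      sum_nonneg fun p _ => mul_nonneg (one_div_nonneg.2 (nrm_nonneg p)) (ell_nonneg p)
    refine (le_add_of_nonneg_right hin).trans (hun.le.trans ?_)
    gcongr
    · rw [Finset.sum_singleton, ell]
      have : nrm ⟨1, 1⟩ = 2 := by simp [nrm, Zsqrtd.norm]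
      rw [this]; linarith
    · rw [Finset.sum_image]
      · rw [hB]
        refine le_trans (sum_le_sum fun q _ => le_of_eq ?_) (hsum.sum_le_tsum _ fun q _ => ?_)
        · have h1 : nrm ⟨q, 0⟩ = (q : ℝ) ^ 2 := by
            rw [nrm]; simp [Zsqrtd.norm, sq]
          rw [ell, h1]; ring
        · rcases Nat.eq_zero_or_pos q with rfl | h
          · simp
          · have : (1 : ℝ) ≤ q := by exact_mod_cast h
            exact div_nonneg (log_nonneg (one_le_pow₀ this)) (by positivity)
      · intro a _ b _ hab
        simpa using hab
  have h2 := hD N hN1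
  have hl2 : log 2 ≤ 1 := by have := log_two_lt_d9; linarith
  rw [abs_le] at h2 hNlog ⊢
  rw [← hsplit, hmain]
  constructor <;> linarith [h2.1, h2.2, hNlog.1, hNlog.2]

theorem exists_sum_gprimes_inv_bound :
    ∃ D, 0 ≤ D ∧ ∀ t : ℝ, 1 ≤ t → |∑ p ∈ gprimes t, 1 / nrm p - log t| ≤ D := by
  obtain ⟨C, hC0, hC⟩ := exists_sum_gprimes_log_bound
  obtain ⟨D, hD0, hD⟩ := abel_log zero_le_one hC0 (log_pos one_lt_two)
  refine ⟨D, hD0, fun T hT => ?_⟩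
  have hfil : ∀ t, t ≤ T → (gprimes T).filter (fun p => ell p ≤ t) = gprimes t := by
    intro t ht
    ext p
    simp only [mem_filter, mem_gprimes]
    exact ⟨fun h => ⟨h.1.1, h.2⟩, fun h => ⟨⟨h.1, h.2.trans ht⟩, h.2⟩⟩
  have := hD (gprimes T) ell (fun p => 1 / nrm p) (fun p _ => one_div_nonneg.2 (nrm_nonneg p))
    (fun p hp => (mem_gprimes.1 hp).1.1.log_two_le_ell) T hT (fun t ht htT => by
      rw [hfil t htT, one_mul]; exact hC t (by linarith))
  rwa [hfil T le_rfl, one_mul] at this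

theorem exists_sum_gprimes_inv_sq_le :
    ∃ B, 0 ≤ B ∧ ∀ t : ℝ, ∑ p ∈ gprimes t, (1 / nrm p) ^ 2 ≤ B := by
  have hs : Summable fun n : ℕ => 1 / (n : ℝ) ^ 2 := Real.summable_one_div_nat_pow.2 one_lt_two
  refine ⟨(∑' n : ℕ, 1 / (n : ℝ) ^ 2) * ∑' n : ℕ, 1 / (n : ℝ) ^ 2, mul_self_nonneg _, fun t => ?_⟩
  have hpos : ∀ p ∈ gprimes t, ((p.re.toNat : ℕ) : ℤ) = p.re ∧ ((p.im.toNat : ℕ) : ℤ) = p.im := by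
    intro p hp
    have := (mem_gprimes.1 hp).1
    exact ⟨Int.toNat_of_nonneg this.2.1.le, Int.toNat_of_nonneg this.2.2⟩
  have hinj : Set.InjOn (fun p : GaussianInt => (p.re.toNat, p.im.toNat + 1)) (gprimes t) := by
    intro p hp q hq h
    simp only [Prod.mk.injEq, add_left_inj] at h
    obtain ⟨h1, h2⟩ := hpos p hp
    obtain ⟨h3, h4⟩ := hpos q hq
    exact Zsqrtd.ext (by rw [← h1, ← h3, h.1]) (by rw [← h2, ← h4, h.2])
  have h1 : ∀ p ∈ gprimes t, (1 / nrm p) ^ 2 ≤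
      1 / ((p.re.toNat : ℕ) : ℝ) ^ 2 * (1 / ((p.im.toNat + 1 : ℕ) : ℝ) ^ 2) := by
    intro p hp
    obtain ⟨hp0, ha, hb⟩ := (mem_gprimes.1 hp).1
    obtain ⟨e1, e2⟩ := hpos p hp
    obtain ⟨a, ha'⟩ : ∃ a, a = p.re.toNat := ⟨_, rfl⟩
    obtain ⟨b, hb'⟩ : ∃ b, b = p.im.toNat := ⟨_, rfl⟩
    rw [← ha'] at e1 ⊢
    rw [← hb'] at e2 ⊢
    have ha1 : 1 ≤ a := by omega
    have hn : nrm p = (a : ℝ) ^ 2 + (b : ℝ) ^ 2 := by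
      rw [nrm, Zsqrtd.norm, ← e1, ← e2]; push_cast; ring
    have hge : (a : ℝ) * (b + 1) ≤ nrm p := by
      rw [hn]
      have : a * (b + 1) ≤ a ^ 2 + b ^ 2 := by
        rcases Nat.eq_zero_or_pos b with rfl | hb
        · nlinarith
        · zify at ha1 hb ⊢
          nlinarith [sq_nonneg ((a : ℤ) - b), mul_nonneg (sub_nonneg.2 ha1) (sub_nonneg.2 hb)]
      exact_mod_cast this
    rw [one_div_mul_one_div, one_div_pow, ← mul_pow]
    push_cast
    gcongr
  refine (sum_le_sum h1).trans ?_
  obtain ⟨M, hM⟩ : ∃ M : ℕ, ∀ p ∈ gprimes t, p.re.toNat < M ∧ p.im.toNat + 1 < M := by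
    refine ⟨((gprimes t).sup fun p => max p.re.toNat (p.im.toNat + 1)) + 1, fun p hp => ?_⟩
    have := Finset.le_sup (f := fun p : GaussianInt => max p.re.toNat (p.im.toNat + 1)) hp
    simp only [max_le_iff] at this
    omega
  calc _ = ∑ x ∈ (gprimes t).image (fun p : GaussianInt => (p.re.toNat, p.im.toNat + 1)),
        1 / (x.1 : ℝ) ^ 2 * (1 / (x.2 : ℝ) ^ 2) := (Finset.sum_image hinj).symm
    _ ≤ ∑ x ∈ range M ×ˢ range M, 1 / (x.1 : ℝ) ^ 2 * (1 / (x.2 : ℝ) ^ 2) := by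
        refine sum_le_sum_of_subset_of_nonneg ?_ fun _ _ _ => by positivity
        intro x hx
        obtain ⟨p, hp, rfl⟩ := mem_image.1 hx
        exact mem_product.2 ⟨mem_range.2 (hM p hp).1, mem_range.2 (hM p hp).2⟩
    _ = (∑ n ∈ range M, 1 / (n : ℝ) ^ 2) * ∑ n ∈ range M, 1 / (n : ℝ) ^ 2 := by
        rw [sum_product, Finset.sum_mul_sum]
    _ ≤ _ := by
        gcongr <;> exact hs.sum_le_tsum _ fun _ _ => by positivity

/-- The density of Gaussian integers without prime factors of log-norm at most `Y`. -/
noncomputable def gdens (Y : ℝ) : ℝ := ∏ p ∈ gprimes Y, (1 - 1 / nrm p)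

theorem exists_gdens_bound : ∃ C, 1 ≤ C ∧ ∀ Y : ℝ, 1 ≤ Y →
    1 / (C * Y) ≤ gdens Y ∧ gdens Y ≤ C / Y := by
  obtain ⟨D, hD0, hD⟩ := exists_sum_gprimes_inv_bound
  obtain ⟨B, hB0, hB⟩ := exists_sum_gprimes_inv_sq_le
  refine ⟨exp (D + B), one_le_exp (by linarith), fun Y hY => ?_⟩
  have hY0 : 0 < Y := by linarith
  have hx : ∀ p ∈ gprimes Y, 0 ≤ 1 / nrm p ∧ 1 / nrm p ≤ 1 / 2 := fun p hp =>
    ⟨one_div_nonneg.2 (nrm_nonneg p),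
      one_div_le_one_div_of_le (by norm_num) (mem_gprimes.1 hp).1.1.two_le_nrm⟩
  have h := abs_le.1 (hD Y hY)
  constructor
  · have h1 : ∏ p ∈ gprimes Y, exp (-(1 / nrm p) - (1 / nrm p) ^ 2) ≤ gdens Y := by
      refine Finset.prod_le_prod (fun _ _ => (exp_pos _).le) fun p hp => ?_
      obtain ⟨h0, h2⟩ := hx p hp
      obtain ⟨x, hx⟩ : ∃ x, x = 1 / nrm p := ⟨_, rfl⟩
      rw [← hx] at h0 h2 ⊢
      have h3 : 1 ≤ exp (x + x ^ 2) * (1 - x) := by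
        have := add_one_le_exp (x + x ^ 2)
        nlinarith [mul_nonneg h0 h0, mul_nonneg h0 (mul_nonneg h0 h0), quadratic_le_exp_of_nonneg (by positivity : 0 ≤ x + x ^ 2)]
      have h4 : exp (-x - x ^ 2) = (exp (x + x ^ 2))⁻¹ := by rw [← exp_neg]; ring_nf
      rw [h4, inv_le_iff_one_le_mul₀ (exp_pos _)]
      linarith
    refine le_trans ?_ h1
    rw [← exp_sum, sum_sub_distrib, Finset.sum_neg_distrib]
    have : 1 / (exp (D + B) * Y) = exp (-(D + B) - log Y) := by
      rw [exp_sub, exp_neg, exp_log hY0]; field_simp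
    rw [this]
    exact exp_le_exp.2 (by linarith [hB Y, h.1, h.2])
  · have h1 : gdens Y ≤ ∏ p ∈ gprimes Y, exp (-(1 / nrm p)) := by
      refine Finset.prod_le_prod (fun p hp => by linarith [(hx p hp).2]) fun p hp => ?_
      have := add_one_le_exp (-(1 / nrm p))
      linarith
    refine h1.trans ?_
    rw [← exp_sum, Finset.sum_neg_distrib]
    have : exp (D + B) / Y = exp (D + B - log Y) := by rw [exp_sub, exp_log hY0]
    rw [this]
    exact exp_le_exp.2 (by linarith [h.1, h.2])

theorem gdens_pos (Y : ℝ) : 0 < gdens Y := by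
  refine Finset.prod_pos fun p hp => ?_
  have h := (mem_gprimes.1 hp).1.1.two_le_nrm
  have : 1 / nrm p ≤ 1 / 2 := one_div_le_one_div_of_le (by norm_num) h
  linarith

theorem eventually_const_mul_rpow_le {a b : ℝ} (h : a < b) (C : ℝ) :
    ∀ᶠ U : ℝ in atTop, C * U ^ a ≤ U ^ b := by
  filter_upwards [(tendsto_rpow_atTop (sub_pos.2 h)).eventually_ge_atTop C, eventually_gt_atTop 0]
    with U h1 h2
  calc C * U ^ a ≤ U ^ (b - a) * U ^ a := by gcongr
    _ = U ^ b := by rw [← rpow_add h2]; congr 1; ring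

theorem eventually_const_mul_log_mul_rpow_le {a b : ℝ} (h : a < b) (C : ℝ) :
    ∀ᶠ U : ℝ in atTop, C * log U * U ^ a ≤ U ^ b := by
  have h2 : 0 < (b - a) / 2 := by linarith
  filter_upwards [eventually_log_le_rpow h2, eventually_gt_atTop 1,
    eventually_const_mul_rpow_le (show a + (b - a) / 2 < b by linarith) |C|] with U h1 h3 h4
  refine le_trans ?_ h4
  rw [add_comm a, rpow_add (by linarith), ← mul_assoc]
  have := log_pos h3
  gcongr
  exact le_abs_self C

/-- `z` has no prime factor of log-norm at most `Y`. -/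
def GRough (Y : ℝ) (z : GaussianInt) : Prop := ∀ p ∈ gprimes Y, ¬ p ∣ z

theorem isCoprime_of_mem_gprimes {X Y : ℝ} {p q : GaussianInt} (hp : p ∈ gprimes X)
    (hq : q ∈ gprimes Y) (h : p ≠ q) : IsCoprime p q :=
  (mem_gprimes.1 hp).1.1.irreducible.coprime_iff_not_dvd.2 fun h' =>
    h ((mem_gprimes.1 hp).1.eq_of_dvd (mem_gprimes.1 hq).1 h')

theorem prod_dvd_iff_of_subset_gprimes {X : ℝ} {E : Finset GaussianInt} (hE : E ⊆ gprimes X)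
    {z : GaussianInt} : ∏ p ∈ E, p ∣ z ↔ ∀ p ∈ E, p ∣ z :=
  ⟨fun h _ hp => (Finset.dvd_prod_of_mem _ hp).trans h, fun h => Finset.prod_dvd_of_coprime
    (fun _ hp _ hq hpq => isCoprime_of_mem_gprimes (hE hp) (hE hq) hpq) h⟩

theorem prod_ne_zero_of_subset_gprimes {X : ℝ} {E : Finset GaussianInt} (hE : E ⊆ gprimes X) :
    ∏ p ∈ E, p ≠ 0 :=
  Finset.prod_ne_zero_iff.2 fun _ hp => (mem_gprimes.1 (hE hp)).1.1.ne_zero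

theorem nrm_prod (E : Finset GaussianInt) : nrm (∏ p ∈ E, p) = ∏ p ∈ E, nrm p := by
  classical
  induction E using Finset.induction_on with
  | empty => simp [nrm]
  | insert a s h ih => rw [prod_insert h, prod_insert h, nrm_mul, ih]

theorem ell_prod {X : ℝ} {E : Finset GaussianInt} (hE : E ⊆ gprimes X) :
    ell (∏ p ∈ E, p) = ∑ p ∈ E, ell p := by
  rw [ell, nrm_prod, log_prod fun p hp => (nrm_pos (mem_gprimes.1 (hE hp)).1.1.ne_zero).ne']
  rfl

open Classical in
theorem brun_gsector_aux {ω : ℂ} (hω : ω ≠ 0) {α u₀ u₁ Y : ℝ} (hα : 0 ≤ α) (hα' : α ≤ π)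
    (hu : u₀ ≤ u₁) {d : GaussianInt} (hd : d ≠ 0) (hr : GRough Y d) {t : ℝ} (hY : 1 ≤ Y) {k : ℕ}
    (hk : (k + 1) * Y + 6 ≤ t / 2) (hdu : ell d + t ≤ u₀) {D : ℝ}
    (hD : ∑ p ∈ gprimes Y, 1 / nrm p ≤ D) :
    |∑ z ∈ gsector ω α u₀ u₁ with d ∣ z ∧ GRough Y z, 1 / nrm z
        - gdens Y * (α * (u₁ - u₀) / nrm d)| ≤
      (k + 2) * (100 * exp (-t / 4) * (1 + (u₁ - u₀)) / nrm d * exp D)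
        + 2 * (α * (u₁ - u₀) / nrm d) * exp (3 * D - (k + 1)) := by
  obtain ⟨s, hs⟩ : ∃ s, s = gprimes Y := ⟨_, rfl⟩
  have hn := nrm_pos hd
  have hΔ : 0 ≤ u₁ - u₀ := by linarith
  have hkY : 0 ≤ (k + 1) * Y := by positivity
  have hg0 : ∀ p ∈ s, 0 ≤ 1 / nrm p := fun p _ => div_nonneg zero_le_one (nrm_nonneg p)
  have hg1 : ∀ p ∈ s, 1 / nrm p ≤ 1 := fun p hp => by
    have := (mem_gprimes.1 (hs ▸ hp)).1.1.two_le_nrm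
    rw [div_le_one (by linarith)]
    linarith
  have key := brun_sum ((gsector ω α u₀ u₁).filter (d ∣ ·)) (fun z => 1 / nrm z)
    (fun z _ => div_nonneg zero_le_one (nrm_nonneg z)) s (fun z p => if p ∣ z then 1 else 0)
    (fun z _ p _ => by split_ifs <;> norm_num) (fun z _ p _ => by split_ifs <;> norm_num)
    (fun p => 1 / nrm p) hg0 hg1 (X := α * (u₁ - u₀) / nrm d) (by positivity) k
    (fun E => 100 * exp (-t / 4) * (1 + (u₁ - u₀)) / nrm d * ∏ p ∈ E, 1 / nrm p) ?_
  · have e1 : ∑ z ∈ (gsector ω α u₀ u₁).filter (d ∣ ·),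
        1 / nrm z * ∏ p ∈ s, (1 - if p ∣ z then (1 : ℝ) else 0) =
        ∑ z ∈ gsector ω α u₀ u₁ with d ∣ z ∧ GRough Y z, 1 / nrm z := by
      rw [← filter_filter, sum_filter _ (fun z => 1 / nrm z)]
      refine sum_congr rfl fun z _ => ?_
      split_ifs with hz
      · rw [Finset.prod_eq_one, mul_one]
        intro p hp
        rw [if_neg (hz p (hs ▸ hp)), sub_zero]
      · unfold GRough at hz
        push Not at hz
        obtain ⟨p, hp, hpz⟩ := hz
        rw [Finset.prod_eq_zero (hs ▸ hp) (by simp [hpz]), mul_zero]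
    rw [e1, mul_comm (α * (u₁ - u₀) / nrm d), hs] at key
    refine key.trans ?_
    rw [← hs] at hD ⊢
    gcongr ?_ + _ * ?_
    · calc _ ≤ ∑ j ∈ range (k + 2),
            100 * exp (-t / 4) * (1 + (u₁ - u₀)) / nrm d * exp D := by
            refine sum_le_sum fun j _ => ?_
            rw [← mul_sum]
            refine mul_le_mul_of_nonneg_left ?_ (by positivity)
            refine (sum_powersetCard_prod_le s _ hg0 j one_pos).trans ?_
            rw [one_pow, div_one, one_mul]
            exact exp_le_exp.2 hD
        _ = _ := by simp
    · refine (sum_powersetCard_prod_le s _ hg0 (k + 1) (exp_pos 1)).trans ?_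
      rw [← exp_nat_mul, ← exp_sub, exp_le_exp]
      have h0 := sum_nonneg hg0
      have := mul_le_mul exp_one_lt_three.le hD h0 (by norm_num)
      push_cast
      linarith
  · intro E hE hEc
    have hE' : E ⊆ gprimes Y := hs ▸ hE
    obtain ⟨e, he⟩ : ∃ e, e = ∏ p ∈ E, p := ⟨_, rfl⟩
    have he0 : e ≠ 0 := he ▸ prod_ne_zero_of_subset_gprimes hE'
    have hne := nrm_pos he0
    have hcop : IsCoprime d e := by
      rw [he]
      refine IsCoprime.prod_right fun p hp => IsCoprime.symm ?_
      exact (mem_gprimes.1 (hE' hp)).1.1.irreducible.coprime_iff_not_dvd.2 (hr p (hE' hp))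
    have hell : ell e ≤ (k + 1) * Y := by
      rw [he, ell_prod hE']
      refine (Finset.sum_le_card_nsmul _ _ Y fun p hp => (mem_gprimes.1 (hE' hp)).2).trans ?_
      rw [nsmul_eq_mul]
      gcongr
      exact_mod_cast hEc
    have e1 : ∑ z ∈ (gsector ω α u₀ u₁).filter (d ∣ ·),
        1 / nrm z * ∏ p ∈ E, (if p ∣ z then (1 : ℝ) else 0) =
        ∑ z ∈ gsector ω α u₀ u₁ with d * e ∣ z, 1 / nrm z := by
      have : ∀ z, (d * e ∣ z ↔ d ∣ z ∧ e ∣ z) := fun z =>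
        ⟨fun h => ⟨(Dvd.intro _ rfl).trans h, (Dvd.intro_left _ rfl).trans h⟩,
          fun h => hcop.mul_dvd h.1 h.2⟩
      simp_rw [this]
      rw [← filter_filter, sum_filter _ (fun z => 1 / nrm z)]
      refine sum_congr rfl fun z _ => ?_
      rw [Finset.prod_ite_zero, Finset.prod_const_one, mul_ite, mul_one, mul_zero, he]
      simp only [prod_dvd_iff_of_subset_gprimes hE']
    rw [e1]
    have h := abs_sum_gsector_dvd_sub_le hω hα hα' hu (mul_ne_zero hd he0)
      (by rw [ell_mul hd he0]; linarith)
    have e2 : (1 : ℝ) / nrm e = ∏ p ∈ E, 1 / nrm p := by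
      rw [he, nrm_prod]; simp
    rw [← e2]
    rw [nrm_mul, ell_mul hd he0] at h
    have e3 : α * (u₁ - u₀) / nrm d * (1 / nrm e) = α * (u₁ - u₀) / (nrm d * nrm e) := by
      field_simp
    rw [e3]
    refine h.trans ?_
    have e4 : 100 * exp (-t / 4) * (1 + (u₁ - u₀)) / nrm d * (1 / nrm e) =
      100 * (exp (-t / 4) * (1 + (u₁ - u₀))) / (nrm d * nrm e) := by
      field_simp
    have e5 : exp ((ell d + ell e - u₀) / 2) ≤ exp (-t / 4) := exp_le_exp.2 (by linarith)
    rw [e4]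
    gcongr

open Classical in
/-- The density of rough Gaussian integers among multiples of `d` in a narrow sector. -/
theorem rough_gsector {a b c : ℝ} (ha : 0 < a) (ha1 : a ≤ 1) (hab : a < b) (hcb : c < b) :
    ∀ᶠ U : ℝ in atTop, ∀ ω : ℂ, ω ≠ 0 → ∀ α u₀ u₁ : ℝ, exp (-U ^ c) ≤ α → α ≤ π → u₀ ≤ u₁ →
    ∀ d : GaussianInt, d ≠ 0 → GRough (U ^ a) d → ell d + U ^ b ≤ u₀ →
    |∑ z ∈ gsector ω α u₀ u₁ with d ∣ z ∧ GRough (U ^ a) z, 1 / nrm z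
        - gdens (U ^ a) * (α * (u₁ - u₀) / nrm d)| ≤
      α * (1 + (u₁ - u₀)) / nrm d / U ^ 10 := by
  obtain ⟨D, hD0, hD⟩ := exists_sum_gprimes_inv_bound
  have hb : 0 < b := ha.trans hab
  filter_upwards [eventually_const_mul_log_mul_rpow_le hab 80, eventually_const_mul_rpow_le hab 16,
    eventually_const_mul_rpow_le hb 48, eventually_const_mul_rpow_le hcb 16,
    eventually_const_mul_log_mul_rpow_le hb (16 * 13), eventually_ge_atTop (5000 * exp D),
    eventually_ge_atTop (4 * exp (3 * D)), eventually_ge_atTop 3] with U h1 h2 h3 h4 h5 h6 h7 hU3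
  intro ω hω α u₀ u₁ hα hα' hu d hd hr hdu
  have hU0 : 0 < U := by linarith
  have hα0 : 0 < α := (exp_pos _).trans_le hα
  have hlog : 0 ≤ log U := log_nonneg (by linarith)
  rw [rpow_zero] at h3 h5
  have hY1 : 1 ≤ U ^ a := one_le_rpow (by linarith) ha.le
  have hDU : ∑ p ∈ gprimes (U ^ a), 1 / nrm p ≤ log U + D := by
    have := (abs_le.1 (hD _ hY1)).2
    rw [log_rpow hU0] at this
    nlinarith
  obtain ⟨k, hk⟩ : ∃ k : ℕ, k = ⌈20 * log U⌉₊ := ⟨_, rfl⟩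
  have hk1 : 20 * log U ≤ k := hk ▸ Nat.le_ceil _
  have hk2 : (k : ℝ) < 20 * log U + 1 := hk ▸ Nat.ceil_lt_add_one (by positivity)
  have hkY : ((k : ℝ) + 1) * U ^ a + 6 ≤ U ^ b / 2 := by
    have := mul_le_mul_of_nonneg_right hk2.le (zero_le_one.trans hY1)
    linarith
  refine (brun_gsector_aux hω hα0.le hα' hu hd hr hY1 hkY hdu hDU).trans ?_
  have hn := nrm_pos hd
  have hΔ : 0 ≤ u₁ - u₀ := by linarith
  have hlogU : log U ≤ U := (log_le_sub_one_of_pos hU0).trans (by linarith)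
  have hexp : exp (13 * log U) = U ^ 13 := by
    rw [mul_comm, exp_mul, exp_log hU0]; norm_cast
  have p1 : (k + 2) * (100 * exp (-U ^ b / 4) * (1 + (u₁ - u₀)) / nrm d * exp (log U + D)) ≤
      α * (1 + (u₁ - u₀)) / nrm d / U ^ 10 / 2 := by
    have q1 : exp (-U ^ b / 4) ≤ α * (1 / U ^ 13) := by
      calc exp (-U ^ b / 4) ≤ exp (-U ^ c) * exp (-(13 * log U)) := by
            rw [← exp_add, exp_le_exp]; linarith
        _ ≤ _ := by
            rw [exp_neg (13 * log U), hexp, one_div]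
            gcongr
    have q2 : (k : ℝ) + 2 ≤ 25 * U := by linarith
    calc _ ≤ 25 * U * (100 * (α * (1 / U ^ 13)) * (1 + (u₁ - u₀)) / nrm d * (U * exp D)) := by
          rw [exp_add, exp_log hU0]
          gcongr
      _ = (5000 * exp D) / (2 * U) * (α * (1 + (u₁ - u₀)) / nrm d / U ^ 10) := by
          field_simp; ring
      _ ≤ 1 / 2 * (α * (1 + (u₁ - u₀)) / nrm d / U ^ 10) := by
          refine mul_le_mul_of_nonneg_right ?_ (by positivity)
          rw [div_le_div_iff₀ (by positivity) (by norm_num)]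
          linarith
      _ = _ := by ring
  have p2 : 2 * (α * (u₁ - u₀) / nrm d) * exp (3 * (log U + D) - (k + 1)) ≤
      α * (1 + (u₁ - u₀)) / nrm d / U ^ 10 / 2 := by
    have q1 : exp (3 * (log U + D) - (k + 1)) ≤ exp (3 * D) * (1 / U ^ 13) := by
      rw [one_div, ← hexp, ← exp_neg, ← exp_add, exp_le_exp]
      linarith
    calc _ ≤ 2 * (α * (1 + (u₁ - u₀)) / nrm d) * (exp (3 * D) * (1 / U ^ 13)) := by
          gcongr
          linarith
      _ = (4 * exp (3 * D)) / (2 * U ^ 3) * (α * (1 + (u₁ - u₀)) / nrm d / U ^ 10) := by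
          field_simp; ring
      _ ≤ 1 / 2 * (α * (1 + (u₁ - u₀)) / nrm d / U ^ 10) := by
          refine mul_le_mul_of_nonneg_right ?_ (by positivity)
          rw [div_le_div_iff₀ (by positivity) (by norm_num)]
          nlinarith [mul_le_mul hU3 hU3 (by norm_num) hU0.le, mul_pos hU0 hU0]
      _ = _ := by ring
  linarith

open Classical in
/-- The logarithmic count of rough Gaussian integers of log-norm at most `t`. -/
noncomputable def grho (Y t : ℝ) : ℝ := ∑ z ∈ gball t with GRough Y z, 1 / nrm z

theorem gRough_one (Y : ℝ) : GRough Y 1 := fun _ hp h =>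
  (mem_gprimes.1 hp).1.1.not_isUnit (isUnit_of_dvd_one h)

theorem nrm_one : nrm 1 = 1 := by simp [nrm]

theorem ell_one : ell 1 = 0 := by simp [ell, nrm_one]

theorem GRough.mono {X Y : ℝ} (h : X ≤ Y) {z : GaussianInt} (hz : GRough Y z) : GRough X z :=
  fun p hp => hz p (mem_gprimes.2 ⟨(mem_gprimes.1 hp).1, (mem_gprimes.1 hp).2.trans h⟩)

theorem ell_le_of_dvd {d z : GaussianInt} (hz : z ≠ 0) (h : d ∣ z) : ell d ≤ ell z := by
  obtain ⟨c, rfl⟩ := h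
  rw [ell_mul (left_ne_zero_of_mul hz) (right_ne_zero_of_mul hz)]
  linarith [ell_nonneg c]

theorem exists_gcan_dvd {z : GaussianInt} (h : ¬ IsUnit z) : ∃ p, GCan p ∧ p ∣ z := by
  rcases eq_or_ne z 0 with rfl | h0
  · obtain ⟨p, hp⟩ := exists_gcan ((gaussianInt_prime_of_norm (z := ⟨1, 1⟩) (by decide)))
    exact ⟨p, hp.1, dvd_zero p⟩
  · obtain ⟨q, hq, hqz⟩ := WfDvdMonoid.exists_irreducible_factor h h0
    obtain ⟨p, hp, hqp⟩ := exists_gcan hq.prime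
    exact ⟨p, hp, hqp.symm.dvd.trans hqz⟩

theorem GRough.lt_ell {Y : ℝ} {z : GaussianInt} (h : GRough Y z) (h0 : z ≠ 0) (hz : ¬ IsUnit z) :
    Y < ell z := by
  obtain ⟨p, hp, hpz⟩ := exists_gcan_dvd hz
  by_contra! h'
  exact h p (mem_gprimes.2 ⟨hp, (ell_le_of_dvd h0 hpz).trans h'⟩) hpz

theorem gRough_mul_iff {Y : ℝ} {d w : GaussianInt} (hd : GRough Y d) :
    GRough Y (d * w) ↔ GRough Y w :=
  ⟨fun h p hp hw => h p hp (hw.mul_left _), fun h p hp hw =>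
    ((mem_gprimes.1 hp).1.1.dvd_or_dvd hw).elim (hd p hp) (h p hp)⟩

/-- The units of the Gaussian integers. -/
def gunits : Finset GaussianInt := {⟨1, 0⟩, ⟨-1, 0⟩, ⟨0, 1⟩, ⟨0, -1⟩}

theorem mem_gunits {z : GaussianInt} : z ∈ gunits ↔ IsUnit z := by
  refine ⟨fun h => ?_, fun h => by simpa [gunits] using gaussianInt_isUnit_cases h⟩
  rw [← Zsqrtd.norm_eq_one_iff]
  simp only [gunits, Finset.mem_insert, mem_singleton] at h
  rcases h with rfl | rfl | rfl | rfl <;> rfl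

theorem card_gunits : gunits.card = 4 := by decide

theorem nrm_of_isUnit {z : GaussianInt} (h : IsUnit z) : nrm z = 1 := by
  rw [nrm_eq_of_associated (associated_one_iff_isUnit.2 h), nrm_one]

theorem grho_nonneg (Y t : ℝ) : 0 ≤ grho Y t :=
  sum_nonneg fun z _ => div_nonneg zero_le_one (nrm_nonneg z)

theorem gball_subset {s t : ℝ} (h : s ≤ t) : gball s ⊆ gball t := fun _ hz =>
  mem_gball.2 ⟨(mem_gball.1 hz).1, (mem_gball.1 hz).2.trans h⟩

theorem grho_mono (Y : ℝ) : Monotone (grho Y) := fun _ _ h => by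
  classical
  exact sum_le_sum_of_subset_of_nonneg (Finset.filter_subset_filter _ (gball_subset h))
    fun z _ _ => div_nonneg zero_le_one (nrm_nonneg z)

open Classical in
theorem grho_sub_grho {s t : ℝ} (h : s ≤ t) (Y : ℝ) :
    grho Y t - grho Y s = ∑ z ∈ gball t with GRough Y z ∧ s < ell z, 1 / nrm z := by
  rw [sub_eq_iff_eq_add', grho, grho,
    ← sum_filter_add_sum_filter_not {z ∈ gball t | GRough Y z} (fun z => s < ell z),
    add_comm]
  congr 1
  · refine sum_congr ?_ fun _ _ => rfl
    ext z
    simp only [mem_filter, mem_gball]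
    exact ⟨fun h' => ⟨⟨h'.1.1.1, not_lt.1 h'.2⟩, h'.1.2⟩,
      fun h' => ⟨⟨⟨h'.1.1, h'.1.2.trans h⟩, h'.2⟩, not_lt.2 h'.1.2⟩⟩
  · rw [filter_filter]

theorem abs_grho_sub_le {a b : ℝ} (ha : 0 < a) (ha1 : a ≤ 1) (hab : a < b) :
    ∀ᶠ U : ℝ in atTop, ∀ s t, U ^ b ≤ s → s ≤ t →
    |grho (U ^ a) t - grho (U ^ a) s - π * gdens (U ^ a) * (t - s)| ≤
      2 * π * (1 + (t - s)) / U ^ 10 := by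
  classical
  filter_upwards [rough_gsector ha ha1 hab (ha.trans hab), eventually_gt_atTop 0] with U hU hU0 s t hs hst
  have hexp : exp (-U ^ (0 : ℝ)) ≤ π := by
    rw [rpow_zero]
    have : exp (-1) ≤ 1 := exp_le_one_iff.2 (by norm_num)
    linarith [pi_gt_three]
  have key : ∀ s' t', U ^ b ≤ s' → s' ≤ t' →
      |∑ z ∈ gsector 1 π s' t' with GRough (U ^ a) z, 1 / nrm z
        - gdens (U ^ a) * (π * (t' - s'))| ≤ π * (1 + (t' - s')) / U ^ 10 := by
    intro s' t' h1 h2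
    have := hU 1 one_ne_zero π s' t' hexp le_rfl h2 1 one_ne_zero (gRough_one _)
      (by rw [ell_one]; linarith)
    simpa [nrm_one] using this
  have k1 := key s t hs hst
  have k2 := key s s hs le_rfl
  have hsplit : ∑ z ∈ gsector 1 π s t with GRough (U ^ a) z, 1 / nrm z =
      (grho (U ^ a) t - grho (U ^ a) s) +
        ∑ z ∈ gsector 1 π s s with GRough (U ^ a) z, 1 / nrm z := by
    rw [grho_sub_grho hst,
      ← sum_filter_add_sum_filter_not {z ∈ gsector 1 π s t | GRough (U ^ a) z}
        (fun z => s < ell z)]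
    have hpi : ∀ z : GaussianInt, InnerProductGeometry.angle (z : ℂ) 1 ≤ π :=
      fun z => InnerProductGeometry.angle_le_pi _ _
    congr 1
    · refine sum_congr ?_ fun _ _ => rfl
      ext z
      simp only [mem_filter, mem_gball, mem_gsector]
      exact ⟨fun h => ⟨⟨h.1.1.1, h.1.1.2.2.1⟩, h.1.2, h.2⟩,
        fun h => ⟨⟨⟨h.1.1, h.2.2.le, h.1.2, hpi z⟩, h.2.1⟩, h.2.2⟩⟩
    · refine sum_congr ?_ fun _ _ => rfl
      ext z
      simp only [mem_filter, mem_gsector]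
      exact ⟨fun h => ⟨⟨h.1.1.1, h.1.1.2.1, not_lt.1 h.2, hpi z⟩, h.1.2⟩,
        fun h => ⟨⟨⟨h.1.1, h.1.2.1, h.1.2.2.1.trans hst, hpi z⟩, h.2⟩, not_lt.2 h.1.2.2.1⟩⟩
  rw [hsplit] at k1
  rw [sub_self, mul_zero, mul_zero, sub_zero, add_zero] at k2
  have k3 : π * 1 / U ^ 10 ≤ π * (1 + (t - s)) / U ^ 10 := by gcongr; linarith
  rw [abs_le] at *
  have e : 2 * π * (1 + (t - s)) / U ^ 10 = 2 * (π * (1 + (t - s)) / U ^ 10) := by ring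
  rw [e]
  constructor <;> linarith [k1.1, k1.2, k2.1, k2.2]

theorem eventually_grho_le : ∀ᶠ U : ℝ in atTop, ∀ t, t ≤ 2 * U ^ (0.72 : ℝ) →
    grho (U ^ (0.7 : ℝ)) t ≤ U ^ (0.05 : ℝ) := by
  classical
  obtain ⟨C, hC1, hC⟩ := exists_gdens_bound
  filter_upwards [abs_grho_sub_le (a := 0.68) (b := 0.7) (by norm_num) (by norm_num) (by norm_num),
    eventually_const_mul_rpow_le (a := 0) (b := 0.05) (by norm_num) 200,
    eventually_const_mul_rpow_le (a := 0.04) (b := 0.05) (by norm_num) (16 * C),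
    eventually_ge_atTop 1] with U h1 h2 h3 hU1 t ht
  rw [rpow_zero, mul_one] at h2
  have hU0 : 0 < U := by linarith
  obtain ⟨T, hT⟩ : ∃ T, T = 2 * U ^ (0.72 : ℝ) := ⟨_, rfl⟩
  have hTY : U ^ (0.7 : ℝ) ≤ T := by
    have := rpow_le_rpow_of_exponent_le hU1 (show (0.7 : ℝ) ≤ 0.72 by norm_num)
    have := rpow_pos_of_pos hU0 (0.7 : ℝ)
    linarith
  have hmono : U ^ (0.68 : ℝ) ≤ U ^ (0.7 : ℝ) :=
    rpow_le_rpow_of_exponent_le hU1 (by norm_num)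
  have hsplit : grho (U ^ (0.7 : ℝ)) t ≤
      4 + (grho (U ^ (0.68 : ℝ)) T - grho (U ^ (0.68 : ℝ)) (U ^ (0.7 : ℝ))) := by
    rw [grho_sub_grho hTY]
    refine (sum_le_sum_of_subset_of_nonneg (t := gunits ∪
      {z ∈ gball T | GRough (U ^ (0.68 : ℝ)) z ∧ U ^ (0.7 : ℝ) < ell z}) ?_
      fun z _ _ => div_nonneg zero_le_one (nrm_nonneg z)).trans ?_
    · intro z hz
      simp only [mem_filter, mem_gball, mem_union, mem_gunits] at hz ⊢
      by_cases hu : IsUnit z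
      · exact Or.inl hu
      · exact Or.inr ⟨⟨hz.1.1, hz.1.2.trans (hT ▸ ht)⟩, hz.2.mono hmono, hz.2.lt_ell hz.1.1 hu⟩
    · have h4 : ∑ z ∈ gunits, 1 / nrm z = 4 := by
        rw [sum_congr rfl fun z hz => by rw [nrm_of_isUnit (mem_gunits.1 hz)]]
        simp [card_gunits]
      rw [← h4, ← Finset.sum_union_inter]
      exact le_add_of_nonneg_right
        (sum_nonneg fun z _ => div_nonneg zero_le_one (nrm_nonneg z))
  have h5 := (abs_le.1 (h1 _ T le_rfl hTY)).2
  have hV := (hC _ (one_le_rpow hU1 (show (0 : ℝ) ≤ 0.68 by norm_num))).2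
  have hT' : T ≤ 2 * U := by
    rw [hT]
    have := rpow_le_rpow_of_exponent_le hU1 (show (0.72 : ℝ) ≤ 1 by norm_num)
    rw [rpow_one] at this
    linarith
  have hY0 := rpow_pos_of_pos hU0 (0.7 : ℝ)
  have h6 : 2 * π * (1 + (T - U ^ (0.7 : ℝ))) / U ^ 10 ≤ 24 := by
    rw [div_le_iff₀ (by positivity)]
    have : U ≤ U ^ 10 := le_self_pow₀ hU1 (by norm_num)
    nlinarith [pi_lt_four, pi_pos]
  have h7 : π * gdens (U ^ (0.68 : ℝ)) * (T - U ^ (0.7 : ℝ)) ≤ 8 * C * U ^ (0.04 : ℝ) := by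
    calc _ ≤ 4 * (C / U ^ (0.68 : ℝ)) * T := by
          have h0 := (gdens_pos (U ^ (0.68 : ℝ))).le
          have h4 := pi_lt_four.le
          have h6 : T - U ^ (0.7 : ℝ) ≤ T := by linarith
          gcongr
      _ = 8 * C * (U ^ (0.72 : ℝ) / U ^ (0.68 : ℝ)) := by rw [hT]; ring
      _ = _ := by rw [← rpow_sub hU0]; norm_num
  linarith

/-- Asymptotics of the logarithmic count `grho (U ^ 0.7)`. -/
structure RoughCount (U β : ℝ) : Prop where
  one_le : 1 ≤ U
  neg_le_shift : -U ^ (0.72 : ℝ) ≤ β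
  abs_shift_le : |β| ≤ U ^ (0.76 : ℝ)
  grho_le : ∀ t, t ≤ 2 * U ^ (0.72 : ℝ) → grho (U ^ (0.7 : ℝ)) t ≤ U ^ (0.05 : ℝ)
  abs_grho_sub_le : ∀ t, U ^ (0.72 : ℝ) ≤ t → t ≤ 2 * U →
    |grho (U ^ (0.7 : ℝ)) t - π * gdens (U ^ (0.7 : ℝ)) * (t + β)| ≤ 1 / U ^ 8
  le_gdens : 1 / U ^ (0.71 : ℝ) ≤ gdens (U ^ (0.7 : ℝ))
  gdens_le : gdens (U ^ (0.7 : ℝ)) ≤ 1 / U ^ (0.69 : ℝ)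

theorem eventually_exists_roughCount : ∀ᶠ U : ℝ in atTop, ∃ β, RoughCount U β := by
  obtain ⟨C, hC1, hC⟩ := exists_gdens_bound
  filter_upwards [abs_grho_sub_le (a := 0.7) (b := 0.72) (by norm_num) (by norm_num) (by norm_num),
    eventually_grho_le,
    eventually_const_mul_rpow_le (a := 0.7) (b := 0.71) (by norm_num) C,
    eventually_const_mul_rpow_le (a := 0.69) (b := 0.7) (by norm_num) C,
    eventually_ge_atTop 24] with U h1 h2 h3 h4 hU
  have hU0 : 0 < U := by linarith
  have hU1 : 1 ≤ U := by linarith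
  have p (x : ℝ) : 0 < U ^ x := rpow_pos_of_pos hU0 x
  obtain ⟨V, hV⟩ : ∃ V, V = gdens (U ^ (0.7 : ℝ)) := ⟨_, rfl⟩
  have hVC := hC _ (one_le_rpow hU1 (show (0 : ℝ) ≤ 0.7 by norm_num))
  have hV0 : 0 < V := hV ▸ gdens_pos _
  have hV1 : 1 / U ^ (0.71 : ℝ) ≤ V := by
    refine le_trans ?_ (hV ▸ hVC.1)
    exact one_div_le_one_div_of_le (mul_pos (by linarith) (p _)) h3
  have hV2 : V ≤ 1 / U ^ (0.69 : ℝ) := by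
    refine (hV ▸ hVC.2).trans ?_
    rw [div_le_div_iff₀ (p _) (p _)]
    linarith
  obtain ⟨r, hr⟩ : ∃ r, r = grho (U ^ (0.7 : ℝ)) (U ^ (0.72 : ℝ)) := ⟨_, rfl⟩
  have hr0 : 0 ≤ r := hr ▸ grho_nonneg _ _
  have hrU : r ≤ U ^ (0.05 : ℝ) := hr ▸ h2 _ (by linarith [p 0.72])
  have hq0 : 0 ≤ r / (π * V) := by positivity
  have hq : r / (π * V) ≤ U ^ (0.76 : ℝ) := by
    rw [div_le_iff₀ (by positivity)]
    refine hrU.trans ?_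
    calc U ^ (0.05 : ℝ) = U ^ (0.76 : ℝ) * (1 * (1 / U ^ (0.71 : ℝ))) := by
          rw [one_mul, one_div, ← rpow_neg hU0.le, ← rpow_add hU0]; norm_num
      _ ≤ _ := by
          gcongr
          linarith [pi_gt_three]
  refine ⟨r / (π * V) - U ^ (0.72 : ℝ), hU1, by linarith, ?_, h2, ?_, hV ▸ hV1, hV ▸ hV2⟩
  · have := rpow_le_rpow_of_exponent_le hU1 (show (0.72 : ℝ) ≤ 0.76 by norm_num)
    rw [abs_le]
    constructor <;> linarith [p 0.72]
  · intro t ht htU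
    have h := h1 _ t le_rfl ht
    rw [← hr, ← hV] at h
    rw [← hV]
    have e : π * V * (t + (r / (π * V) - U ^ (0.72 : ℝ))) =
      r + π * V * (t - U ^ (0.72 : ℝ)) := by
      field_simp; ring
    rw [e, ← sub_sub]
    refine h.trans ?_
    rw [div_le_div_iff₀ (by positivity) (by positivity), one_mul]
    have h9 : 2 * π * (1 + (t - U ^ (0.72 : ℝ))) ≤ U ^ 2 := by
      nlinarith [pi_lt_four, pi_pos, p 0.72]
    calc _ ≤ U ^ 2 * U ^ 8 := by gcongr
      _ = _ := by ring

/-- The first-quadrant Gaussian primes of log-norm in `(U ^ 0.7, 2 * U]`. -/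
noncomputable def gmid (U : ℝ) : Finset GaussianInt := gprimes (2 * U) \ gprimes (U ^ (0.7 : ℝ))

theorem mem_gmid {U : ℝ} {p : GaussianInt} :
    p ∈ gmid U ↔ GCan p ∧ U ^ (0.7 : ℝ) < ell p ∧ ell p ≤ 2 * U := by
  simp only [gmid, Finset.mem_sdiff, mem_gprimes, not_and, not_le]
  exact ⟨fun h => ⟨h.1.1, h.2 h.1.1, h.1.2⟩, fun h => ⟨⟨h.1, h.2.2⟩, fun _ => h.2.1⟩⟩

theorem gmid_subset (U : ℝ) : gmid U ⊆ gprimes (2 * U) := Finset.sdiff_subset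

open Classical in
/-- The primes of `gmid U` dividing `z`. -/
noncomputable def gfac (U : ℝ) (z : GaussianInt) : Finset GaussianInt := {p ∈ gmid U | p ∣ z}

open Classical in
theorem mem_gfac {U : ℝ} {z p : GaussianInt} : p ∈ gfac U z ↔ p ∈ gmid U ∧ p ∣ z := by
  unfold gfac
  exact mem_filter

theorem gfac_subset (U : ℝ) (z : GaussianInt) : gfac U z ⊆ gmid U :=
  fun _ hp => (mem_gfac.1 hp).1

/-- The alternating sum of `F` over the subset sums of `g` on `P`. -/
noncomputable def altSum {ι : Type*} (g : ι → ℝ) (P : Finset ι) (F : ℝ → ℝ) : ℝ :=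
  ∑ D ∈ P.powerset, (-1) ^ D.card * F (∑ p ∈ D, g p)

theorem altSum_empty {ι : Type*} (g : ι → ℝ) (F : ℝ → ℝ) : altSum g ∅ F = F 0 := by
  simp [altSum]

theorem altSum_insert {ι : Type*} [DecidableEq ι] (g : ι → ℝ) {a : ι} {s : Finset ι} (ha : a ∉ s)
    (F : ℝ → ℝ) : altSum g (insert a s) F = altSum g s fun x => F x - F (x + g a) := by
  rw [altSum, Finset.sum_powerset_insert ha, altSum, ← sum_add_distrib]
  refine sum_congr rfl fun D hD => ?_
  have : a ∉ D := fun h => ha (mem_powerset.1 hD h)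
  rw [card_insert_of_notMem this, Finset.sum_insert this, add_comm (g a)]
  ring

theorem altSum_zero {ι : Type*} (g : ι → ℝ) (s : Finset ι) : altSum g s (fun _ => 0) = 0 := by
  simp [altSum]

theorem altSum_singleton {ι : Type*} (g : ι → ℝ) (a : ι) (F : ℝ → ℝ) :
    altSum g {a} F = F 0 - F (g a) := by
  classical
  rw [← insert_empty_eq, altSum_insert g (Finset.notMem_empty a), altSum_empty, zero_add]

theorem altSum_linear {ι : Type*} (g : ι → ℝ) (P : Finset ι) (t : ℝ) (hP : 2 ≤ P.card) :
    altSum g P (fun x => t - x) = 0 := by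
  classical
  obtain ⟨a, s, ha, rfl, hs⟩ := Finset.card_eq_succ.1 (show P.card = (P.card - 1) + 1 by omega)
  rw [card_insert_of_notMem ha] at hP
  obtain ⟨b, r, hb, rfl, -⟩ := Finset.card_eq_succ.1 (show s.card = (s.card - 1) + 1 by omega)
  rw [altSum_insert g ha, altSum_insert g hb]
  convert altSum_zero g r using 2
  funext x
  ring

theorem sum_gfac_powerset (U : ℝ) (S : Finset GaussianInt) (w : GaussianInt → ℝ)
    (f : Finset GaussianInt → ℝ) [∀ d : GaussianInt, DecidablePred (d ∣ ·)] :
    ∑ z ∈ S, w z * ∑ D ∈ (gfac U z).powerset, f D =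
      ∑ D ∈ (gmid U).powerset, f D * ∑ z ∈ S with ∏ p ∈ D, p ∣ z, w z := by
  have h : ∀ z, (gfac U z).powerset = {D ∈ (gmid U).powerset | ∏ p ∈ D, p ∣ z} := by
    intro z
    ext D
    simp only [mem_powerset, mem_filter]
    refine ⟨fun h => ?_, fun h p hp => ?_⟩
    · have hD := h.trans (gfac_subset U z)
      exact ⟨hD, (prod_dvd_iff_of_subset_gprimes (hD.trans (gmid_subset U))).2
        fun p hp => (mem_gfac.1 (h hp)).2⟩
    · exact mem_gfac.2 ⟨h.1 hp, (Finset.dvd_prod_of_mem _ hp).trans h.2⟩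
  simp_rw [h, sum_filter, mul_sum]
  rw [sum_comm]
  refine sum_congr rfl fun D _ => sum_congr rfl fun z _ => ?_
  split_ifs <;> ring

open Classical in
theorem sum_rough_dvd {Y : ℝ} (T : ℝ) {d : GaussianInt} (hd : d ≠ 0) (hr : GRough Y d) :
    ∑ z ∈ gball T with GRough Y z ∧ d ∣ z, 1 / nrm z = grho Y (T - ell d) / nrm d := by
  rw [grho, Finset.sum_div]
  symm
  refine sum_bij (fun w _ => d * w) ?_ (fun _ _ _ _ h => mul_left_cancel₀ hd h) ?_ ?_
  · intro w hw
    simp only [mem_filter, mem_gball] at hw ⊢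
    refine ⟨⟨mul_ne_zero hd hw.1.1, ?_⟩, (gRough_mul_iff hr).2 hw.2, Dvd.intro _ rfl⟩
    rw [ell_mul hd hw.1.1]; linarith
  · intro z hz
    simp only [mem_filter, mem_gball] at hz
    obtain ⟨⟨h0, h1⟩, h2, w, rfl⟩ := hz
    have hw := right_ne_zero_of_mul h0
    rw [ell_mul hd hw] at h1
    exact ⟨w, by
      simp only [mem_filter, mem_gball]
      exact ⟨⟨hw, by linarith⟩, (gRough_mul_iff hr).1 h2⟩, rfl⟩
  · intro w _
    rw [nrm_mul, div_div, mul_comm]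

theorem gRough_prod {U : ℝ} {D : Finset GaussianInt} (hD : D ⊆ gmid U) :
    GRough (U ^ (0.7 : ℝ)) (∏ p ∈ D, p) := by
  intro q hq hqD
  obtain ⟨p, hp, hqp⟩ := ((mem_gprimes.1 hq).1.1.dvd_finsetProd_iff _).1 hqD
  have h := (mem_gprimes.1 hq).1.eq_of_dvd (mem_gmid.1 (hD hp)).1 hqp
  have h1 := (mem_gprimes.1 hq).2
  have h2 := (mem_gmid.1 (hD hp)).2.1
  rw [← h] at h2
  linarith

theorem prod_injOn_gmid (U : ℝ) :
    Set.InjOn (fun D : Finset GaussianInt => ∏ p ∈ D, p) (gmid U).powerset := by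
  have key : ∀ D ∈ (gmid U).powerset, ∀ E ∈ (gmid U).powerset, ∏ p ∈ D, p = ∏ p ∈ E, p →
      D ⊆ E := by
    intro D hD E hE h p hp
    have hpD := mem_gmid.1 (mem_powerset.1 hD hp)
    have h1 : p ∣ ∏ q ∈ E, q := h ▸ Finset.dvd_prod_of_mem _ hp
    obtain ⟨q, hq, hpq⟩ := (hpD.1.1.dvd_finsetProd_iff _).1 h1
    rwa [hpD.1.eq_of_dvd (mem_gmid.1 (mem_powerset.1 hE hq)).1 hpq]
  exact fun D hD E hE h => (key D hD E hE h).antisymm (key E hE D hD h.symm)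

theorem sum_one_div_nrm_prod_le {U : ℝ} {𝒟 : Finset (Finset GaussianInt)}
    (h𝒟 : 𝒟 ⊆ (gmid U).powerset) {S : Finset GaussianInt} (hS : ∀ D ∈ 𝒟, ∏ p ∈ D, p ∈ S) :
    ∑ D ∈ 𝒟, 1 / nrm (∏ p ∈ D, p) ≤ ∑ z ∈ S, 1 / nrm z := by
  classical
  rw [← Finset.sum_image (f := fun z => 1 / nrm z) (g := fun D => ∏ p ∈ D, p)
    fun D hD E hE h => prod_injOn_gmid U (h𝒟 hD) (h𝒟 hE) h]
  refine sum_le_sum_of_subset_of_nonneg ?_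
    fun z _ _ => div_nonneg zero_le_one (nrm_nonneg z)
  intro z hz
  obtain ⟨D, hD, rfl⟩ := mem_image.1 hz
  exact hS D hD

theorem prod_gmid_ne_zero {U : ℝ} {D : Finset GaussianInt} (hD : D ⊆ gmid U) :
    ∏ p ∈ D, p ≠ 0 := prod_ne_zero_of_subset_gprimes (hD.trans (gmid_subset U))

theorem ell_prod_gmid {U : ℝ} {D : Finset GaussianInt} (hD : D ⊆ gmid U) :
    ell (∏ p ∈ D, p) = ∑ p ∈ D, ell p := ell_prod (hD.trans (gmid_subset U))

theorem gfac_eq_empty_iff {U : ℝ} {z : GaussianInt} (h0 : z ≠ 0) (hz : ell z ≤ 2 * U)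
    (hr : GRough (U ^ (0.7 : ℝ)) z) : gfac U z = ∅ ↔ IsUnit z := by
  refine ⟨fun h => ?_, fun h => ?_⟩
  · by_contra hu
    obtain ⟨p, hp, hpz⟩ := exists_gcan_dvd hu
    have hp1 : p ∈ gmid U := mem_gmid.2 ⟨hp, not_le.1 fun h' => hr p (mem_gprimes.2 ⟨hp, h'⟩) hpz,
      (ell_le_of_dvd h0 hpz).trans hz⟩
    exact Finset.notMem_empty p (h ▸ mem_gfac.2 ⟨hp1, hpz⟩)
  · refine Finset.eq_empty_of_forall_notMem fun p hp => ?_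
    rw [mem_gfac, mem_gmid] at hp
    exact hp.1.1.1.not_isUnit (isUnit_of_dvd_unit hp.2 h)

/-- A rough element with a single prime factor is a prime or divisible by the square of it. -/
theorem associated_or_sq_dvd {U : ℝ} {z p : GaussianInt} (h0 : z ≠ 0) (hz : ell z ≤ 2 * U)
    (hr : GRough (U ^ (0.7 : ℝ)) z) (h : gfac U z = {p}) : Associated p z ∨ p ^ 2 ∣ z := by
  obtain ⟨hp, w, rfl⟩ := mem_gfac.1 (h ▸ Finset.mem_singleton_self p)
  by_cases hu : IsUnit w
  · exact Or.inl (associated_mul_unit_right p w hu)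
  · obtain ⟨q, hq, hqw⟩ := exists_gcan_dvd hu
    have hqz : q ∣ p * w := hqw.mul_left _
    have hq1 : q ∈ gfac U (p * w) := mem_gfac.2 ⟨mem_gmid.2 ⟨hq,
      not_le.1 fun h' => hr q (mem_gprimes.2 ⟨hq, h'⟩) hqz,
      (ell_le_of_dvd h0 hqz).trans hz⟩, hqz⟩
    rw [h, mem_singleton] at hq1
    exact Or.inr (by rw [sq]; exact mul_dvd_mul_left p (hq1 ▸ hqw))

/-- Primes of log-norm in `(U ^ 0.7, 2 * U]` are rough with a single prime factor. -/
theorem rough_of_associated {U : ℝ} {z p : GaussianInt} (hp : p ∈ gmid U) (h : Associated p z) :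
    GRough (U ^ (0.7 : ℝ)) z ∧ gfac U z = {p} := by
  have hp' := mem_gmid.1 hp
  have key : ∀ q, GCan q → q ∣ z → q = p := fun q hq hqz =>
    hq.eq_of_dvd hp'.1 (h.dvd_iff_dvd_right.2 hqz)
  refine ⟨fun q hq hqz => ?_, ?_⟩
  · have h1 := (mem_gprimes.1 hq).2
    rw [key q (mem_gprimes.1 hq).1 hqz] at h1
    linarith
  · ext q
    rw [mem_singleton, mem_gfac]
    exact ⟨fun hq => key q (mem_gmid.1 hq.1).1 hq.2, fun hq => hq ▸ ⟨hp, h.dvd⟩⟩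

open Classical in
/-- The contribution of the rough elements divisible by the square of a prime of `gmid U`. -/
noncomputable def gsq (U : ℝ) : ℝ := ∑ p ∈ gmid U,
  ∑ z ∈ gball (2 * U) with GRough (U ^ (0.7 : ℝ)) z ∧ p ^ 2 ∣ z, 1 / nrm z

theorem one_div_nrm_nonneg (z : GaussianInt) : 0 ≤ 1 / nrm z := div_nonneg zero_le_one (nrm_nonneg z)

theorem RoughCount.grho_two_mul_le {U β : ℝ} (h : RoughCount U β) :
    grho (U ^ (0.7 : ℝ)) (2 * U) ≤ 13 * U := by
  have hU := h.one_le
  have h72 := rpow_le_rpow_of_exponent_le hU (show (0.72 : ℝ) ≤ 1 by norm_num)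
  have h76 := rpow_le_rpow_of_exponent_le hU (show (0.76 : ℝ) ≤ 1 by norm_num)
  rw [rpow_one] at h72 h76
  have h1 := (abs_le.1 (h.abs_grho_sub_le (2 * U) (by linarith) le_rfl)).2
  have h2 : 1 / U ^ 8 ≤ 1 := by
    rw [div_le_one (by positivity)]; exact one_le_pow₀ hU
  have h3 : gdens (U ^ (0.7 : ℝ)) ≤ 1 := by
    refine h.gdens_le.trans ?_
    rw [div_le_one (by positivity)]
    exact one_le_rpow hU (by norm_num)
  have h4 := (abs_le.1 h.abs_shift_le).2
  have h5 := (abs_le.1 h.abs_shift_le).1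
  have h6 : π * gdens (U ^ (0.7 : ℝ)) * (2 * U + β) ≤ 4 * 1 * (2 * U + U) := by
    have := (gdens_pos (U ^ (0.7 : ℝ))).le
    have := pi_lt_four.le
    have : β ≤ U := by linarith
    gcongr
    linarith
  linarith

theorem eventually_gsq_le : ∀ᶠ U : ℝ in atTop, ∀ β, RoughCount U β →
    gsq U ≤ 13 * U ^ 2 * exp (-U ^ (0.7 : ℝ)) := by
  obtain ⟨D, hD0, hD⟩ := exists_sum_gprimes_inv_bound
  filter_upwards [eventually_log_le_rpow (show (0 : ℝ) < 0.5 by norm_num),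
    eventually_const_mul_rpow_le (a := 0.5) (b := 1) (by norm_num) 2,
    eventually_ge_atTop (2 * (D + 2))] with U h1 h2 h3 β hβ
  have hU := hβ.one_le
  rw [rpow_one] at h2
  have hsum : ∑ p ∈ gmid U, 1 / nrm p ≤ U := by
    have h4 := (abs_le.1 (hD (2 * U) (by linarith))).2
    have h5 : ∑ p ∈ gmid U, 1 / nrm p ≤ ∑ p ∈ gprimes (2 * U), 1 / nrm p :=
      sum_le_sum_of_subset_of_nonneg (gmid_subset U) fun z _ _ => one_div_nrm_nonneg z
    have h6 : log (2 * U) = log 2 + log U := log_mul (by norm_num) (by linarith)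
    have h7 := log_two_lt_d9
    linarith
  have h8 := hβ.grho_two_mul_le
  calc gsq U ≤ ∑ p ∈ gmid U, 1 / nrm p * (exp (-U ^ (0.7 : ℝ)) * (13 * U)) := by
        refine sum_le_sum fun p hp => ?_
        have hp' := mem_gmid.1 hp
        have hr : GRough (U ^ (0.7 : ℝ)) (p ^ 2) := fun q hq hqp =>
          (rough_of_associated hp (Associated.refl p)).1 q hq
            ((mem_gprimes.1 hq).1.1.dvd_of_dvd_pow hqp)
        rw [sum_rough_dvd (2 * U) (pow_ne_zero 2 hp'.1.1.ne_zero) hr]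
        have hn := nrm_pos hp'.1.1.ne_zero
        have e : 1 / nrm p ≤ exp (-U ^ (0.7 : ℝ)) := by
          rw [← exp_ell hp'.1.1.ne_zero, one_div, ← exp_neg]
          exact exp_le_exp.2 (by linarith)
        have h9 : grho (U ^ (0.7 : ℝ)) (2 * U - ell (p ^ 2)) ≤ 13 * U :=
          (grho_mono _ (by linarith [ell_nonneg (p ^ 2)])).trans h8
        rw [sq, nrm_mul]
        calc _ = 1 / nrm p * (1 / nrm p * grho (U ^ (0.7 : ℝ)) (2 * U - ell (p * p))) := by
              field_simp
          _ ≤ _ := by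
              rw [sq] at h9
              have := grho_nonneg (U ^ (0.7 : ℝ)) (2 * U - ell (p * p))
              gcongr
    _ = (∑ p ∈ gmid U, 1 / nrm p) * (exp (-U ^ (0.7 : ℝ)) * (13 * U)) := by rw [sum_mul]
    _ ≤ U * (exp (-U ^ (0.7 : ℝ)) * (13 * U)) := by gcongr
    _ = _ := by ring

open Classical in
theorem altSum_linear_eq (U t : ℝ) (z : GaussianInt) : altSum ell (gfac U z) (fun x => t - x) =
    t * (if gfac U z = ∅ then 1 else 0) + ∑ p ∈ gmid U, ell p * if gfac U z = {p} then 1 else 0 := by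
  rcases Nat.lt_or_ge (gfac U z).card 2 with h | h
  · rcases Nat.lt_or_ge (gfac U z).card 1 with h | h
    · have : gfac U z = ∅ := Finset.card_eq_zero.1 (by omega)
      rw [this, altSum_empty, sum_eq_zero]
      · simp
      · intro p _
        rw [if_neg (Finset.singleton_ne_empty p).symm, mul_zero]
    · obtain ⟨q, hq⟩ := Finset.card_eq_one.1 (show (gfac U z).card = 1 by omega)
      have hqm : q ∈ gmid U := gfac_subset U z (hq ▸ Finset.mem_singleton_self q)
      rw [hq, altSum_singleton, if_neg (Finset.singleton_ne_empty q),
        Finset.sum_eq_single_of_mem q hqm]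
      · simp
      · intro p _ hp
        rw [if_neg (fun h => hp (Finset.singleton_injective h).symm), mul_zero]
  · rw [altSum_linear _ _ _ h, if_neg (fun h' => by rw [h'] at h; simp at h), sum_eq_zero]
    · simp
    · intro p _
      rw [if_neg (fun h' => by rw [h'] at h; simp at h), mul_zero]

open Classical in
theorem abs_sum_single_sub_le {U T : ℝ} (hT : T ≤ 2 * U) {p : GaussianInt} (hp : p ∈ gmid U) :
    |∑ z ∈ gball T with GRough (U ^ (0.7 : ℝ)) z ∧ gfac U z = {p}, 1 / nrm z -
      (if ell p ≤ T then 4 / nrm p else 0)| ≤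
      ∑ z ∈ gball (2 * U) with GRough (U ^ (0.7 : ℝ)) z ∧ p ^ 2 ∣ z, 1 / nrm z := by
  have hp0 := (mem_gmid.1 hp).1.1.ne_zero
  rw [← sum_filter_add_sum_filter_not _ (Associated p)]
  have h1 : ∑ z ∈ {z ∈ gball T | GRough (U ^ (0.7 : ℝ)) z ∧ gfac U z = {p}} with Associated p z,
      1 / nrm z = if ell p ≤ T then 4 / nrm p else 0 := by
    split_ifs with h
    · rw [show (4 : ℝ) / nrm p = ∑ u ∈ gunits, 1 / nrm p by
        rw [sum_const, card_gunits, nsmul_eq_mul]; push_cast; ring]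
      symm
      refine sum_bij (fun u _ => p * u) ?_ (fun _ _ _ _ h => mul_left_cancel₀ hp0 h) ?_ ?_
      · intro u hu
        have ha := associated_mul_unit_right p u (mem_gunits.1 hu)
        simp only [mem_filter, mem_gball]
        exact ⟨⟨⟨ha.ne_zero_iff.1 hp0, ell_eq_of_associated ha ▸ h⟩, rough_of_associated hp ha⟩, ha⟩
      · intro z hz
        obtain ⟨u, hu⟩ := (mem_filter.1 hz).2
        exact ⟨u, mem_gunits.2 u.isUnit, hu⟩
      · intro u hu
        rw [nrm_eq_of_associated (associated_mul_unit_right p u (mem_gunits.1 hu))]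
    · refine sum_eq_zero fun z hz => absurd ?_ h
      simp only [mem_filter, mem_gball] at hz
      rw [ell_eq_of_associated hz.2]
      exact hz.1.1.2
  rw [h1, add_sub_cancel_left, abs_of_nonneg (sum_nonneg fun z _ => one_div_nrm_nonneg z)]
  refine sum_le_sum_of_subset_of_nonneg ?_ fun z _ _ => one_div_nrm_nonneg z
  intro z hz
  simp only [mem_filter, mem_gball] at hz ⊢
  have h2 := hz.1.1.2.trans hT
  exact ⟨⟨hz.1.1.1, h2⟩, hz.1.2.1,
    (associated_or_sq_dvd hz.1.1.1 h2 hz.1.2.1 hz.1.2.2).resolve_left hz.2⟩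

open Classical in
theorem abs_sum_altSum_linear_sub_le {U T : ℝ} (t : ℝ) (hT : T ≤ 2 * U) :
    |∑ z ∈ gball T with GRough (U ^ (0.7 : ℝ)) z, 1 / nrm z * altSum ell (gfac U z) (fun x => t - x)
      - (t * (if 0 ≤ T then 4 else 0) + 4 * ∑ p ∈ gmid U with ell p ≤ T, 1 / nrm p * ell p)|
      ≤ 2 * U * gsq U := by
  have e1 : ∑ z ∈ gball T with GRough (U ^ (0.7 : ℝ)) z,
      1 / nrm z * (if gfac U z = ∅ then 1 else 0) = if 0 ≤ T then 4 else 0 := by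
    simp_rw [mul_ite, mul_one, mul_zero]
    rw [← sum_filter]
    split_ifs with h
    · have : {z ∈ {z ∈ gball T | GRough (U ^ (0.7 : ℝ)) z} | gfac U z = ∅} = gunits := by
        ext z
        simp only [mem_filter, mem_gball, mem_gunits]
        refine ⟨fun hz => (gfac_eq_empty_iff hz.1.1.1 (hz.1.1.2.trans hT) hz.1.2).1 hz.2,
          fun hz => ?_⟩
        have h0 := hz.ne_zero
        have hl : ell z ≤ T := by rw [ell, nrm_of_isUnit hz, log_one]; exact h
        have hr : GRough (U ^ (0.7 : ℝ)) z := fun q hq hqz =>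
          (mem_gprimes.1 hq).1.1.not_isUnit (isUnit_of_dvd_unit hqz hz)
        exact ⟨⟨⟨h0, hl⟩, hr⟩, (gfac_eq_empty_iff h0 (hl.trans hT) hr).2 hz⟩
      rw [this, sum_congr rfl fun z hz => by rw [nrm_of_isUnit (mem_gunits.1 hz)]]
      simp [card_gunits]
    · refine sum_eq_zero fun z hz => absurd ?_ h
      simp only [mem_filter, mem_gball] at hz
      exact (ell_nonneg z).trans hz.1.1.2
  have e2 : ∑ z ∈ gball T with GRough (U ^ (0.7 : ℝ)) z,
      1 / nrm z * ∑ p ∈ gmid U, ell p * (if gfac U z = {p} then 1 else 0) =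
      ∑ p ∈ gmid U, ell p *
        ∑ z ∈ gball T with GRough (U ^ (0.7 : ℝ)) z ∧ gfac U z = {p}, 1 / nrm z := by
    simp_rw [← filter_filter, mul_sum]
    rw [sum_comm]
    refine sum_congr rfl fun p _ => ?_
    rw [sum_filter (fun z => gfac U z = {p})]
    refine sum_congr rfl fun z _ => ?_
    split_ifs <;> ring
  have e3 : 4 * ∑ p ∈ gmid U with ell p ≤ T, 1 / nrm p * ell p =
      ∑ p ∈ gmid U, ell p * if ell p ≤ T then 4 / nrm p else 0 := by
    rw [sum_filter, mul_sum]
    refine sum_congr rfl fun p _ => ?_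
    split_ifs <;> ring
  simp_rw [altSum_linear_eq, mul_add, sum_add_distrib]
  rw [e2, e3, sum_congr rfl fun z _ => mul_left_comm _ t _, ← mul_sum, e1,
    add_sub_add_left_eq_sub, ← sum_sub_distrib, gsq, mul_sum]
  refine (abs_sum_le_sum_abs _ _).trans (sum_le_sum fun p hp => ?_)
  rw [← mul_sub, abs_mul, abs_of_nonneg (ell_nonneg p)]
  have := (mem_gmid.1 hp).2.2
  exact mul_le_mul this (abs_sum_single_sub_le hT hp) (abs_nonneg _) ((ell_nonneg p).trans this)

/-- The sieve-weighted moments `∑ (-1) ^ |D| (t - ℓ(D))₊ ^ k / N(D)`. -/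
noncomputable def gmom (k : ℕ) (U t : ℝ) : ℝ := ∑ D ∈ (gmid U).powerset,
  (-1) ^ D.card * max (t - ell (∏ p ∈ D, p)) 0 ^ k / nrm (∏ p ∈ D, p)

theorem RoughCount.grho_sub_le {U β : ℝ} (h : RoughCount U β) {s t : ℝ} (hst : s ≤ t)
    (ht : t ≤ 2 * U) : grho (U ^ (0.7 : ℝ)) t - grho (U ^ (0.7 : ℝ)) s ≤
      π * gdens (U ^ (0.7 : ℝ)) * (t - s) + 3 * U ^ (0.05 : ℝ) := by
  have hU := h.one_le
  obtain ⟨V, hV⟩ : ∃ V, V = π * gdens (U ^ (0.7 : ℝ)) := ⟨_, rfl⟩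
  have hV0 : 0 < V := hV ▸ mul_pos pi_pos (gdens_pos _)
  have h1 : 1 ≤ U ^ (0.05 : ℝ) := one_le_rpow hU (by norm_num)
  have h8 : 1 / U ^ 8 ≤ 1 := by
    rw [div_le_one (by positivity)]; exact one_le_pow₀ hU
  have hp : 0 < U ^ (0.72 : ℝ) := rpow_pos_of_pos (by linarith) _
  have h72 := rpow_le_rpow_of_exponent_le hU (show (0.72 : ℝ) ≤ 1 by norm_num)
  rw [rpow_one] at h72
  have hs := grho_nonneg (U ^ (0.7 : ℝ)) s
  have hVst : 0 ≤ V * (t - s) := mul_nonneg hV0.le (by linarith)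
  have key := h.abs_grho_sub_le
  rw [← hV] at key ⊢
  rcases le_total t (U ^ (0.72 : ℝ)) with ht0 | ht0
  · have := h.grho_le t (by linarith)
    linarith
  · have k1 := abs_le.1 (key t ht0 ht)
    rcases le_total s (U ^ (0.72 : ℝ)) with hs0 | hs0
    · have k2 := abs_le.1 (key _ le_rfl (by linarith))
      have k3 := h.grho_le (U ^ (0.72 : ℝ)) (by linarith)
      have k4 : V * (t + β) - V * (U ^ (0.72 : ℝ) + β) ≤ V * (t - s) := by
        rw [← mul_sub]
        exact mul_le_mul_of_nonneg_left (by linarith) hV0.le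
      linarith [k1.1, k1.2, k2.1, k2.2]
    · have k2 := abs_le.1 (key s hs0 (by linarith))
      linarith [k1.1, k1.2, k2.1, k2.2]

theorem sum_window_le (U : ℝ) {s t : ℝ} (hst : s ≤ t) :
    ∑ D ∈ (gmid U).powerset with s < ell (∏ p ∈ D, p) ∧ ell (∏ p ∈ D, p) ≤ t,
      1 / nrm (∏ p ∈ D, p) ≤ grho (U ^ (0.7 : ℝ)) t - grho (U ^ (0.7 : ℝ)) s := by
  classical
  rw [grho_sub_grho hst]
  refine sum_one_div_nrm_prod_le (filter_subset _ _) fun D hD => ?_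
  rw [mem_filter, mem_powerset] at hD
  exact mem_filter.2 ⟨mem_gball.2 ⟨prod_gmid_ne_zero hD.1, hD.2.2⟩, gRough_prod hD.1, hD.2.1⟩

theorem sum_ball_le (U t : ℝ) :
    ∑ D ∈ (gmid U).powerset with ell (∏ p ∈ D, p) ≤ t, 1 / nrm (∏ p ∈ D, p) ≤
      grho (U ^ (0.7 : ℝ)) t := by
  classical
  refine sum_one_div_nrm_prod_le (filter_subset _ _) fun D hD => ?_
  rw [mem_filter, mem_powerset] at hD
  exact mem_filter.2 ⟨mem_gball.2 ⟨prod_gmid_ne_zero hD.1, hD.2⟩, gRough_prod hD.1⟩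

open Classical in
theorem sum_altSum_linear_eq (U T t : ℝ) :
    ∑ z ∈ gball T with GRough (U ^ (0.7 : ℝ)) z, 1 / nrm z * altSum ell (gfac U z) (fun x => t - x)
      = ∑ D ∈ (gmid U).powerset, (-1) ^ D.card * (t - ell (∏ p ∈ D, p)) *
        (grho (U ^ (0.7 : ℝ)) (T - ell (∏ p ∈ D, p)) / nrm (∏ p ∈ D, p)) := by
  unfold altSum
  rw [sum_gfac_powerset U _ (fun z => 1 / nrm z)
    (fun D => (-1) ^ D.card * (t - ∑ p ∈ D, ell p))]
  refine sum_congr rfl fun D hD => ?_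
  rw [mem_powerset] at hD
  rw [filter_filter, sum_rough_dvd T (prod_gmid_ne_zero hD) (gRough_prod hD),
    ell_prod_gmid hD]

theorem abs_sum_gmid_log_sub_le : ∃ C, 0 ≤ C ∧ ∀ U T : ℝ, 1 ≤ U → 0 ≤ T → T ≤ 2 * U →
    |∑ p ∈ gmid U with ell p ≤ T, 1 / nrm p * ell p - T| ≤ U ^ (0.7 : ℝ) + C := by
  obtain ⟨C, hC0, hC⟩ := exists_sum_gprimes_log_bound
  refine ⟨2 * C, by linarith, fun U T hU hT hTU => ?_⟩
  have hY : 0 < U ^ (0.7 : ℝ) := rpow_pos_of_pos (by linarith) _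
  rcases le_total T (U ^ (0.7 : ℝ)) with h | h
  · rw [Finset.filter_false_of_mem fun p hp => not_le.2 (h.trans_lt (mem_gmid.1 hp).2.1),
      Finset.sum_empty, zero_sub, abs_neg, abs_of_nonneg hT]
    linarith
  · have e : (gmid U).filter (fun p => ell p ≤ T) = gprimes T \ gprimes (U ^ (0.7 : ℝ)) := by
      ext p
      simp only [mem_filter, mem_gmid, Finset.mem_sdiff, mem_gprimes, not_and, not_le]
      exact ⟨fun h => ⟨⟨h.1.1, h.2⟩, fun _ => h.1.2.1⟩,
        fun h => ⟨⟨h.1.1, h.2 h.1.1, h.1.2.trans hTU⟩, h.1.2⟩⟩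
    have hsub : gprimes (U ^ (0.7 : ℝ)) ⊆ gprimes T := fun p hp =>
      mem_gprimes.2 ⟨(mem_gprimes.1 hp).1, (mem_gprimes.1 hp).2.trans h⟩
    rw [e]
    have h1 := Finset.sum_sdiff hsub (f := fun p => 1 / nrm p * ell p)
    have h2 := abs_le.1 (hC T hT)
    have h3 := abs_le.1 (hC _ hY.le)
    rw [abs_le]
    constructor <;> linarith [h2.1, h2.2, h3.1, h3.2]

theorem abs_altSum_sub_gmom_le {U β t : ℝ} (h : RoughCount U β) (htU : t ≤ U)
    (hU : 2 * U ^ (0.76 : ℝ) ≤ U) :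
    |∑ D ∈ (gmid U).powerset, (-1) ^ D.card * (t - ell (∏ p ∈ D, p)) *
        (grho (U ^ (0.7 : ℝ)) (t - β - ell (∏ p ∈ D, p)) / nrm (∏ p ∈ D, p)) -
      π * gdens (U ^ (0.7 : ℝ)) * gmom 2 U t| ≤ 200 * U ^ (0.9 : ℝ) + 26 := by
  have hU1 := h.one_le
  have hU0 : 0 < U := by linarith
  obtain ⟨V, hV⟩ : ∃ V, V = π * gdens (U ^ (0.7 : ℝ)) := ⟨_, rfl⟩
  have hV0 : 0 < V := hV ▸ mul_pos pi_pos (gdens_pos _)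
  obtain ⟨a, ha⟩ : ∃ a, a = U ^ (0.76 : ℝ) := ⟨_, rfl⟩
  obtain ⟨v, hv⟩ : ∃ v, v = U ^ (0.07 : ℝ) := ⟨_, rfl⟩
  obtain ⟨s, hs⟩ : ∃ s, s = U ^ (0.72 : ℝ) := ⟨_, rfl⟩
  have ha0 : 0 < a := ha ▸ rpow_pos_of_pos hU0 _
  have hv0 : 0 < v := hv ▸ rpow_pos_of_pos hU0 _
  have hs0 : 0 < s := hs ▸ rpow_pos_of_pos hU0 _
  have hsa : s ≤ a := by
    rw [hs, ha]; exact rpow_le_rpow_of_exponent_le hU1 (by norm_num)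
  have huv : U ^ (0.05 : ℝ) ≤ v := by
    rw [hv]; exact rpow_le_rpow_of_exponent_le hU1 (by norm_num)
  have hVa : V * a ≤ 4 * v := by
    have : v = 1 / U ^ (0.69 : ℝ) * a := by
      rw [hv, ha, one_div, ← rpow_neg hU0.le, ← rpow_add hU0]; norm_num
    rw [this, ← mul_assoc, hV]
    have h1 := h.gdens_le
    have := (gdens_pos (U ^ (0.7 : ℝ))).le
    have := pi_lt_four.le
    gcongr
  have hav : a * v * v = U ^ (0.9 : ℝ) := by
    rw [ha, hv, ← rpow_add hU0, ← rpow_add hU0]; norm_num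
  have hβ := abs_le.1 h.abs_shift_le
  have hβs := h.neg_le_shift
  rw [← ha] at hβ hU
  rw [← hs] at hβs
  obtain ⟨M, hM⟩ : ∃ M, M = max (t - β) t := ⟨_, rfl⟩
  have hM1 : t - β ≤ M := hM ▸ le_max_left _ _
  have hM2 : t ≤ M := hM ▸ le_max_right _ _
  have hM3 : M ≤ t + a := hM ▸ max_le (by linarith) (by linarith)
  have hM4 : M - (t - β - s) ≤ 2 * a := by
    have : M ≤ 2 * a + (t - β - s) := hM ▸ max_le (by linarith) (by linarith)
    linarith
  have hpt : ∀ x : ℝ, 0 ≤ x → |(t - x) * grho (U ^ (0.7 : ℝ)) (t - β - x) - V * max (t - x) 0 ^ 2| ≤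
      (if x ≤ 2 * U then 2 / U ^ 7 else 0) +
        18 * (a * v) * (if t - β - s < x ∧ x ≤ M then 1 else 0) := by
    intro x hx
    have eM : (t - x) * grho (U ^ (0.7 : ℝ)) (t - β - x) - V * max (t - x) 0 ^ 2 =
        (t - x) * (grho (U ^ (0.7 : ℝ)) (t - β - x) - V * max (t - x) 0) := by
      have : max (t - x) 0 ^ 2 = (t - x) * max (t - x) 0 := by
        rcases le_total (t - x) 0 with h | h
        · rw [max_eq_right h]; ring
        · rw [max_eq_left h]; ring
      rw [this]; ring
    rw [eM, abs_mul]
    rcases le_or_gt x (t - β - s) with hx1 | hx1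
    · have htx : 0 ≤ t - x := by linarith
      rw [if_pos (by linarith), if_neg (fun h => by linarith [h.1]), max_eq_left htx,
        abs_of_nonneg htx]
      have k := h.abs_grho_sub_le (t - β - x) (by rw [← hs]; linarith) (by linarith)
      rw [← hV, show t - β - x + β = t - x by ring] at k
      calc _ ≤ (2 * U) * (1 / U ^ 8) := by gcongr; linarith
        _ = 2 / U ^ 7 + 18 * (a * v) * 0 := by field_simp; ring
    · rcases le_or_gt x M with hx2 | hx2
      · rw [if_pos (⟨hx1, hx2⟩ : t - β - s < x ∧ x ≤ M)]
        have k1 := h.grho_le (t - β - x) (by rw [← hs]; linarith)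
        have k2 := grho_nonneg (U ^ (0.7 : ℝ)) (t - β - x)
        have k3 : |t - x| ≤ 2 * a := abs_le.2 ⟨by linarith, by linarith⟩
        have k4 : V * max (t - x) 0 ≤ 8 * v := by
          calc V * max (t - x) 0 ≤ V * (2 * a) := by
                refine mul_le_mul_of_nonneg_left (max_le ((le_abs_self _).trans k3) ?_) hV0.le
                linarith
            _ ≤ _ := by linarith
        have k5 : 0 ≤ V * max (t - x) 0 := mul_nonneg hV0.le (le_max_right _ _)
        have k6 : |grho (U ^ (0.7 : ℝ)) (t - β - x) - V * max (t - x) 0| ≤ 9 * v :=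
          abs_le.2 ⟨by linarith, by linarith⟩
        calc _ ≤ (2 * a) * (9 * v) := by gcongr
          _ ≤ _ := by
            have : (0 : ℝ) ≤ if x ≤ 2 * U then 2 / U ^ 7 else 0 := by split_ifs <;> positivity
            linarith
      · have e1 : grho (U ^ (0.7 : ℝ)) (t - β - x) = 0 := by
          classical
          refine sum_eq_zero fun z hz => ?_
          rw [mem_filter, mem_gball] at hz
          linarith [ell_nonneg z, hz.1.2]
        rw [e1, max_eq_right (by linarith)]
        simp only [mul_zero, sub_zero, abs_zero]
        positivity
  rw [← hV, gmom, mul_sum, ← sum_sub_distrib]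
  calc _ ≤ ∑ D ∈ (gmid U).powerset, ((if ell (∏ p ∈ D, p) ≤ 2 * U then 2 / U ^ 7 else 0) +
        18 * (a * v) * (if t - β - s < ell (∏ p ∈ D, p) ∧ ell (∏ p ∈ D, p) ≤ M then 1 else 0)) *
          (1 / nrm (∏ p ∈ D, p)) := by
        refine (abs_sum_le_sum_abs _ _).trans (sum_le_sum fun D _ => ?_)
        refine le_trans (le_of_eq ?_) (mul_le_mul_of_nonneg_right (hpt _ (ell_nonneg (∏ p ∈ D, p)))
          (one_div_nrm_nonneg _))
        rw [show ∀ e x g n y : ℝ, e * x * (g / n) - V * (e * y / n) = e * ((x * g - V * y) * (1 / n))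
          from fun e x g n y => by ring, abs_mul, abs_neg_one_pow, one_mul, abs_mul,
          abs_of_nonneg (one_div_nrm_nonneg _)]
    _ = 2 / U ^ 7 * ∑ D ∈ (gmid U).powerset with ell (∏ p ∈ D, p) ≤ 2 * U, 1 / nrm (∏ p ∈ D, p) +
        18 * (a * v) * ∑ D ∈ (gmid U).powerset with
          t - β - s < ell (∏ p ∈ D, p) ∧ ell (∏ p ∈ D, p) ≤ M, 1 / nrm (∏ p ∈ D, p) := by
        rw [sum_filter, sum_filter, mul_sum, mul_sum,
          ← sum_add_distrib]
        refine sum_congr rfl fun D _ => ?_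
        split_ifs <;> ring
    _ ≤ 2 / U ^ 7 * (13 * U) + 18 * (a * v) * (11 * v) := by
        have k1 := (sum_ball_le U (2 * U)).trans h.grho_two_mul_le
        have k2 := (sum_window_le U (show t - β - s ≤ M by linarith)).trans
          (h.grho_sub_le (by linarith) (by linarith))
        rw [← hV] at k2
        have k3 : V * (M - (t - β - s)) ≤ V * (2 * a) := mul_le_mul_of_nonneg_left hM4 hV0.le
        have k4 : ∑ D ∈ (gmid U).powerset with
          t - β - s < ell (∏ p ∈ D, p) ∧ ell (∏ p ∈ D, p) ≤ M, 1 / nrm (∏ p ∈ D, p) ≤ 11 * v := by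
          linarith
        gcongr
    _ ≤ _ := by
        have : 2 / U ^ 7 * (13 * U) ≤ 26 := by
          rw [div_mul_eq_mul_div, div_le_iff₀ (by positivity)]
          have : U ≤ U ^ 7 := le_self_pow₀ hU1 (by norm_num)
          linarith
        have : 0 < U ^ (0.9 : ℝ) := rpow_pos_of_pos hU0 _
        linarith

theorem eventually_abs_gmom_two_sub_le : ∀ᶠ U : ℝ in atTop, ∀ β, RoughCount U β →
    ∀ t, 0 ≤ t → t ≤ U →
      |π * gdens (U ^ (0.7 : ℝ)) * gmom 2 U t - 8 * t| ≤ U ^ (0.95 : ℝ) := by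
  classical
  obtain ⟨C, hC0, hC⟩ := abs_sum_gmid_log_sub_le
  filter_upwards [eventually_gsq_le,
    eventually_const_mul_rpow_le (a := 0.76) (b := 1) (by norm_num) 2,
    eventually_const_mul_rpow_le (a := 0.9) (b := 0.95) (by norm_num) 400,
    eventually_const_mul_rpow_le (a := 0) (b := 0.95) (by norm_num) (4 * (4 * C + 52)),
    eventually_const_mul_log_mul_rpow_le (a := 0) (b := 0.7) (by norm_num) 3] with
    U h1 h2 h3 h4 h5 β h t ht htU
  have hU1 := h.one_le
  have hU0 : 0 < U := by linarith
  rw [rpow_one] at h2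
  rw [rpow_zero, mul_one] at h4 h5
  have hβ := abs_le.1 h.abs_shift_le
  have k1 := abs_altSum_sub_gmom_le h htU h2
  have k2 := abs_sum_altSum_linear_sub_le (U := U) (T := t - β) t (by linarith)
  rw [sum_altSum_linear_eq] at k2
  have k3 : 2 * U * gsq U ≤ 26 := by
    have : exp (-U ^ (0.7 : ℝ)) ≤ 1 / U ^ 3 := by
      rw [one_div, ← exp_log (pow_pos hU0 3), ← exp_neg, exp_le_exp, log_pow]
      push_cast; linarith
    calc _ ≤ 2 * U * (13 * U ^ 2 * (1 / U ^ 3)) := by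
          have := h1 β h
          gcongr
          exact this.trans (by gcongr)
      _ = 26 := by field_simp; ring
  have e70 := rpow_le_rpow_of_exponent_le hU1 (show (0.7 : ℝ) ≤ 0.9 by norm_num)
  have e76 := rpow_le_rpow_of_exponent_le hU1 (show (0.76 : ℝ) ≤ 0.9 by norm_num)
  have k4 : |t * (if 0 ≤ t - β then 4 else 0) +
      4 * ∑ p ∈ gmid U with ell p ≤ t - β, 1 / nrm p * ell p - 8 * t| ≤
      12 * U ^ (0.9 : ℝ) + 4 * C := by
    split_ifs with h0
    · have := abs_le.1 (hC U (t - β) hU1 h0 (by linarith))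
      rw [abs_le]
      constructor <;> linarith [this.1, this.2]
    · rw [sum_eq_zero fun p hp => absurd ((ell_nonneg p).trans (mem_filter.1 hp).2) h0,
        abs_le]
      constructor <;> linarith
  rw [abs_le] at *
  constructor <;> linarith [k1.1, k1.2, k2.1, k2.2, k4.1, k4.2]

theorem hasDerivAt_max_zero_pow_three (x : ℝ) :
    HasDerivAt (fun x : ℝ => max x 0 ^ 3) (3 * max x 0 ^ 2) x := by
  have h := ((hasDerivAt_pow 3 x).add (hasDerivAt_abs_rpow x (p := 3) (by norm_num))).div_const 2
  refine (h.congr_deriv ?_).congr_of_eventuallyEq (Eventually.of_forall fun y => ?_)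
  · rw [show (3 : ℝ) - 2 = 1 by norm_num, rpow_one]
    rcases le_total 0 x with h | h
    · rw [max_eq_left h, abs_of_nonneg h]; push_cast; ring
    · rw [max_eq_right h, abs_of_nonpos h]; push_cast; ring
  · simp only [Pi.add_apply]
    rw [show (3 : ℝ) = (3 : ℕ) by norm_num, rpow_natCast]
    rcases le_total 0 y with h | h
    · rw [max_eq_left h, abs_of_nonneg h]; ring
    · rw [max_eq_right h, abs_of_nonpos h]; ring

theorem hasDerivAt_gmom_three (U t : ℝ) : HasDerivAt (gmom 3 U) (3 * gmom 2 U t) t := by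
  unfold gmom
  rw [mul_sum]
  refine (HasDerivAt.fun_sum fun D _ => ?_)
  have h := (((hasDerivAt_max_zero_pow_three (t - ell (∏ p ∈ D, p))).comp t
    ((hasDerivAt_id t).sub_const _)).const_mul ((-1) ^ D.card)).div_const (nrm (∏ p ∈ D, p))
  refine (h.congr_deriv ?_)
  ring

theorem eventually_abs_gmom_three_sub_le : ∀ᶠ U : ℝ in atTop, ∀ β, RoughCount U β →
    |π * gdens (U ^ (0.7 : ℝ)) * gmom 3 U U - 12 * U ^ 2| ≤ 3 * U ^ (1.95 : ℝ) := by
  filter_upwards [eventually_abs_gmom_two_sub_le] with U h β hβ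
  have hU : 0 ≤ U := by linarith [hβ.one_le]
  have hd : ∀ t ∈ Set.Icc 0 U, HasDerivWithinAt
      (fun t => π * gdens (U ^ (0.7 : ℝ)) * gmom 3 U t - 12 * t ^ 2)
      (3 * (π * gdens (U ^ (0.7 : ℝ)) * gmom 2 U t - 8 * t)) (Set.Icc 0 U) t := fun t _ => by
    refine HasDerivAt.hasDerivWithinAt ?_
    refine (((hasDerivAt_gmom_three U t).const_mul _).sub
      ((hasDerivAt_pow 2 t).const_mul 12)).congr_deriv ?_
    push_cast; ring
  have key := (convex_Icc (0 : ℝ) U).norm_image_sub_le_of_norm_hasDerivWithin_le hd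
    (C := 3 * U ^ (0.95 : ℝ)) (fun t ht => by
      rw [norm_eq_abs, abs_mul, abs_of_nonneg (show (0 : ℝ) ≤ 3 by norm_num)]
      have := h β hβ t ht.1 ht.2
      linarith) (Set.left_mem_Icc.2 hU) (Set.right_mem_Icc.2 hU)
  have h0 : gmom 3 U 0 = 0 := sum_eq_zero fun D _ => by
    rw [max_eq_right (by linarith [ell_nonneg (∏ p ∈ D, p)])]
    simp
  rw [h0, sub_zero, norm_eq_abs, norm_of_nonneg hU] at key
  refine le_trans (le_of_eq (by ring_nf)) (key.trans (le_of_eq ?_))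
  rw [mul_assoc, ← rpow_add_one (by linarith [hβ.one_le])]
  norm_num

open Classical in
/-- Divisor switching: the weight of the large squarefree divisors is that of their complements. -/
theorem sum_large_dvd_le {U v : ℝ} (T : Finset GaussianInt) (hT : ∀ z ∈ T, z ≠ 0 ∧ ell z ≤ U) :
    ∑ D ∈ (gmid U).powerset with v < ell (∏ p ∈ D, p),
      ∑ z ∈ T with ∏ p ∈ D, p ∣ z, 1 / nrm z ≤
    ∑ D ∈ (gmid U).powerset with ell (∏ p ∈ D, p) ≤ U - v,
      ∑ z ∈ T with ∏ p ∈ D, p ∣ z, 1 / nrm z := by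
  have key : ∀ Q : ℝ → Prop, ∑ D ∈ (gmid U).powerset with Q (ell (∏ p ∈ D, p)),
      ∑ z ∈ T with ∏ p ∈ D, p ∣ z, 1 / nrm z =
      ∑ z ∈ T, 1 / nrm z * ∑ D ∈ (gfac U z).powerset, if Q (∑ p ∈ D, ell p) then (1 : ℝ) else 0 := by
    intro Q
    rw [sum_gfac_powerset U T (fun z => 1 / nrm z), sum_filter]
    refine sum_congr rfl fun D hD => ?_
    rw [ell_prod_gmid (mem_powerset.1 hD)]
    split_ifs <;> simp
  rw [key (fun x => v < x), key (fun x => x ≤ U - v)]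
  refine sum_le_sum fun z hz => mul_le_mul_of_nonneg_left ?_ (one_div_nrm_nonneg z)
  rw [← sum_filter, ← sum_filter, sum_const, sum_const, nsmul_one,
    nsmul_one]
  refine Nat.cast_le.2 (Finset.card_le_card_of_injOn (fun D => gfac U z \ D) (fun D hD => ?_)
    fun D hD E hE h => ?_)
  · rw [Finset.mem_coe, mem_filter, mem_powerset] at *
    refine ⟨Finset.sdiff_subset, ?_⟩
    have h1 := Finset.sum_sdiff hD.1 (f := ell)
    have h2 : ∑ p ∈ gfac U z, ell p ≤ ell z := by
      rw [← ell_prod_gmid (gfac_subset U z)]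
      exact ell_le_of_dvd (hT z hz).1 ((prod_dvd_iff_of_subset_gprimes
        ((gfac_subset U z).trans (gmid_subset U))).2 fun p hp => (mem_gfac.1 hp).2)
    linarith [(hT z hz).2, hD.2]
  · rw [Finset.mem_coe, mem_filter, mem_powerset] at hD hE
    rw [← Finset.sdiff_sdiff_eq_self hD.1, ← Finset.sdiff_sdiff_eq_self hE.1]
    exact congrArg _ h

open Classical in
/-- The rough elements of a sector. -/
noncomputable def rsec (ω : ℂ) (α u₀ U : ℝ) : Finset GaussianInt :=
  {z ∈ gsector ω α u₀ U | GRough (U ^ (0.7 : ℝ)) z}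

theorem mem_rsec {ω : ℂ} {α u₀ U : ℝ} {z : GaussianInt} : z ∈ rsec ω α u₀ U ↔
    z ∈ gsector ω α u₀ U ∧ GRough (U ^ (0.7 : ℝ)) z := by
  classical exact mem_filter

theorem abs_sum_altSum_sub_le {ω : ℂ} {α K U R e : ℝ} {k : ℕ} (hK : 0 ≤ K) (hU : 0 ≤ U)
    (hKU : K ≤ U ^ (0.72 : ℝ)) (hU4 : 4 * U ^ (0.72 : ℝ) ≤ U) (hk : k ≠ 0)
    (hR : 0 ≤ R) (he : 0 ≤ e)
    (h : open Classical in ∀ D ∈ (gmid U).powerset,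
      ell (∏ p ∈ D, p) ≤ U - (K + U ^ (0.72 : ℝ)) →
      |∑ z ∈ rsec ω α (U - K) U with ∏ p ∈ D, p ∣ z, 1 / nrm z - R * (1 / nrm (∏ p ∈ D, p))| ≤
        e * (1 / nrm (∏ p ∈ D, p))) :
    |∑ z ∈ rsec ω α (U - K) U, 1 / nrm z * altSum ell (gfac U z) (fun x => (U - x) ^ k) -
      R * gmom k U U| ≤ U ^ k * e * grho (U ^ (0.7 : ℝ)) (2 * U) + (2 * U ^ (0.72 : ℝ)) ^ k *
        ((R + e) * grho (U ^ (0.7 : ℝ)) (2 * U ^ (0.72 : ℝ)) +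
          R * (grho (U ^ (0.7 : ℝ)) U - grho (U ^ (0.7 : ℝ)) (U - 2 * U ^ (0.72 : ℝ)))) := by
  classical
  obtain ⟨s, hs⟩ : ∃ s, s = U ^ (0.72 : ℝ) := ⟨_, rfl⟩
  obtain ⟨v, hv⟩ : ∃ v, v = U - (K + s) := ⟨_, rfl⟩
  rw [← hs] at h hKU hU4 ⊢
  rw [← hv] at h
  have hs0 : 0 ≤ s := hK.trans hKU
  obtain ⟨I, hI⟩ : ∃ I : Finset GaussianInt → ℝ, I = fun D =>
    ∑ z ∈ rsec ω α (U - K) U with ∏ p ∈ D, p ∣ z, 1 / nrm z := ⟨_, rfl⟩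
  have hI0 : ∀ D, 0 ≤ I D := fun D => hI ▸ sum_nonneg fun z _ => one_div_nrm_nonneg z
  have hT : ∀ z ∈ rsec ω α (U - K) U, z ≠ 0 ∧ ell z ≤ U := fun z hz => by
    have := mem_gsector.1 (mem_rsec.1 hz).1
    exact ⟨this.1, this.2.2.1⟩
  have htail : ∑ D ∈ (gmid U).powerset with v < ell (∏ p ∈ D, p), I D ≤
      (R + e) * grho (U ^ (0.7 : ℝ)) (2 * s) := by
    rw [hI]
    refine (sum_large_dvd_le _ hT).trans ?_
    calc _ ≤ ∑ D ∈ (gmid U).powerset with ell (∏ p ∈ D, p) ≤ U - v,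
          (R + e) * (1 / nrm (∏ p ∈ D, p)) := by
          refine sum_le_sum fun D hD => ?_
          rw [mem_filter] at hD
          have := (abs_le.1 (h D hD.1 (by linarith [hD.2]))).2
          linarith
      _ ≤ _ := by
          rw [← mul_sum]
          exact mul_le_mul_of_nonneg_left ((sum_ball_le U _).trans (grho_mono _ (by linarith)))
            (by linarith)
  have hwin : ∑ D ∈ (gmid U).powerset with v < ell (∏ p ∈ D, p) ∧ ell (∏ p ∈ D, p) ≤ U,
      1 / nrm (∏ p ∈ D, p) ≤ grho (U ^ (0.7 : ℝ)) U - grho (U ^ (0.7 : ℝ)) (U - 2 * s) := by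
    refine (sum_window_le U (by linarith)).trans ?_
    have := grho_mono (U ^ (0.7 : ℝ)) (show U - 2 * s ≤ v by linarith)
    linarith
  have hball := sum_ball_le U (2 * U)
  have hpt : ∀ D ∈ (gmid U).powerset,
      |(-1) ^ D.card * (U - ell (∏ p ∈ D, p)) ^ k * I D -
        R * ((-1) ^ D.card * max (U - ell (∏ p ∈ D, p)) 0 ^ k / nrm (∏ p ∈ D, p))| ≤
      U ^ k * e * (if ell (∏ p ∈ D, p) ≤ 2 * U then 1 / nrm (∏ p ∈ D, p) else 0) +
      (2 * s) ^ k * ((if v < ell (∏ p ∈ D, p) then I D else 0) +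
        R * (if v < ell (∏ p ∈ D, p) ∧ ell (∏ p ∈ D, p) ≤ U then 1 / nrm (∏ p ∈ D, p) else 0)) := by
    intro D hD
    have hw := one_div_nrm_nonneg (∏ p ∈ D, p)
    have hx0 := ell_nonneg (∏ p ∈ D, p)
    have hh := h D hD
    have hID : U < ell (∏ p ∈ D, p) → I D = 0 := fun hlt => by
      rw [hI]
      refine sum_eq_zero fun z hz => ?_
      rw [mem_filter] at hz
      have := hT z hz.1
      linarith [ell_le_of_dvd this.1 hz.2]
    have hI1 : I D = ∑ z ∈ rsec ω α (U - K) U with ∏ p ∈ D, p ∣ z, 1 / nrm z := by rw [hI]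
    rw [← hI1] at hh
    obtain ⟨x, hx⟩ : ∃ x, x = ell (∏ p ∈ D, p) := ⟨_, rfl⟩
    obtain ⟨w, hw'⟩ : ∃ w, w = 1 / nrm (∏ p ∈ D, p) := ⟨_, rfl⟩
    rw [show ∀ a b : ℝ, (-1) ^ D.card * a ^ k * I D -
        R * ((-1) ^ D.card * b ^ k / nrm (∏ p ∈ D, p)) = (-1) ^ D.card *
          (a ^ k * I D - R * (1 / nrm (∏ p ∈ D, p)) * b ^ k) from fun a b => by ring,
      abs_mul, abs_neg_one_pow, one_mul]
    rw [← hx] at hh hID hx0 ⊢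
    rw [← hw'] at hh hw ⊢
    have hI2 := hI0 D
    rcases le_or_gt x v with h1 | h1
    · rw [if_pos (by linarith), if_neg (not_lt.2 h1), if_neg (fun hc => not_lt.2 h1 hc.1),
        max_eq_left (by linarith), show (U - x) ^ k * I D - R * w * (U - x) ^ k =
          (U - x) ^ k * (I D - R * w) by ring, abs_mul,
        abs_of_nonneg (pow_nonneg (show 0 ≤ U - x by linarith) k)]
      calc _ ≤ U ^ k * (e * w) := mul_le_mul (pow_le_pow_left₀ (by linarith) (by linarith) _)
            (hh h1) (abs_nonneg _) (by positivity)
        _ = _ := by ring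
    · rw [if_pos h1]
      have h0 : 0 ≤ U ^ k * e * (if x ≤ 2 * U then w else 0) := by
        split_ifs <;> positivity
      refine le_trans ?_ (le_add_of_nonneg_left h0)
      rcases le_or_gt x U with h2 | h2
      · rw [if_pos ⟨h1, h2⟩, max_eq_left (by linarith), show (U - x) ^ k * I D -
          R * w * (U - x) ^ k = (U - x) ^ k * (I D - R * w) by ring, abs_mul,
          abs_of_nonneg (pow_nonneg (show 0 ≤ U - x by linarith) k)]
        have hRw := mul_nonneg hR hw
        exact mul_le_mul (pow_le_pow_left₀ (by linarith) (by linarith) _)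
          (abs_le.2 ⟨by linarith, by linarith⟩) (abs_nonneg _) (by positivity)
      · rw [if_neg (fun hc => not_lt.2 hc.2 h2), hID h2, max_eq_right (by linarith), zero_pow hk]
        simp
  have e1 : ∑ z ∈ rsec ω α (U - K) U, 1 / nrm z * altSum ell (gfac U z) (fun x => (U - x) ^ k) =
      ∑ D ∈ (gmid U).powerset, (-1) ^ D.card * (U - ell (∏ p ∈ D, p)) ^ k * I D := by
    unfold altSum
    rw [sum_gfac_powerset U _ (fun z => 1 / nrm z)
      (fun D => (-1) ^ D.card * (U - ∑ p ∈ D, ell p) ^ k)]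
    refine sum_congr rfl fun D hD => ?_
    rw [ell_prod_gmid (mem_powerset.1 hD), hI]
  rw [e1, gmom, mul_sum, ← sum_sub_distrib]
  refine (abs_sum_le_sum_abs _ _).trans ((sum_le_sum hpt).trans ?_)
  rw [sum_add_distrib, ← mul_sum, ← mul_sum, sum_add_distrib,
    ← mul_sum, ← sum_filter, ← sum_filter, ← sum_filter]
  gcongr

theorem eventually_abs_sum_altSum_sub_le {K : ℝ} (hK : 1 ≤ K) {k : ℕ} (hk : 2 ≤ k) :
    ∀ᶠ U : ℝ in atTop, ∀ β, RoughCount U β → ∀ ω : ℂ, ω ≠ 0 → ∀ α, exp (-U ^ (0.69 : ℝ)) ≤ α →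
      α ≤ π → |∑ z ∈ rsec ω α (U - K) U, 1 / nrm z * altSum ell (gfac U z) (fun x => (U - x) ^ k) -
        gdens (U ^ (0.7 : ℝ)) * (α * K) * gmom k U U| ≤ α * K * U ^ ((k : ℝ) - 1.1) := by
  classical
  have hk' : (2 : ℝ) ≤ k := by exact_mod_cast hk
  filter_upwards [rough_gsector (a := 0.7) (b := 0.72) (c := 0.69) (by norm_num) (by norm_num)
      (by norm_num) (by norm_num),
    eventually_const_mul_rpow_le (a := 0) (b := 0.72) (by norm_num) K,
    eventually_const_mul_rpow_le (a := 0.72) (b := 1) (by norm_num) 4,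
    eventually_const_mul_rpow_le (a := k - 9) (b := k - 1.1) (by linarith) 52,
    eventually_const_mul_rpow_le (a := 0.72 * k - 0.64) (b := k - 1.1) (by linarith)
      (2 * (2 ^ k * 14))] with U h1 h2 h3 h4 h5 β h ω hω α hα hαπ
  have hU1 := h.one_le
  have hU0 : 0 < U := one_pos.trans_le hU1
  have hα0 : 0 < α := (exp_pos _).trans_le hα
  rw [rpow_zero, mul_one] at h2
  rw [rpow_one] at h3
  have hV := gdens_pos (U ^ (0.7 : ℝ))
  have hgr := grho_nonneg (U ^ (0.7 : ℝ))
  have key := abs_sum_altSum_sub_le (ω := ω) (α := α) (R := gdens (U ^ (0.7 : ℝ)) * (α * K))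
    (e := 2 * (α * K) / U ^ 10) (k := k) (by linarith) hU0.le h2 h3 (by omega) (by positivity)
    (by positivity) fun D hD hlt => by
      have hD' := mem_powerset.1 hD
      have := h1 ω hω α (U - K) U hα hαπ (by linarith) (∏ p ∈ D, p) (prod_gmid_ne_zero hD')
        (gRough_prod hD') (by linarith)
      unfold rsec
      rw [filter_filter]
      simp only [and_comm (a := GRough _ _)]
      refine le_trans (le_of_eq ?_) (this.trans ?_)
      · congr 1; ring
      · rw [show ∀ a n b : ℝ, a / n / b = a / b * (1 / n) from fun a n b => by ring]
        refine mul_le_mul_of_nonneg_right ?_ (one_div_nrm_nonneg _)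
        refine div_le_div_of_nonneg_right ?_ (by positivity)
        linear_combination mul_le_mul_of_nonneg_left hK hα0.le
  refine key.trans ?_
  clear key h1
  obtain ⟨s, hs⟩ : ∃ s, s = U ^ (0.72 : ℝ) := ⟨_, rfl⟩
  obtain ⟨v, hv⟩ : ∃ v, v = U ^ (0.05 : ℝ) := ⟨_, rfl⟩
  have hs0 : 0 < s := hs ▸ rpow_pos_of_pos hU0 _
  have hV' := h.gdens_le
  obtain ⟨r, hr⟩ : ∃ r, r = 1 / U ^ (0.69 : ℝ) := ⟨_, rfl⟩
  have hr0 : 0 < r := hr ▸ one_div_pos.2 (rpow_pos_of_pos hU0 _)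
  obtain ⟨V, hVV⟩ : ∃ V, V = gdens (U ^ (0.7 : ℝ)) := ⟨_, rfl⟩
  have g1 := h.grho_two_mul_le
  have g2 := h.grho_le _ le_rfl
  have g3 := h.grho_sub_le (show U - 2 * s ≤ U by linarith) (by linarith)
  have hrs : r * s ≤ v := by
    rw [hr, hs, hv, one_div, ← rpow_neg hU0.le, ← rpow_add hU0]
    exact rpow_le_rpow_of_exponent_le hU1 (by norm_num)
  have he : 2 * (α * K) / U ^ 10 ≤ 2 * (r * (α * K)) := by
    have : 1 / U ^ 10 ≤ r := by
      rw [hr]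
      refine one_div_le_one_div_of_le (rpow_pos_of_pos hU0 _) ?_
      rw [← rpow_natCast]
      exact rpow_le_rpow_of_exponent_le hU1 (by norm_num)
    calc _ = 2 * (1 / U ^ 10 * (α * K)) := by ring
      _ ≤ _ := by gcongr
  rw [← hr, ← hVV] at hV'
  rw [← hs] at g2 ⊢
  rw [← hv] at g2 g3
  rw [← hVV] at hV g3 ⊢
  have g4 : π * V * (U - (U - 2 * s)) ≤ 8 * v := by
    calc π * V * (U - (U - 2 * s)) = 2 * π * (V * s) := by ring
      _ ≤ 2 * 4 * (r * s) := by
        have := pi_lt_four.le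
        gcongr
      _ ≤ _ := by linarith
  calc _ ≤ U ^ k * (2 * (α * K) / U ^ 10) * (13 * U) +
        (2 * s) ^ k * (3 * (r * (α * K)) * v + r * (α * K) * (11 * v)) := by
        have hA : V * (α * K) ≤ r * (α * K) := by gcongr
        have hB := hgr (2 * s)
        have hF := sub_nonneg.2 (grho_mono (U ^ (0.7 : ℝ)) (show U - 2 * s ≤ U by linarith))
        have hD : grho (U ^ (0.7 : ℝ)) U - grho (U ^ (0.7 : ℝ)) (U - 2 * s) ≤ 11 * v := by linarith
        have hE : V * (α * K) + 2 * (α * K) / U ^ 10 ≤ 3 * (r * (α * K)) := by linarith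
        gcongr
    _ = α * K * (26 * (U ^ k * U / U ^ 10)) + α * K * (2 ^ k * 14 * (s ^ k * r * v)) := by
        rw [mul_pow]; ring
    _ = α * K * (26 * U ^ ((k : ℝ) - 9)) + α * K * (2 ^ k * 14 * U ^ (0.72 * (k : ℝ) - 0.64)) := by
        congr 3
        · rw [show (k : ℝ) - 9 = k + 1 - (10 : ℕ) by push_cast; ring, rpow_sub hU0,
            rpow_add hU0, rpow_natCast, rpow_natCast, rpow_one]
        · rw [hs, hr, hv, ← rpow_mul_natCast hU0.le, one_div, ← rpow_neg hU0.le, ← rpow_add hU0,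
            ← rpow_add hU0]
          ring_nf
    _ ≤ α * K * (U ^ ((k : ℝ) - 1.1) / 2) + α * K * (U ^ ((k : ℝ) - 1.1) / 2) := by
        gcongr <;> linarith
    _ = _ := by ring

theorem altSum_sq_nonneg {ι : Type*} (g : ι → ℝ) {P : Finset ι} {U : ℝ} (hg : ∀ p ∈ P, 0 ≤ g p)
    (hP : ∑ p ∈ P, g p ≤ U) : 0 ≤ altSum g P fun x => (U - x) ^ 2 := by
  classical
  rcases P.eq_empty_or_nonempty with rfl | ⟨a, ha⟩
  · rw [altSum_empty]; positivity
  obtain ⟨s, hs, rfl⟩ : ∃ s, a ∉ s ∧ insert a s = P := ⟨P.erase a, notMem_erase _ _,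
    insert_erase ha⟩
  have ha0 := hg a (mem_insert_self _ _)
  rw [altSum_insert g hs]
  rcases s.eq_empty_or_nonempty with rfl | ⟨b, hb⟩
  · rw [altSum_empty]
    rw [insert_empty_eq, Finset.sum_singleton] at hP
    nlinarith
  obtain ⟨t, ht, rfl⟩ : ∃ t, b ∉ t ∧ insert b t = s := ⟨s.erase b, notMem_erase _ _,
    insert_erase hb⟩
  have hb0 := hg b (by simp)
  rw [altSum_insert g ht]
  rcases t.eq_empty_or_nonempty with rfl | ⟨c, hc⟩
  · rw [altSum_empty]
    have := mul_nonneg ha0 hb0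
    linear_combination 2 * this
  obtain ⟨r, hr, rfl⟩ : ∃ r, c ∉ r ∧ insert c r = t := ⟨t.erase c, notMem_erase _ _,
    insert_erase hc⟩
  rw [altSum_insert g hr]
  refine le_of_eq ((altSum_zero g r).symm.trans ?_)
  congr 1
  funext x
  ring

/-- The sieve weight that is at most `U ^ 3 / 2` on numbers with one prime factor and nonpositive on
numbers with more. -/
theorem altSum_cubic_le {ι : Type*} (g : ι → ℝ) {P : Finset ι} {U : ℝ} (hg : ∀ p ∈ P, 0 ≤ g p)
    (hP : ∑ p ∈ P, g p ≤ U) (hne : P.Nonempty) :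
    (altSum g P fun x => 3 / 2 * U * (U - x) ^ 2 - (U - x) ^ 3) ≤
      (if P.card = 1 then U ^ 3 / 2 else 0) - if P.card = 3 then 6 * ∏ p ∈ P, g p else 0 := by
  classical
  obtain ⟨a, ha⟩ := hne
  obtain ⟨s, hs, rfl⟩ : ∃ s, a ∉ s ∧ insert a s = P := ⟨P.erase a, notMem_erase _ _,
    insert_erase ha⟩
  have ha0 := hg a (mem_insert_self _ _)
  rw [altSum_insert g hs, card_insert_of_notMem hs]
  rcases s.eq_empty_or_nonempty with rfl | ⟨b, hb⟩
  · rw [altSum_empty, Finset.card_empty, if_pos rfl, if_neg (by norm_num)]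
    rw [insert_empty_eq, Finset.sum_singleton] at hP
    nlinarith [mul_nonneg (sq_nonneg (U - g a)) (show 0 ≤ U / 2 + g a by linarith)]
  obtain ⟨t, ht, rfl⟩ : ∃ t, b ∉ t ∧ insert b t = s := ⟨s.erase b, notMem_erase _ _,
    insert_erase hb⟩
  have hb0 := hg b (by simp)
  rw [altSum_insert g ht, card_insert_of_notMem ht, if_neg (by omega)]
  rcases t.eq_empty_or_nonempty with rfl | ⟨c, hc⟩
  · rw [altSum_empty, Finset.card_empty, if_neg (by norm_num)]
    rw [Finset.sum_insert hs, insert_empty_eq, Finset.sum_singleton] at hP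
    have := mul_nonneg (mul_nonneg ha0 hb0) (sub_nonneg.2 hP)
    linear_combination 3 * this
  obtain ⟨r, hr, rfl⟩ : ∃ r, c ∉ r ∧ insert c r = t := ⟨t.erase c, notMem_erase _ _,
    insert_erase hc⟩
  rw [altSum_insert g hr, card_insert_of_notMem hr]
  rcases r.eq_empty_or_nonempty with rfl | ⟨d, hd⟩
  · rw [altSum_empty, Finset.card_empty, if_pos rfl, prod_insert hs, prod_insert ht,
      prod_insert hr, Finset.prod_empty]
    refine le_of_eq ?_
    ring
  obtain ⟨q, hq, rfl⟩ : ∃ q, d ∉ q ∧ insert d q = r := ⟨r.erase d, notMem_erase _ _,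
    insert_erase hd⟩
  rw [altSum_insert g hq, card_insert_of_notMem hq, if_neg (by omega), sub_zero]
  refine le_of_eq ((congrArg _ ?_).trans (altSum_zero g q))
  funext x
  ring

theorem altSum_sub {ι : Type*} (g : ι → ℝ) (P : Finset ι) (a : ℝ) (F G : ℝ → ℝ) :
    altSum g P (fun x => a * F x - G x) = a * altSum g P F - altSum g P G := by
  unfold altSum
  rw [mul_sum, ← sum_sub_distrib]
  exact sum_congr rfl fun D _ => by ring

theorem sum_ell_gfac_le {U : ℝ} {z : GaussianInt} (hz : z ≠ 0) :
    ∑ p ∈ gfac U z, ell p ≤ ell z := by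
  rw [← ell_prod_gmid (gfac_subset U z)]
  exact ell_le_of_dvd hz ((prod_dvd_iff_of_subset_gprimes
    ((gfac_subset U z).trans (gmid_subset U))).2 fun p hp => (mem_gfac.1 hp).2)

theorem exists_gmid_associated {U : ℝ} {z : GaussianInt} (hz : Prime z)
    (h1 : U ^ (0.7 : ℝ) < ell z) (h2 : ell z ≤ 2 * U) : ∃ p ∈ gmid U, Associated p z := by
  obtain ⟨p, hp, hpz⟩ := exists_gcan hz
  have := ell_eq_of_associated hpz
  exact ⟨p, mem_gmid.2 ⟨hp, by rwa [← this], by rwa [← this]⟩, hpz.symm⟩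

open Classical in
/-- The Selberg upper bound for Gaussian primes in a thin sector. -/
theorem eventually_sum_prime_gsector_le {K : ℝ} (hK : 1 ≤ K) :
    ∀ᶠ U : ℝ in atTop, ∀ ω : ℂ, ω ≠ 0 → ∀ α, exp (-U ^ (0.69 : ℝ)) ≤ α → α ≤ π →
      ∑ z ∈ gsector ω α (U - K) U with Prime z, 1 / nrm z ≤ 2.55 * (α * K / U) := by
  filter_upwards [eventually_abs_sum_altSum_sub_le hK le_rfl, eventually_abs_gmom_two_sub_le,
    eventually_exists_roughCount,
    eventually_const_mul_rpow_le (a := 0.7) (b := 1) (by norm_num) 2,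
    eventually_const_mul_rpow_le (a := 0.95) (b := 1) (by norm_num) 10000,
    eventually_ge_atTop (10000 * K)] with U h1 h2 ⟨β, hβ⟩ h4 h5 h6 ω hω α hα hαπ
  have hU1 := hβ.one_le
  have hU0 : 0 < U := one_pos.trans_le hU1
  have hα0 : 0 < α := (exp_pos _).trans_le hα
  rw [rpow_one] at h4 h5
  have k1 := (abs_le.1 (h1 β hβ ω hω α hα hαπ)).2
  have k2 := (abs_le.1 (h2 β hβ U hU0.le le_rfl)).2
  have k3 : (U ^ 2 - K ^ 2) * ∑ z ∈ gsector ω α (U - K) U with Prime z, 1 / nrm z ≤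
      ∑ z ∈ rsec ω α (U - K) U, 1 / nrm z * altSum ell (gfac U z) (fun x => (U - x) ^ 2) := by
    rw [mul_sum]
    have hprime : ∀ z ∈ (gsector ω α (U - K) U).filter Prime, GRough (U ^ (0.7 : ℝ)) z ∧
        ∃ p, gfac U z = {p} ∧ ell p = ell z := fun z hz => by
      rw [mem_filter, mem_gsector] at hz
      obtain ⟨p, hp, hpz⟩ := exists_gmid_associated (U := U) hz.2 (by linarith) (by linarith)
      obtain ⟨h1, h2⟩ := rough_of_associated hp hpz
      exact ⟨h1, p, h2, (ell_eq_of_associated hpz)⟩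
    refine le_trans (sum_le_sum fun z hz => ?_) (sum_le_sum_of_subset_of_nonneg
      (fun z hz => mem_rsec.2 ⟨(mem_filter.1 hz).1, (hprime z hz).1⟩) fun z hz _ => ?_)
    · obtain ⟨-, p, hp, hpz⟩ := hprime z hz
      rw [hp, altSum_singleton, hpz, mul_comm]
      refine mul_le_mul_of_nonneg_left ?_ (one_div_nrm_nonneg z)
      have := mem_gsector.1 (mem_filter.1 hz).1
      nlinarith
    · have := mem_gsector.1 (mem_rsec.1 hz).1
      exact mul_nonneg (one_div_nrm_nonneg z) (altSum_sq_nonneg _ (fun p _ => ell_nonneg p)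
        ((sum_ell_gfac_le this.1).trans this.2.2.1))
  have hαK : 0 < α * K := by positivity
  have e1 : U ^ (((2 : ℕ) : ℝ) - 1.1) ≤ U / 10000 := by
    refine (rpow_le_rpow_of_exponent_le hU1 (show _ ≤ (0.95 : ℝ) by norm_num)).trans ?_
    linarith
  have k4 : gdens (U ^ (0.7 : ℝ)) * (α * K) * gmom 2 U U ≤ α * K * (2.548 * U) := by
    rw [show gdens (U ^ (0.7 : ℝ)) * (α * K) * gmom 2 U U =
      α * K * (gdens (U ^ (0.7 : ℝ)) * gmom 2 U U) by ring]
    refine mul_le_mul_of_nonneg_left ?_ hαK.le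
    by_contra! hc
    nlinarith [pi_gt_d2]
  have k5 : α * K * U ^ (((2 : ℕ) : ℝ) - 1.1) ≤ α * K * (U / 10000) := by gcongr
  have hK2 : K ^ 2 ≤ U ^ 2 / 10000 := by nlinarith
  have hS : 0 ≤ ∑ z ∈ gsector ω α (U - K) U with Prime z, 1 / nrm z :=
    sum_nonneg fun z _ => one_div_nrm_nonneg z
  generalize ∑ z ∈ gsector ω α (U - K) U with Prime z, 1 / nrm z = S at *
  have k6 : U ^ 2 * 0.9999 * S ≤ α * K * (2.5481 * U) := by nlinarith
  rw [mul_div_assoc', le_div_iff₀ hU0]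
  have : U * (S * U) ≤ U * (2.55 * (α * K)) := by nlinarith
  exact le_of_mul_le_mul_left this hU0

open Classical in
theorem sum_card_one_le {ω : ℂ} {α u₀ U : ℝ} (hU : 0 ≤ U) :
    ∑ z ∈ rsec ω α u₀ U with (gfac U z).card = 1, 1 / nrm z ≤
      ∑ z ∈ gsector ω α u₀ U with Prime z, 1 / nrm z + gsq U := by
  have hz : ∀ z ∈ rsec ω α u₀ U, z ≠ 0 ∧ ell z ≤ 2 * U ∧ GRough (U ^ (0.7 : ℝ)) z := fun z hz => by
    have h1 := mem_rsec.1 hz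
    have h2 := mem_gsector.1 h1.1
    exact ⟨h2.1, by linarith [h2.2.2.1], h1.2⟩
  rw [← sum_filter_add_sum_filter_not _ Prime]
  refine add_le_add (sum_le_sum_of_subset_of_nonneg (fun z h => ?_)
    fun z _ _ => one_div_nrm_nonneg z) ?_
  · rw [filter_filter, mem_filter] at h
    exact mem_filter.2 ⟨(mem_rsec.1 h.1).1, h.2.2⟩
  rw [filter_filter]
  calc _ ≤ ∑ z ∈ rsec ω α u₀ U with (gfac U z).card = 1 ∧ ¬Prime z,
        ∑ p ∈ gmid U with p ^ 2 ∣ z, 1 / nrm z := by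
        refine sum_le_sum fun z h => ?_
        rw [mem_filter] at h
        obtain ⟨p, hp⟩ := Finset.card_eq_one.1 h.2.1
        have hpm := mem_gfac.1 (hp ▸ Finset.mem_singleton_self p)
        have hzz := hz z h.1
        refine Finset.single_le_sum (f := fun _ => 1 / nrm z) (fun _ _ => one_div_nrm_nonneg z)
          (mem_filter.2 ⟨hpm.1, (associated_or_sq_dvd hzz.1 hzz.2.1 hzz.2.2 hp).resolve_left
            fun ha => h.2.2 (ha.prime (mem_gmid.1 hpm.1).1.1)⟩)
    _ ≤ _ := by
        simp_rw [sum_filter _ (fun _ => 1 / nrm _)]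
        rw [sum_comm]
        refine sum_le_sum fun p _ => ?_
        rw [← sum_filter, filter_filter]
        refine sum_le_sum_of_subset_of_nonneg (fun z h => ?_)
          fun z _ _ => one_div_nrm_nonneg z
        rw [mem_filter] at h
        have hzz := hz z h.1
        exact mem_filter.2 ⟨mem_gball.2 ⟨hzz.1, hzz.2.1⟩, hzz.2.2, h.2.2⟩

open Classical in
/-- Products of three primes in a sector force primes in that sector. -/
theorem eventually_sum_card_three_le {K : ℝ} (hK : 1 ≤ K) :
    ∀ᶠ U : ℝ in atTop, ∀ ω : ℂ, ω ≠ 0 → ∀ α, exp (-U ^ (0.69 : ℝ)) ≤ α → α ≤ π →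
      12 / U ^ 3 * ∑ z ∈ rsec ω α (U - K) U with (gfac U z).card = 3,
        1 / nrm z * ∏ p ∈ gfac U z, ell p ≤
      ∑ z ∈ gsector ω α (U - K) U with Prime z, 1 / nrm z + 10 * (α * K) * U ^ (-1.05 : ℝ) := by
  filter_upwards [eventually_abs_sum_altSum_sub_le hK le_rfl,
    eventually_abs_sum_altSum_sub_le hK (show 2 ≤ 3 by norm_num), eventually_abs_gmom_two_sub_le,
    eventually_abs_gmom_three_sub_le, eventually_exists_roughCount, eventually_gsq_le,
    eventually_const_mul_rpow_le (a := 0.69) (b := 0.7) (by norm_num) 2,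
    eventually_const_mul_log_mul_rpow_le (a := 0) (b := 0.69) (by norm_num) 5,
    eventually_gt_atTop (13 + K)] with U h1 h2 h3 h4 ⟨β, hβ⟩ h5 h6 h7 h8 ω hω α hα hαπ
  have hU1 := hβ.one_le
  have hU0 : 0 < U := one_pos.trans_le hU1
  have hα0 : 0 < α := (exp_pos _).trans_le hα
  have hαK : 0 < α * K := by positivity
  rw [rpow_zero, mul_one] at h7
  have k1 := (abs_le.1 (h1 β hβ ω hω α hα hαπ)).1
  have k2 := (abs_le.1 (h2 β hβ ω hω α hα hαπ)).2
  have k3 := (abs_le.1 (h3 β hβ U hU0.le le_rfl)).1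
  have k4 := (abs_le.1 (h4 β hβ)).2
  have k5 : gsq U ≤ α * K * U ^ (-1.05 : ℝ) := by
    have e1 : U ^ 5 ≤ exp (U ^ (0.69 : ℝ)) := by
      rw [← exp_log (pow_pos hU0 5), exp_le_exp, log_pow]
      exact_mod_cast h7
    have e2 : U ^ (-2 : ℝ) ≤ U ^ (-1.05 : ℝ) := rpow_le_rpow_of_exponent_le hU1 (by norm_num)
    have e3 : exp (-U ^ (0.7 : ℝ)) ≤ exp (-U ^ (0.69 : ℝ)) * exp (-U ^ (0.69 : ℝ)) := by
      rw [← exp_add, exp_le_exp]; linarith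
    have e4 : 13 ≤ U := by linarith
    calc gsq U ≤ 13 * U ^ 2 * exp (-U ^ (0.7 : ℝ)) := h5 β hβ
      _ ≤ U * U ^ 2 * (α * (1 / U ^ 5)) := by
          gcongr
          refine e3.trans (mul_le_mul hα ?_ (exp_pos _).le hα0.le)
          rw [exp_neg, ← one_div]
          exact one_div_le_one_div_of_le (by positivity) e1
      _ = α * 1 * U ^ (-2 : ℝ) := by
          rw [show (-2 : ℝ) = -((2 : ℕ) : ℝ) by norm_num, rpow_neg hU0.le, rpow_natCast]
          field_simp
      _ ≤ _ := by gcongr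
  have hz : ∀ z ∈ rsec ω α (U - K) U, 1 / nrm z * (3 / 2 * U * altSum ell (gfac U z)
      (fun x => (U - x) ^ 2) - altSum ell (gfac U z) (fun x => (U - x) ^ 3)) ≤
      U ^ 3 / 2 * (if (gfac U z).card = 1 then 1 / nrm z else 0) -
        6 * (if (gfac U z).card = 3 then 1 / nrm z * ∏ p ∈ gfac U z, ell p else 0) := fun z h => by
    have hr := mem_rsec.1 h
    have hs := mem_gsector.1 hr.1
    rw [← altSum_sub]
    refine (mul_le_mul_of_nonneg_left (altSum_cubic_le ell (fun p _ => ell_nonneg p)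
      ((sum_ell_gfac_le hs.1).trans hs.2.2.1) ?_) (one_div_nrm_nonneg z)).trans (le_of_eq ?_)
    · rw [Finset.nonempty_iff_ne_empty, Ne, gfac_eq_empty_iff hs.1 (by linarith [hs.2.2.1]) hr.2]
      intro hu
      have : ell z = 0 := by rw [ell, nrm_of_isUnit hu, log_one]
      linarith [hs.2.1]
    · split_ifs <;> ring
  have k6 := sum_le_sum hz
  rw [sum_sub_distrib, ← mul_sum, ← mul_sum, ← sum_filter,
    ← sum_filter] at k6
  have e0 : ∑ z ∈ rsec ω α (U - K) U, 1 / nrm z * (3 / 2 * U * altSum ell (gfac U z)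
      (fun x => (U - x) ^ 2) - altSum ell (gfac U z) (fun x => (U - x) ^ 3)) = 3 / 2 * U *
      ∑ z ∈ rsec ω α (U - K) U, 1 / nrm z * altSum ell (gfac U z) (fun x => (U - x) ^ 2) -
      ∑ z ∈ rsec ω α (U - K) U, 1 / nrm z * altSum ell (gfac U z) (fun x => (U - x) ^ 3) := by
    rw [mul_sum, ← sum_sub_distrib]
    exact sum_congr rfl fun z _ => by ring
  rw [e0] at k6
  have k7 := sum_card_one_le (ω := ω) (α := α) (u₀ := U - K) hU0.le
  generalize ∑ z ∈ rsec ω α (U - K) U, 1 / nrm z * altSum ell (gfac U z) (fun x => (U - x) ^ 2)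
    = A at *
  generalize ∑ z ∈ rsec ω α (U - K) U, 1 / nrm z * altSum ell (gfac U z) (fun x => (U - x) ^ 3)
    = B at *
  generalize ∑ z ∈ rsec ω α (U - K) U with (gfac U z).card = 1, 1 / nrm z = S at *
  generalize ∑ z ∈ rsec ω α (U - K) U with (gfac U z).card = 3,
    1 / nrm z * ∏ p ∈ gfac U z, ell p = T at *
  obtain ⟨r, hr⟩ : ∃ r, r = U ^ (-1.05 : ℝ) := ⟨_, rfl⟩
  have hr0 : 0 < r := hr ▸ rpow_pos_of_pos hU0 _
  have r1 : U ^ (((2 : ℕ) : ℝ) - 1.1) ≤ r * U ^ 2 := by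
    rw [hr, ← rpow_natCast U 2, ← rpow_add hU0]
    exact rpow_le_rpow_of_exponent_le hU1 (by norm_num)
  have r2 : U ^ (((3 : ℕ) : ℝ) - 1.1) ≤ r * U ^ 3 := by
    rw [hr, ← rpow_natCast U 3, ← rpow_add hU0]
    exact rpow_le_rpow_of_exponent_le hU1 (by norm_num)
  have r3 : U ^ (0.95 : ℝ) = r * U ^ 2 := by
    rw [hr, ← rpow_natCast U 2, ← rpow_add hU0]; norm_num
  have r4 : U ^ (1.95 : ℝ) = r * U ^ 3 := by
    rw [hr, ← rpow_natCast U 3, ← rpow_add hU0]; norm_num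
  rw [r3] at k3
  rw [r4] at k4
  rw [← hr] at k5 ⊢
  generalize gdens (U ^ (0.7 : ℝ)) = V at *
  generalize gmom 2 U U = m at *
  generalize gmom 3 U U = n at *
  have q1 : α * K * U ^ (((2 : ℕ) : ℝ) - 1.1) ≤ α * K * (r * U ^ 2) := by gcongr
  have q2 : α * K * U ^ (((3 : ℕ) : ℝ) - 1.1) ≤ α * K * (r * U ^ 3) := by gcongr
  have q3 : -(1.5 * (r * U ^ 3)) ≤ 3 / 2 * U * (V * m) - V * n := by
    have : -(4.5 * (r * U ^ 3)) ≤ π * (3 / 2 * U * (V * m) - V * n) := by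
      have := mul_le_mul_of_nonneg_left k3 hU0.le
      linear_combination 3 / 2 * this + k4
    by_contra! hc
    have hp : 0 < r * U ^ 3 := by positivity
    nlinarith [pi_gt_three]
  have q4 : 3 / 2 * U * (V * (α * K) * m - α * K * (r * U ^ 2)) ≤ 3 / 2 * U * A :=
    mul_le_mul_of_nonneg_left (by linarith) (by positivity)
  have q5 : 6 * T - 4 * (α * K) * (r * U ^ 3) ≤ U ^ 3 / 2 * S := by
    have := mul_le_mul_of_nonneg_left q3 hαK.le
    linear_combination this + q4 + k2 + k6 + q2
  have q6 : 12 / U ^ 3 * T - 8 * (α * K) * r ≤ S := by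
    have h2 : 0 ≤ 2 / U ^ 3 := by positivity
    refine le_trans (le_of_eq ?_) ((mul_le_mul_of_nonneg_left q5 h2).trans (le_of_eq ?_)) <;>
      field_simp; ring
  linarith [mul_pos hαK hr0]

/-- The number of representations `x = a + b` with `a ∈ A`, `b ∈ B`. -/
def repCount {G : Type*} [AddGroup G] [DecidableEq G] (A B : Finset G) (x : G) : ℕ :=
  {a ∈ A | x - a ∈ B}.card

theorem repCount_le {G : Type*} [AddGroup G] [DecidableEq G] (A B : Finset G) (x : G) :
    repCount A B x ≤ B.card :=
  Finset.card_le_card_of_injOn (fun a => x - a) (fun _ ha => (mem_filter.1 ha).2)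
    fun _ _ _ _ h => sub_right_injective h

section
variable {G : Type*} [AddCommGroup G] [DecidableEq G] [Fintype G]

theorem repCount_eq_sum (A B : Finset G) (x : G) :
    repCount A B x = ∑ a : G, if a ∈ A ∧ x - a ∈ B then 1 else 0 := by
  rw [repCount, card_filter, ← sum_filter, ← sum_filter]
  congr 1
  ext; simp

theorem sum_repCount (A B : Finset G) : ∑ x, repCount A B x = A.card * B.card := by
  simp_rw [repCount, card_filter]
  rw [sum_comm, ← smul_eq_mul, ← sum_const]
  refine sum_congr rfl fun a _ => ?_
  refine (Equiv.sum_comp (Equiv.subRight a) (fun x => if x ∈ B then 1 else 0)).trans ?_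
  simp

theorem repCount_dyson (A B : Finset G) (x : G) :
    repCount A B x = repCount (A ∪ B) (A ∩ B) x + repCount (A \ B) (B \ A) x := by
  have h : (∑ a : G, if a ∈ A ∩ B ∧ x - a ∈ B \ A then 1 else 0) =
      ∑ a : G, if x - a ∈ A ∩ B ∧ a ∈ B \ A then 1 else 0 := by
    rw [← Equiv.sum_comp (Equiv.subLeft x)]
    simp
  have h1 : repCount A B x = (∑ a : G, if a ∈ A ∧ x - a ∈ A ∩ B then 1 else 0) +
      (∑ a : G, if a ∈ A ∩ B ∧ x - a ∈ B \ A then 1 else 0) +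
      ∑ a : G, if a ∈ A \ B ∧ x - a ∈ B \ A then 1 else 0 := by
    rw [repCount_eq_sum, ← sum_add_distrib, ← sum_add_distrib]
    refine sum_congr rfl fun a _ => ?_
    simp only [Finset.mem_inter, Finset.mem_sdiff]
    by_cases h1 : a ∈ A <;> by_cases h2 : a ∈ B <;> by_cases h3 : x - a ∈ A <;>
      by_cases h4 : x - a ∈ B <;> simp [h1, h2, h3, h4]
  rw [h1, h, repCount_eq_sum, repCount_eq_sum, ← sum_add_distrib]
  congr 1
  refine sum_congr rfl fun a _ => ?_
  simp only [Finset.mem_inter, Finset.mem_sdiff, mem_union]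
  by_cases h1 : a ∈ A <;> by_cases h2 : a ∈ B <;> by_cases h3 : x - a ∈ A <;>
    by_cases h4 : x - a ∈ B <;> simp [h1, h2, h3, h4]

end

theorem exists_mem_add_notMem {p : ℕ} [Fact p.Prime] {A : Finset (ZMod p)} (hA : A.Nonempty)
    (hA' : A.card < p) {d : ZMod p} (hd : d ≠ 0) : ∃ a ∈ A, a + d ∉ A := by
  by_contra! h
  obtain ⟨a, ha⟩ := hA
  have h1 : ∀ n : ℕ, a + n * d ∈ A := by
    intro n
    induction n with
    | zero => simpa using ha
    | succ n ih =>
      have := h _ ih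
      rwa [add_assoc, ← add_one_mul, ← Nat.cast_succ] at this
  have h2 : A = univ := Finset.eq_univ_of_forall fun x => by
    have := h1 ((x - a) / d).val
    rwa [ZMod.natCast_zmod_val, div_mul_cancel₀ _ hd, add_sub_cancel] at this
  rw [h2, Finset.card_univ, ZMod.card] at hA'
  exact lt_irrefl _ hA'

/-- **Pollard's theorem** on the number of popular sums modulo a prime. -/
theorem pollard {p : ℕ} [Fact p.Prime] (A B : Finset (ZMod p)) (t : ℕ) (hA : t ≤ A.card)
    (hB : t ≤ B.card) (h : A.card + B.card ≤ p + t) :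
    t * (A.card + B.card) ≤ t * t + ∑ x, min t (repCount A B x) := by
  induction hn : B.card using Nat.strong_induction_on generalizing A B t with
  | _ n ih =>
  subst hn
  rcases t.eq_zero_or_pos with rfl | ht
  · simp
  rcases hB.eq_or_lt with hBt | hBt
  · have : ∑ x, min t (repCount A B x) = A.card * B.card := by
      rw [← sum_repCount]
      exact sum_congr rfl fun x _ => min_eq_right (by rw [hBt]; exact repCount_le A B x)
    rw [this, ← hBt]
    exact le_of_eq (by ring)
  obtain ⟨b, hb, b', hb', hne⟩ := Finset.one_lt_card.1 (show 1 < B.card by omega)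
  obtain ⟨a, ha, ha'⟩ := exists_mem_add_notMem (A := A) (Finset.card_pos.1 (by omega)) (by omega)
    (sub_ne_zero.2 hne.symm)
  obtain ⟨B₁, hB₁⟩ : ∃ B₁, B₁ = B.image (a - b + ·) := ⟨_, rfl⟩
  have hc : B₁.card = B.card := hB₁ ▸ Finset.card_image_of_injective _ (add_right_injective _)
  have hsum : ∑ x, min t (repCount A B x) = ∑ x, min t (repCount A B₁ x) := by
    rw [← Equiv.sum_comp (Equiv.subRight (a - b))]
    refine sum_congr rfl fun x _ => ?_
    simp only [repCount, hB₁, Equiv.subRight_apply, mem_image]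
    congr 3
    ext c
    exact ⟨fun h => ⟨_, h, by ring⟩, fun ⟨y, hy, e⟩ => by rwa [← sub_eq_iff_eq_add'.2 e.symm,
      sub_right_comm] at hy⟩
  have hI1 : 1 ≤ (A ∩ B₁).card := Finset.card_pos.2 ⟨a, Finset.mem_inter.2 ⟨ha, by
    rw [hB₁]; exact mem_image.2 ⟨b, hb, by ring⟩⟩⟩
  have hI2 : (A ∩ B₁).card < B₁.card := Finset.card_lt_card
    ⟨Finset.inter_subset_right, fun hs => ha' (Finset.mem_inter.1 (hs (by
      rw [hB₁]; exact mem_image.2 ⟨b', hb', by ring⟩))).1⟩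
  have hU := Finset.card_union_add_card_inter A B₁
  have h1 := Finset.card_sdiff_add_card_inter A B₁
  have h2 := Finset.card_sdiff_add_card_inter B₁ A
  rw [Finset.inter_comm] at h2
  rw [hsum, ← hc]
  rcases le_or_gt t (A ∩ B₁).card with hi | hi
  · have := ih _ (hc ▸ hI2) (A ∪ B₁) (A ∩ B₁) t (by omega) hi (by omega) rfl
    rw [hU] at this
    refine this.trans (Nat.add_le_add_left (sum_le_sum fun x _ => ?_) _)
    have := repCount_dyson A B₁ x
    omega
  · have h3 := ih _ (show (B₁ \ A).card < B.card by omega) (A \ B₁) (B₁ \ A)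
      (t - (A ∩ B₁).card) (by omega) (by omega) (by omega) rfl
    have h4 : ∑ x, min (t - (A ∩ B₁).card) (repCount (A \ B₁) (B₁ \ A) x) +
        (A ∪ B₁).card * (A ∩ B₁).card ≤ ∑ x, min t (repCount A B₁ x) := by
      rw [← sum_repCount, ← sum_add_distrib]
      refine sum_le_sum fun x _ => ?_
      have := repCount_dyson A B₁ x
      have := repCount_le (A ∪ B₁) (A ∩ B₁) x
      omega
    have hu : (A ∪ B₁).card = (A \ B₁).card + (B₁ \ A).card + (A ∩ B₁).card := by omega
    obtain ⟨s, hs⟩ : ∃ s, t = (A ∩ B₁).card + s := ⟨t - (A ∩ B₁).card, by omega⟩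
    rw [hu, show t - (A ∩ B₁).card = s by omega] at h4
    rw [show t - (A ∩ B₁).card = s by omega] at h3
    rw [← h1, ← h2]
    generalize ∑ x, min t (repCount A B₁ x) = S at *
    generalize ∑ x, min s (repCount (A \ B₁) (B₁ \ A) x) = M at *
    rw [hs]
    linarith

theorem repCount_mono {G : Type*} [AddGroup G] [DecidableEq G] {A A' B B' : Finset G} (hA : A ⊆ A')
    (hB : B ⊆ B') (x : G) : repCount A B x ≤ repCount A' B' x :=
  card_le_card fun a ha => by
    rw [mem_filter] at *
    exact ⟨hA ha.1, hB ha.2⟩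

theorem sum_repCount_sub_eq {G : Type*} [AddCommGroup G] [DecidableEq G] (A B C : Finset G)
    (b : G) : ∑ c ∈ C, repCount A B (b - c) =
      {y ∈ A ×ˢ B ×ˢ C | y.1 + y.2.1 + y.2.2 = b}.card := by
  rw [card_filter, sum_product]
  simp_rw [Finset.sum_product_right, repCount, card_filter]
  rw [sum_comm]
  refine sum_congr rfl fun x _ => sum_congr rfl fun c _ => ?_
  rw [← Finset.sum_ite_eq' B (b - c - x) fun _ => 1]
  refine sum_congr rfl fun y _ => if_congr ⟨fun h => ?_, fun h => ?_⟩ rfl rfl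
  · rw [h]; abel
  · rw [← h]; abel

/-- Three sets of density almost one half modulo a prime represent everything many times. -/
theorem card_triples_ge {p : ℕ} [Fact p.Prime] (hp : 1000 ≤ p) {A B C : Finset (ZMod p)}
    (hA : 0.47 * (p : ℝ) ≤ A.card) (hB : 0.47 * (p : ℝ) ≤ B.card) (hC : 0.47 * (p : ℝ) ≤ C.card)
    (b : ZMod p) :
    (p : ℝ) ^ 2 / 1000 ≤ ({y ∈ A ×ˢ B ×ˢ C | y.1 + y.2.1 + y.2.2 = b}.card : ℝ) := by
  have hp' : (1000 : ℝ) ≤ p := by exact_mod_cast hp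
  obtain ⟨m, hm⟩ : ∃ m, m = ⌈0.47 * (p : ℝ)⌉₊ := ⟨_, rfl⟩
  obtain ⟨t, ht⟩ : ∃ t, t = ⌊0.05 * (p : ℝ)⌋₊ := ⟨_, rfl⟩
  have hm1 : 0.47 * (p : ℝ) ≤ m := hm ▸ Nat.le_ceil _
  have hm2 : (m : ℝ) < 0.47 * p + 1 := hm ▸ Nat.ceil_lt_add_one (by positivity)
  have ht1 : (t : ℝ) ≤ 0.05 * p := ht ▸ Nat.floor_le (by positivity)
  have ht2 : 0.05 * (p : ℝ) < t + 1 := ht ▸ Nat.lt_floor_add_one _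
  obtain ⟨A', hAA, hAm⟩ := Finset.exists_subset_card_eq (s := A) (n := m)
    (hm ▸ Nat.ceil_le.2 hA)
  obtain ⟨B', hBB, hBm⟩ := Finset.exists_subset_card_eq (s := B) (n := m)
    (hm ▸ Nat.ceil_le.2 hB)
  have htm : t ≤ m := by exact_mod_cast (by linarith : (t : ℝ) ≤ m)
  have key := pollard A' B' t (hAm ▸ htm) (hBm ▸ htm) (by
    rw [hAm, hBm]; exact_mod_cast (by linarith : (m : ℝ) + m ≤ p + t))
  rw [hAm, hBm] at key
  obtain ⟨S, hS⟩ : ∃ S : Finset (ZMod p),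
      S = univ.filter (fun x => 0.01 * (p : ℝ) ≤ repCount A' B' x) := ⟨_, rfl⟩
  have h1 : ((∑ x, min t (repCount A' B' x) : ℕ) : ℝ) ≤ S.card * t + p * (0.01 * p) := by
    push_cast
    calc _ ≤ ∑ x : ZMod p, ((if x ∈ S then (t : ℝ) else 0) + 0.01 * p) := by
          refine sum_le_sum fun x _ => ?_
          split_ifs with h
          · have : (0 : ℝ) ≤ 0.01 * p := by positivity
            exact (min_le_left _ _).trans (by linarith)
          · rw [hS, mem_filter] at h
            push Not at h
            exact (min_le_right _ _).trans (by linarith [h (mem_univ _)])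
      _ = _ := by
          rw [sum_add_distrib, ← sum_filter, sum_const, sum_const,
            Finset.card_univ, ZMod.card]
          simp
  have h2 : 0.65 * (p : ℝ) ≤ S.card := by
    have k : (t : ℝ) * (m + m) ≤ t * t + ((∑ x, min t (repCount A' B' x) : ℕ) : ℝ) := by
      exact_mod_cast key
    by_contra! hc
    nlinarith
  have h3 : 0.12 * (p : ℝ) ≤ ({c ∈ C | b - c ∈ S}.card : ℝ) := by
    have e : {c ∈ C | b - c ∈ S} = C ∩ S.image (b - ·) := by
      ext c
      simp only [mem_filter, Finset.mem_inter, mem_image]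
      exact and_congr_right fun _ => ⟨fun h => ⟨_, h, by abel⟩, fun ⟨y, hy, e⟩ => by
        rw [← e]; simpa using hy⟩
    have h4 := Finset.card_union_add_card_inter C (S.image (b - ·))
    have h5 := Finset.card_le_univ (C ∪ S.image (b - ·))
    rw [ZMod.card] at h5
    rw [Finset.card_image_of_injective _ sub_right_injective, ← e] at h4
    have h6 : (C.card : ℝ) + S.card ≤ p + ({c ∈ C | b - c ∈ S}.card : ℝ) := by
      exact_mod_cast (by omega)
    linarith
  rw [← sum_repCount_sub_eq]
  push_cast
  calc (p : ℝ) ^ 2 / 1000 ≤ ∑ c ∈ C with b - c ∈ S, 0.01 * (p : ℝ) := by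
        rw [sum_const, nsmul_eq_mul]
        nlinarith
    _ ≤ ∑ c ∈ C with b - c ∈ S, (repCount A B (b - c) : ℝ) := by
        refine sum_le_sum fun c hc => ?_
        have := (mem_filter.1 hc).2
        rw [hS, mem_filter] at this
        exact this.2.trans (Nat.cast_le.2 (repCount_mono hAA hBB _))
    _ ≤ _ := sum_le_sum_of_subset_of_nonneg (filter_subset _ _)
        fun _ _ _ => Nat.cast_nonneg _

section

open InnerProductGeometry

theorem angle_exp_of_abs_lt {z : ℂ} (hz : z ≠ 0) {t : ℝ} (h : |z.arg - t| < π) :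
    angle z (Complex.exp (t * Complex.I)) = |z.arg - t| := by
  have h1 : z / Complex.exp (t * Complex.I) =
      (‖z‖ : ℂ) * Complex.exp (((z.arg - t : ℝ) : ℂ) * Complex.I) := by
    rw [div_eq_iff (Complex.exp_ne_zero _), mul_assoc, ← Complex.exp_add]
    conv_lhs => rw [← Complex.norm_mul_exp_arg_mul_I z]
    congr 2; push_cast; ring
  rw [Complex.angle_eq_abs_arg hz (Complex.exp_ne_zero _), h1,
    Complex.arg_real_mul _ (norm_pos_iff.2 hz), Complex.arg_exp_mul_I, toIocMod_eq_self _ |>.2]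
  rw [abs_lt] at h
  constructor <;> linarith

theorem exists_stdAddChar_angle_le {P : ℕ} (hP : 2 ≤ P) [NeZero P] {z : ℂ} (hz : z ≠ 0) :
    ∃ b : ZMod P, angle z (ZMod.stdAddChar b) ≤ π / P := by
  have hP' : (2 : ℝ) ≤ P := by exact_mod_cast hP
  obtain ⟨x, hx⟩ : ∃ x, x = z.arg * P / (2 * π) := ⟨_, rfl⟩
  have h1 : |z.arg - 2 * π * round x / P| ≤ π / P := by
    have e : z.arg - 2 * π * round x / P = 2 * π / P * (x - round x) := by
      rw [hx]; field_simp
    rw [e, abs_mul, abs_of_pos (by positivity)]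
    calc _ ≤ 2 * π / P * (1 / 2) := by gcongr; exact abs_sub_round x
      _ = _ := by ring
  refine ⟨(round x : ℤ), ?_⟩
  have e : ZMod.stdAddChar ((round x : ℤ) : ZMod P) =
      Complex.exp ((2 * π * round x / P : ℝ) * Complex.I) := by
    rw [ZMod.stdAddChar_coe]; congr 1; push_cast; ring
  rw [e, angle_exp_of_abs_lt hz]
  · exact h1
  · refine h1.trans_lt ((div_lt_iff₀ (by positivity)).2 ?_)
    nlinarith [pi_pos]

open Classical in
theorem exists_le_sum_prime_ell : ∃ C, ∀ K X : ℝ, 0 ≤ K → K ≤ X →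
    4 * (K - C) ≤ ∑ z ∈ gball X with Prime z ∧ X - K < ell z, 1 / nrm z * ell z := by
  obtain ⟨C, -, hC⟩ := exists_sum_gprimes_log_bound
  refine ⟨2 * C, fun K X hK hKX => ?_⟩
  have h1 := abs_le.1 (hC X (hK.trans hKX))
  have h2 := abs_le.1 (hC (X - K) (by linarith))
  have h3 : gprimes (X - K) = {p ∈ gprimes X | ¬ X - K < ell p} := by
    ext p
    simp only [mem_gprimes, mem_filter, not_lt]
    exact ⟨fun h => ⟨⟨h.1, by linarith [h.2]⟩, h.2⟩, fun h => ⟨h.1.1, h.2⟩⟩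
  have h4 := sum_filter_add_sum_filter_not (gprimes X) (fun p => X - K < ell p)
    (fun p => 1 / nrm p * ell p)
  rw [← h3] at h4
  obtain ⟨S, hS⟩ : ∃ S, S = {p ∈ gprimes X | X - K < ell p} := ⟨_, rfl⟩
  rw [← hS] at h4
  have hmem : ∀ y ∈ gunits ×ˢ S, IsUnit y.1 ∧ GCan y.2 ∧ ell y.2 ≤ X ∧ X - K < ell y.2 ∧
      Associated (y.1 * y.2) y.2 := by
    intro y hy
    rw [mem_product, hS, mem_filter, mem_gprimes, mem_gunits] at hy
    exact ⟨hy.1, hy.2.1.1, hy.2.1.2, hy.2.2, (associated_isUnit_mul_left_iff hy.1).2 (.refl _)⟩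
  calc 4 * (K - 2 * C) ≤ ∑ y ∈ gunits ×ˢ S, 1 / nrm y.2 * ell y.2 := by
        simp only [sum_product]
        rw [sum_const, card_gunits, nsmul_eq_mul]
        push_cast
        linarith
    _ = ∑ z ∈ (gunits ×ˢ S).image (fun y => y.1 * y.2), 1 / nrm z * ell z := by
        rw [Finset.sum_image]
        · refine sum_congr rfl fun y hy => ?_
          have h := (hmem y hy).2.2.2.2
          rw [nrm_eq_of_associated h, ell_eq_of_associated h]
        · intro y hy w hw e
          obtain ⟨-, h2, -, -, h5⟩ := hmem y hy
          obtain ⟨-, k2, -, -, k5⟩ := hmem w hw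
          simp only at e
          have h := h2.eq_of_associated k2 (h5.symm.trans (e ▸ k5))
          rw [h] at e
          exact Prod.ext (mul_right_cancel₀ k2.1.ne_zero e) h
    _ ≤ _ := by
        refine sum_le_sum_of_subset_of_nonneg ?_ fun z hz _ =>
          mul_nonneg (one_div_nrm_nonneg z) (ell_nonneg z)
        intro z hz
        obtain ⟨y, hy, rfl⟩ := mem_image.1 hz
        obtain ⟨-, h2, h3, h4, h5⟩ := hmem y hy
        have hp := h5.symm.prime h2.1
        simp only [mem_filter, mem_gball, ell_eq_of_associated h5]
        exact ⟨⟨hp.ne_zero, h3⟩, hp, h4⟩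

open Classical in
/-- The Gaussian primes with logarithm of the norm in a short window and in a given bin. -/
noncomputable def gbin (K : ℝ) {β : Type*} (bin : GaussianInt → β) (X : ℝ) (b : β) :
    Finset GaussianInt :=
  {z ∈ gball X | (Prime z ∧ X - K < ell z) ∧ bin z = b}

theorem mem_gbin {K : ℝ} {β : Type*} {bin : GaussianInt → β} {X : ℝ} {b : β} {z : GaussianInt} :
    z ∈ gbin K bin X b ↔ Prime z ∧ X - K < ell z ∧ ell z ≤ X ∧ bin z = b := by
  simp only [gbin, mem_filter, mem_gball]
  exact ⟨fun h => ⟨h.2.1.1, h.2.1.2, h.1.2, h.2.2⟩,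
    fun h => ⟨⟨h.1.ne_zero, h.2.2.1⟩, ⟨h.1, h.2.1⟩, h.2.2.2⟩⟩

open Classical in
/-- Almost half of all bins contain a positive proportion of Gaussian primes. -/
theorem exists_card_bins_ge : ∃ K₀ : ℝ, 1 ≤ K₀ ∧ ∀ K, K₀ ≤ K → ∀ᶠ X : ℝ in atTop,
    ∀ (P : ℕ) [NeZero P], 2 ≤ P → exp (-X ^ (0.69 : ℝ)) ≤ π / P →
    ∀ bin : GaussianInt → ZMod P, (∀ z : GaussianInt, z ≠ 0 → angle (z : ℂ) (ZMod.stdAddChar (bin z)) ≤ π / P) →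
    0.47 * (P : ℝ) ≤ ((univ.filter fun b : ZMod P => 0.1 * K / P ≤
      ∑ z ∈ gbin K bin X b, 1 / nrm z * ell z).card : ℝ) := by
  obtain ⟨C, hC⟩ := exists_le_sum_prime_ell
  refine ⟨max 1 (40 * C), le_max_left _ _, fun K hK => ?_⟩
  have hK1 : 1 ≤ K := (le_max_left _ _).trans hK
  have hKC : 40 * C ≤ K := (le_max_right _ _).trans hK
  filter_upwards [eventually_sum_prime_gsector_le hK1, eventually_ge_atTop K]
    with X hX hKX P _ hP hPX bin hbin
  have hP' : (2 : ℝ) ≤ P := by exact_mod_cast hP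
  have hX0 : 0 < X := by linarith
  obtain ⟨m, hm⟩ : ∃ m : ZMod P → ℝ, ∀ b, m b =
    ∑ z ∈ gbin K bin X b, 1 / nrm z * ell z :=
    ⟨_, fun _ => rfl⟩
  have hup : ∀ b, m b ≤ 8.02 * K / P := by
    intro b
    have h := hX (ZMod.stdAddChar b) (by
      rw [ZMod.stdAddChar_apply]; exact Circle.coe_ne_zero _) (π / P) hPX
      (div_le_self pi_pos.le (by linarith))
    calc m b ≤ ∑ z ∈ gsector (ZMod.stdAddChar b) (π / P) (X - K) X with Prime z,
          1 / nrm z * X := by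
          rw [hm]
          refine (sum_le_sum fun z hz => ?_).trans
            (sum_le_sum_of_subset_of_nonneg ?_ fun z _ _ =>
              mul_nonneg (one_div_nrm_nonneg z) hX0.le)
          · exact mul_le_mul_of_nonneg_left (mem_gbin.1 hz).2.2.1 (one_div_nrm_nonneg z)
          · intro z hz
            obtain ⟨h1, h2, h3, rfl⟩ := mem_gbin.1 hz
            exact mem_filter.2
              ⟨mem_gsector.2 ⟨h1.ne_zero, h2.le, h3, hbin z h1.ne_zero⟩, h1⟩
      _ ≤ 2.55 * (π / P * K / X) * X := by rw [← sum_mul]; gcongr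
      _ = 2.55 * π * (K / P) := by field_simp
      _ ≤ 8.02 * (K / P) := by
          gcongr
          linarith [pi_lt_d4]
      _ = _ := by ring
  have hsum : 4 * (K - C) ≤ ∑ b, m b := by
    refine (hC K X (by linarith) hKX).trans_eq ?_
    rw [← Finset.sum_fiberwise _ bin]
    refine sum_congr rfl fun b _ => ?_
    rw [hm, filter_filter, gbin]
    congr!
  simp only [← hm]
  obtain ⟨A, hA⟩ : ∃ A, A = univ.filter (fun b => 0.1 * K / P ≤ m b) := ⟨_, rfl⟩
  rw [← hA]
  have h2 : ∑ b, m b ≤ A.card * (7.92 * K / P) + P * (0.1 * K / P) := by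
    calc _ ≤ ∑ b : ZMod P, ((if b ∈ A then 7.92 * K / P else 0) + 0.1 * K / P) := by
          refine sum_le_sum fun b _ => ?_
          split_ifs with h
          · exact (hup b).trans_eq (by ring)
          · rw [hA, mem_filter, not_and, not_le] at h
            linarith [h (mem_univ _)]
      _ = _ := by
          rw [sum_add_distrib, ← sum_filter, sum_const, sum_const,
            Finset.card_univ, ZMod.card]
          simp
  have h3 : 3.8 * K ≤ A.card * (7.92 * K / P) := by
    have : (P : ℝ) * (0.1 * K / P) = 0.1 * K := by field_simp
    linarith
  rw [mul_div_assoc', le_div_iff₀ (by positivity)] at h3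
  nlinarith

theorem angle_mul_mul_le {x y u v : ℂ} (hy : y ≠ 0) (hu : u ≠ 0) :
    angle (x * y) (u * v) ≤ angle x u + angle y v := by
  refine (angle_le_angle_add_angle _ (u * y) _).trans ?_
  rw [Complex.angle_mul_right hy, Complex.angle_mul_left hu]

theorem gfac_mul {U : ℝ} {x y : GaussianInt} : gfac U (x * y) = gfac U x ∪ gfac U y := by
  ext p
  simp only [mem_gfac, mem_union, ← and_or_left]
  exact and_congr_right fun h => (mem_gmid.1 h).1.1.dvd_mul

theorem GRough.mul {Y : ℝ} {x y : GaussianInt} (hx : GRough Y x) (hy : GRough Y y) :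
    GRough Y (x * y) := fun p hp h =>
  ((mem_gprimes.1 hp).1.1.dvd_or_dvd h).elim (hx p hp) (hy p hp)

/-- The elements of `z` whose triple products are recovered up to units from the factors. -/
noncomputable def gassoc (U : ℝ) (z : GaussianInt) : Finset GaussianInt :=
  (gunits ×ˢ gfac U z).image fun y => y.1 * y.2

theorem mem_gassoc {U : ℝ} {z p q : GaussianInt} (hq : q ∈ gfac U z) (h : Associated q p) :
    p ∈ gassoc U z := by
  obtain ⟨u, hu⟩ := h
  exact mem_image.2 ⟨(u, q), mem_product.2 ⟨mem_gunits.2 u.isUnit, hq⟩,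
    by rw [mul_comm]; exact hu⟩

section
variable {K : ℝ} {P : ℕ} [NeZero P] {bin : GaussianInt → ZMod P}

theorem prod_three_mem_rsec {U α X₁ X₂ X₃ : ℝ} {b₁ b₂ b₃ : ZMod P} {p₁ p₂ p₃ : GaussianInt}
    (hbin : ∀ z : GaussianInt, z ≠ 0 → angle (z : ℂ) (ZMod.stdAddChar (bin z)) ≤ α)
    (h₁ : p₁ ∈ gbin K bin X₁ b₁) (h₂ : p₂ ∈ gbin K bin X₂ b₂) (h₃ : p₃ ∈ gbin K bin X₃ b₃)
    (hU : 0 ≤ U) (hX : X₁ + X₂ + X₃ = U) (h0 : U ^ (0.7 : ℝ) ≤ X₁ - K)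
    (h12 : X₁ ≤ X₂ - K) (h23 : X₂ ≤ X₃ - K) :
    p₁ * p₂ * p₃ ∈ rsec (ZMod.stdAddChar (b₁ + b₂ + b₃)) (3 * α) (U - 3 * K) U ∧
    (gfac U (p₁ * p₂ * p₃)).card = 3 ∧
    1 / nrm (p₁ * p₂ * p₃) * ∏ p ∈ gfac U (p₁ * p₂ * p₃), ell p =
      (1 / nrm p₁ * ell p₁) * (1 / nrm p₂ * ell p₂) * (1 / nrm p₃ * ell p₃) ∧
    p₁ ∈ gassoc U (p₁ * p₂ * p₃) ∧ p₂ ∈ gassoc U (p₁ * p₂ * p₃) ∧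
    p₃ ∈ gassoc U (p₁ * p₂ * p₃) := by
  obtain ⟨hp₁, hl₁, hu₁, rfl⟩ := mem_gbin.1 h₁
  obtain ⟨hp₂, hl₂, hu₂, rfl⟩ := mem_gbin.1 h₂
  obtain ⟨hp₃, hl₃, hu₃, rfl⟩ := mem_gbin.1 h₃
  have e₁ := ell_nonneg p₁
  have key : ∀ p, Prime p → U ^ (0.7 : ℝ) < ell p → ell p ≤ U →
      ∃ q, Associated q p ∧ GRough (U ^ (0.7 : ℝ)) p ∧ gfac U p = {q} ∧ ell q = ell p := by
    intro p hp k1 k2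
    obtain ⟨q, hq, ha⟩ := exists_gmid_associated hp k1 (by linarith)
    obtain ⟨k3, k4⟩ := rough_of_associated hq ha
    exact ⟨q, ha, k3, k4, ell_eq_of_associated ha⟩
  obtain ⟨q₁, a₁, r₁, f₁, l₁⟩ := key p₁ hp₁ (by linarith) (by linarith)
  obtain ⟨q₂, a₂, r₂, f₂, l₂⟩ := key p₂ hp₂ (by linarith) (by linarith)
  obtain ⟨q₃, a₃, r₃, f₃, l₃⟩ := key p₃ hp₃ (by linarith) (by linarith)
  have hfac : gfac U (p₁ * p₂ * p₃) = {q₁, q₂, q₃} := by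
    rw [gfac_mul, gfac_mul, f₁, f₂, f₃]; ext; simp
  have n12 : q₁ ≠ q₂ := fun h => by rw [h] at l₁; linarith
  have n13 : q₁ ≠ q₃ := fun h => by rw [h] at l₁; linarith
  have n23 : q₂ ≠ q₃ := fun h => by rw [h] at l₂; linarith
  have z₁ := hp₁.ne_zero
  have z₂ := hp₂.ne_zero
  have z₃ := hp₃.ne_zero
  have hell : ell (p₁ * p₂ * p₃) = ell p₁ + ell p₂ + ell p₃ := by
    rw [ell_mul (mul_ne_zero z₁ z₂) z₃, ell_mul z₁ z₂]
  have hc : ∀ b : ZMod P, (ZMod.stdAddChar b : ℂ) ≠ 0 := fun b => by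
    rw [ZMod.stdAddChar_apply]; exact Circle.coe_ne_zero _
  have hc' : ∀ z : GaussianInt, z ≠ 0 → (z : ℂ) ≠ 0 := fun z hz => by
    rwa [Ne, GaussianInt.toComplex_eq_zero]
  refine ⟨mem_rsec.2 ⟨mem_gsector.2 ⟨mul_ne_zero (mul_ne_zero z₁ z₂) z₃, by linarith,
    by linarith, ?_⟩, (r₁.mul r₂).mul r₃⟩, ?_, ?_, ?_⟩
  · rw [AddChar.map_add_eq_mul, AddChar.map_add_eq_mul, map_mul, map_mul]
    have k1 := angle_mul_mul_le (x := (p₁ : ℂ) * p₂)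
      (v := ZMod.stdAddChar (bin p₃)) (hc' _ z₃) (mul_ne_zero (hc (bin p₁)) (hc (bin p₂)))
    have k2 := angle_mul_mul_le (x := (p₁ : ℂ)) (v := ZMod.stdAddChar (bin p₂)) (hc' _ z₂)
      (hc (bin p₁))
    linarith [hbin _ z₁, hbin _ z₂, hbin _ z₃]
  · rw [hfac, Finset.card_eq_three]
    exact ⟨q₁, q₂, q₃, n12, n13, n23, rfl⟩
  · rw [hfac, prod_insert (by simp [n12, n13]), Finset.prod_pair n23, l₁, l₂, l₃, nrm_mul,
      nrm_mul]
    have := nrm_pos z₁; have := nrm_pos z₂; have := nrm_pos z₃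
    field_simp
  · exact ⟨mem_gassoc (by simp [hfac]) a₁, mem_gassoc (by simp [hfac]) a₂,
      mem_gassoc (by simp [hfac]) a₃⟩
end

theorem sum_comp_le_of_card_fiber_le {ι κ : Type*} [DecidableEq κ] {T : Finset ι} {S : Finset κ}
    {f : ι → κ} {w : κ → ℝ} {n : ℕ} (hf : ∀ y ∈ T, f y ∈ S) (hw : ∀ z ∈ S, 0 ≤ w z)
    (hn : ∀ z ∈ S, {y ∈ T | f y = z}.card ≤ n) : ∑ y ∈ T, w (f y) ≤ n * ∑ z ∈ S, w z := by
  rw [← Finset.sum_fiberwise_of_maps_to hf, mul_sum]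
  refine sum_le_sum fun z hz => ?_
  rw [sum_congr rfl fun y hy => by rw [(mem_filter.1 hy).2], sum_const,
    nsmul_eq_mul]
  exact mul_le_mul_of_nonneg_right (Nat.cast_le.2 (hn z hz)) (hw z hz)

theorem card_fiber_gassoc_le {U : ℝ} {z : GaussianInt} (hz : (gfac U z).card = 3)
    {T : Finset (GaussianInt × GaussianInt × GaussianInt)}
    (hT : ∀ y ∈ T, y.1 ∈ gassoc U z ∧ y.2.1 ∈ gassoc U z ∧ y.2.2 ∈ gassoc U z) :
    T.card ≤ 1728 := by
  have h : (gassoc U z).card ≤ 12 := Finset.card_image_le.trans_eq (by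
    rw [Finset.card_product, card_gunits, hz])
  calc T.card ≤ (gassoc U z ×ˢ gassoc U z ×ˢ gassoc U z).card :=
        card_le_card fun y hy => by
          simpa only [mem_product] using hT y hy
    _ ≤ 12 * (12 * 12) := by
        rw [Finset.card_product, Finset.card_product]; gcongr
    _ = _ := by norm_num

open Classical in
theorem card_mul_le_sum_rsec {K : ℝ} (hK : 1 ≤ K) {P : ℕ} [NeZero P]
    {bin : GaussianInt → ZMod P} {I n : ℕ} {U α m : ℝ} (hm : 0 ≤ m)
    (hbin : ∀ z : GaussianInt, z ≠ 0 → angle (z : ℂ) (ZMod.stdAddChar (bin z)) ≤ α)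
    (hn : 1 ≤ n) (hI : 20 * n ≤ I) (hU : U = (I + 3) * K) (h0 : U ^ (0.7 : ℝ) ≤ 4 * n * K)
    (b : ZMod P) {X : Finset ((ℕ × ℕ) × ZMod P × ZMod P × ZMod P)}
    (hX : ∀ x ∈ X, (4 * n ≤ x.1.1 ∧ x.1.1 ≤ 5 * n ∧ 6 * n ≤ x.1.2 ∧ x.1.2 ≤ 7 * n) ∧
      x.2.1 + x.2.2.1 + x.2.2.2 = b ∧
      m ≤ ∑ z ∈ gbin K bin ((x.1.1 + 1) * K) x.2.1, 1 / nrm z * ell z ∧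
      m ≤ ∑ z ∈ gbin K bin ((x.1.2 + 1) * K) x.2.2.1, 1 / nrm z * ell z ∧
      m ≤ ∑ z ∈ gbin K bin (((I - x.1.1 - x.1.2 : ℕ) + 1) * K) x.2.2.2, 1 / nrm z * ell z) :
    X.card * m ^ 3 ≤ 1728 * ∑ z ∈ rsec (ZMod.stdAddChar b) (3 * α) (U - 3 * K) U with
      (gfac U z).card = 3, 1 / nrm z * ∏ p ∈ gfac U z, ell p := by
  obtain ⟨G, hG⟩ : ∃ G : (ℕ × ℕ) × ZMod P × ZMod P × ZMod P →
      Finset (GaussianInt × GaussianInt × GaussianInt), ∀ x, G x =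
        gbin K bin ((x.1.1 + 1) * K) x.2.1 ×ˢ gbin K bin ((x.1.2 + 1) * K) x.2.2.1 ×ˢ
        gbin K bin (((I - x.1.1 - x.1.2 : ℕ) + 1) * K) x.2.2.2 := ⟨_, fun _ => rfl⟩
  obtain ⟨g, hg⟩ : ∃ g : GaussianInt → ℝ, ∀ z, g z = 1 / nrm z * ell z := ⟨_, fun _ => rfl⟩
  simp only [← hg] at hX
  obtain ⟨w, hw⟩ : ∃ w : GaussianInt → ℝ, ∀ z, w z = 1 / nrm z * ∏ p ∈ gfac U z, ell p :=
    ⟨_, fun _ => rfl⟩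
  simp only [← hw]
  have key : ∀ x ∈ X, ∀ y ∈ G x,
      y.1 * y.2.1 * y.2.2 ∈ {z ∈ rsec (ZMod.stdAddChar b) (3 * α) (U - 3 * K) U |
        (gfac U z).card = 3} ∧ w (y.1 * y.2.1 * y.2.2) = g y.1 * g y.2.1 * g y.2.2 ∧
      y.1 ∈ gassoc U (y.1 * y.2.1 * y.2.2) ∧ y.2.1 ∈ gassoc U (y.1 * y.2.1 * y.2.2) ∧
      y.2.2 ∈ gassoc U (y.1 * y.2.1 * y.2.2) := by
    intro x hx y hy
    rw [hG, mem_product, mem_product] at hy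
    obtain ⟨⟨k1, k2, k3, k4⟩, hb, -⟩ := hX x hx
    have e1 : ((I - x.1.1 - x.1.2 : ℕ) : ℝ) = I - x.1.1 - x.1.2 := by
      rw [Nat.cast_sub (by omega), Nat.cast_sub (by omega)]
    have c1 : (4 * n : ℝ) ≤ x.1.1 := by exact_mod_cast k1
    have c2 : (x.1.1 : ℝ) + 1 ≤ x.1.2 := by exact_mod_cast (by omega : x.1.1 + 1 ≤ x.1.2)
    have c3 : (x.1.2 : ℝ) + 1 ≤ (I - x.1.1 - x.1.2 : ℕ) := by
      exact_mod_cast (by omega : x.1.2 + 1 ≤ I - x.1.1 - x.1.2)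
    have := prod_three_mem_rsec (U := U) hbin hy.1 hy.2.1 hy.2.2 (by rw [hU]; positivity)
      (by rw [e1, hU]; ring) (by nlinarith) (by nlinarith) (by nlinarith)
    rw [hb] at this
    obtain ⟨j1, j2, j3, j4⟩ := this
    exact ⟨mem_filter.2 ⟨j1, j2⟩, by rw [hw, j3, hg, hg, hg], j4⟩
  have hdisj : (X : Set ((ℕ × ℕ) × ZMod P × ZMod P × ZMod P)).PairwiseDisjoint G := by
    intro x hx x' hx' hne
    rw [Function.onFun, Finset.disjoint_left]
    intro y hy hy'
    refine hne ?_
    rw [hG, mem_product, mem_product, mem_gbin, mem_gbin, mem_gbin] at hy hy'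
    obtain ⟨⟨-, a1, a2, a3⟩, ⟨-, b1, b2, b3⟩, -, -, -, d3⟩ := hy
    obtain ⟨⟨-, a1', a2', a3'⟩, ⟨-, b1', b2', b3'⟩, -, -, -, d3'⟩ := hy'
    have aux : ∀ {i j : ℕ} {t : ℝ}, (i + 1) * K - K < t → t ≤ (j + 1) * K → i ≤ j := by
      intro i j t h1 h2
      have : (i : ℝ) * K < (j + 1) * K := by linarith
      have := lt_of_mul_lt_mul_right this (by linarith)
      exact Nat.lt_succ_iff.1 (by exact_mod_cast this)
    exact Prod.ext (Prod.ext ((aux a1 a2').antisymm (aux a1' a2))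
      ((aux b1 b2').antisymm (aux b1' b2)))
      (Prod.ext (a3.symm.trans a3') (Prod.ext (b3.symm.trans b3') (d3.symm.trans d3')))
  have hlow : ∀ x ∈ X, m ^ 3 ≤ ∑ y ∈ G x, w (y.1 * y.2.1 * y.2.2) := by
    intro x hx
    obtain ⟨-, -, m1, m2, m3⟩ := hX x hx
    rw [sum_congr rfl fun y hy => (key x hx y hy).2.1, hG, sum_product]
    simp only [sum_product, mul_assoc, ← mul_sum, ← sum_mul]
    rw [pow_succ, pow_two, mul_assoc]
    have := hm.trans m1
    have := hm.trans m2
    gcongr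
  calc _ = ∑ x ∈ X, m ^ 3 := by rw [sum_const, nsmul_eq_mul]
    _ ≤ ∑ x ∈ X, ∑ y ∈ G x, w (y.1 * y.2.1 * y.2.2) := sum_le_sum hlow
    _ = ∑ y ∈ X.biUnion G, w (y.1 * y.2.1 * y.2.2) := (Finset.sum_biUnion hdisj).symm
    _ ≤ _ := by
        rw [show (1728 : ℝ) = ((1728 : ℕ) : ℝ) by norm_num]
        refine sum_comp_le_of_card_fiber_le (fun y hy => ?_) (fun z _ => ?_) fun z hz => ?_
        · obtain ⟨x, hx, hy⟩ := Finset.mem_biUnion.1 hy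
          exact (key x hx y hy).1
        · rw [hw]
          exact mul_nonneg (one_div_nrm_nonneg z) (prod_nonneg fun p _ => ell_nonneg p)
        · refine card_fiber_gassoc_le (mem_filter.1 hz).2 fun y hy => ?_
          obtain ⟨hy', rfl⟩ := mem_filter.1 hy
          obtain ⟨x, hx, hy⟩ := Finset.mem_biUnion.1 hy'
          exact (key x hx y hy).2.2

open Classical in
/-- Gaussian primes exist with the right order of magnitude in thin sectors. -/
theorem exists_sum_prime_gsector_ge : ∃ K : ℝ, 1 ≤ K ∧ ∀ᶠ I : ℕ in atTop,
    ∀ P : ℕ, P.Prime → 1000 ≤ P → log P ≤ (I : ℝ) ^ (0.68 : ℝ) → ∀ t : ℤ,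
    0.000000000001 / ((P : ℝ) * I) ≤ ∑ z ∈ gsector (Complex.exp ((2 * π * t / P : ℝ) * Complex.I))
      (3 * (π / P)) (I * K) ((I + 3) * K) with Prime z, 1 / nrm z := by
  obtain ⟨K, hK, hbins⟩ := exists_card_bins_ge
  have hbins := hbins K le_rfl
  refine ⟨K, hK, ?_⟩
  obtain ⟨X₀, hX₀⟩ := eventually_atTop.1 hbins
  have hU : Tendsto (fun I : ℕ => ((I : ℝ) + 3) * K) atTop atTop :=
    (tendsto_atTop_add_const_right _ _ tendsto_natCast_atTop_atTop).atTop_mul_const (by linarith)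
  filter_upwards [hU.eventually (eventually_sum_card_three_le (K := 3 * K) (by linarith)),
    hU.eventually (eventually_const_mul_rpow_le (a := 0.7) (b := 1) (by norm_num) 21),
    tendsto_natCast_atTop_atTop.eventually
      (eventually_const_mul_rpow_le (a := 0.68) (b := 0.69) (by norm_num) (10 ^ (0.69 : ℝ))),
    hU.eventually (eventually_const_mul_rpow_le (a := -1.05) (b := -1) (by norm_num) (300000000000000 * K)),
    tendsto_natCast_atTop_atTop.eventually (eventually_ge_atTop (10 * X₀)),
    eventually_ge_atTop 100] with I h1 h2 h3 h4 h5 h100 P hP hP1 hPI t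
  have : Fact P.Prime := ⟨hP⟩
  have hP' : (1000 : ℝ) ≤ P := by exact_mod_cast hP1
  have hP0 : (0 : ℝ) < P := by linarith
  have hI' : (100 : ℝ) ≤ I := by exact_mod_cast h100
  obtain ⟨U, hUd⟩ : ∃ U, U = ((I : ℝ) + 3) * K := ⟨_, rfl⟩
  rw [← hUd] at h1 h2 h4 ⊢
  have hIU : (I : ℝ) ≤ U := by rw [hUd]; nlinarith
  have hU0 : 0 < U := by linarith
  rw [rpow_one] at h2
  obtain ⟨n, hn⟩ : ∃ n, n = I / 20 := ⟨_, rfl⟩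
  have hn1 : 20 * n ≤ I := by omega
  have hn2 : (I : ℝ) ≤ 20 * n + 19 := by exact_mod_cast (by omega : I ≤ 20 * n + 19)
  have hexp : ∀ X : ℝ, (I : ℝ) / 10 ≤ X → exp (-X ^ (0.69 : ℝ)) ≤ π / P := by
    intro X hX
    have k : (I : ℝ) ^ (0.68 : ℝ) ≤ X ^ (0.69 : ℝ) := by
      have : (I : ℝ) ^ (0.69 : ℝ) ≤ 10 ^ (0.69 : ℝ) * X ^ (0.69 : ℝ) := by
        rw [← mul_rpow (by norm_num) (by linarith)]
        exact rpow_le_rpow (by linarith) (by linarith) (by norm_num)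
      exact le_of_mul_le_mul_left (h3.trans this) (by positivity)
    calc exp (-X ^ (0.69 : ℝ)) ≤ exp (-log P) := exp_le_exp.2 (by linarith)
      _ = 1 / P := by rw [exp_neg, exp_log hP0, one_div]
      _ ≤ _ := by gcongr; linarith [pi_gt_three]
  have hbin : ∀ z : GaussianInt, ∃ b : ZMod P,
      z ≠ 0 → angle (z : ℂ) (ZMod.stdAddChar b) ≤ π / P := by
    intro z
    by_cases hz : z = 0
    · exact ⟨0, fun h => absurd hz h⟩
    · obtain ⟨b, hb⟩ := exists_stdAddChar_angle_le (P := P) (by omega) (z := (z : ℂ))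
        (by rwa [Ne, GaussianInt.toComplex_eq_zero])
      exact ⟨b, fun _ => hb⟩
  choose bin hbin using hbin
  obtain ⟨A, hA⟩ : ∃ A : ℕ → Finset (ZMod P), ∀ i, A i = univ.filter
    fun b => 0.1 * K / P ≤ ∑ z ∈ gbin K bin ((i + 1) * K) b, 1 / nrm z * ell z := ⟨_, fun _ => rfl⟩
  have hAc : ∀ i, 4 * n ≤ i → 0.47 * (P : ℝ) ≤ (A i).card := by
    intro i hi
    have k1 : (4 * n : ℝ) ≤ i := by exact_mod_cast hi
    have k2 : (I : ℝ) / 10 ≤ (i + 1) * K := by nlinarith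
    rw [hA]
    exact hX₀ _ (by linarith) P (by omega) (hexp _ k2) bin hbin
  obtain ⟨b, hb⟩ : ∃ b : ZMod P, b = t := ⟨_, rfl⟩
  have hω : Complex.exp ((2 * π * t / P : ℝ) * Complex.I) = ZMod.stdAddChar b := by
    rw [hb, ZMod.stdAddChar_coe]; congr 1; push_cast; ring
  rw [hω, show (I : ℝ) * K = U - 3 * K by rw [hUd]; ring]
  obtain ⟨X, hX⟩ : ∃ X : Finset ((ℕ × ℕ) × ZMod P × ZMod P × ZMod P),
      X = {x ∈ (Icc (4 * n) (5 * n) ×ˢ Icc (6 * n) (7 * n)) ×ˢ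
        (univ : Finset (ZMod P × ZMod P × ZMod P)) | x.2 ∈
        {y ∈ A x.1.1 ×ˢ A x.1.2 ×ˢ A (I - x.1.1 - x.1.2) | y.1 + y.2.1 + y.2.2 = b}} :=
    ⟨_, rfl⟩
  have hXc : (I : ℝ) ^ 2 / 400 * ((P : ℝ) ^ 2 / 1000) ≤ X.card := by
    rw [hX, card_filter, sum_product]
    push_cast
    calc _ ≤ ∑ x ∈ Icc (4 * n) (5 * n) ×ˢ Icc (6 * n) (7 * n),
          (P : ℝ) ^ 2 / 1000 := by
          rw [sum_const, Finset.card_product, Nat.card_Icc, Nat.card_Icc, nsmul_eq_mul,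
            show 5 * n + 1 - 4 * n = n + 1 by omega, show 7 * n + 1 - 6 * n = n + 1 by omega]
          push_cast
          gcongr
          nlinarith
      _ ≤ _ := by
          refine sum_le_sum fun x hx => ?_
          rw [mem_product, mem_Icc, mem_Icc] at hx
          refine (card_triples_ge hP1 (hAc _ hx.1.1) (hAc x.2 (by omega))
            (hAc (I - x.1 - x.2) (by omega)) b).trans_eq ?_
          rw [← sum_filter, sum_const, nsmul_eq_mul, mul_one]
          congr 2
          ext y; simp
  have hmain := card_mul_le_sum_rsec hK (m := 0.1 * K / P) (X := X) (by positivity) hbin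
    (by omega) hn1 hUd (by nlinarith) b (by
      intro x hx
      simp only [hX, hA, mem_filter, mem_product, mem_Icc, mem_univ,
        true_and, and_true] at hx
      exact ⟨⟨hx.1.1.1, hx.1.1.2, hx.1.2.1, hx.1.2.2⟩, hx.2.2, hx.2.1⟩)
  have h6 := h1 (ZMod.stdAddChar b) (by
    rw [ZMod.stdAddChar_apply]; exact Circle.coe_ne_zero _) (3 * (π / P))
    ((hexp U (by linarith)).trans (by linarith [div_pos pi_pos hP0]))
    (by rw [mul_div_assoc', div_le_iff₀ hP0]; nlinarith [pi_pos])
  generalize ∑ z ∈ rsec (ZMod.stdAddChar b) (3 * (π / P)) (U - 3 * K) U with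
      (gfac U z).card = 3, 1 / nrm z * ∏ p ∈ gfac U z, ell p = S at hmain h6
  have h7 : (I : ℝ) ^ 2 * K ^ 3 / (400000000 * P) ≤ 1728 * S := by
    refine le_trans ?_ hmain
    calc _ = (I : ℝ) ^ 2 / 400 * ((P : ℝ) ^ 2 / 1000) * (0.1 * K / P) ^ 3 := by
          field_simp; norm_num
      _ ≤ _ := by gcongr
  have h8 : 0.000000000002 / (P * I) ≤ 12 / U ^ 3 * S := by
    have hU2 : U ≤ 1.03 * (I * K) := by rw [hUd]; nlinarith
    calc 0.000000000002 / (P * I) ≤ 12 / (1.03 * (I * K)) ^ 3 * ((I : ℝ) ^ 2 * K ^ 3 / (400000000 * P) / 1728) := by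
          rw [← sub_nonneg]
          have : 12 / (1.03 * (I * K)) ^ 3 * ((I : ℝ) ^ 2 * K ^ 3 / (400000000 * P) / 1728) =
            (12 / 1.03 ^ 3 / 400000000 / 1728) * (1 / (P * I)) := by field_simp
          rw [this, show 0.000000000002 / ((P : ℝ) * I) = 0.000000000002 * (1 / (P * I)) by ring, ← sub_mul]
          exact mul_nonneg (by norm_num) (by positivity)
      _ ≤ 12 / U ^ 3 * S := by
          gcongr
          linarith
  have h9 : 10 * (3 * (π / P) * (3 * K)) * U ^ (-1.05 : ℝ) ≤ 0.000000000001 / (P * I) := by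
    have k1 : 300000000000000 * K * U ^ (-1.05 : ℝ) ≤ 1 / I := by
      refine h4.trans ?_
      rw [rpow_neg_one, one_div]
      gcongr
    have k2 : π ≤ 3.2 := by linarith [pi_lt_d2]
    calc _ = π * (90 * K * U ^ (-1.05 : ℝ) / P) := by ring
      _ ≤ 3.2 * (90 * K * U ^ (-1.05 : ℝ) / P) := by gcongr
      _ ≤ 0.000000000001 / P * (300000000000000 * K * U ^ (-1.05 : ℝ)) := by
          rw [← sub_nonneg]
          have : 0.000000000001 / P * (300000000000000 * K * U ^ (-1.05 : ℝ)) - 3.2 * (90 * K * U ^ (-1.05 : ℝ) / P)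
            = 12 * K * U ^ (-1.05 : ℝ) / P := by ring
          rw [this]; positivity
      _ ≤ 0.000000000001 / P * (1 / I) := by gcongr
      _ = _ := by ring
  have : 0.000000000002 / ((P : ℝ) * I) = 0.000000000001 / (P * I) + 0.000000000001 / (P * I) := by ring
  linarith

theorem abs_arg_sub_le_of_angle_le {z : ℂ} (hz : z ≠ 0) {θ α : ℝ} (h0 : 0 ≤ θ)
    (hθ : α + 2 * θ < π) (h : angle z (Complex.exp (θ * Complex.I)) ≤ α) : |z.arg - θ| ≤ α := by
  have h1 : angle (1 : ℂ) (Complex.exp (θ * Complex.I)) = θ := by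
    have hα : 0 ≤ α := (angle_nonneg _ _).trans h
    rw [angle_exp_of_abs_lt one_ne_zero] <;> rw [Complex.arg_one, zero_sub, abs_neg, abs_of_nonneg h0]
    linarith
  have h2 := angle_le_angle_add_angle z (Complex.exp (θ * Complex.I)) 1
  rw [Complex.angle_one_right hz, angle_comm _ (1 : ℂ), h1] at h2
  rwa [angle_exp_of_abs_lt hz] at h
  calc |z.arg - θ| ≤ |z.arg| + |θ| := abs_sub _ _
    _ < π := by rw [abs_of_nonneg h0]; linarith

theorem mem_pairSet_of_mem_gsector {N J u₀ u₁ : ℝ} {P j : ℕ} (hj : 1 ≤ j) (hjP : 100 * j ≤ P)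
    (hPJ : (P : ℝ) ≤ 14 * exp J) (hu₁ : exp u₁ * (41 * j / P) ≤ N)
    (hu₀ : N * exp (-J) ≤ exp u₀ * (12 * j / P)) {z : GaussianInt}
    (hz : z ∈ gsector (Complex.exp ((2 * π * (5 * j : ℕ) / P : ℝ) * Complex.I))
      (3 * (π / P)) u₀ u₁) (hp : Prime z) :
    0 < z.im ∧ 0 < z.re ∧ |(z : ℂ).arg - 10 * j * (π / P)| ≤ 3 * (π / P) ∧
      (z.im.natAbs, z.re.natAbs) ∈ pairSet N J := by
  obtain ⟨h0, h1, h2, h3⟩ := mem_gsector.1 hz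
  have hj' : (1 : ℝ) ≤ j := by exact_mod_cast hj
  have hjP' : 100 * (j : ℝ) ≤ P := by exact_mod_cast hjP
  have hP0 : (0 : ℝ) < P := by linarith
  have hzc : (z : ℂ) ≠ 0 := by rwa [Ne, GaussianInt.toComplex_eq_zero]
  obtain ⟨s, hs⟩ : ∃ s, s = π / P := ⟨_, rfl⟩
  have hs0 : 0 < s := hs ▸ div_pos pi_pos hP0
  have hjs : j * s ≤ π / 100 := by
    rw [hs, mul_div_assoc', div_le_div_iff₀ hP0 (by norm_num)]
    nlinarith [pi_pos]
  have hsj : s ≤ j * s := le_mul_of_one_le_left hs0.le hj'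
  have hπ := pi_lt_d2
  rw [show (2 * π * (5 * j : ℕ) / P : ℝ) = 10 * j * s by rw [hs]; push_cast; ring, ← hs] at h3
  rw [← hs]
  have harg := abs_arg_sub_le_of_angle_le hzc (by positivity) (by nlinarith) h3
  obtain ⟨φ, hφ⟩ : ∃ φ, φ = (z : ℂ).arg := ⟨_, rfl⟩
  have hre : ‖(z : ℂ)‖ * cos φ = (z.re : ℝ) := by
    rw [hφ, Complex.norm_mul_cos_arg, GaussianInt.intCast_re]
  have him : ‖(z : ℂ)‖ * sin φ = (z.im : ℝ) := by
    rw [hφ, Complex.norm_mul_sin_arg, GaussianInt.intCast_im]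
  rw [← hφ] at harg ⊢
  have hφ' := abs_le.1 harg
  have hφ1 : 7 * (j * s) ≤ φ := by linarith
  have hφ2 : φ ≤ 13 * (j * s) := by linarith
  have hφ0 : 0 < φ := lt_of_lt_of_le (by positivity) hφ1
  have hr : 0 < ‖(z : ℂ)‖ := norm_pos_iff.2 hzc
  have hsin : 14 * (j / P : ℝ) ≤ sin φ := by
    refine le_trans ?_ (mul_le_sin hφ0.le (by linarith))
    calc 14 * (j / P : ℝ) = 2 / π * (7 * (j * s)) := by rw [hs]; field_simp; norm_num
      _ ≤ _ := by gcongr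
  have hsin' : sin φ ≤ 41 * (j / P : ℝ) := by
    refine (sin_le hφ0.le).trans (hφ2.trans ?_)
    rw [hs]
    calc 13 * (j * (π / P)) = 13 * π * (j / P) := by ring
      _ ≤ _ := by gcongr; linarith
  have hcos : 0.9 ≤ cos φ := by
    have := one_sub_sq_div_two_le_cos (x := φ)
    nlinarith
  have hjp0 : 0 < (j : ℝ) / P := by positivity
  have him0 : (0 : ℝ) < z.im := him ▸ mul_pos hr (by linarith)
  have hre0 : (0 : ℝ) < z.re := hre ▸ mul_pos hr (by linarith)
  have hlt : (z.im : ℝ) < z.re := by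
    rw [← him, ← hre]
    have := sin_le hφ0.le
    gcongr
    linarith
  have hi : 0 < z.im := by exact_mod_cast him0
  have hr0 : 0 < z.re := by exact_mod_cast hre0
  have hlt' : z.im < z.re := by exact_mod_cast hlt
  have ei : ((z.im.natAbs : ℕ) : ℝ) = z.im := by
    rw [Nat.cast_natAbs, abs_of_pos hi]
  have er : ((z.re.natAbs : ℕ) : ℝ) = z.re := by
    rw [Nat.cast_natAbs, abs_of_pos hr0]
  have hprod : (z.im : ℝ) * z.re = nrm z * (sin φ * cos φ) := by
    rw [← him, ← hre, nrm_eq_norm_sq]; ring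
  have hnz : exp u₀ ≤ nrm z ∧ nrm z ≤ exp u₁ := by
    rw [← exp_ell h0]; exact ⟨exp_le_exp.2 h1, exp_le_exp.2 h2⟩
  have hc1 := cos_le_one φ
  have hsin0 : 0 ≤ sin φ := by linarith
  have hcos0 : 0 ≤ cos φ := by linarith
  have hnn := nrm_nonneg z
  refine ⟨hi, hr0, harg, mem_pairSet.2 ⟨by omega, by omega, ?_, ?_, ?_, ?_⟩⟩
  · rw [ei, er, ← hre, ← him, mul_assoc]
    refine mul_le_mul_of_nonneg_left (hc1.trans ?_) hr.le
    calc (1 : ℝ) ≤ 14 * (1 / P) * exp J := by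
          rw [mul_one_div, div_mul_eq_mul_div, le_div_iff₀ hP0]; linarith
      _ ≤ 14 * (j / P) * exp J := by gcongr
      _ ≤ _ := by gcongr
  · rw [ei, er, hprod]
    refine le_trans ?_ hu₁
    calc nrm z * (sin φ * cos φ) ≤ exp u₁ * (41 * (j / P) * 1) := by
          gcongr
          exact hnz.2
      _ = _ := by ring
  · rw [ei, er, hprod]
    refine hu₀.trans ?_
    calc exp u₀ * (12 * j / P) ≤ exp u₀ * (14 * (j / P) * 0.9) := by
          gcongr
          rw [mul_div_assoc]; linarith
      _ ≤ _ := by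
          gcongr
          exact hnz.1
  · have hcan : GCan z := ⟨hp, hr0, hi.le⟩
    have hn : z.im.natAbs ^ 2 + z.re.natAbs ^ 2 = z.norm.natAbs := by
      zify
      rw [sq_abs, sq_abs, Zsqrtd.norm_def, abs_of_nonneg (by nlinarith)]
      ring
    rw [hn]
    rcases hcan.cases with h | h | ⟨q, -, h⟩
    · exact h.1
    · rw [h] at hlt'; exact absurd hlt' (lt_irrefl _)
    · rw [h] at hi; exact absurd hi (lt_irrefl _)

theorem sum_card_gsector_le {N J : ℝ} {P n : ℕ} (hnP : 100 * n ≤ P) (hPJ : (P : ℝ) ≤ 14 * exp J)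
    {u₀ u₁ : ℕ → ℝ} (hu₁ : ∀ j ∈ Icc 1 n, exp (u₁ j) * (41 * j / P) ≤ N)
    (hu₀ : ∀ j ∈ Icc 1 n, N * exp (-J) ≤ exp (u₀ j) * (12 * j / P))
    {Z : ℕ → Finset GaussianInt} (hZ : ∀ j ∈ Icc 1 n, ∀ z ∈ Z j, Prime z ∧
      z ∈ gsector (Complex.exp ((2 * π * (5 * j : ℕ) / P : ℝ) * Complex.I))
        (3 * (π / P)) (u₀ j) (u₁ j)) :
    ∑ j ∈ Icc 1 n, (Z j).card ≤ (pairSet N J).card := by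
  have key : ∀ j ∈ Icc 1 n, ∀ z ∈ Z j, 0 < z.im ∧ 0 < z.re ∧
      |(z : ℂ).arg - 10 * j * (π / P)| ≤ 3 * (π / P) ∧
      (z.im.natAbs, z.re.natAbs) ∈ pairSet N J := by
    intro j hj z hz
    have h := mem_Icc.1 hj
    exact mem_pairSet_of_mem_gsector h.1 (by omega) hPJ (hu₁ j hj) (hu₀ j hj)
      (hZ j hj z hz).2 (hZ j hj z hz).1
  rw [← Finset.card_biUnion]
  · refine Finset.card_le_card_of_injOn (fun z => (z.im.natAbs, z.re.natAbs)) ?_ ?_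
    · intro z hz
      obtain ⟨j, hj, hz⟩ := Finset.mem_biUnion.1 hz
      exact (key j hj z hz).2.2.2
    · intro z hz w hw e
      obtain ⟨j, hj, hz⟩ := Finset.mem_biUnion.1 hz
      obtain ⟨i, hi, hw⟩ := Finset.mem_biUnion.1 hw
      have h1 := key j hj z hz
      have h2 := key i hi w hw
      simp only [Prod.mk.injEq] at e
      exact Zsqrtd.ext (by omega) (by omega)
  · intro i hi j hj hne
    rw [Function.onFun, Finset.disjoint_left]
    intro z hz hz'
    have h1 := abs_le.1 (key i hi z hz).2.2.1
    have h2 := abs_le.1 (key j hj z hz').2.2.1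
    have hP : 0 < P := by have := mem_Icc.1 hi; omega
    have hs : 0 < π / P := div_pos pi_pos (by exact_mod_cast hP)
    generalize π / P = s at *
    rcases lt_or_gt_of_ne hne with h | h
    · have : (i : ℝ) + 1 ≤ j := by exact_mod_cast h
      nlinarith
    · have : (j : ℝ) + 1 ≤ i := by exact_mod_cast h
      nlinarith

theorem exists_pairSet_card_ge : ∃ c : ℝ, 0 < c ∧ ∀ᶠ N : ℝ in atTop,
    c * (N * windowLog N / log N) ≤ (pairSet N (windowLog N)).card := by
  classical
  obtain ⟨K, hK, hev⟩ := exists_sum_prime_gsector_ge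
  obtain ⟨I₀, hI₀⟩ := eventually_atTop.1 hev
  refine ⟨exp (-4 * K) * 0.000000000001 / 41 / 16, by positivity, ?_⟩
  have hJ : Tendsto windowLog atTop atTop :=
    (tendsto_rpow_atTop (by norm_num)).comp tendsto_log_atTop
  filter_upwards [eventually_windowLog one_pos, hJ.eventually (eventually_ge_atTop (4 * K + 24)),
    tendsto_log_atTop.eventually (eventually_const_mul_rpow_le (a := 2 / 3) (b := 0.68)
      (by norm_num) (2 * (2 * K) ^ (0.68 : ℝ))),
    tendsto_log_atTop.eventually (eventually_ge_atTop (K * (I₀ + 10)))]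
    with N hw h4 h5 h6
  obtain ⟨-, h1, h2, h3⟩ := hw
  obtain ⟨L, hL⟩ : ∃ L, L = log N := ⟨_, rfl⟩
  obtain ⟨J, hJ⟩ : ∃ J, J = windowLog N := ⟨_, rfl⟩
  rw [← hL] at h1 h2 h5 h6 ⊢
  rw [← hJ, one_mul] at h1
  rw [← hJ] at h4 ⊢
  have hN0 : 0 < N := (exp_pos _).trans_le h3
  have hJ5 : 2 * (2 * K) ^ (0.68 : ℝ) * J ≤ L ^ (0.68 : ℝ) := by rw [hJ, windowLog, ← hL]; exact h5
  obtain ⟨P, hP, hP1, hP2⟩ := Nat.exists_prime_lt_and_le_two_mul ⌈exp (J / 2)⌉₊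
    (Nat.ceil_pos.2 (exp_pos _)).ne'
  have hP1' : exp (J / 2) ≤ P := (Nat.le_ceil _).trans (by exact_mod_cast hP1.le)
  have hP2' : (P : ℝ) ≤ 4 * exp (J / 2) := by
    have k1 : (P : ℝ) ≤ 2 * ⌈exp (J / 2)⌉₊ := by exact_mod_cast hP2
    have k2 := Nat.ceil_lt_add_one (exp_pos (J / 2)).le
    have k3 := one_le_exp (show 0 ≤ J / 2 by linarith)
    linarith
  have h1000 : (1000 : ℝ) ≤ exp (J / 2) := by
    have : (2.7 : ℝ) ^ 14 ≤ exp (J / 2) := by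
      calc (2.7 : ℝ) ^ 14 ≤ exp 1 ^ 14 := by gcongr; linarith [exp_one_gt_d9]
        _ = exp (14 : ℝ) := by rw [← exp_nat_mul]; norm_num
        _ ≤ _ := exp_le_exp.2 (by linarith)
    exact le_trans (by norm_num) this
  have hP0 : (0 : ℝ) < P := by linarith
  have hlogP : log P ≤ 2 * J := by
    rw [log_le_iff_le_exp hP0]
    calc (P : ℝ) ≤ 4 * exp (J / 2) := hP2'
      _ ≤ exp (J / 2) * exp (J / 2) := by gcongr; linarith
      _ = exp J := by rw [← exp_add]; ring_nf
      _ ≤ _ := exp_le_exp.2 (by linarith)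
  have hPJ : (P : ℝ) ≤ 14 * exp J := hP2'.trans (by
    have := exp_le_exp.2 (show J / 2 ≤ J by linarith)
    linarith)
  obtain ⟨n, hn⟩ : ∃ n, n = P / 100 := ⟨_, rfl⟩
  obtain ⟨T, hT⟩ : ∃ T : ℕ → ℝ, ∀ j, T j = N * (P / (41 * j)) := ⟨_, fun _ => rfl⟩
  obtain ⟨I, hI⟩ : ∃ I : ℕ → ℕ, ∀ j, I j = ⌊log (T j) / K⌋₊ - 3 := ⟨_, fun _ => rfl⟩
  have hT0 : ∀ j ∈ Icc 1 n, 0 < T j ∧ T j * (41 * j / P) = N ∧ I₀ ≤ I j ∧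
      ((I j : ℝ) + 3) * K ≤ log (T j) ∧ log (T j) ≤ (I j + 4) * K ∧ L / (2 * K) ≤ I j ∧
      (I j : ℝ) ≤ 4 * L := by
    intro j hj
    have hj' := mem_Icc.1 hj
    have hj1 : (1 : ℝ) ≤ j := by exact_mod_cast hj'.1
    have hjP : 100 * (j : ℝ) ≤ P := by exact_mod_cast (by omega : 100 * j ≤ P)
    have k0 : 1 ≤ (P : ℝ) / (41 * j) := by rw [le_div_iff₀ (by positivity)]; linarith
    have k1 : 0 < T j := by rw [hT]; positivity
    have k2 : L ≤ log (T j) := by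
      rw [hL, hT]; exact log_le_log hN0 (le_mul_of_one_le_right hN0.le k0)
    have k3 : log (T j) ≤ 3 * L := by
      have : log (T j) ≤ log (N * P) := log_le_log k1 (by
        rw [hT]; gcongr; exact div_le_self hP0.le (by linarith))
      rw [log_mul hN0.ne' hP0.ne', ← hL] at this
      linarith
    have k4 : (I₀ : ℝ) + 10 ≤ log (T j) / K := by
      rw [le_div_iff₀ (by linarith)]; linarith
    have k5 : I₀ + 10 ≤ ⌊log (T j) / K⌋₊ := Nat.le_floor (by exact_mod_cast k4)
    have k6 : (I j : ℝ) + 3 = ⌊log (T j) / K⌋₊ := by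
      exact_mod_cast (by rw [hI]; omega : I j + 3 = ⌊log (T j) / K⌋₊)
    have k7 : (I j : ℝ) + 3 ≤ log (T j) / K := k6 ▸ Nat.floor_le (by linarith)
    have k8 : log (T j) / K < I j + 4 := by
      have := Nat.lt_floor_add_one (log (T j) / K); rw [← k6] at this; linarith
    have k9 : log (T j) / K ≤ log (T j) := div_le_self (by linarith) hK
    have k10 : L / K ≤ log (T j) / K := by gcongr
    refine ⟨k1, by rw [hT]; field_simp, by rw [hI]; omega, (le_div_iff₀ (by linarith)).1 k7,
      (div_le_iff₀ (by linarith)).1 k8.le, ?_, by linarith⟩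
    have : L / (2 * K) = L / K / 2 := by field_simp
    linarith
  have hcount := sum_card_gsector_le (N := N) (J := J) (P := P) (n := n) (by omega) hPJ
    (u₀ := fun j => I j * K) (u₁ := fun j => (I j + 3) * K) (fun j hj => by
      obtain ⟨a1, a2, -, a3, -⟩ := hT0 j hj
      rw [← a2]
      gcongr
      rw [← exp_log a1]
      exact exp_le_exp.2 a3) (fun j hj => by
      obtain ⟨a1, a2, -, -, a4, -⟩ := hT0 j hj
      have b1 : T j * exp (-(4 * K)) ≤ exp (I j * K) := by
        conv_lhs => rw [← exp_log a1]
        rw [← exp_add]; exact exp_le_exp.2 (by linarith)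
      have b2 : 4 * exp (-J) ≤ exp (-(4 * K)) := by
        have : exp (-J) ≤ exp (-(4 * K)) * exp (-24) := by
          rw [← exp_add]; exact exp_le_exp.2 (by linarith)
        have : exp (-24 : ℝ) ≤ 1 / 4 := by
          rw [exp_neg, inv_le_comm₀ (exp_pos _) (by norm_num)]; linarith [add_one_le_exp (24 : ℝ)]
        nlinarith [exp_pos (-(4 * K))]
      calc N * exp (-J) = 41 / 12 * (T j * exp (-J)) * (12 * j / P) := by
            conv_lhs => rw [← a2]
            ring
        _ ≤ (T j * exp (-(4 * K))) * (12 * j / P) := by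
            refine mul_le_mul_of_nonneg_right ?_ (by positivity)
            linarith [mul_le_mul_of_nonneg_left b2 a1.le, mul_pos a1 (exp_pos (-J))]
        _ ≤ _ := by gcongr)
    (Z := fun j => {z ∈ gsector (Complex.exp ((2 * π * (5 * j : ℕ) / P : ℝ) * Complex.I))
      (3 * (π / P)) (I j * K) ((I j + 3) * K) | Prime z})
    (fun j _ z hz => (mem_filter.1 hz).symm)
  refine le_trans ?_ (Nat.cast_le.2 hcount)
  rw [Nat.cast_sum]
  have hcard : ∀ j ∈ Icc 1 n, exp (-4 * K) * 0.000000000001 / 41 / 4 * (N / L) * (1 / j) ≤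
      ({z ∈ gsector (Complex.exp ((2 * π * (5 * j : ℕ) / P : ℝ) * Complex.I))
        (3 * (π / P)) (I j * K) ((I j + 3) * K) | Prime z}.card : ℝ) := by
    intro j hj
    obtain ⟨a1, a2, a3, -, a4, a5, a6⟩ := hT0 j hj
    have hj1 : (1 : ℝ) ≤ j := by exact_mod_cast (mem_Icc.1 hj).1
    have hI0 : 0 < (I j : ℝ) := lt_of_lt_of_le (by positivity) a5
    have hlog : log P ≤ (I j : ℝ) ^ (0.68 : ℝ) := by
      have e : (L / (2 * K)) ^ (0.68 : ℝ) * (2 * K) ^ (0.68 : ℝ) = L ^ (0.68 : ℝ) := by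
        rw [← mul_rpow (by positivity) (by positivity)]; congr 1; field_simp
      have : 2 * J ≤ (L / (2 * K)) ^ (0.68 : ℝ) := by
        refine le_of_mul_le_mul_right ?_ (show 0 < (2 * K) ^ (0.68 : ℝ) by positivity)
        rw [e]; linarith
      exact hlogP.trans (this.trans (rpow_le_rpow (by positivity) a5 (by norm_num)))
    have h := hI₀ (I j) a3 P hP (by exact_mod_cast h1000.trans hP1') hlog (5 * j : ℕ)
    rw [Int.cast_natCast] at h
    have hle : ∀ z ∈ {z ∈ gsector (Complex.exp ((2 * π * (5 * j : ℕ) / P : ℝ) * Complex.I))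
        (3 * (π / P)) (I j * K) ((I j + 3) * K) | Prime z}, 1 / nrm z ≤ exp (-(I j * K)) := by
      intro z hz
      obtain ⟨b0, b1, -⟩ := mem_gsector.1 (mem_filter.1 hz).1
      rw [exp_neg, ← one_div, ← exp_ell b0]
      exact one_div_le_one_div_of_le (exp_pos _) (exp_le_exp.2 b1)
    have h' := h.trans (Finset.sum_le_card_nsmul _ _ _ hle)
    rw [nsmul_eq_mul, exp_neg, ← div_eq_mul_inv, le_div_iff₀ (exp_pos _)] at h'
    refine le_trans ?_ h'
    have b1 : T j * exp (-4 * K) ≤ exp (I j * K) := by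
      conv_lhs => rw [← exp_log a1]
      rw [← exp_add]; exact exp_le_exp.2 (by linarith)
    calc exp (-4 * K) * 0.000000000001 / 41 / 4 * (N / L) * (1 / j)
        = 0.000000000001 / (P * (4 * L)) * (T j * exp (-4 * K)) := by rw [hT]; field_simp
      _ ≤ _ := by gcongr
  refine le_trans ?_ (sum_le_sum hcard)
  rw [← mul_sum]
  have hsum : J / 4 ≤ ∑ j ∈ Icc 1 n, (1 : ℝ) / j := by
    have e : ∑ j ∈ Icc 1 n, (1 : ℝ) / j = (harmonic n : ℚ) := by
      rw [harmonic_eq_sum_Icc]; push_cast; simp only [one_div]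
    have k1 : (P : ℝ) ≤ 100 * (n + 1 : ℕ) := by exact_mod_cast (by omega : P ≤ 100 * (n + 1))
    have k2 : J / 2 ≤ log (100 * (n + 1 : ℕ)) :=
      (le_log_iff_exp_le (by positivity)).2 (hP1'.trans k1)
    rw [log_mul (by norm_num) (by positivity)] at k2
    have k3 : log 100 ≤ 5 := by
      rw [log_le_iff_le_exp (by norm_num)]
      calc (100 : ℝ) ≤ 2.7 ^ 5 := by norm_num
        _ ≤ exp 1 ^ 5 := by gcongr; linarith [exp_one_gt_d9]
        _ = exp 5 := by rw [← exp_nat_mul]; norm_num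
    have k4 := log_add_one_le_harmonic n
    rw [e]
    linarith
  calc exp (-4 * K) * 0.000000000001 / 41 / 16 * (N * J / L)
      = exp (-4 * K) * 0.000000000001 / 41 / 4 * (N / L) * (J / 4) := by ring
    _ ≤ _ := by gcongr

end

theorem stmt_1 (ε : ℝ) (hε : 0 < ε) :
    ∃ N₀ : ℝ, ∀ N : ℝ, N₀ ≤ N →
      N / Real.log N ^ (Real.log 4 - 1 + ε) ≤ (countC N : ℝ) := by
  obtain ⟨c, hc, hE⟩ := exists_pairSet_card_ge
  exact eventually_atTop.1 (countC_lower_bound hc hE hε)
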